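/- Let d ≥ 2, let Γ = SL(d,ℤ) viewed inside G = SL(d,ℝ), let μ be a Haar measure on the locally compact group SL(d,ℝ), and for t > 0 let D_t := {g ∈ SL(d,ℝ) : ∑_{i=1}^d (log σ_i(g))² ≤ t²}, where σ_1(g),…,σ_d(g) are the singular values of g, i.e. the square roots of the eigenvalues of gᵀ·g. For a prime p let Γ(p) := {γ ∈ Γ : γ ≡ Id (mod p)} be the principal congruence subgroup, which has finite index [Γ : Γ(p)] in Γ. Let covol(Γ) := μ(F₀) for a Borel fundamental domain F₀ of the left-multiplication action of Γ on G (this quantity is finite and independent of the choice of F₀). Then there exist ε > 0 and C > 0 such that for every prime p, every γ ∈ Γ, and every t > 1: |#(γ·Γ(p) ∩ D_t) − μ(D_t)/([Γ : Γ(p)]·covol(Γ))| ≤ C·μ(D_t)·e^{−εt}. -/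

import Mathlib

open Matrix Polynomial MeasureTheory

/-- `SL(d,ℝ)` carries the topology induced from the space of matrices. -/
noncomputable instance SLRtop (d : ℕ) :
    TopologicalSpace (Matrix.SpecialLinearGroup (Fin d) ℝ) :=
  TopologicalSpace.induced (fun g => (g : Matrix (Fin d) (Fin d) ℝ)) inferInstance

noncomputable instance SLRmeas (d : ℕ) :
    MeasurableSpace (Matrix.SpecialLinearGroup (Fin d) ℝ) :=
  borel _

instance SLRborel (d : ℕ) :
    BorelSpace (Matrix.SpecialLinearGroup (Fin d) ℝ) := ⟨rfl⟩

/-- The canonical morphism `SL(d,ℤ) →* SL(d,ℝ)`. -/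
noncomputable def toSLR {d : ℕ} :
    Matrix.SpecialLinearGroup (Fin d) ℤ →* Matrix.SpecialLinearGroup (Fin d) ℝ :=
  Matrix.SpecialLinearGroup.map (Int.castRingHom ℝ)

/-- `Dt d t` is the set of `g ∈ SL(d,ℝ)` whose vector of logarithms of singular values
(the square roots of the eigenvalues of `gᵀ·g`) has Euclidean norm at most `t`. -/
def Dt (d : ℕ) (t : ℝ) : Set (Matrix.SpecialLinearGroup (Fin d) ℝ) :=
  {g | ∃ μ : Fin d → ℝ,
    ((g : Matrix (Fin d) (Fin d) ℝ)ᵀ * (g : Matrix (Fin d) (Fin d) ℝ)).charpoly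
      = ∏ i, (X - C (μ i)) ∧
    ∑ i, Real.log (Real.sqrt (μ i)) ^ 2 ≤ t ^ 2}

/-- The principal congruence subgroup `Γ(p) = {γ ∈ SL(d,ℤ) : γ ≡ Id (mod p)}`,
realized as the kernel of the reduction map `SL(d,ℤ) →* SL(d,ℤ/pℤ)`. -/
noncomputable def congSubgroup (d p : ℕ) :
    Subgroup (Matrix.SpecialLinearGroup (Fin d) ℤ) :=
  (Matrix.SpecialLinearGroup.map (n := Fin d) (Int.castRingHom (ZMod p))).ker

section proof

set_option linter.all false
open scoped Matrix.Norms.L2Operator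

abbrev SLR (d : ℕ) := Matrix.SpecialLinearGroup (Fin d) ℝ

section basic
variable {d : ℕ}

instance SLR.topGroup : IsTopologicalGroup (SLR d) :=
  Matrix.SpecialLinearGroup.topologicalGroup

theorem SLR.coe_injective {g h : SLR d}
    (e : (g : Matrix (Fin d) (Fin d) ℝ) = (h : Matrix (Fin d) (Fin d) ℝ)) : g = h :=
  Subtype.ext e

theorem SLR.isClosedEmbedding_val :
    Topology.IsClosedEmbedding (fun g : SLR d => (g : Matrix (Fin d) (Fin d) ℝ)) :=
  Matrix.SpecialLinearGroup.isClosedEmbedding_val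

theorem SLR.continuous_val : Continuous (fun g : SLR d => (g : Matrix (Fin d) (Fin d) ℝ)) :=
  SLR.isClosedEmbedding_val.continuous

theorem SLR.continuous_iff {α : Type*} [TopologicalSpace α] {f : α → SLR d} :
    Continuous f ↔ Continuous fun x => (f x : Matrix (Fin d) (Fin d) ℝ) :=
  SLR.isClosedEmbedding_val.isInducing.continuous_iff

instance : T2Space (SLR d) := SLR.isClosedEmbedding_val.isEmbedding.t2Space

instance : PolishSpace (Matrix (Fin d) (Fin d) ℝ) :=
  inferInstanceAs (PolishSpace (Fin d → Fin d → ℝ))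

instance : LocallyCompactSpace (Matrix (Fin d) (Fin d) ℝ) :=
  inferInstanceAs (LocallyCompactSpace (Fin d → Fin d → ℝ))

instance : PolishSpace (SLR d) := SLR.isClosedEmbedding_val.polishSpace

instance : LocallyCompactSpace (SLR d) := SLR.isClosedEmbedding_val.locallyCompactSpace

theorem diag2n_val {i j : Fin d} (hij : i ≠ j) (a : ℝ) (ha : a ≠ 0) :
    (Matrix.SpecialLinearGroup.diag2n hij a ha : Matrix (Fin d) (Fin d) ℝ) =
      diagonal (fun k ↦ if k = i then a else if k = j then a⁻¹ else 1) := rfl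

theorem transvection_word {i j : Fin d} (hij : i ≠ j) (a : ℝ) (ha : a ≠ 0) :
    Matrix.SpecialLinearGroup.diag2n hij a ha =
      Matrix.SpecialLinearGroup.transvection hij a * Matrix.SpecialLinearGroup.transvection hij.symm (-a⁻¹) *
      Matrix.SpecialLinearGroup.transvection hij (a - 1) * Matrix.SpecialLinearGroup.transvection hij.symm 1 *
      Matrix.SpecialLinearGroup.transvection hij (-1) := by
  apply SLR.coe_injective
  simp only [Matrix.SpecialLinearGroup.coe_mul, Matrix.SpecialLinearGroup.transvection_coe,
    diag2n_val]
  simp only [add_mul, mul_add, one_mul, mul_one, Matrix.single_mul_single_same,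
    Matrix.single_mul_single_of_ne _ _ _ _ hij, Matrix.single_mul_single_of_ne _ _ _ _ hij.symm,
    add_zero, zero_add, zero_mul, mul_zero]
  ext k l
  simp only [Matrix.diagonal_apply, Matrix.add_apply, Matrix.one_apply, Matrix.single_apply]
  by_cases h1 : i = k <;> by_cases h2 : j = k <;> by_cases h3 : i = l <;> by_cases h4 : j = l <;>
    by_cases h5 : k = l <;> subst_vars <;> simp_all <;> grind

theorem SLR.subgroup_eq_top (hd : 2 ≤ d) (S : Subgroup (SLR d))
    (h : ∀ (i j : Fin d) (hij : i ≠ j) (a : ℝ), Matrix.SpecialLinearGroup.transvection hij a ∈ S) :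
    S = ⊤ := by
  have : Nontrivial (Fin d) := Fin.nontrivial_iff_two_le.2 hd
  rw [eq_top_iff]
  intro g _
  refine Matrix.SpecialLinearGroup.diagonal_transvection_induction' (fun g => g ∈ S) g ?_ h
    (fun A B hA hB => S.mul_mem hA hB)
  intro i j hij c hc
  rw [transvection_word]
  exact S.mul_mem (S.mul_mem (S.mul_mem (S.mul_mem (h _ _ _ _) (h _ _ _ _)) (h _ _ _ _))
    (h _ _ _ _)) (h _ _ _ _)

theorem diag2n_conj_transvection {i j : Fin d} (hij : i ≠ j) (a : ℝ) (ha : a ≠ 0) (c : ℝ) :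
    Matrix.SpecialLinearGroup.diag2n hij a ha * Matrix.SpecialLinearGroup.transvection hij c =
      Matrix.SpecialLinearGroup.transvection hij (a ^ 2 * c) * Matrix.SpecialLinearGroup.diag2n hij a ha := by
  apply SLR.coe_injective
  simp only [Matrix.SpecialLinearGroup.coe_mul, Matrix.SpecialLinearGroup.transvection_coe,
    diag2n_val]
  ext k l
  simp only [mul_add, add_mul, mul_one, one_mul, Matrix.add_apply, Matrix.diagonal_mul,
    Matrix.mul_diagonal, Matrix.single_apply]
  rw [Matrix.one_apply]
  by_cases h1 : i = k <;> by_cases h4 : j = l <;> by_cases h5 : k = l <;>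
    subst_vars <;> simp_all <;> grind

/-- `SL(d,ℝ)` has no nontrivial homomorphisms to a commutative group. -/
theorem SLR.hom_trivial (hd : 2 ≤ d) {A : Type*} [CommMonoid A] (f : SLR d →* A) (g : SLR d) :
    f g = 1 := by
  have key : f.ker = ⊤ := by
    refine SLR.subgroup_eq_top hd _ fun i j hij a => ?_
    rw [MonoidHom.mem_ker]
    have h := congrArg f (diag2n_conj_transvection hij 2 two_ne_zero (a / 3))
    rw [map_mul, map_mul, mul_comm] at h
    have h' : f (Matrix.SpecialLinearGroup.transvection hij (a / 3)) =
        f (Matrix.SpecialLinearGroup.transvection hij (2 ^ 2 * (a / 3))) := by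
      have := congrArg (· * f (Matrix.SpecialLinearGroup.diag2n hij 2 two_ne_zero)⁻¹) h
      simpa only [mul_assoc, ← map_mul, mul_inv_cancel, map_one, mul_one] using this
    have e : Matrix.SpecialLinearGroup.transvection hij a =
        Matrix.SpecialLinearGroup.transvection hij (2 ^ 2 * (a / 3)) *
        Matrix.SpecialLinearGroup.transvection hij (-(a / 3)) := by
      rw [← Matrix.SpecialLinearGroup.transvection_add]; congr 1; ring
    rw [e, map_mul, ← h', ← map_mul, ← Matrix.SpecialLinearGroup.transvection_add]
    simp
  exact MonoidHom.mem_ker.1 (key ▸ Subgroup.mem_top g)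

theorem SLR.isMulRightInvariant (hd : 2 ≤ d) (μ : Measure (SLR d)) [μ.IsHaarMeasure] :
    μ.IsMulRightInvariant := by
  constructor
  intro g
  have := Measure.map_right_mul_eq_modularCharacterFun_smul μ g
  rw [this]
  have h1 : Measure.modularCharacterFun g = 1 := SLR.hom_trivial hd Measure.modularCharacter g
  rw [h1, one_smul]

end basic

section cartan
variable {d : ℕ}

/-- The Euclidean norm of a vector. -/
noncomputable def en (v : Fin d → ℝ) : ℝ := √(∑ i, v i ^ 2)

theorem en_eq_norm (v : Fin d → ℝ) : en v = ‖(WithLp.toLp 2 v : EuclideanSpace ℝ (Fin d))‖ := by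
  rw [EuclideanSpace.norm_eq, en]; simp

theorem en_nonneg (v : Fin d → ℝ) : 0 ≤ en v := Real.sqrt_nonneg _

theorem en_sq (v : Fin d → ℝ) : en v ^ 2 = ∑ i, v i ^ 2 :=
  Real.sq_sqrt (Finset.sum_nonneg fun _ _ => sq_nonneg _)

theorem en_pos {v : Fin d → ℝ} (h : v ≠ 0) : 0 < en v := by
  rw [en_eq_norm, norm_pos_iff]
  intro h'; apply h
  exact (WithLp.toLp_eq_zero 2).1 h'

theorem en_neg (v : Fin d → ℝ) : en (-v) = en v := by simp [en]

theorem en_smul (c : ℝ) (v : Fin d → ℝ) : en (c • v) = |c| * en v := by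
  simp only [en_eq_norm, WithLp.toLp_smul, norm_smul, Real.norm_eq_abs]

theorem abs_en_sub_le (v w : Fin d → ℝ) : |en v - en w| ≤ en (v - w) := by
  simp only [en_eq_norm, WithLp.toLp_sub]; exact abs_norm_sub_norm_le _ _

theorem abs_apply_le_en (v : Fin d → ℝ) (i : Fin d) : |v i| ≤ en v := by
  apply Real.abs_le_sqrt
  exact Finset.single_le_sum (f := fun i => v i ^ 2) (fun _ _ => sq_nonneg _) (Finset.mem_univ i)

theorem en_le_of_abs_le {v : Fin d → ℝ} {c : ℝ} (hc : 0 ≤ c) (h : ∀ i, |v i| ≤ c) :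
    en v ≤ √d * c := by
  rw [en]
  apply Real.sqrt_le_iff.2
  refine ⟨by positivity, ?_⟩
  calc ∑ i, v i ^ 2 ≤ ∑ i : Fin d, c ^ 2 := by
        refine Finset.sum_le_sum fun i _ => ?_
        exact sq_le_sq' (abs_le.1 (h i)).1 (abs_le.1 (h i)).2
    _ = (√d * c) ^ 2 := by rw [mul_pow, Real.sq_sqrt (by positivity)]; simp

theorem en_mulVec_le (A : Matrix (Fin d) (Fin d) ℝ) (v : Fin d → ℝ) :
    en (A *ᵥ v) ≤ ‖A‖ * en v := by
  rw [en_eq_norm, en_eq_norm]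
  exact Matrix.l2_opNorm_mulVec A (WithLp.toLp 2 v)

theorem en_sq_dot (v : Fin d → ℝ) : en v ^ 2 = v ⬝ᵥ v := by
  rw [en_sq, dotProduct]; exact Finset.sum_congr rfl fun i _ => sq _

theorem en_orth {O : Matrix (Fin d) (Fin d) ℝ} (hO : Oᵀ * O = 1) (v : Fin d → ℝ) :
    en (O *ᵥ v) = en v := by
  have : en (O *ᵥ v) ^ 2 = en v ^ 2 := by
    rw [en_sq_dot, en_sq_dot, Matrix.dotProduct_mulVec, Matrix.vecMul_mulVec, hO, Matrix.vecMul_one]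
  exact (pow_left_inj₀ (en_nonneg _) (en_nonneg _) two_ne_zero).1 this

theorem mem_unitary_of_orth {O : Matrix (Fin d) (Fin d) ℝ} (hO : Oᵀ * O = 1) :
    O ∈ unitary (Matrix (Fin d) (Fin d) ℝ) := by
  rw [Unitary.mem_iff, Matrix.star_eq_conjTranspose, Matrix.conjTranspose_eq_transpose_of_trivial]
  exact ⟨hO, mul_eq_one_comm.1 hO⟩

/-- `g = O · diag(exp x) · O'` with `O`, `O'` orthogonal. -/
def IsSVD (g : SLR d) (x : Fin d → ℝ) : Prop :=
  ∃ O O' : Matrix (Fin d) (Fin d) ℝ, Oᵀ * O = 1 ∧ O'ᵀ * O' = 1 ∧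
    (g : Matrix (Fin d) (Fin d) ℝ) = O * diagonal (fun i => Real.exp (x i)) * O'

theorem exists_isSVD (g : SLR d) : ∃ x, Antitone x ∧ IsSVD g x := by
  set g' : Matrix (Fin d) (Fin d) ℝ := (g : Matrix (Fin d) (Fin d) ℝ) with hg'
  have hdet : g'.det = 1 := g.2
  set A := g'ᵀ * g' with hA
  have hpd : A.PosDef := by
    have := Matrix.PosDef.conjTranspose_mul_self (A := g') (Matrix.mulVec_injective_iff_isUnit.2
      ((Matrix.isUnit_iff_isUnit_det _).2 (by rw [hdet]; exact isUnit_one)))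
    rwa [Matrix.conjTranspose_eq_transpose_of_trivial] at this
  set U : Matrix (Fin d) (Fin d) ℝ := hpd.isHermitian.eigenvectorUnitary.1 with hU
  set l := hpd.isHermitian.eigenvalues with hl
  have hlpos : ∀ i, 0 < l i := hpd.eigenvalues_pos
  have hUU : Uᵀ * U = 1 := by
    have := (Unitary.mem_iff.1 hpd.isHermitian.eigenvectorUnitary.2).1
    rwa [Matrix.star_eq_conjTranspose, Matrix.conjTranspose_eq_transpose_of_trivial] at this
  have hspec : A = U * diagonal l * Uᵀ := by
    have := hpd.isHermitian.spectral_theorem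
    rw [Unitary.conjStarAlgAut_apply] at this
    rw [Matrix.star_eq_conjTranspose, Matrix.conjTranspose_eq_transpose_of_trivial] at this
    exact this
  have hdiag : Uᵀ * A * U = diagonal l := by
    rw [hspec]
    calc Uᵀ * (U * diagonal l * Uᵀ) * U = (Uᵀ * U) * diagonal l * (Uᵀ * U) := by
          simp only [Matrix.mul_assoc]
      _ = _ := by rw [hUU]; simp
  obtain ⟨σ, hσ⟩ : ∃ σ : Equiv.Perm (Fin d), Antitone (l ∘ σ) := by
    refine ⟨Tuple.sort (fun i => - l i), fun i j hij => ?_⟩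
    have := Tuple.monotone_sort (fun i => - l i) hij
    simpa using this
  set V := U.submatrix id σ with hV
  have hVV : Vᵀ * V = 1 := by
    have : Vᵀ * V = (Uᵀ * U).submatrix σ σ := by
      rw [hV, Matrix.transpose_submatrix]; rfl
    rw [this, hUU, Matrix.submatrix_one_equiv]
  have hVA : Vᵀ * A * V = diagonal (l ∘ σ) := by
    have : Vᵀ * A * V = (Uᵀ * A * U).submatrix σ σ := by
      rw [hV, Matrix.transpose_submatrix]; rfl
    rw [this, hdiag, Matrix.submatrix_diagonal_equiv]
  set x : Fin d → ℝ := fun i => Real.log (l (σ i)) / 2 with hx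
  refine ⟨x, fun i j hij => ?_, g' * V * diagonal (fun i => Real.exp (- x i)), Vᵀ, ?_, ?_, ?_⟩
  · simp only [hx]
    have := Real.log_le_log (hlpos _) (hσ hij)
    simp only [Function.comp] at this
    linarith
  · have : (g' * V * diagonal (fun i => Real.exp (- x i)))ᵀ *
        (g' * V * diagonal (fun i => Real.exp (- x i))) =
        diagonal (fun i => Real.exp (- x i)) * (Vᵀ * A * V) *
          diagonal (fun i => Real.exp (- x i)) := by
      rw [Matrix.transpose_mul, Matrix.transpose_mul, Matrix.diagonal_transpose, hA]
      simp only [Matrix.mul_assoc]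
    rw [this, hVA, Matrix.diagonal_mul_diagonal, Matrix.diagonal_mul_diagonal, ← Matrix.diagonal_one]
    congr 1
    ext i
    have : l (σ i) = Real.exp (2 * x i) := by
      simp only [hx]; rw [mul_div_cancel₀ _ two_ne_zero, Real.exp_log (hlpos _)]
    simp only [Function.comp, this, ← Real.exp_add]
    rw [show -x i + 2 * x i + -x i = 0 by ring, Real.exp_zero]
  · rw [Matrix.transpose_transpose]; exact mul_eq_one_comm.1 hVV
  · have : diagonal (fun i => Real.exp (- x i)) * diagonal (fun i => Real.exp (x i)) =
        (1 : Matrix (Fin d) (Fin d) ℝ) := by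
      rw [Matrix.diagonal_mul_diagonal, ← Matrix.diagonal_one]
      congr 1; ext i; rw [← Real.exp_add]; simp
    rw [Matrix.mul_assoc (g' * V), this, Matrix.mul_one, Matrix.mul_assoc, mul_eq_one_comm.1 hVV,
      Matrix.mul_one]

theorem IsSVD.charpoly {g : SLR d} {x : Fin d → ℝ} (h : IsSVD g x) :
    ((g : Matrix (Fin d) (Fin d) ℝ)ᵀ * (g : Matrix (Fin d) (Fin d) ℝ)).charpoly =
      ∏ i, (X - C (Real.exp (2 * x i))) := by
  obtain ⟨O, O', hO, hO', e⟩ := h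
  have e2 : (g : Matrix (Fin d) (Fin d) ℝ)ᵀ * (g : Matrix (Fin d) (Fin d) ℝ) =
      O'ᵀ * (diagonal (fun i => Real.exp (2 * x i)) * O') := by
    rw [e]
    have : diagonal (fun i => Real.exp (2 * x i)) =
        diagonal (fun i => Real.exp (x i)) * (Oᵀ * O) * diagonal (fun i => Real.exp (x i)) := by
      rw [hO, Matrix.mul_one, Matrix.diagonal_mul_diagonal]
      congr 1; ext i; rw [← Real.exp_add]; congr 1; ring
    rw [this, Matrix.transpose_mul, Matrix.transpose_mul, Matrix.diagonal_transpose]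
    simp only [Matrix.mul_assoc]
  rw [e2, Matrix.charpoly_mul_comm, Matrix.mul_assoc, mul_eq_one_comm.1 hO', Matrix.mul_one,
    Matrix.charpoly_diagonal]

theorem IsSVD.sum_eq {g : SLR d} {x : Fin d → ℝ} (h : IsSVD g x) {m : Fin d → ℝ}
    (hm : ((g : Matrix (Fin d) (Fin d) ℝ)ᵀ * (g : Matrix (Fin d) (Fin d) ℝ)).charpoly =
      ∏ i, (X - C (m i))) :
    ∑ i, Real.log (√(m i)) ^ 2 = ∑ i, x i ^ 2 := by
  have key : Finset.univ.val.map m = Finset.univ.val.map (fun i => Real.exp (2 * x i)) := by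
    have h1 := h.charpoly
    rw [hm] at h1
    have h2 := congrArg Polynomial.roots h1
    have r : ∀ f : Fin d → ℝ, (∏ i, (X - C (f i))).roots = Finset.univ.val.map f := by
      intro f
      have := Polynomial.roots_multiset_prod_X_sub_C (Finset.univ.val.map f)
      rw [Multiset.map_map] at this
      exact this
    rwa [r, r] at h2
  have h3 := congrArg (fun s : Multiset ℝ => (s.map (fun y => Real.log (√y) ^ 2)).sum) key
  simp only [Multiset.map_map, Function.comp_def] at h3
  calc ∑ i, Real.log (√(m i)) ^ 2 = ∑ i, Real.log (√(Real.exp (2 * x i))) ^ 2 := h3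
    _ = _ := by
      refine Finset.sum_congr rfl fun i _ => ?_
      rw [Real.log_sqrt (Real.exp_pos _).le, Real.log_exp]; ring

/-- The Euclidean norm of the Cartan projection. -/
noncomputable def phi (g : SLR d) : ℝ := en (exists_isSVD g).choose

theorem IsSVD.phi_eq {g : SLR d} {x : Fin d → ℝ} (h : IsSVD g x) : phi g = en x := by
  have h1 := h.sum_eq h.charpoly
  have h2 := (exists_isSVD g).choose_spec.2.sum_eq h.charpoly
  rw [phi, en, en, ← h1, ← h2]

theorem phi_nonneg (g : SLR d) : 0 ≤ phi g := en_nonneg _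

theorem mem_Dt_iff {g : SLR d} {t : ℝ} (ht : 0 ≤ t) : g ∈ Dt d t ↔ phi g ≤ t := by
  obtain ⟨x, -, hx⟩ := exists_isSVD g
  rw [hx.phi_eq, en, Real.sqrt_le_left ht]
  constructor
  · rintro ⟨m, hm, h⟩
    rwa [← hx.sum_eq hm]
  · intro h
    exact ⟨_, hx.charpoly, by rwa [hx.sum_eq hx.charpoly]⟩

end cartan

section cartan
variable {d : ℕ}

/-- The maximal compact subgroup `SO(d)`. -/
def Kd (d : ℕ) : Subgroup (SLR d) where
  carrier := {g | (g : Matrix (Fin d) (Fin d) ℝ)ᵀ * (g : Matrix (Fin d) (Fin d) ℝ) = 1}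
  mul_mem' := by
    intro a b ha hb
    simp only [Set.mem_setOf_eq, Matrix.SpecialLinearGroup.coe_mul, Matrix.transpose_mul] at *
    calc _ = (b : Matrix (Fin d) (Fin d) ℝ)ᵀ * ((a : Matrix (Fin d) (Fin d) ℝ)ᵀ *
        (a : Matrix (Fin d) (Fin d) ℝ)) * (b : Matrix (Fin d) (Fin d) ℝ) := by
          simp only [Matrix.mul_assoc]
      _ = 1 := by rw [ha, Matrix.mul_one, hb]
  one_mem' := by simp
  inv_mem' := by
    intro a ha
    simp only [Set.mem_setOf_eq] at *
    have h1 : (a : Matrix (Fin d) (Fin d) ℝ) * ((a⁻¹ : SLR d) : Matrix (Fin d) (Fin d) ℝ) = 1 := by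
      rw [← Matrix.SpecialLinearGroup.coe_mul]; simp
    have h2 : ((a⁻¹ : SLR d) : Matrix (Fin d) (Fin d) ℝ) = (a : Matrix (Fin d) (Fin d) ℝ)ᵀ := by
      calc _ = ((a : Matrix (Fin d) (Fin d) ℝ)ᵀ * (a : Matrix (Fin d) (Fin d) ℝ)) *
            ((a⁻¹ : SLR d) : Matrix (Fin d) (Fin d) ℝ) := by rw [ha, Matrix.one_mul]
        _ = _ := by rw [Matrix.mul_assoc, h1, Matrix.mul_one]
    rw [h2, Matrix.transpose_transpose]
    exact mul_eq_one_comm.1 ha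

theorem mem_Kd {g : SLR d} : g ∈ Kd d ↔
    (g : Matrix (Fin d) (Fin d) ℝ)ᵀ * (g : Matrix (Fin d) (Fin d) ℝ) = 1 := Iff.rfl

theorem val_mul_inv (g : SLR d) :
    (g : Matrix (Fin d) (Fin d) ℝ) * ((g⁻¹ : SLR d) : Matrix (Fin d) (Fin d) ℝ) = 1 := by
  rw [← Matrix.SpecialLinearGroup.coe_mul]; simp

theorem orth_mul {A B : Matrix (Fin d) (Fin d) ℝ} (hA : Aᵀ * A = 1) (hB : Bᵀ * B = 1) :
    (A * B)ᵀ * (A * B) = 1 := by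
  rw [Matrix.transpose_mul]
  calc _ = Bᵀ * (Aᵀ * A) * B := by simp only [Matrix.mul_assoc]
    _ = 1 := by rw [hA, Matrix.mul_one, hB]

theorem IsSVD.mul_left {g k : SLR d} {x : Fin d → ℝ} (h : IsSVD g x) (hk : k ∈ Kd d) :
    IsSVD (k * g) x := by
  obtain ⟨O, O', hO, hO', e⟩ := h
  refine ⟨(k : Matrix (Fin d) (Fin d) ℝ) * O, O', orth_mul hk hO, hO', ?_⟩
  rw [Matrix.SpecialLinearGroup.coe_mul, e]; simp only [Matrix.mul_assoc]

theorem IsSVD.mul_right {g k : SLR d} {x : Fin d → ℝ} (h : IsSVD g x) (hk : k ∈ Kd d) :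
    IsSVD (g * k) x := by
  obtain ⟨O, O', hO, hO', e⟩ := h
  refine ⟨O, O' * (k : Matrix (Fin d) (Fin d) ℝ), hO, orth_mul hO' hk, ?_⟩
  rw [Matrix.SpecialLinearGroup.coe_mul, e]; simp only [Matrix.mul_assoc]

theorem phi_mul_left {g k : SLR d} (hk : k ∈ Kd d) : phi (k * g) = phi g := by
  obtain ⟨x, -, hx⟩ := exists_isSVD g
  rw [hx.phi_eq, (hx.mul_left hk).phi_eq]

theorem phi_mul_right {g k : SLR d} (hk : k ∈ Kd d) : phi (g * k) = phi g := by
  obtain ⟨x, -, hx⟩ := exists_isSVD g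
  rw [hx.phi_eq, (hx.mul_right hk).phi_eq]

theorem IsSVD.inv {g : SLR d} {x : Fin d → ℝ} (h : IsSVD g x) : IsSVD g⁻¹ (-x) := by
  obtain ⟨O, O', hO, hO', e⟩ := h
  refine ⟨O'ᵀ, Oᵀ, ?_, ?_, ?_⟩
  · rw [Matrix.transpose_transpose]; exact mul_eq_one_comm.1 hO'
  · rw [Matrix.transpose_transpose]; exact mul_eq_one_comm.1 hO
  · have h1 := val_mul_inv g
    have h2 : (O'ᵀ * diagonal (fun i => Real.exp ((-x) i)) * Oᵀ) *
        (g : Matrix (Fin d) (Fin d) ℝ) = 1 := by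
      rw [e]
      calc _ = O'ᵀ * (diagonal (fun i => Real.exp ((-x) i)) * (Oᵀ * O) *
            diagonal (fun i => Real.exp (x i))) * O' := by simp only [Matrix.mul_assoc]
        _ = 1 := by
          rw [hO, Matrix.mul_one, Matrix.diagonal_mul_diagonal]
          have : (fun i => Real.exp ((-x) i) * Real.exp (x i)) = fun _ => (1 : ℝ) := by
            ext i; rw [← Real.exp_add]; simp
          rw [this, Matrix.diagonal_one, Matrix.mul_one, hO']
    calc _ = (O'ᵀ * diagonal (fun i => Real.exp ((-x) i)) * Oᵀ) *
          (g : Matrix (Fin d) (Fin d) ℝ) * ((g⁻¹ : SLR d) : Matrix (Fin d) (Fin d) ℝ) := by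
            rw [h2, Matrix.one_mul]
      _ = _ := by rw [Matrix.mul_assoc _ _ ((g⁻¹ : SLR d) : Matrix (Fin d) (Fin d) ℝ), h1,
        Matrix.mul_one]

theorem phi_inv (g : SLR d) : phi g⁻¹ = phi g := by
  obtain ⟨x, -, hx⟩ := exists_isSVD g
  rw [hx.phi_eq, hx.inv.phi_eq, en_neg]

theorem IsSVD.norm_eq {g : SLR d} {x : Fin d → ℝ} (h : IsSVD g x) :
    ‖(g : Matrix (Fin d) (Fin d) ℝ)‖ = ‖fun i => Real.exp (x i)‖ := by
  obtain ⟨O, O', hO, hO', e⟩ := h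
  rw [e, CStarRing.norm_mul_mem_unitary _ (mem_unitary_of_orth hO'),
    CStarRing.norm_mem_unitary_mul _ (mem_unitary_of_orth hO), Matrix.l2_opNorm_diagonal]

theorem IsSVD.exp_le_norm {g : SLR d} {x : Fin d → ℝ} (h : IsSVD g x) (i : Fin d) :
    Real.exp (x i) ≤ ‖(g : Matrix (Fin d) (Fin d) ℝ)‖ := by
  rw [h.norm_eq]
  refine le_trans (le_abs_self _) ?_
  exact norm_le_pi_norm (fun i => Real.exp (x i)) i

theorem norm_le_exp_phi (g : SLR d) : ‖(g : Matrix (Fin d) (Fin d) ℝ)‖ ≤ Real.exp (phi g) := by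
  obtain ⟨x, -, hx⟩ := exists_isSVD g
  rw [hx.norm_eq, hx.phi_eq]
  refine (pi_norm_le_iff_of_nonneg (Real.exp_pos _).le).2 fun i => ?_
  rw [Real.norm_eq_abs, abs_of_pos (Real.exp_pos _)]
  exact Real.exp_le_exp.2 ((le_abs_self _).trans (abs_apply_le_en x i))

theorem phi_le_of_norm {g : SLR d} {c : ℝ} (hc : 0 ≤ c)
    (h1 : ‖(g : Matrix (Fin d) (Fin d) ℝ)‖ ≤ Real.exp c)
    (h2 : ‖((g⁻¹ : SLR d) : Matrix (Fin d) (Fin d) ℝ)‖ ≤ Real.exp c) : phi g ≤ √d * c := by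
  obtain ⟨x, -, hx⟩ := exists_isSVD g
  rw [hx.phi_eq]
  refine en_le_of_abs_le hc fun i => abs_le.2 ⟨?_, ?_⟩
  · have := Real.exp_le_exp.1 ((hx.inv.exp_le_norm i).trans h2)
    simp only [Pi.neg_apply] at this
    linarith
  · exact Real.exp_le_exp.1 ((hx.exp_le_norm i).trans h1)

theorem norm_one_le : ‖(1 : Matrix (Fin d) (Fin d) ℝ)‖ ≤ 1 := by
  rw [← Matrix.diagonal_one, Matrix.l2_opNorm_diagonal]
  exact (pi_norm_le_iff_of_nonneg zero_le_one).2 fun i => by simp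

theorem phi_le_norm_sub_one {g : SLR d} {c : ℝ}
    (h1 : ‖(g : Matrix (Fin d) (Fin d) ℝ) - 1‖ ≤ c)
    (h2 : ‖((g⁻¹ : SLR d) : Matrix (Fin d) (Fin d) ℝ) - 1‖ ≤ c) : phi g ≤ √d * c := by
  have key : ∀ A : Matrix (Fin d) (Fin d) ℝ, ‖A - 1‖ ≤ c → ‖A‖ ≤ Real.exp c := by
    intro A hA
    have := norm_add_le (A - 1) 1
    rw [sub_add_cancel] at this
    have h3 := norm_one_le (d := d)
    have h4 := Real.add_one_le_exp c
    linarith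
  exact phi_le_of_norm ((norm_nonneg _).trans h1) (key _ h1) (key _ h2)

theorem sv_le_of_mul {g h : SLR d} {x y : Fin d → ℝ} (hx : Antitone x) (hy : Antitone y)
    (hgx : IsSVD g x) (hgy : IsSVD (g * h) y) (i : Fin d) :
    Real.exp (y i) ≤ Real.exp (x i) * ‖(h : Matrix (Fin d) (Fin d) ℝ)‖ := by
  obtain ⟨O1, O1', hO1, hO1', e1⟩ := hgx
  obtain ⟨O2, O2', hO2, hO2', e2⟩ := hgy
  set h' := (h : Matrix (Fin d) (Fin d) ℝ) with hh'
  set M : Matrix (Fin d) (Fin d) ℝ := Matrix.of fun j k =>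
    if j = i then 0 else if i < j then O2' j k else (O1' * h') j k with hM
  have hdet : M.det = 0 := by
    refine Matrix.det_eq_zero_of_row_eq_zero i fun k => ?_
    simp [hM]
  obtain ⟨u, hu0, hu⟩ := Matrix.exists_mulVec_eq_zero_iff.2 hdet
  have hupos := en_pos hu0
  have hA : ∀ j, i < j → (O2' *ᵥ u) j = 0 := by
    intro j hj
    have := congrFun hu j
    simp only [hM, Matrix.mulVec, Matrix.of_apply, Pi.zero_apply, if_neg hj.ne', if_pos hj,
      dotProduct] at this
    simpa [Matrix.mulVec, dotProduct] using this
  have hB : ∀ j, j < i → (O1' *ᵥ (h' *ᵥ u)) j = 0 := by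
    intro j hj
    have := congrFun hu j
    simp only [hM, Matrix.mulVec, Matrix.of_apply, Pi.zero_apply, if_neg hj.ne,
      if_neg hj.not_gt, dotProduct] at this
    rw [Matrix.mulVec_mulVec]
    simpa [Matrix.mulVec, dotProduct] using this
  have l1 : Real.exp (y i) * en u ≤ en ((g * h : SLR d).1 *ᵥ u) := by
    have : (g * h : SLR d).1 *ᵥ u = O2 *ᵥ (diagonal (fun i => Real.exp (y i)) *ᵥ (O2' *ᵥ u)) := by
      rw [e2, Matrix.mulVec_mulVec, Matrix.mulVec_mulVec]
    rw [this, en_orth hO2, ← en_orth hO2' u]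
    refine (pow_le_pow_iff_left₀ (by have := en_nonneg (O2' *ᵥ u); positivity) (en_nonneg _)
      two_ne_zero).1 ?_
    rw [mul_pow, en_sq, en_sq, Finset.mul_sum]
    refine Finset.sum_le_sum fun j _ => ?_
    rw [Matrix.mulVec_diagonal, mul_pow]
    rcases le_or_gt j i with hj | hj
    · have := Real.exp_le_exp.2 (hy hj)
      gcongr
    · rw [hA j hj]; simp
  have l2 : en ((g * h : SLR d).1 *ᵥ u) ≤ Real.exp (x i) * en (h' *ᵥ u) := by
    have : (g * h : SLR d).1 *ᵥ u =
        O1 *ᵥ (diagonal (fun i => Real.exp (x i)) *ᵥ (O1' *ᵥ (h' *ᵥ u))) := by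
      rw [Matrix.SpecialLinearGroup.coe_mul, e1]
      simp only [Matrix.mulVec_mulVec, Matrix.mul_assoc]
      rfl
    rw [this, en_orth hO1, ← en_orth hO1' (h' *ᵥ u)]
    refine (pow_le_pow_iff_left₀ (en_nonneg _) (by have := en_nonneg (O1' *ᵥ (h' *ᵥ u)); positivity)
      two_ne_zero).1 ?_
    rw [mul_pow, en_sq, en_sq, Finset.mul_sum]
    refine Finset.sum_le_sum fun j _ => ?_
    rw [Matrix.mulVec_diagonal, mul_pow]
    rcases le_or_gt i j with hj | hj
    · have := Real.exp_le_exp.2 (hx hj)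
      gcongr
    · rw [hB j hj]; simp
  have l3 := en_mulVec_le h' u
  have l4 : Real.exp (x i) * en (h' *ᵥ u) ≤ Real.exp (x i) * (‖h'‖ * en u) := by gcongr
  have : Real.exp (y i) * en u ≤ (Real.exp (x i) * ‖h'‖) * en u := by linarith
  exact le_of_mul_le_mul_right this hupos

theorem phi_mul_sub_le (g h : SLR d) : |phi (g * h) - phi g| ≤ √d * phi h := by
  obtain ⟨x, hxa, hx⟩ := exists_isSVD g
  obtain ⟨y, hya, hy⟩ := exists_isSVD (g * h)
  rw [hx.phi_eq, hy.phi_eq]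
  refine (abs_en_sub_le _ _).trans (en_le_of_abs_le (phi_nonneg _) fun i => ?_)
  have h1 := sv_le_of_mul hxa hya hx hy i
  have h2 := sv_le_of_mul (g := g * h) (h := h⁻¹) hya hxa hy (by simpa using hx) i
  have h3 := norm_le_exp_phi h
  have h4 := norm_le_exp_phi h⁻¹
  rw [phi_inv] at h4
  have h5 : Real.exp (y i) ≤ Real.exp (x i + phi h) := by
    rw [Real.exp_add]; exact h1.trans (by gcongr)
  have h6 : Real.exp (x i) ≤ Real.exp (y i + phi h) := by
    rw [Real.exp_add]; exact h2.trans (by gcongr)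
  have h7 := Real.exp_le_exp.1 h5
  have h8 := Real.exp_le_exp.1 h6
  rw [Pi.sub_apply, abs_le]; constructor <;> linarith

theorem phi_mul_le (g h : SLR d) : phi (g * h) ≤ phi g + √d * phi h := by
  have := (abs_le.1 (phi_mul_sub_le g h)).2; linarith

theorem phi_one : phi (1 : SLR d) = 0 := by
  have : IsSVD (1 : SLR d) 0 := ⟨1, 1, by simp, by simp, by simp⟩
  rw [this.phi_eq]; simp [en]

theorem phi_of_mem_Kd {k : SLR d} (hk : k ∈ Kd d) : phi k = 0 := by
  have := phi_mul_left (g := 1) hk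
  rwa [mul_one, phi_one] at this

theorem phi_le_norm_add (h : SLR d) : phi h ≤ √d *
    (‖(h : Matrix (Fin d) (Fin d) ℝ) - 1‖ + ‖((h⁻¹ : SLR d) : Matrix (Fin d) (Fin d) ℝ) - 1‖) :=
  phi_le_norm_sub_one (le_add_of_nonneg_right (norm_nonneg _))
    (le_add_of_nonneg_left (norm_nonneg _))

theorem tendsto_phi_one : Filter.Tendsto (phi : SLR d → ℝ) (nhds 1) (nhds 0) := by
  have h1 : Continuous fun g : SLR d => √d *
      (‖(g : Matrix (Fin d) (Fin d) ℝ) - 1‖ + ‖((g⁻¹ : SLR d) : Matrix (Fin d) (Fin d) ℝ) - 1‖) := by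
    have a := SLR.continuous_val (d := d)
    have b := a.comp continuous_inv
    exact continuous_const.mul ((a.sub continuous_const).norm.add (b.sub continuous_const).norm)
  have h2 := h1.tendsto 1
  simp only [inv_one, Matrix.SpecialLinearGroup.coe_one, sub_self, norm_zero, add_zero,
    mul_zero] at h2
  exact squeeze_zero phi_nonneg phi_le_norm_add h2

theorem continuous_phi : Continuous (phi : SLR d → ℝ) := by
  rw [continuous_iff_continuousAt]
  intro g
  rw [ContinuousAt, tendsto_iff_dist_tendsto_zero]
  have h2 : Filter.Tendsto (fun h : SLR d => g⁻¹ * h) (nhds g) (nhds 1) := by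
    have := (continuous_const_mul (g⁻¹ : SLR d)).tendsto g
    rwa [inv_mul_cancel] at this
  have h3 := (tendsto_phi_one.comp h2).const_mul (√d)
  rw [mul_zero] at h3
  refine squeeze_zero (fun _ => dist_nonneg) (fun h => ?_) h3
  have h3 := phi_mul_sub_le g (g⁻¹ * h)
  rw [mul_inv_cancel_left] at h3
  rw [Real.dist_eq]
  exact h3

theorem isCompact_phi_le (t : ℝ) : IsCompact {g : SLR d | phi g ≤ t} := by
  have hc : IsClosed {g : SLR d | phi g ≤ t} := isClosed_le continuous_phi continuous_const
  have : {g : SLR d | phi g ≤ t} ⊆ (fun g : SLR d => (g : Matrix (Fin d) (Fin d) ℝ)) ⁻¹'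
      (Metric.closedBall 0 (Real.exp t)) := by
    intro g hg
    simp only [Set.mem_preimage, Metric.mem_closedBall, dist_zero_right]
    exact (norm_le_exp_phi g).trans (Real.exp_le_exp.2 hg)
  have : ProperSpace (Matrix (Fin d) (Fin d) ℝ) := FiniteDimensional.proper_real _
  exact (SLR.isClosedEmbedding_val.isCompact_preimage
    (isCompact_closedBall 0 (Real.exp t))).of_isClosed_subset hc (by assumption)

end cartan

section cartan
variable {d : ℕ}

/-- The diagonal element `exp (x - mean x)` of `SL(d,ℝ)`. -/
noncomputable def dg (x : Fin d → ℝ) : SLR d :=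
  ⟨diagonal fun i => Real.exp (x i - (∑ j, x j) / d), by
    rw [Matrix.det_diagonal, ← Real.exp_sum, Finset.sum_sub_distrib, Finset.sum_const,
      Finset.card_univ, Fintype.card_fin, nsmul_eq_mul]
    rcases Nat.eq_zero_or_pos d with rfl | h
    · simp
    · have : (d : ℝ) ≠ 0 := by positivity
      rw [mul_div_cancel₀ _ this, sub_self, Real.exp_zero]⟩

theorem dg_val (x : Fin d → ℝ) : (dg x : Matrix (Fin d) (Fin d) ℝ) =
    diagonal fun i => Real.exp (x i - (∑ j, x j) / d) := rfl

theorem dg_val_of_sum {x : Fin d → ℝ} (h : ∑ i, x i = 0) :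
    (dg x : Matrix (Fin d) (Fin d) ℝ) = diagonal fun i => Real.exp (x i) := by
  rw [dg_val, h]; simp

theorem dg_add (x y : Fin d → ℝ) : dg (x + y) = dg x * dg y := by
  apply SLR.coe_injective
  rw [Matrix.SpecialLinearGroup.coe_mul, dg_val, dg_val, dg_val, Matrix.diagonal_mul_diagonal]
  congr 1; ext i
  rw [← Real.exp_add]
  simp only [Pi.add_apply, Finset.sum_add_distrib]
  congr 1; ring

theorem dg_zero : dg (0 : Fin d → ℝ) = 1 := by
  apply SLR.coe_injective; rw [dg_val]; simp

theorem dg_neg (x : Fin d → ℝ) : dg (-x) = (dg x)⁻¹ := by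
  rw [eq_inv_iff_mul_eq_one, ← dg_add, neg_add_cancel, dg_zero]

theorem isSVD_dg {x : Fin d → ℝ} (h : ∑ i, x i = 0) : IsSVD (dg x) x :=
  ⟨1, 1, by simp, by simp, by rw [dg_val_of_sum h]; simp⟩

theorem phi_dg {x : Fin d → ℝ} (h : ∑ i, x i = 0) : phi (dg x) = en x := (isSVD_dg h).phi_eq

theorem det_orth {O : Matrix (Fin d) (Fin d) ℝ} (hO : Oᵀ * O = 1) : O.det = 1 ∨ O.det = -1 := by
  have := congrArg Matrix.det hO
  rw [Matrix.det_mul, Matrix.det_transpose, Matrix.det_one] at this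
  exact mul_self_eq_one_iff.1 this

theorem IsSVD.sum_zero {g : SLR d} {x : Fin d → ℝ} (h : IsSVD g x) : ∑ i, x i = 0 := by
  obtain ⟨O, O', hO, hO', e⟩ := h
  have h1 : (g : Matrix (Fin d) (Fin d) ℝ).det = 1 := g.2
  rw [e, Matrix.det_mul, Matrix.det_mul, Matrix.det_diagonal, ← Real.exp_sum] at h1
  rw [← Real.exp_eq_one_iff]
  have := Real.exp_pos (∑ i, x i)
  rcases det_orth hO with h2 | h2 <;> rcases det_orth hO' with h3 | h3 <;> rw [h2, h3] at h1 <;>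
    linarith

theorem IsSVD.exists_kak {g : SLR d} {x : Fin d → ℝ} (h : IsSVD g x) :
    ∃ k ∈ Kd d, ∃ k' ∈ Kd d, g = k * dg x * k' := by
  have hs := h.sum_zero
  obtain ⟨O, O', hO, hO', e⟩ := h
  have h1 : (g : Matrix (Fin d) (Fin d) ℝ).det = 1 := g.2
  rw [e, Matrix.det_mul, Matrix.det_mul, Matrix.det_diagonal, ← Real.exp_sum, hs, Real.exp_zero,
    mul_one] at h1
  rcases det_orth hO with h2 | h2
  · have h3 : O'.det = 1 := by rw [h2, one_mul] at h1; exact h1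
    refine ⟨⟨O, h2⟩, hO, ⟨O', h3⟩, hO', SLR.coe_injective ?_⟩
    show (g : Matrix (Fin d) (Fin d) ℝ) = O * (dg x : Matrix (Fin d) (Fin d) ℝ) * O'
    rw [dg_val_of_sum hs]
    exact e
  · have h3 : O'.det = -1 := by rw [h2] at h1; linarith
    rcases Nat.eq_zero_or_pos d with rfl | hd
    · simp at h2; norm_num at h2
    set r : Fin d → ℝ := fun i => if i = ⟨0, hd⟩ then -1 else 1 with hr
    set R : Matrix (Fin d) (Fin d) ℝ := diagonal r with hR
    have hrr : R * R = 1 := by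
      rw [hR, Matrix.diagonal_mul_diagonal, ← Matrix.diagonal_one]
      congr 1; ext i; simp only [hr]; split_ifs <;> norm_num
    have hRR : Rᵀ * R = 1 := by rw [hR, Matrix.diagonal_transpose]; exact hrr
    have hdet : R.det = -1 := by
      rw [hR, Matrix.det_diagonal]; simp [hr, Finset.prod_ite_eq']
    refine ⟨⟨O * R, by rw [Matrix.det_mul, h2, hdet]; norm_num⟩, orth_mul hO hRR,
      ⟨R * O', by rw [Matrix.det_mul, h3, hdet]; norm_num⟩, orth_mul hRR hO',
      SLR.coe_injective ?_⟩
    show (g : Matrix (Fin d) (Fin d) ℝ) = (O * R) * (dg x : Matrix (Fin d) (Fin d) ℝ) * (R * O')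
    rw [dg_val_of_sum hs, e]
    have hc : R * diagonal (fun i => Real.exp (x i)) * R = diagonal (fun i => Real.exp (x i)) := by
      rw [hR, Matrix.diagonal_mul_diagonal, Matrix.diagonal_mul_diagonal]
      congr 1; ext i; simp only [hr]; split_ifs <;> ring
    calc O * diagonal (fun i => Real.exp (x i)) * O' =
          O * (R * diagonal (fun i => Real.exp (x i)) * R) * O' := by rw [hc]
      _ = (O * R) * diagonal (fun i => Real.exp (x i)) * (R * O') := by
        simp only [Matrix.mul_assoc]

theorem exists_kak (g : SLR d) : ∃ x : Fin d → ℝ, Antitone x ∧ ∑ i, x i = 0 ∧ phi g = en x ∧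
    ∃ k ∈ Kd d, ∃ k' ∈ Kd d, g = k * dg x * k' := by
  obtain ⟨x, hx, h⟩ := exists_isSVD g
  exact ⟨x, hx, h.sum_zero, h.phi_eq, h.exists_kak⟩

end cartan

section rep
variable {H : Type*} [NormedAddCommGroup H] [InnerProductSpace ℝ H]
  {G : Type*} [Group G] (ρ : G →* (H ≃ₗᵢ[ℝ] H))

theorem rep_mul (g h : G) (v : H) : ρ (g * h) v = ρ g (ρ h v) := by rw [map_mul]; rfl

theorem rep_one (v : H) : ρ 1 v = v := by rw [map_one]; rfl

theorem rep_inner (g : G) (v w : H) : inner ℝ (ρ g v) (ρ g w) = inner ℝ v w :=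
  LinearIsometryEquiv.inner_map_map _ _ _

theorem rep_inner_inv (g : G) (v w : H) : inner ℝ v (ρ g w) = inner ℝ (ρ g⁻¹ v) w := by
  rw [← rep_inner ρ g⁻¹ v, ← rep_mul, inv_mul_cancel, rep_one]

theorem rep_norm (g : G) (v : H) : ‖ρ g v‖ = ‖v‖ := LinearIsometryEquiv.norm_map _ _

theorem rep_fix_inv {g : G} {v : H} (h : ρ g v = v) : ρ g⁻¹ v = v := by
  conv_lhs => rw [← h]
  rw [← rep_mul, inv_mul_cancel, rep_one]

theorem rep_inner_le (g : G) (v w : H) : |inner ℝ v (ρ g w)| ≤ ‖v‖ * ‖w‖ :=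
  (abs_real_inner_le_norm _ _).trans (by rw [rep_norm])

/-- The subgroup fixing a vector. -/
def fixer (v : H) : Subgroup G where
  carrier := {g | ρ g v = v}
  one_mem' := rep_one ρ v
  mul_mem' {a b} ha hb := by
    show ρ (a * b) v = v
    rw [rep_mul, show ρ b v = v from hb, show ρ a v = v from ha]
  inv_mem' {a} ha := rep_fix_inv ρ ha

theorem mem_fixer {g : G} {v : H} : g ∈ fixer ρ v ↔ ρ g v = v := Iff.rfl

variable [CompleteSpace H]

/-- Averaging over a circle subgroup fixing `ζ`. -/
theorem circle_average {u : ℝ → G} (hu : ∀ a b, u (a + b) = u a * u b)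
    (hp : u (2 * Real.pi) = 1) {η ζ : H} (hc : Continuous fun s => ρ (u s) η)
    (hζ : ∀ s, ρ (u s) ζ = ζ) :
    inner ℝ ζ η ^ 2 * (2 * Real.pi) ≤
      ‖ζ‖ ^ 2 * ∫ s in (0 : ℝ)..(2 * Real.pi), inner ℝ η (ρ (u s) η) := by
  have hpi := Real.pi_pos
  set A : H := ∫ s in (0 : ℝ)..(2 * Real.pi), ρ (u s) η with hA
  have hitg : ∀ a b, IntervalIntegrable (fun s => ρ (u s) η) volume a b :=
    fun a b => hc.intervalIntegrable a b
  have h1 : ∀ z : H, inner ℝ z A = ∫ s in (0 : ℝ)..(2 * Real.pi), inner ℝ z (ρ (u s) η) := by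
    intro z
    have := ContinuousLinearMap.intervalIntegral_comp_comm (innerSL ℝ z) (hitg 0 (2 * Real.pi))
    simpa using this.symm
  have hu0 : u 0 = 1 := by
    have := hu 0 0
    simpa using this
  have hper : Function.Periodic (fun s => ρ (u s) η) (2 * Real.pi) := by
    intro s
    simp only [hu, hp, mul_one]
  have h2 : ∀ r, ρ (u r) A = A := by
    intro r
    have := ContinuousLinearMap.intervalIntegral_comp_comm
      ((ρ (u r)).toContinuousLinearEquiv : H →L[ℝ] H) (hitg 0 (2 * Real.pi))
    have e : (∫ s in (0 : ℝ)..(2 * Real.pi), ρ (u (s + r)) η) = ρ (u r) A := by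
      rw [hA]
      refine Eq.trans (intervalIntegral.integral_congr fun s _ => ?_) this
      show ρ (u (s + r)) η = ρ (u r) (ρ (u s) η)
      rw [← rep_mul, ← hu, add_comm]
    rw [← e, intervalIntegral.integral_comp_add_right (fun s => ρ (u s) η), zero_add, add_comm,
      hper.intervalIntegral_add_eq r 0, zero_add]
  have h3 : inner ℝ ζ A = 2 * Real.pi * inner ℝ ζ η := by
    rw [h1]
    rw [intervalIntegral.integral_congr (g := fun _ => inner ℝ ζ η)]
    · simp
    · intro s _
      show inner ℝ ζ (ρ (u s) η) = _
      conv_lhs => rw [← hζ s]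
      rw [rep_inner]
  have h4 : inner ℝ A A = 2 * Real.pi * inner ℝ A η := by
    rw [h1]
    rw [intervalIntegral.integral_congr (g := fun _ => inner ℝ A η)]
    · simp
    · intro s _
      show inner ℝ A (ρ (u s) η) = _
      conv_lhs => rw [← h2 s]
      rw [rep_inner]
  have h5 : inner ℝ A η = ∫ s in (0 : ℝ)..(2 * Real.pi), inner ℝ η (ρ (u s) η) := by
    rw [real_inner_comm, h1]
  rw [← h5]
  have h6 : (inner ℝ ζ A) ^ 2 ≤ ‖ζ‖ ^ 2 * inner ℝ A A := by
    have := real_inner_mul_inner_self_le ζ A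
    rw [real_inner_self_eq_norm_sq ζ] at this
    nlinarith
  rw [h3, h4] at h6
  have : (2 * Real.pi) * (inner ℝ ζ η ^ 2 * (2 * Real.pi)) ≤ (2 * Real.pi) * (‖ζ‖ ^ 2 * inner ℝ A η) := by
    nlinarith
  exact le_of_mul_le_mul_left this (by positivity)

end rep

section calculus

theorem integral_comp_arccos {f : ℝ → ℝ} (hf : Continuous f) {M : ℝ} (hM : ∀ x, |f x| ≤ M)
    {a b : ℝ} (hb : 0 < b) (hab : |a| + b ≤ 1) :
    |(∫ s in (0 : ℝ)..Real.pi, f (Real.arccos (a + b * Real.cos s))) -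
      ∫ s in (0 : ℝ)..Real.pi, f s| ≤
      2 * M * (Real.arccos (a + b) + (Real.pi - Real.arccos (a - b))) := by
  have hpi := Real.pi_pos
  have ha := abs_le.1 (show |a| ≤ 1 - b by linarith)
  have hM0 : 0 ≤ M := (abs_nonneg _).trans (hM 0)
  set P : ℝ → ℝ := fun s => Real.arccos (a + b * Real.cos s) with hP
  set P' : ℝ → ℝ := fun s => b * Real.sin s / √(1 - (a + b * Real.cos s) ^ 2) with hP'
  have hPc : Continuous P := by
    apply Real.continuous_arccos.comp; fun_prop
  have hd : ∀ s ∈ Set.Ioo (0 : ℝ) Real.pi, HasDerivAt P (P' s) s := by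
    intro s hs
    have hs1 : Real.cos s < 1 := by
      rw [← Real.cos_zero]
      exact Real.cos_lt_cos_of_nonneg_of_le_pi le_rfl hs.2.le hs.1
    have hs2 : -1 < Real.cos s := by
      rw [← Real.cos_pi]
      exact Real.cos_lt_cos_of_nonneg_of_le_pi hs.1.le le_rfl hs.2
    have h1 : a + b * Real.cos s ≠ 1 := by nlinarith
    have h2 : a + b * Real.cos s ≠ -1 := by nlinarith
    have := (Real.hasDerivAt_arccos h2 h1).comp s
      (((Real.hasDerivAt_cos s).const_mul b).const_add a)
    refine this.congr_deriv ?_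
    simp only [hP']; ring
  have hpos : ∀ s ∈ Set.Ioo (0 : ℝ) Real.pi, 0 ≤ P' s := fun s hs =>
    div_nonneg (mul_nonneg hb.le (Real.sin_nonneg_of_nonneg_of_le_pi hs.1.le hs.2.le))
      (Real.sqrt_nonneg _)
  have hle : ∀ s ∈ Set.Ioo (0 : ℝ) Real.pi, P' s ≤ 1 := by
    intro s hs
    apply div_le_one_of_le₀ _ (Real.sqrt_nonneg _)
    apply Real.le_sqrt_of_sq_le
    have hc := abs_le.1 (Real.abs_cos_le_one s)
    have h1 : a * Real.cos s ≤ |a| := by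
      calc a * Real.cos s ≤ |a * Real.cos s| := le_abs_self _
        _ = |a| * |Real.cos s| := abs_mul _ _
        _ ≤ |a| * 1 := by gcongr; exact Real.abs_cos_le_one s
        _ = |a| := mul_one _
    have h2 : a ^ 2 = |a| ^ 2 := (sq_abs a).symm
    have h3 := Real.sin_sq_add_cos_sq s
    have h4 : (|a| + b) ^ 2 ≤ 1 := by
      have := abs_nonneg a
      nlinarith
    have h5 : b * (a * Real.cos s) ≤ b * |a| := by gcongr
    have h6 : b ^ 2 * (Real.sin s ^ 2 + Real.cos s ^ 2) = b ^ 2 := by rw [h3, mul_one]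
    nlinarith
  have huI : Set.uIcc (0 : ℝ) Real.pi = Set.Icc 0 Real.pi := Set.uIcc_of_le hpi.le
  have hitg : IntervalIntegrable P' volume 0 Real.pi := by
    apply intervalIntegral.intervalIntegrable_deriv_of_nonneg (g := P) hPc.continuousOn
    · intro s hs; rw [min_eq_left hpi.le, max_eq_right hpi.le] at hs; exact hd s hs
    · intro s hs; rw [min_eq_left hpi.le, max_eq_right hpi.le] at hs; exact hpos s hs
  have hsub : (∫ s in (0 : ℝ)..Real.pi, (f ∘ P) s * P' s) = ∫ x in P 0..P Real.pi, f x := by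
    apply intervalIntegral.integral_comp_mul_deriv''' hPc.continuousOn
    · intro s hs; rw [min_eq_left hpi.le, max_eq_right hpi.le] at hs
      exact (hd s hs).hasDerivWithinAt
    · exact hf.continuousOn
    · exact hf.continuousOn.integrableOn_compact (isCompact_uIcc.image_of_continuousOn hPc.continuousOn)
    · have : IntervalIntegrable (fun s => (f ∘ P) s * P' s) volume 0 Real.pi :=
        hitg.continuousOn_mul (hf.comp hPc).continuousOn
      exact (intervalIntegrable_iff' enorm_ne_top).1 this
  have hone : (∫ s in (0 : ℝ)..Real.pi, P' s) = P Real.pi - P 0 := by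
    apply intervalIntegral.integral_eq_sub_of_hasDerivAt_of_le hpi.le hPc.continuousOn hd hitg
  have hP0 : P 0 = Real.arccos (a + b) := by simp [hP]
  have hPpi : P Real.pi = Real.arccos (a - b) := by simp [hP]; ring_nf
  have key : |∫ s in (0 : ℝ)..Real.pi, f (P s) * (1 - P' s)| ≤ ∫ s in (0 : ℝ)..Real.pi, M * (1 - P' s) := by
    rw [← Real.norm_eq_abs]
    apply intervalIntegral.norm_integral_le_of_norm_le hpi.le
    · have : ∀ᵐ s : ℝ, s ≠ Real.pi := by simp [ae_iff]
      filter_upwards [this] with s hs1 hs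
      have h1 : s ∈ Set.Ioo (0 : ℝ) Real.pi := ⟨hs.1, lt_of_le_of_ne hs.2 hs1⟩
      rw [norm_mul, Real.norm_eq_abs, Real.norm_eq_abs, abs_of_nonneg (sub_nonneg.2 (hle s h1))]
      exact mul_le_mul_of_nonneg_right (hM _) (sub_nonneg.2 (hle s h1))
    · exact (intervalIntegrable_const.sub hitg).const_mul M
  have e1 : (∫ s in (0 : ℝ)..Real.pi, f (P s) * (1 - P' s)) =
      (∫ s in (0 : ℝ)..Real.pi, f (P s)) - ∫ x in P 0..P Real.pi, f x := by
    rw [← hsub, ← intervalIntegral.integral_sub]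
    · congr 1; ext s; simp only [Function.comp]; ring
    · exact (hf.comp hPc).intervalIntegrable _ _
    · exact hitg.continuousOn_mul (hf.comp hPc).continuousOn
  have e2 : (∫ s in (0 : ℝ)..Real.pi, M * (1 - P' s)) = M * (Real.pi - (P Real.pi - P 0)) := by
    rw [intervalIntegral.integral_const_mul, intervalIntegral.integral_sub intervalIntegrable_const hitg,
      hone]
    simp
  have e3 : (∫ s in (0 : ℝ)..Real.pi, f s) = (∫ s in (0 : ℝ)..P 0, f s) +
      (∫ s in P 0..P Real.pi, f s) + ∫ s in P Real.pi..Real.pi, f s := by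
    rw [intervalIntegral.integral_add_adjacent_intervals, intervalIntegral.integral_add_adjacent_intervals]
      <;> exact hf.intervalIntegrable _ _
  have b1 : |∫ s in (0 : ℝ)..P 0, f s| ≤ M * P 0 := by
    have := intervalIntegral.norm_integral_le_of_norm_le_const (a := 0) (b := P 0) (f := f) (C := M)
      (fun x _ => hM x)
    rw [sub_zero, abs_of_nonneg (Real.arccos_nonneg _)] at this
    exact this
  have b2 : |∫ s in P Real.pi..Real.pi, f s| ≤ M * (Real.pi - P Real.pi) := by
    have := intervalIntegral.norm_integral_le_of_norm_le_const (a := P Real.pi) (b := Real.pi) (f := f) (C := M)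
      (fun x _ => hM x)
    rw [abs_of_nonneg (sub_nonneg.2 (Real.arccos_le_pi _))] at this
    exact this
  rw [e1, e2] at key
  rw [e3, ← hP0, ← hPpi]
  have k := abs_le.1 key
  have b1' := abs_le.1 b1
  have b2' := abs_le.1 b2
  rw [abs_le]
  constructor <;> linarith

end calculus

section so3

theorem SLR.ext_val {d : ℕ} {g h : SLR d} (e : (g : Matrix (Fin d) (Fin d) ℝ) = h) : g = h :=
  SLR.coe_injective e

theorem SLR.val_mul {d : ℕ} (g h : SLR d) : ((g * h : SLR d) : Matrix (Fin d) (Fin d) ℝ) =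
  (g : Matrix (Fin d) (Fin d) ℝ) * (h : Matrix (Fin d) (Fin d) ℝ) := rfl

/-- Rotation in the first two coordinates. -/
noncomputable def rotA (t : ℝ) : SLR 3 :=
  ⟨!![Real.cos t, -Real.sin t, 0; Real.sin t, Real.cos t, 0; 0, 0, 1], by
    simp [Matrix.det_fin_three, ← sq]⟩

/-- Rotation in the last two coordinates. -/
noncomputable def rotB (t : ℝ) : SLR 3 :=
  ⟨!![1, 0, 0; 0, Real.cos t, -Real.sin t; 0, Real.sin t, Real.cos t], by
    simp [Matrix.det_fin_three, ← sq]⟩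

theorem rotA_val (t : ℝ) : (rotA t : Matrix (Fin 3) (Fin 3) ℝ) =
  !![Real.cos t, -Real.sin t, 0; Real.sin t, Real.cos t, 0; 0, 0, 1] := rfl

theorem rotB_val (t : ℝ) : (rotB t : Matrix (Fin 3) (Fin 3) ℝ) =
  !![1, 0, 0; 0, Real.cos t, -Real.sin t; 0, Real.sin t, Real.cos t] := rfl

theorem rotB_add (s t : ℝ) : rotB (s + t) = rotB s * rotB t := by
  apply SLR.ext_val
  rw [SLR.val_mul, rotB_val, rotB_val, rotB_val]
  ext i j
  fin_cases i <;> fin_cases j <;> simp [Matrix.mul_apply, Fin.sum_univ_three, Real.cos_add, Real.sin_add] <;> ring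

theorem rotA_add (s t : ℝ) : rotA (s + t) = rotA s * rotA t := by
  apply SLR.ext_val
  rw [SLR.val_mul, rotA_val, rotA_val, rotA_val]
  ext i j
  fin_cases i <;> fin_cases j <;> simp [Matrix.mul_apply, Fin.sum_univ_three, Real.cos_add, Real.sin_add] <;> ring

theorem rotA_zero : rotA 0 = 1 := by
  apply SLR.ext_val
  rw [rotA_val]
  ext i j
  fin_cases i <;> fin_cases j <;> simp

theorem rotB_zero : rotB 0 = 1 := by
  apply SLR.ext_val
  rw [rotB_val]
  ext i j
  fin_cases i <;> fin_cases j <;> simp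

theorem rotA_neg (t : ℝ) : rotA (-t) = (rotA t)⁻¹ := by
  rw [eq_inv_iff_mul_eq_one, ← rotA_add, neg_add_cancel, rotA_zero]

theorem rotB_neg (t : ℝ) : rotB (-t) = (rotB t)⁻¹ := by
  rw [eq_inv_iff_mul_eq_one, ← rotB_add, neg_add_cancel, rotB_zero]

theorem rotB_two_pi : rotB (2 * Real.pi) = 1 := by
  apply SLR.ext_val
  rw [rotB_val]
  ext i j
  fin_cases i <;> fin_cases j <;> simp

theorem rotA_mem (t : ℝ) : rotA t ∈ Kd 3 := by
  rw [mem_Kd, rotA_val]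
  ext i j
  fin_cases i <;> fin_cases j <;> simp [Matrix.mul_apply, Fin.sum_univ_three] <;>
    nlinarith [Real.sin_sq_add_cos_sq t]

theorem rotB_mem (t : ℝ) : rotB t ∈ Kd 3 := by
  rw [mem_Kd, rotB_val]
  ext i j
  fin_cases i <;> fin_cases j <;> simp [Matrix.mul_apply, Fin.sum_univ_three] <;>
    nlinarith [Real.sin_sq_add_cos_sq t]

theorem continuous_rotA : Continuous rotA := by
  rw [SLR.continuous_iff]
  refine continuous_matrix fun i j => ?_
  fin_cases i <;> fin_cases j <;> simp [rotA_val] <;> fun_prop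

theorem continuous_rotB : Continuous rotB := by
  rw [SLR.continuous_iff]
  refine continuous_matrix fun i j => ?_
  fin_cases i <;> fin_cases j <;> simp [rotB_val] <;> fun_prop

theorem exists_angle {x y : ℝ} (h : x ^ 2 + y ^ 2 = 1) : ∃ t, Real.cos t = x ∧ Real.sin t = y := by
  refine ⟨Complex.arg ⟨x, y⟩, ?_⟩
  have hn : ‖(⟨x, y⟩ : ℂ)‖ = 1 := by
    rw [Complex.norm_def, Complex.normSq_mk, ← sq, ← sq, h, Real.sqrt_one]
  have h0 : (⟨x, y⟩ : ℂ) ≠ 0 := by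
    intro h; rw [h] at hn; simp at hn
  rw [Complex.cos_arg h0, Complex.sin_arg, hn]
  simp

theorem exists_angle' {r x y : ℝ} (h : x ^ 2 + y ^ 2 = r ^ 2) :
    ∃ t, r * Real.cos t = x ∧ r * Real.sin t = y := by
  by_cases hr : r = 0
  · subst hr
    have hx : x = 0 := by nlinarith [sq_nonneg x, sq_nonneg y]
    have hy : y = 0 := by nlinarith [sq_nonneg x, sq_nonneg y]
    exact ⟨0, by simp [hx], by simp [hy]⟩
  · obtain ⟨t, h1, h2⟩ := exists_angle (x := x / r) (y := y / r) (by
      rw [div_pow, div_pow, ← add_div, h, div_self (pow_ne_zero 2 hr)])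
    exact ⟨t, by rw [h1]; field_simp, by rw [h2]; field_simp⟩

/-- An element of `SO(3)` fixing the first basis vector is a rotation of the last two coordinates. -/
theorem eq_rotB {g : SLR 3} (hg : g ∈ Kd 3) (h : g 0 0 = 1) : ∃ t, g = rotB t := by
  have h1 : (g : Matrix (Fin 3) (Fin 3) ℝ)ᵀ * (g : Matrix (Fin 3) (Fin 3) ℝ) = 1 := hg
  have h2 : (g : Matrix (Fin 3) (Fin 3) ℝ) * (g : Matrix (Fin 3) (Fin 3) ℝ)ᵀ = 1 :=
    mul_eq_one_comm.1 h1
  have hdet : (g : Matrix (Fin 3) (Fin 3) ℝ).det = 1 := g.2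
  have e1 := congrFun₂ h1 0 0
  have e2 := congrFun₂ h2 0 0
  have e3 := congrFun₂ h1 1 1
  have e4 := congrFun₂ h1 1 2
  have e5 := congrFun₂ h1 2 2
  simp [Matrix.mul_apply, Fin.sum_univ_three, h] at e1 e2 e3 e4 e5
  rw [Matrix.det_fin_three] at hdet
  have a1 : g 1 0 = 0 := by nlinarith [sq_nonneg (g 1 0), sq_nonneg (g 2 0)]
  have a2 : g 2 0 = 0 := by nlinarith [sq_nonneg (g 1 0), sq_nonneg (g 2 0)]
  have a3 : g 0 1 = 0 := by nlinarith [sq_nonneg (g 0 1), sq_nonneg (g 0 2)]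
  have a4 : g 0 2 = 0 := by nlinarith [sq_nonneg (g 0 1), sq_nonneg (g 0 2)]
  simp only [h, a1, a2, a3, a4] at hdet e1 e2 e3 e4 e5
  obtain ⟨t, ht1, ht2⟩ := exists_angle (x := g 1 1) (y := g 2 1) (by linarith)
  refine ⟨t, SLR.ext_val ?_⟩
  have b1 : g 2 2 = g 1 1 := by
    linear_combination (g 1 1) * hdet + (g 2 1) * e4 - (g 2 2) * e3
  have b2 : g 1 2 = - g 2 1 := by
    linear_combination -(g 2 1) * hdet + (g 1 1) * e4 - (g 1 2) * e3
  rw [rotB_val, ht1, ht2]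
  ext i j
  fin_cases i <;> fin_cases j <;> simp [h, a1, a2, a3, a4, b1, b2]

/-- The double coset of an element of `SO(3)` only depends on its upper left entry. -/
theorem so3_double_coset {g : SLR 3} (hg : g ∈ Kd 3) :
    ∃ s t, g = rotB s * rotA (Real.arccos (g 0 0)) * rotB t := by
  have h1 : (g : Matrix (Fin 3) (Fin 3) ℝ)ᵀ * (g : Matrix (Fin 3) (Fin 3) ℝ) = 1 := hg
  have e1 := congrFun₂ h1 0 0
  simp [Matrix.mul_apply, Fin.sum_univ_three] at e1
  have hb : -1 ≤ g 0 0 ∧ g 0 0 ≤ 1 := by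
    constructor <;> nlinarith [sq_nonneg (g 1 0), sq_nonneg (g 2 0)]
  set θ := Real.arccos (g 0 0) with hθ
  have hc : Real.cos θ = g 0 0 := Real.cos_arccos hb.1 hb.2
  obtain ⟨s, hs1, hs2⟩ := exists_angle' (r := Real.sin θ) (x := g 1 0) (y := g 2 0) (by
    have := Real.sin_sq_add_cos_sq θ
    rw [hc] at this; nlinarith)
  have hm : (rotB s * rotA θ)⁻¹ * g ∈ Kd 3 :=
    mul_mem (inv_mem (mul_mem (rotB_mem s) (rotA_mem θ))) hg
  obtain ⟨t, ht⟩ := eq_rotB hm (by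
    rw [_root_.mul_inv_rev, ← rotA_neg, ← rotB_neg]
    show ((rotA (-θ) : Matrix (Fin 3) (Fin 3) ℝ) * (rotB (-s) : Matrix (Fin 3) (Fin 3) ℝ) *
      (g : Matrix (Fin 3) (Fin 3) ℝ)) 0 0 = 1
    have q : Real.cos θ * Real.cos θ + Real.sin θ * Real.sin θ = 1 := by
      nlinarith [Real.sin_sq_add_cos_sq θ]
    have q' : Real.cos s * Real.cos s + Real.sin s * Real.sin s = 1 := by
      nlinarith [Real.sin_sq_add_cos_sq s]
    rw [rotA_val, rotB_val]
    simp [Matrix.mul_apply, Fin.sum_univ_three, ← hc, ← hs1, ← hs2]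
    linear_combination q + Real.sin θ ^ 2 * (q'))
  exact ⟨s, t, by rw [← ht, mul_inv_cancel_left]⟩

end so3

section holder
variable {H : Type*} [NormedAddCommGroup H] [InnerProductSpace ℝ H] [CompleteSpace H]
  (ρ : SLR 3 →* (H ≃ₗᵢ[ℝ] H))

theorem rotA_rotB_rotA (α s β : ℝ) : ((rotA α)⁻¹ * rotB s * rotA β : SLR 3) 0 0 =
    Real.cos α * Real.cos β + Real.sin α * Real.sin β * Real.cos s := by
  rw [← rotA_neg]
  show ((rotA (-α) : Matrix (Fin 3) (Fin 3) ℝ) * (rotB s : Matrix (Fin 3) (Fin 3) ℝ) *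
      (rotA β : Matrix (Fin 3) (Fin 3) ℝ)) 0 0 = _
  rw [rotA_val, rotB_val, rotA_val]
  simp [Matrix.mul_apply, Fin.sum_univ_three]
  ring

theorem integral_two_pi_cos {F : ℝ → ℝ} (hF : Continuous F) :
    (∫ s in (0 : ℝ)..(2 * Real.pi), F (Real.cos s)) = 2 * ∫ s in (0 : ℝ)..Real.pi, F (Real.cos s) := by
  have hc : Continuous fun s => F (Real.cos s) := hF.comp Real.continuous_cos
  rw [← intervalIntegral.integral_add_adjacent_intervals (hc.intervalIntegrable 0 Real.pi)
    (hc.intervalIntegrable Real.pi (2 * Real.pi)),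
    two_mul (∫ s in (0 : ℝ)..Real.pi, F (Real.cos s))]
  congr 1
  have := intervalIntegral.integral_comp_sub_left (a := 0) (b := Real.pi)
    (fun s => F (Real.cos s)) (2 * Real.pi)
  rw [sub_zero, show 2 * Real.pi - Real.pi = Real.pi by ring] at this
  rw [← this]
  simp [Real.cos_two_pi_sub]

theorem so3_holder (hρ : ∀ v, Continuous fun g => ρ g v) {ξ ζ : H}
    (hξ : ∀ s, ρ (rotB s) ξ = ξ) (hζ : ∀ s, ρ (rotB s) ζ = ζ) {θ : ℝ} (h0 : 0 ≤ θ)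
    (h1 : θ ≤ Real.pi / 2) :
    inner ℝ ζ (ρ (rotA θ) ξ - ρ (rotA (Real.pi / 2)) ξ) ^ 2 ≤
      6 * Real.cos θ * (‖ζ‖ * ‖ξ‖) ^ 2 := by
  have hpi := Real.pi_pos
  rcases h0.eq_or_lt with rfl | hθ
  · have := abs_real_inner_le_norm ζ (ρ (rotA 0) ξ - ρ (rotA (Real.pi / 2)) ξ)
    have h2 : ‖ρ (rotA 0) ξ - ρ (rotA (Real.pi / 2)) ξ‖ ≤ ‖ξ‖ + ‖ξ‖ :=
      (norm_sub_le _ _).trans (by rw [rep_norm, rep_norm])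
    have h3 : |inner ℝ ζ (ρ (rotA 0) ξ - ρ (rotA (Real.pi / 2)) ξ)| ≤ ‖ζ‖ * (‖ξ‖ + ‖ξ‖) :=
      this.trans (by gcongr)
    rw [← sq_abs, Real.cos_zero]
    have h4 := pow_le_pow_left₀ (abs_nonneg _) h3 2
    nlinarith [sq_nonneg (‖ζ‖ * ‖ξ‖)]
  set f : ℝ → ℝ := fun t => inner ℝ ξ (ρ (rotA t) ξ) with hf
  have hfc : Continuous f := continuous_const.inner ((hρ ξ).comp continuous_rotA)
  have hfb : ∀ t, |f t| ≤ ‖ξ‖ ^ 2 := fun t => by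
    rw [sq]; exact rep_inner_le ρ _ _ _
  have hcoef : ∀ g ∈ Kd 3, inner ℝ ξ (ρ g ξ) = f (Real.arccos (g 0 0)) := by
    intro g hg
    obtain ⟨s, t, e⟩ := so3_double_coset hg
    set A := rotA (Real.arccos (g 0 0)) with hA
    have : f (Real.arccos (g 0 0)) = inner ℝ ξ (ρ A ξ) := rfl
    rw [this]
    rw [e, rep_mul, rep_mul, hξ t, rep_inner_inv, ← rotB_neg, hξ]
  set c := Real.cos θ with hc
  set σ := Real.sin θ with hσ
  have hσ0 : 0 < σ := Real.sin_pos_of_pos_of_lt_pi hθ (by linarith)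
  have hσ1 : σ ≤ 1 := Real.sin_le_one θ
  have hcs : σ ^ 2 + c ^ 2 = 1 := Real.sin_sq_add_cos_sq θ
  set η := ρ (rotA θ) ξ - ρ (rotA (Real.pi / 2)) ξ with hη
  have hpair : ∀ α β s, inner ℝ (ρ (rotA α) ξ) (ρ (rotB s) (ρ (rotA β) ξ)) =
      f (Real.arccos (Real.cos α * Real.cos β + Real.sin α * Real.sin β * Real.cos s)) := by
    intro α β s
    rw [← rotA_rotB_rotA, ← hcoef _ (mul_mem (mul_mem (inv_mem (rotA_mem _)) (rotB_mem _)) (rotA_mem _)),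
      mul_assoc, rep_mul, rep_mul, rep_inner_inv ρ (rotA α)⁻¹, inv_inv]
  have hav := circle_average ρ (u := rotB) rotB_add rotB_two_pi (η := η) (ζ := ζ)
    ((hρ η).comp continuous_rotB) hζ
  have hexp : ∀ s, inner ℝ η (ρ (rotB s) η) = f (Real.arccos (c ^ 2 + σ ^ 2 * Real.cos s)) -
      2 * f (Real.arccos (0 + σ * Real.cos s)) + f (Real.arccos (0 + 1 * Real.cos s)) := by
    intro s
    rw [hη, map_sub, inner_sub_left, inner_sub_right, inner_sub_right, hpair, hpair, hpair, hpair,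
      Real.cos_pi_div_two, Real.sin_pi_div_two]
    simp only [← hc, ← hσ]
    ring_nf
  have hk : ∀ a b : ℝ, Continuous fun s => f (Real.arccos (a + b * Real.cos s)) := fun a b => by
    apply hfc.comp; apply Real.continuous_arccos.comp; fun_prop
  have hval : (∫ s in (0 : ℝ)..(2 * Real.pi), inner ℝ η (ρ (rotB s) η)) =
      2 * ((∫ s in (0 : ℝ)..Real.pi, f (Real.arccos (c ^ 2 + σ ^ 2 * Real.cos s))) -
      2 * (∫ s in (0 : ℝ)..Real.pi, f (Real.arccos (0 + σ * Real.cos s))) +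
      ∫ s in (0 : ℝ)..Real.pi, f (Real.arccos (0 + 1 * Real.cos s))) := by
    simp only [hexp]
    have := integral_two_pi_cos (F := fun x => f (Real.arccos (c ^ 2 + σ ^ 2 * x)) -
      2 * f (Real.arccos (0 + σ * x)) + f (Real.arccos (0 + 1 * x))) (by
        have : ∀ a b : ℝ, Continuous fun s => f (Real.arccos (a + b * s)) := fun a b => by
          apply hfc.comp; apply Real.continuous_arccos.comp; fun_prop
        exact ((this (c ^ 2) (σ ^ 2)).sub (continuous_const.mul (this 0 σ))).add (this 0 1))
    rw [this]
    congr 1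
    rw [intervalIntegral.integral_add, intervalIntegral.integral_sub, intervalIntegral.integral_const_mul]
    · exact (hk _ _).intervalIntegrable _ _
    · exact ((hk 0 σ).intervalIntegrable _ _).const_mul 2
    · exact ((hk _ _).intervalIntegrable _ _).sub (((hk 0 σ).intervalIntegrable _ _).const_mul 2)
    · exact (hk _ _).intervalIntegrable _ _
  have i1 := integral_comp_arccos hfc hfb (a := c ^ 2) (b := σ ^ 2) (by positivity)
    (by rw [abs_of_nonneg (sq_nonneg c)]; linarith)
  have i2 := integral_comp_arccos hfc hfb (a := 0) (b := σ) hσ0 (by rw [abs_zero]; linarith)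
  have i3 := integral_comp_arccos hfc hfb (a := 0) (b := 1) one_pos (by rw [abs_zero]; linarith)
  have q1 : Real.arccos (c ^ 2 + σ ^ 2) = 0 := by rw [add_comm, hcs, Real.arccos_one]
  have q2 : Real.arccos (c ^ 2 - σ ^ 2) = 2 * θ := by
    rw [show c ^ 2 - σ ^ 2 = Real.cos (2 * θ) by rw [Real.cos_two_mul']]
    exact Real.arccos_cos (by linarith) (by linarith)
  have q3 : Real.arccos σ = Real.pi / 2 - θ := by
    rw [hσ, ← Real.cos_pi_div_two_sub]
    exact Real.arccos_cos (by linarith) (by linarith)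
  rw [q1, q2] at i1
  rw [zero_add, zero_sub, Real.arccos_neg, q3] at i2
  rw [zero_add, zero_sub, Real.arccos_neg, Real.arccos_one] at i3
  have i1' := abs_le.1 i1
  have i2' := abs_le.1 i2
  have i3' := abs_le.1 i3
  rw [hval] at hav
  simp only [zero_add] at hav i2' i3'
  have hM : 0 ≤ ‖ξ‖ ^ 2 := by positivity
  have hsum : 2 * ((∫ s in (0 : ℝ)..Real.pi, f (Real.arccos (c ^ 2 + σ ^ 2 * Real.cos s))) -
      2 * (∫ s in (0 : ℝ)..Real.pi, f (Real.arccos (σ * Real.cos s))) +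
      ∫ s in (0 : ℝ)..Real.pi, f (Real.arccos (1 * Real.cos s))) ≤ 24 * ‖ξ‖ ^ 2 * (Real.pi / 2 - θ) := by
    nlinarith
  have hsin : 2 / Real.pi * (Real.pi / 2 - θ) ≤ c := by
    have := Real.mul_le_sin (x := Real.pi / 2 - θ) (by linarith) (by linarith)
    rwa [Real.sin_pi_div_two_sub] at this
  have hsin' : Real.pi / 2 - θ ≤ Real.pi / 2 * c := by
    calc Real.pi / 2 - θ = Real.pi / 2 * (2 / Real.pi * (Real.pi / 2 - θ)) := by field_simp
      _ ≤ _ := by gcongr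
  have hfin : inner ℝ ζ η ^ 2 * (2 * Real.pi) ≤ ‖ζ‖ ^ 2 * (24 * ‖ξ‖ ^ 2 * (Real.pi / 2 * c)) := by
    refine hav.trans (mul_le_mul_of_nonneg_left (hsum.trans ?_) (sq_nonneg _))
    gcongr
  have : (2 * Real.pi) * inner ℝ ζ η ^ 2 ≤ (2 * Real.pi) * (6 * c * (‖ζ‖ * ‖ξ‖) ^ 2) := by
    calc (2 * Real.pi) * inner ℝ ζ η ^ 2 ≤ ‖ζ‖ ^ 2 * (24 * ‖ξ‖ ^ 2 * (Real.pi / 2 * c)) := by linarith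
      _ = _ := by ring
  exact le_of_mul_le_mul_left this (by positivity)

end holder

section ergodic
variable {H : Type*} [NormedAddCommGroup H] [InnerProductSpace ℝ H] [CompleteSpace H]
  {G : Type*} [Group G] (ρ : G →* (H ≃ₗᵢ[ℝ] H))

theorem rep_ergodic (a : G) {z : H} (hz : ∀ u, ρ a u = u → inner ℝ u z = 0) :
    Filter.Tendsto (fun N : ℕ => (N : ℝ)⁻¹ • ∑ n ∈ Finset.range N, ρ (a ^ n) z) Filter.atTop (nhds 0) := by
  set f : H →L[ℝ] H := ((ρ a).toContinuousLinearEquiv : H →L[ℝ] H) with hf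
  have hfa : ∀ x, f x = ρ a x := fun x => rfl
  have hn : ‖f‖ ≤ 1 := by
    apply ContinuousLinearMap.opNorm_le_bound _ zero_le_one
    intro x; rw [hfa, rep_norm, one_mul]
  have h := f.tendsto_birkhoffAverage_orthogonalProjection hn z
  have h0 : (f.eqLocus (1 : H →L[ℝ] H)).orthogonalProjectionOnto z = 0 := by
    refine Submodule.orthogonalProjectionOnto_apply_of_mem_orthogonal ?_
    rw [Submodule.mem_orthogonal]
    intro u hu
    exact hz u hu
  have hit : ∀ n : ℕ, f^[n] z = ρ (a ^ n) z := by
    intro n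
    induction n with
    | zero => simp
    | succ n ih => rw [Function.iterate_succ_apply', ih, pow_succ', rep_mul, hfa]
  rw [h0] at h
  refine h.congr fun N => ?_
  simp only [birkhoffAverage, birkhoffSum]
  congr 1
  exact Finset.sum_congr rfl fun n _ => hit n

end ergodic

section svd
variable {d : ℕ}

theorem IsSVD.trace {g : SLR d} {x : Fin d → ℝ} (h : IsSVD g x) :
    ((g : Matrix (Fin d) (Fin d) ℝ)ᵀ * (g : Matrix (Fin d) (Fin d) ℝ)).trace =
      ∑ i, Real.exp (2 * x i) := by
  obtain ⟨O, O', hO, hO', e⟩ := h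
  have h2 : O' * O'ᵀ = 1 := mul_eq_one_comm.1 hO'
  rw [e, Matrix.transpose_mul, Matrix.transpose_mul, Matrix.trace_mul_comm]
  have : O * diagonal (fun i => Real.exp (x i)) * O' *
      (O'ᵀ * ((diagonal fun i => Real.exp (x i))ᵀ * Oᵀ)) =
      O * (diagonal (fun i => Real.exp (x i)) * (O' * O'ᵀ) * (diagonal fun i => Real.exp (x i))) * Oᵀ := by
    rw [Matrix.diagonal_transpose]; simp only [Matrix.mul_assoc]
  rw [this, h2, Matrix.mul_one, Matrix.trace_mul_comm, ← Matrix.mul_assoc, hO, Matrix.one_mul,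
    Matrix.diagonal_mul_diagonal, Matrix.trace_diagonal]
  exact Finset.sum_congr rfl fun i _ => by rw [← Real.exp_add]; ring_nf

/-- The embedding of `SL(2)` in the first two coordinates. -/
noncomputable def emb2 (k : SLR 2) : SLR 3 :=
  ⟨!![k 0 0, k 0 1, 0; k 1 0, k 1 1, 0; 0, 0, 1], by
    have : (k : Matrix (Fin 2) (Fin 2) ℝ).det = 1 := k.2
    rw [Matrix.det_fin_two] at this
    simp [Matrix.det_fin_three]; linarith⟩

theorem emb2_val (k : SLR 2) : (emb2 k : Matrix (Fin 3) (Fin 3) ℝ) =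
  !![k 0 0, k 0 1, 0; k 1 0, k 1 1, 0; 0, 0, 1] := rfl

theorem emb2_mem {k : SLR 2} (hk : k ∈ Kd 2) : emb2 k ∈ Kd 3 := by
  have h : (k : Matrix (Fin 2) (Fin 2) ℝ)ᵀ * (k : Matrix (Fin 2) (Fin 2) ℝ) = 1 := hk
  have e1 := congrFun₂ h 0 0
  have e2 := congrFun₂ h 0 1
  have e3 := congrFun₂ h 1 0
  have e4 := congrFun₂ h 1 1
  simp [Matrix.mul_apply, Fin.sum_univ_two] at e1 e2 e3 e4
  rw [mem_Kd, emb2_val]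
  ext i j
  fin_cases i <;> fin_cases j <;> simp [Matrix.mul_apply, Fin.sum_univ_three, e1, e2, e3, e4]

theorem dg3_val {p q r : ℝ} (h : p + q + r = 0) : (dg ![p, q, r] : Matrix (Fin 3) (Fin 3) ℝ) =
    !![Real.exp p, 0, 0; 0, Real.exp q, 0; 0, 0, Real.exp r] := by
  rw [dg_val_of_sum (by simp [Fin.sum_univ_three]; exact h)]
  ext i j
  fin_cases i <;> fin_cases j <;> simp

theorem dg3_swap {p q r : ℝ} (h : p + q + r = 0) :
    dg ![q, p, r] = rotA (-(Real.pi / 2)) * dg ![p, q, r] * rotA (Real.pi / 2) := by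
  apply SLR.ext_val
  rw [SLR.val_mul, SLR.val_mul, dg3_val h, dg3_val (by linarith), rotA_val, rotA_val]
  ext i j
  fin_cases i <;> fin_cases j <;> simp [Matrix.mul_apply, Fin.sum_univ_three]

theorem block_kak {θ p q r : ℝ} (hs : p + q + r = 0)
    (h : Real.cos θ ^ 2 * (Real.cosh (3 * r) - 1) = Real.cosh (p - q) - 1) :
    ∃ k ∈ Kd 3, ∃ k' ∈ Kd 3, dg ![-r, r / 2, r / 2] * rotA θ * dg ![-r, r / 2, r / 2] =
      k * dg ![p, q, r] * k' := by
  obtain ⟨A, hA⟩ : ∃ A : SLR 2, (A : Matrix (Fin 2) (Fin 2) ℝ) =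
      !![Real.exp (-(3 * r) / 2) * Real.cos θ, -Real.sin θ; Real.sin θ, Real.exp (3 * r / 2) * Real.cos θ] :=
    ⟨⟨_, by
      rw [Matrix.det_fin_two_of]
      have e : Real.exp (-(3 * r) / 2) * Real.exp (3 * r / 2) = 1 := by
        rw [← Real.exp_add]; simp; ring
      have := Real.sin_sq_add_cos_sq θ
      linear_combination this + Real.cos θ ^ 2 * e⟩, rfl⟩
  obtain ⟨z, -, hz⟩ := exists_isSVD A
  have hz0 := hz.sum_zero
  obtain ⟨k, hk, k', hk', e⟩ := hz.exists_kak
  have htr := hz.trace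
  rw [hA, Matrix.trace_fin_two] at htr
  rw [Fin.sum_univ_two] at hz0 htr
  have hz1 : z 1 = - z 0 := by linarith
  rw [hz1] at htr
  simp [Matrix.mul_apply, Fin.sum_univ_two] at htr
  have e1 : Real.exp (-(3 * r) / 2) * Real.exp (-(3 * r) / 2) = Real.exp (-(3 * r)) := by
    rw [← Real.exp_add]; ring_nf
  have e2 : Real.exp (3 * r / 2) * Real.exp (3 * r / 2) = Real.exp (3 * r) := by
    rw [← Real.exp_add]; ring_nf
  have hcosh : Real.cosh (2 * z 0) = Real.cosh (p - q) := by
    have c1 := Real.cosh_eq (2 * z 0)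
    have c2 := Real.cosh_eq (3 * r)
    have := Real.sin_sq_add_cos_sq θ
    have e3 : Real.cosh (2 * z 0) * 2 = Real.cos θ ^ 2 * (Real.cosh (3 * r) * 2) + 2 * Real.sin θ ^ 2 := by
      rw [c1, c2]
      linear_combination -htr + Real.cos θ ^ 2 * e1 + Real.cos θ ^ 2 * e2
    linear_combination e3 / 2 + h + this
  have habs : |2 * z 0| = |p - q| :=
    le_antisymm (Real.cosh_le_cosh.1 hcosh.le) (Real.cosh_le_cosh.1 hcosh.ge)
  have hAe := congrArg (fun g : SLR 2 => (g : Matrix (Fin 2) (Fin 2) ℝ)) e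
  simp only [SLR.val_mul, hA] at hAe
  rw [dg_val_of_sum hz.sum_zero] at hAe
  have a00 := congrFun₂ hAe 0 0
  have a01 := congrFun₂ hAe 0 1
  have a10 := congrFun₂ hAe 1 0
  have a11 := congrFun₂ hAe 1 1
  simp [Matrix.mul_apply, Fin.sum_univ_two, hz1] at a00 a01 a10 a11
  have key : dg ![-r, r / 2, r / 2] * rotA θ * dg ![-r, r / 2, r / 2] =
      emb2 k * dg ![z 0 - r / 2, -z 0 - r / 2, r] * emb2 k' := by
    apply SLR.ext_val
    simp only [SLR.val_mul]
    rw [dg3_val (by ring), dg3_val (by ring), rotA_val, emb2_val, emb2_val]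
    have x1 : Real.exp (-r) * Real.exp (-r) = Real.exp (-(r / 2)) * Real.exp (-(3 * r) / 2) := by
      rw [← Real.exp_add, ← Real.exp_add]; ring_nf
    have x2 : Real.exp (r / 2) * Real.exp (-r) = Real.exp (-(r / 2)) := by
      rw [← Real.exp_add]; ring_nf
    have x3 : Real.exp (r / 2) * Real.exp (r / 2) = Real.exp (-(r / 2)) * Real.exp (3 * r / 2) := by
      rw [← Real.exp_add, ← Real.exp_add]; ring_nf
    have x4 : Real.exp (z 0 - r / 2) = Real.exp (-(r / 2)) * Real.exp (z 0) := by
      rw [← Real.exp_add]; ring_nf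
    have x5 : Real.exp (-z 0 - r / 2) = Real.exp (-(r / 2)) * Real.exp (-z 0) := by
      rw [← Real.exp_add]; ring_nf
    have x6 : Real.exp (r / 2) * Real.exp (r / 2) = Real.exp r := by
      rw [← Real.exp_add]; ring_nf
    ext i j
    fin_cases i <;> fin_cases j <;> simp [Matrix.mul_apply, Fin.sum_univ_three, x4, x5]
    · linear_combination Real.cos θ * x1 + Real.exp (-(r / 2)) * a00
    · linear_combination -Real.sin θ * x2 + Real.exp (-(r / 2)) * a01
    · linear_combination Real.sin θ * x2 + Real.exp (-(r / 2)) * a10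
    · linear_combination Real.cos θ * x3 + Real.exp (-(r / 2)) * a11
    · exact x6
  rcases abs_eq_abs.1 habs with h1 | h1
  · refine ⟨emb2 k, emb2_mem hk, emb2 k', emb2_mem hk', ?_⟩
    rw [key, show z 0 - r / 2 = p by linarith, show - z 0 - r / 2 = q by linarith]
  · refine ⟨emb2 k * rotA (-(Real.pi / 2)), mul_mem (emb2_mem hk) (rotA_mem _),
      rotA (Real.pi / 2) * emb2 k', mul_mem (rotA_mem _) (emb2_mem hk'), ?_⟩
    rw [key, show z 0 - r / 2 = q by linarith, show - z 0 - r / 2 = p by linarith,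
      dg3_swap hs]
    simp only [mul_assoc]

end svd

theorem sinh_ratio {a b : ℝ} (ha : 0 ≤ a) (hab : a ≤ b) :
    Real.sinh a ≤ Real.exp (a - b) * Real.sinh b := by
  rw [Real.sinh_eq, Real.sinh_eq]
  have e1 : Real.exp (a - b) * Real.exp b = Real.exp a := by rw [← Real.exp_add]; ring_nf
  have e2 : Real.exp (a - b) * Real.exp (-b) ≤ Real.exp (-a) := by
    rw [← Real.exp_add]; apply Real.exp_le_exp.2; linarith
  linarith

section cf
variable {H : Type*} [NormedAddCommGroup H] [InnerProductSpace ℝ H] [CompleteSpace H]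
  (ρ : SLR 3 →* (H ≃ₗᵢ[ℝ] H))

/-- The diagonal matrix coefficient. -/
noncomputable def cf (w v : H) (p q r : ℝ) : ℝ := inner ℝ w (ρ (dg ![p, q, r]) v)

variable {ρ} {v w : H}

theorem cf_kak (hv : ∀ k ∈ Kd 3, ρ k v = v) (hw : ∀ k ∈ Kd 3, ρ k w = w) {g k k' : SLR 3}
    {p q r : ℝ} (hk : k ∈ Kd 3) (hk' : k' ∈ Kd 3) (e : g = k * dg ![p, q, r] * k') :
    inner ℝ w (ρ g v) = cf ρ w v p q r := by
  rw [e, rep_mul, rep_mul, hv _ hk', rep_inner_inv, hw _ (inv_mem hk)]; rfl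

theorem cf_low (hρ : ∀ v, Continuous fun g => ρ g v)
    (hv : ∀ k ∈ Kd 3, ρ k v = v) (hw : ∀ k ∈ Kd 3, ρ k w = w)
    {p q r : ℝ} (hs : p + q + r = 0) (h1 : r ≤ q) (h2 : q ≤ p) :
    |cf ρ w v p q r - cf ρ w v (-r / 2) (-r / 2) r| ≤
      3 * Real.exp (-(q - r) / 2) * (‖w‖ * ‖v‖) := by
  rcases eq_or_ne r 0 with hr | hr
  · have hq : q = 0 := by linarith
    have hp : p = 0 := by linarith
    subst hr hq hp
    simp; positivity
  have hr0 : r < 0 := lt_of_le_of_ne (by linarith) hr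
  set D : SLR 3 := dg ![-r, r / 2, r / 2] with hD
  have hDs : -r + r / 2 + r / 2 = 0 := by ring
  have hcomm : ∀ s, rotB s * D = D * rotB s := by
    intro s
    apply SLR.ext_val
    rw [SLR.val_mul, SLR.val_mul, hD, dg3_val hDs, rotB_val]
    ext i j
    fin_cases i <;> fin_cases j <;> simp [Matrix.mul_apply, Fin.sum_univ_three] <;> ring
  set S := Real.sinh (3 * (-r) / 2) with hS
  have hS0 : 0 < S := Real.sinh_pos_iff.2 (by linarith)
  set T := Real.sinh ((p - q) / 2) with hT
  have hT0 : 0 ≤ T := Real.sinh_nonneg_iff.2 (by linarith)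
  have hTS : T ≤ Real.exp (-(q - r)) * S := by
    have := sinh_ratio (a := (p - q) / 2) (b := 3 * (-r) / 2) (by linarith) (by linarith)
    rwa [show (p - q) / 2 - 3 * (-r) / 2 = -(q - r) by linarith] at this
  have hc : T / S ≤ Real.exp (-(q - r)) := by rwa [div_le_iff₀ hS0]
  have hc1 : T / S ≤ 1 := hc.trans (Real.exp_le_one_iff.2 (by linarith))
  have hc0 : 0 ≤ T / S := by positivity
  have hcos : Real.cos (Real.arccos (T / S)) = T / S := Real.cos_arccos (by linarith) hc1
  have hC : ∀ x, Real.cosh x - 1 = 2 * Real.sinh (x / 2) ^ 2 := by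
    intro x
    have := Real.cosh_two_mul (x / 2)
    have h' := Real.cosh_sq (x / 2)
    rw [show 2 * (x / 2) = x by ring] at this
    linarith
  have h3r : Real.cosh (3 * r) - 1 = 2 * S ^ 2 := by
    rw [hC, hS, show 3 * r / 2 = -(3 * (-r) / 2) by ring, Real.sinh_neg]; ring
  have hfix : ∀ s, ρ (rotB s) (ρ D v) = ρ D v := by
    intro s; rw [← rep_mul, hcomm, rep_mul, hv _ (rotB_mem s)]
  have hfix' : ∀ s, ρ (rotB s) (ρ D⁻¹ w) = ρ D⁻¹ w := by
    intro s
    rw [← rep_mul, show rotB s * D⁻¹ = D⁻¹ * rotB s by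
      rw [eq_inv_mul_iff_mul_eq, ← mul_assoc, ← hcomm, mul_assoc, mul_inv_cancel, mul_one], rep_mul,
      hw _ (rotB_mem s)]
  have key := so3_holder ρ hρ hfix hfix' (Real.arccos_nonneg (T / S))
    (Real.arccos_le_pi_div_two.2 hc0)
  rw [inner_sub_right, hcos, rep_norm, rep_norm] at key
  have hex : ∀ θ, inner ℝ (ρ D⁻¹ w) (ρ (rotA θ) (ρ D v)) = inner ℝ w (ρ (D * rotA θ * D) v) := by
    intro θ; rw [← rep_inner_inv, rep_mul, rep_mul]
  obtain ⟨k, hk, k', hk', e⟩ := block_kak (θ := Real.arccos (T / S)) hs (by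
    rw [hcos, h3r, hC]; field_simp; rw [hT])
  obtain ⟨l, hl, l', hl', e'⟩ := block_kak (θ := Real.pi / 2) (p := -r / 2) (q := -r / 2) (r := r)
    (by ring) (by simp)
  rw [hex, hex, cf_kak hv hw hk hk' e, cf_kak hv hw hl hl' e'] at key
  apply abs_le_of_sq_le_sq _ (by positivity)
  refine key.trans ?_
  have : (3 * Real.exp (-(q - r) / 2) * (‖w‖ * ‖v‖)) ^ 2 =
      9 * Real.exp (-(q - r)) * (‖w‖ * ‖v‖) ^ 2 := by
    rw [mul_pow, mul_pow, ← Real.exp_nat_mul]; ring_nf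
  rw [this]
  gcongr
  norm_num

theorem cf_swap (hv : ∀ k ∈ Kd 3, ρ k v = v) (hw : ∀ k ∈ Kd 3, ρ k w = w) {p q r : ℝ}
    (hs : p + q + r = 0) : cf ρ w v p q r = cf ρ v w (-r) (-q) (-p) := by
  obtain ⟨k, hkv⟩ : ∃ k : SLR 3, (k : Matrix (Fin 3) (Fin 3) ℝ) = !![0, 0, 1; 0, -1, 0; 1, 0, 0] :=
    ⟨⟨_, by simp [Matrix.det_fin_three]⟩, rfl⟩
  have hk : k ∈ Kd 3 := by
    rw [mem_Kd, hkv]; ext i j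
    fin_cases i <;> fin_cases j <;> simp [Matrix.mul_apply, Fin.sum_univ_three]
  have e : dg ![-p, -q, -r] = k * dg ![-r, -q, -p] * k := by
    apply SLR.ext_val
    rw [SLR.val_mul, SLR.val_mul, dg3_val (by linarith), dg3_val (by linarith), hkv]
    ext i j
    fin_cases i <;> fin_cases j <;> simp [Matrix.mul_apply, Fin.sum_univ_three]
  rw [← cf_kak hw hv hk hk e, cf, rep_inner_inv, ← dg_neg, real_inner_comm]
  congr 3
  ext i; fin_cases i <;> rfl

theorem cf_high (hρ : ∀ v, Continuous fun g => ρ g v)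
    (hv : ∀ k ∈ Kd 3, ρ k v = v) (hw : ∀ k ∈ Kd 3, ρ k w = w)
    {p q r : ℝ} (hs : p + q + r = 0) (h1 : r ≤ q) (h2 : q ≤ p) :
    |cf ρ w v p q r - cf ρ w v p (-p / 2) (-p / 2)| ≤
      3 * Real.exp (-(p - q) / 2) * (‖w‖ * ‖v‖) := by
  have := cf_low hρ hw hv (p := -r) (q := -q) (r := -p) (by linarith) (by linarith) (by linarith)
  rw [cf_swap hv hw hs, cf_swap hv hw (p := p) (by ring)]
  rw [mul_comm ‖w‖]
  convert this using 3
  · rw [show -(-p / 2) = - -p / 2 by ring]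
  · congr 2; ring

theorem cf_zigzag (hρ : ∀ v, Continuous fun g => ρ g v)
    (hv : ∀ k ∈ Kd 3, ρ k v = v) (hw : ∀ k ∈ Kd 3, ρ k w = w)
    {s s' : ℝ} (h1 : 1 ≤ s) (h2 : s ≤ s') (h3 : s' ≤ s + 1) :
    |cf ρ w v s s (-2 * s) - cf ρ w v (2 * s') (-s') (-s')| ≤ 12 * Real.exp (-s) * (‖w‖ * ‖v‖) := by
  have a := cf_low hρ hv hw (p := 2 * s') (q := 2 * s - 2 * s') (r := -2 * s) (by ring)
    (by linarith) (by linarith)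
  have b := cf_high hρ hv hw (p := 2 * s') (q := 2 * s - 2 * s') (r := -2 * s) (by ring)
    (by linarith) (by linarith)
  rw [show -(-2 * s) / 2 = s by ring] at a
  rw [show -(2 * s') / 2 = -s' by ring] at b
  have x1 : Real.exp (-(2 * s - 2 * s' - -2 * s) / 2) ≤ 2.7182818286 * Real.exp (-s) := by
    have : Real.exp (-(2 * s - 2 * s' - -2 * s) / 2) ≤ Real.exp (1 + -s) :=
      Real.exp_le_exp.2 (by linarith)
    rw [Real.exp_add] at this
    refine this.trans ?_
    gcongr
    exact Real.exp_one_lt_d9.le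
  have x2 : Real.exp (-(2 * s' - (2 * s - 2 * s')) / 2) ≤ Real.exp (-s) :=
    Real.exp_le_exp.2 (by linarith)
  have hN : 0 ≤ ‖w‖ * ‖v‖ := by positivity
  have y1 := mul_le_mul_of_nonneg_right x1 hN
  have y2 := mul_le_mul_of_nonneg_right x2 hN
  have y3 := mul_nonneg (Real.exp_pos (-s)).le hN
  rw [abs_le] at *
  constructor <;> nlinarith [a.1, a.2, b.1, b.2]

theorem cf_step (hρ : ∀ v, Continuous fun g => ρ g v)
    (hv : ∀ k ∈ Kd 3, ρ k v = v) (hw : ∀ k ∈ Kd 3, ρ k w = w)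
    {s : ℝ} (h1 : 1 ≤ s) (n : ℕ) :
    |cf ρ w v (2 * s) (-s) (-s) - cf ρ w v (2 * (s + n)) (-(s + n)) (-(s + n))| ≤
      48 * (1 - (1 / 2) ^ n) * Real.exp (-s) * (‖w‖ * ‖v‖) := by
  induction n with
  | zero => simp
  | succ n ih =>
    have hn : (0 : ℝ) ≤ n := n.cast_nonneg
    have a := cf_zigzag hρ hv hw (s := s + n) (s' := s + n) (by linarith) le_rfl (by linarith)
    have b := cf_zigzag hρ hv hw (s := s + n) (s' := s + (n + 1 : ℕ)) (by linarith)
      (by push_cast; linarith) (by push_cast; linarith)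
    have x : Real.exp (-(s + n)) ≤ (1 / 2) ^ n * Real.exp (-s) := by
      rw [neg_add, Real.exp_add, mul_comm, ← mul_neg_one, Real.exp_nat_mul]
      gcongr
      rw [Real.exp_neg, one_div]
      gcongr
      have := Real.exp_one_gt_d9; linarith
    have hN : 0 ≤ ‖w‖ * ‖v‖ := by positivity
    have y := mul_le_mul_of_nonneg_right x hN
    rw [pow_succ]
    rw [abs_le] at *
    constructor <;> nlinarith [a.1, a.2, b.1, b.2, ih.1, ih.2]

theorem cf_high_decay (hρ : ∀ v, Continuous fun g => ρ g v)
    (hv : ∀ k ∈ Kd 3, ρ k v = v) (hw : ∀ k ∈ Kd 3, ρ k w = w)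
    (hv0 : ∀ u, ρ (dg ![2, -1, -1]) u = u → inner ℝ u v = 0) {s : ℝ} (h1 : 1 ≤ s) :
    |cf ρ w v (2 * s) (-s) (-s)| ≤ 48 * Real.exp (-s) * (‖w‖ * ‖v‖) := by
  have h := rep_ergodic ρ (dg ![2, -1, -1]) hv0
  have h2 : Filter.Tendsto (fun N : ℕ => inner ℝ w (ρ (dg ![2 * s, -s, -s])
      (((N + 1 : ℕ) : ℝ)⁻¹ • ∑ n ∈ Finset.range (N + 1), ρ (dg ![2, -1, -1] ^ n) v))) Filter.atTop (nhds 0) := by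
    have h' := (Filter.tendsto_add_atTop_iff_nat 1).2 h
    have := (((innerSL ℝ w).continuous.comp (ρ (dg ![2 * s, -s, -s])).continuous).tendsto 0).comp h'
    simp only [Function.comp_apply, map_zero] at this
    exact this
  have hpow : ∀ n : ℕ, dg ![2 * s, -s, -s] * dg ![2, -1, -1] ^ n =
      dg ![2 * (s + n), -(s + n), -(s + n)] := by
    intro n
    induction n with
    | zero => simp
    | succ n ih =>
      rw [pow_succ, ← mul_assoc, ih, ← dg_add]
      congr 1; ext i; fin_cases i <;> simp <;> ring
  have h3 := (h2.const_sub (cf ρ w v (2 * s) (-s) (-s))).abs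
  rw [sub_zero] at h3
  refine le_of_tendsto h3 (Filter.Eventually.of_forall fun N => ?_)
  have hN : (0 : ℝ) < ((N + 1 : ℕ) : ℝ) := by positivity
  have e : cf ρ w v (2 * s) (-s) (-s) - inner ℝ w (ρ (dg ![2 * s, -s, -s])
      (((N + 1 : ℕ) : ℝ)⁻¹ • ∑ n ∈ Finset.range (N + 1), ρ (dg ![2, -1, -1] ^ n) v)) =
      ((N + 1 : ℕ) : ℝ)⁻¹ * ∑ n ∈ Finset.range (N + 1), (cf ρ w v (2 * s) (-s) (-s) -
        cf ρ w v (2 * (s + n)) (-(s + n)) (-(s + n))) := by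
    rw [Finset.sum_sub_distrib, Finset.sum_const, Finset.card_range, nsmul_eq_mul, mul_sub,
      inv_mul_cancel_left₀ hN.ne', map_smul, map_sum, inner_smul_right, inner_sum]
    congr 2
    refine Finset.sum_congr rfl fun n _ => ?_
    rw [← rep_mul, hpow]; rfl
  rw [e, abs_mul, abs_of_pos (inv_pos.2 hN), inv_mul_le_iff₀ hN]
  refine (Finset.abs_sum_le_sum_abs _ _).trans ?_
  refine (Finset.sum_le_card_nsmul _ _ (48 * Real.exp (-s) * (‖w‖ * ‖v‖)) fun n _ => ?_).trans (by
    simp)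
  refine (cf_step hρ hv hw h1 n).trans ?_
  gcongr
  have : (0 : ℝ) < (1 / 2) ^ n := by positivity
  linarith

theorem d3_decay (hρ : ∀ v, Continuous fun g => ρ g v)
    (hv : ∀ k ∈ Kd 3, ρ k v = v) (hw : ∀ k ∈ Kd 3, ρ k w = w)
    (hv0 : ∀ u, ρ (dg ![2, -1, -1]) u = u → inner ℝ u v = 0)
    {p q r : ℝ} (hs : p + q + r = 0) (h1 : r ≤ q) (h2 : q ≤ p) :
    |inner ℝ w (ρ (dg ![p, q, r]) v)| ≤ 63 * Real.exp (-(p - r) / 6) * (‖w‖ * ‖v‖) := by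
  have hN : 0 ≤ ‖w‖ * ‖v‖ := by positivity
  by_cases hsm : p - r ≤ 6
  · refine (rep_inner_le ρ _ _ _).trans ?_
    refine le_mul_of_one_le_left hN ?_
    have : Real.exp (-1) ≤ Real.exp (-(p - r) / 6) := Real.exp_le_exp.2 (by linarith)
    have h3 : (1 : ℝ) / 63 ≤ Real.exp (-1) := by
      rw [Real.exp_neg, one_div]
      gcongr
      have := Real.exp_one_lt_d9; linarith
    linarith
  change |cf ρ w v p q r| ≤ _
  have hE := mul_nonneg (Real.exp_pos (-(p - r) / 6)).le hN
  rcases le_total (p - q) (q - r) with h | h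
  · have a := cf_low hρ hv hw hs h1 h2
    have b := cf_zigzag hρ hv hw (s := -r / 2) (s' := -r / 2) (by linarith) le_rfl (by linarith)
    have c := cf_high_decay hρ hv hw hv0 (s := -r / 2) (by linarith)
    rw [show -2 * (-r / 2) = r by ring] at b
    have x1 : Real.exp (-(-r / 2)) ≤ Real.exp (-(p - r) / 6) := Real.exp_le_exp.2 (by linarith)
    have x2 : Real.exp (-(q - r) / 2) ≤ Real.exp (-(p - r) / 6) := Real.exp_le_exp.2 (by linarith)
    have y1 := mul_le_mul_of_nonneg_right x1 hN
    have y2 := mul_le_mul_of_nonneg_right x2 hN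
    rw [abs_le] at *
    constructor <;> nlinarith [a.1, a.2, b.1, b.2, c.1, c.2]
  · have a := cf_high hρ hv hw hs h1 h2
    have c := cf_high_decay hρ hv hw hv0 (s := p / 2) (by linarith)
    rw [show 2 * (p / 2) = p by ring, show -(p / 2) = -p / 2 by ring] at c
    have x1 : Real.exp (-p / 2) ≤ Real.exp (-(p - r) / 6) := Real.exp_le_exp.2 (by linarith)
    have x2 : Real.exp (-(p - q) / 2) ≤ Real.exp (-(p - r) / 6) := Real.exp_le_exp.2 (by linarith)
    have y1 := mul_le_mul_of_nonneg_right x1 hN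
    have y2 := mul_le_mul_of_nonneg_right x2 hN
    rw [abs_le] at *
    constructor <;> nlinarith [a.1, a.2, c.1, c.2]

end cf

section mautner
variable {H : Type*} [NormedAddCommGroup H] [InnerProductSpace ℝ H]

theorem rep_fix_of_tendsto {G : Type*} [Group G] [TopologicalSpace G] {ρ : G →* (H ≃ₗᵢ[ℝ] H)}
    (hρ : ∀ v, Continuous fun g => ρ g v) {v : H} {a b e : ℕ → G} {e₀ : G}
    (ha : ∀ n, ρ (a n) v = v) (hb : ∀ n, ρ (b n) v = v)
    (he : ∀ n, a n * e n * b n = e₀) (hlim : Filter.Tendsto e Filter.atTop (nhds 1)) : ρ e₀ v = v := by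
  have h1 : ∀ n, ‖ρ e₀ v - v‖ = ‖ρ (e n) v - v‖ := by
    intro n
    rw [← he n, rep_mul, hb, rep_mul]
    conv_lhs => rw [← ha n]
    rw [ha n, show ρ (a n) (ρ (e n) v) - v = ρ (a n) (ρ (e n) v - v) by rw [map_sub, ha], rep_norm]
  have h2 : Filter.Tendsto (fun n => ‖ρ (e n) v - v‖) Filter.atTop (nhds 0) := by
    have := (((hρ v).tendsto 1).comp hlim).sub_const v |>.norm
    simpa [rep_one] using this
  have h3 : Filter.Tendsto (fun n : ℕ => ‖ρ e₀ v - v‖) Filter.atTop (nhds 0) := by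
    exact h2.congr fun n => (h1 n).symm
  have := tendsto_nhds_unique h3 tendsto_const_nhds
  exact (sub_eq_zero.1 (norm_eq_zero.1 this.symm))

theorem continuous_transvection {d : ℕ} {i j : Fin d} (hij : i ≠ j) :
    Continuous fun c : ℝ => (Matrix.SpecialLinearGroup.transvection hij c : SLR d) := by
  rw [SLR.continuous_iff]
  simp only [Matrix.SpecialLinearGroup.transvection_coe]
  refine continuous_matrix fun k l => ?_
  simp only [Matrix.add_apply, Matrix.single_apply]
  split_ifs <;> fun_prop

theorem dg_transvection {d : ℕ} {i j : Fin d} (hij : i ≠ j) (x : Fin d → ℝ) (c : ℝ) :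
    dg x * Matrix.SpecialLinearGroup.transvection hij c =
      Matrix.SpecialLinearGroup.transvection hij (Real.exp (x i - x j) * c) * dg x := by
  apply SLR.coe_injective
  simp only [Matrix.SpecialLinearGroup.coe_mul, Matrix.SpecialLinearGroup.transvection_coe,
    dg_val]
  ext k l
  simp only [mul_add, add_mul, mul_one, one_mul, Matrix.add_apply, Matrix.diagonal_mul,
    Matrix.mul_diagonal, Matrix.single_apply]
  have h1 : Real.exp (x k - (∑ j, x j) / d) * (1 : Matrix (Fin d) (Fin d) ℝ) k l =
      (1 : Matrix (Fin d) (Fin d) ℝ) k l * Real.exp (x l - (∑ j, x j) / d) := by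
    rw [Matrix.one_apply]; split_ifs with h
    · rw [h]; ring
    · simp
  rw [h1]
  congr 1
  split_ifs with h
  swap
  · simp
  obtain ⟨rfl, rfl⟩ := h
  have : Real.exp (x i - x j) * Real.exp (x j - (∑ i, x i) / d) = Real.exp (x i - (∑ i, x i) / d) := by
    rw [← Real.exp_add]; ring_nf
  linear_combination (-c) * this

theorem dg_fix_transvection {d : ℕ} {ρ : SLR d →* (H ≃ₗᵢ[ℝ] H)}
    (hρ : ∀ v, Continuous fun g => ρ g v) {v : H} {x : Fin d → ℝ} (h : ρ (dg x) v = v)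
    {i j : Fin d} (hij : i ≠ j) (hlt : x i < x j) (c : ℝ) :
    ρ (Matrix.SpecialLinearGroup.transvection hij c) v = v := by
  set a : ℕ → SLR d := fun n => dg ((n : ℝ) • x)
  have hpow : ∀ n, a n = (dg x) ^ n := by
    intro n
    induction n with
    | zero => simp [a, dg_zero]
    | succ n ih => rw [pow_succ, ← ih]; simp only [a]; rw [← dg_add]; congr 1; push_cast; module
  have ha : ∀ n, ρ (a n) v = v := fun n => by
    rw [hpow]; exact (fixer ρ v).pow_mem (mem_fixer ρ |>.2 h) n
  refine rep_fix_of_tendsto hρ (a := fun n => (a n)⁻¹) (b := a)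
    (e := fun n => Matrix.SpecialLinearGroup.transvection hij (Real.exp (n * (x i - x j)) * c))
    (fun n => rep_fix_inv ρ (ha n)) ha ?_ ?_
  · intro n
    show (a n)⁻¹ * _ * a n = _
    rw [mul_assoc, inv_mul_eq_iff_eq_mul]
    simp only [a]
    rw [dg_transvection]
    simp [mul_sub]
  · have h1 := (continuous_transvection hij).tendsto 0
    rw [show (Matrix.SpecialLinearGroup.transvection hij (0 : ℝ) : SLR d) = 1 by
      apply SLR.coe_injective; simp [Matrix.SpecialLinearGroup.transvection_coe]] at h1
    refine h1.comp ?_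
    have : Filter.Tendsto (fun n : ℕ => (n : ℝ) * (x i - x j)) Filter.atTop Filter.atBot :=
      Filter.Tendsto.atTop_mul_const_of_neg (by linarith) tendsto_natCast_atTop_atTop
    simpa using (Real.tendsto_exp_atBot.comp this).mul_const c

theorem transvection_commutator {d : ℕ} {i j k : Fin d} (hij : i ≠ j) (hik : i ≠ k) (hkj : k ≠ j) (c : ℝ) :
    (Matrix.SpecialLinearGroup.transvection hij c : SLR d) =
      Matrix.SpecialLinearGroup.transvection hik c * Matrix.SpecialLinearGroup.transvection hkj 1 *
      Matrix.SpecialLinearGroup.transvection hik (-c) * Matrix.SpecialLinearGroup.transvection hkj (-1) := by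
  apply SLR.coe_injective
  simp only [Matrix.SpecialLinearGroup.coe_mul, Matrix.SpecialLinearGroup.transvection_coe]
  simp only [add_mul, mul_add, one_mul, mul_one, Matrix.single_mul_single_same,
    Matrix.single_mul_single_of_ne _ _ _ _ hij, Matrix.single_mul_single_of_ne _ _ _ _ hij.symm,
    Matrix.single_mul_single_of_ne _ _ _ _ hik, Matrix.single_mul_single_of_ne _ _ _ _ hik.symm,
    Matrix.single_mul_single_of_ne _ _ _ _ hkj, Matrix.single_mul_single_of_ne _ _ _ _ hkj.symm,
    add_zero, zero_add, zero_mul, mul_zero]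
  ext k l
  simp only [Matrix.add_apply, Matrix.one_apply, Matrix.single_apply]
  split_ifs <;> simp_all

/-- **Mautner phenomenon**: a vector fixed by a nonconstant diagonal matrix is fixed by the group. -/
theorem mautner {d : ℕ} {ρ : SLR d →* (H ≃ₗᵢ[ℝ] H)}
    (hρ : ∀ v, Continuous fun g => ρ g v) {v : H} {x : Fin d → ℝ} (h : ρ (dg x) v = v)
    {i₀ j₀ : Fin d} (hx : x i₀ ≠ x j₀) (g : SLR d) : ρ g v = v := by
  have hd : 2 ≤ d := by
    rw [← Fin.nontrivial_iff_two_le]; exact ⟨i₀, j₀, fun e => hx (by rw [e])⟩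
  have h' : ρ (dg (-x)) v = v := by rw [dg_neg]; exact rep_fix_inv ρ h
  have h1 : ∀ (i j : Fin d) (hij : i ≠ j) (c : ℝ), x i ≠ x j →
      Matrix.SpecialLinearGroup.transvection hij c ∈ fixer ρ v := by
    intro i j hij c hne
    rcases lt_or_gt_of_ne hne with hl | hl
    · exact dg_fix_transvection hρ h hij hl c
    · exact dg_fix_transvection hρ h' hij (by simpa using hl) c
  have : fixer ρ v = ⊤ := by
    refine SLR.subgroup_eq_top hd _ fun i j hij c => ?_
    by_cases hne : x i = x j
    · obtain ⟨k, hk⟩ : ∃ k, x k ≠ x i := by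
        by_contra! hc
        exact hx (by rw [hc i₀, hc j₀])
      have hik : i ≠ k := fun e => hk (by rw [e])
      have hkj : k ≠ j := fun e => hk (by rw [e, hne])
      rw [transvection_commutator hij hik hkj]
      refine mul_mem (mul_mem (mul_mem ?_ ?_) ?_) ?_
      · exact h1 _ _ _ _ hk.symm
      · exact h1 _ _ _ _ (by rwa [← hne])
      · exact h1 _ _ _ _ hk.symm
      · exact h1 _ _ _ _ (by rwa [← hne])
    · exact h1 _ _ _ _ hne
  exact (mem_fixer ρ).1 (this ▸ Subgroup.mem_top g)

end mautner

theorem IsSVD.comp_perm {d : ℕ} {g : SLR d} {x : Fin d → ℝ} (h : IsSVD g x) (σ : Equiv.Perm (Fin d)) :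
    IsSVD g (x ∘ σ) := by
  obtain ⟨O, O', hO, hO', e⟩ := h
  refine ⟨O.submatrix _root_.id σ, O'.submatrix σ _root_.id, ?_, ?_, ?_⟩
  · rw [Matrix.transpose_submatrix]
    have := Matrix.submatrix_mul_equiv Oᵀ O σ (Equiv.refl _) σ
    rw [Equiv.coe_refl] at this
    rw [this, hO, Matrix.submatrix_one_equiv]
  · rw [Matrix.transpose_submatrix, Matrix.submatrix_mul_equiv, hO', Matrix.submatrix_id_id]
  · have : (diagonal fun i => Real.exp ((x ∘ σ) i)) = (diagonal fun i => Real.exp (x i)).submatrix σ σ := by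
      rw [Matrix.submatrix_diagonal_equiv]; rfl
    rw [this, Matrix.submatrix_mul_equiv, Matrix.submatrix_mul_equiv, Matrix.submatrix_id_id, e]

section embed
variable (n : ℕ)

/-- The upper left block embedding of `SL(3)`. -/
noncomputable def emb3 : SLR 3 →* SLR (3 + n) where
  toFun g := ⟨Matrix.reindex finSumFinEquiv finSumFinEquiv
    (Matrix.fromBlocks (g : Matrix (Fin 3) (Fin 3) ℝ) 0 0 (1 : Matrix (Fin n) (Fin n) ℝ)), by
      rw [Matrix.det_reindex_self, Matrix.det_fromBlocks_zero₂₁, Matrix.det_one, mul_one]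
      exact g.2⟩
  map_one' := by
    apply SLR.ext_val
    show Matrix.reindex finSumFinEquiv finSumFinEquiv (Matrix.fromBlocks (1 : Matrix (Fin 3) (Fin 3) ℝ) 0 0 1) = 1
    rw [Matrix.fromBlocks_one]; simp
  map_mul' g h := by
    apply SLR.ext_val
    show Matrix.reindex finSumFinEquiv finSumFinEquiv (Matrix.fromBlocks
      ((g : Matrix (Fin 3) (Fin 3) ℝ) * (h : Matrix (Fin 3) (Fin 3) ℝ)) 0 0 1) =
      Matrix.reindex finSumFinEquiv finSumFinEquiv (Matrix.fromBlocks
        (g : Matrix (Fin 3) (Fin 3) ℝ) 0 0 1) *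
      Matrix.reindex finSumFinEquiv finSumFinEquiv (Matrix.fromBlocks
        (h : Matrix (Fin 3) (Fin 3) ℝ) 0 0 1)
    simp only [Matrix.reindex_apply]
    rw [Matrix.submatrix_mul_equiv, Matrix.fromBlocks_multiply]
    simp

theorem emb3_val (g : SLR 3) : (emb3 n g : Matrix (Fin (3 + n)) (Fin (3 + n)) ℝ) =
    (Matrix.fromBlocks (g : Matrix (Fin 3) (Fin 3) ℝ) 0 0 (1 : Matrix (Fin n) (Fin n) ℝ)).submatrix
      finSumFinEquiv.symm finSumFinEquiv.symm := rfl

theorem continuous_emb3 : Continuous (emb3 n) := by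
  rw [SLR.continuous_iff]
  simp only [emb3_val]
  refine Continuous.matrix_submatrix ?_ _ _
  exact Continuous.matrix_fromBlocks SLR.continuous_val continuous_const continuous_const continuous_const

theorem emb3_mem {k : SLR 3} (hk : k ∈ Kd 3) : emb3 n k ∈ Kd (3 + n) := by
  rw [mem_Kd] at hk ⊢
  rw [emb3_val, Matrix.transpose_submatrix, Matrix.submatrix_mul_equiv, Matrix.fromBlocks_transpose,
    Matrix.fromBlocks_multiply]
  simp [hk]

theorem emb3_dg {p q r : ℝ} (h : p + q + r = 0) : emb3 n (dg ![p, q, r]) =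
    dg (Sum.elim ![p, q, r] (0 : Fin n → ℝ) ∘ finSumFinEquiv.symm) := by
  apply SLR.ext_val
  have hs : ∑ i, (Sum.elim ![p, q, r] (0 : Fin n → ℝ) ∘ finSumFinEquiv.symm) i = 0 := by
    rw [← finSumFinEquiv.sum_comp]
    simp [Fintype.sum_sum_type, Fin.sum_univ_three, h]
  rw [emb3_val, dg_val_of_sum hs, dg_val_of_sum (by simp [Fin.sum_univ_three]; exact h)]
  rw [show (1 : Matrix (Fin n) (Fin n) ℝ) = diagonal fun i => 1 from Matrix.diagonal_one.symm,
    Matrix.fromBlocks_diagonal, Matrix.submatrix_diagonal_equiv]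
  congr 1
  ext i
  simp only [Function.comp]
  rcases finSumFinEquiv.symm i with j | j <;> simp

theorem emb3_dg_comm {m : ℝ} {b : Fin n → ℝ} (k : SLR 3) :
    dg (Sum.elim (fun _ : Fin 3 => m) b ∘ finSumFinEquiv.symm) * emb3 n k =
      emb3 n k * dg (Sum.elim (fun _ : Fin 3 => m) b ∘ finSumFinEquiv.symm) := by
  apply SLR.ext_val
  rw [SLR.val_mul, SLR.val_mul, emb3_val, dg_val]
  have : (diagonal fun i => Real.exp ((Sum.elim (fun _ : Fin 3 => m) b ∘ finSumFinEquiv.symm) i -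
      (∑ j, (Sum.elim (fun _ : Fin 3 => m) b ∘ finSumFinEquiv.symm) j) / ((3 + n : ℕ) : ℝ))) =
      (Matrix.fromBlocks (diagonal fun _ : Fin 3 => Real.exp (m -
      (∑ j, (Sum.elim (fun _ : Fin 3 => m) b ∘ finSumFinEquiv.symm) j) / ((3 + n : ℕ) : ℝ))) 0 0
      (diagonal fun i : Fin n => Real.exp (b i -
      (∑ j, (Sum.elim (fun _ : Fin 3 => m) b ∘ finSumFinEquiv.symm) j) / ((3 + n : ℕ) : ℝ)))).submatrix
      finSumFinEquiv.symm finSumFinEquiv.symm := by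
    rw [Matrix.fromBlocks_diagonal, Matrix.submatrix_diagonal_equiv]
    congr 1
    ext i
    simp only [Function.comp]
    rcases finSumFinEquiv.symm i with j | j <;> simp
  rw [this, Matrix.submatrix_mul_equiv, Matrix.submatrix_mul_equiv, Matrix.fromBlocks_multiply,
    Matrix.fromBlocks_multiply]
  congr 2
  · simp only [Matrix.zero_mul, Matrix.mul_zero, add_zero]
    ext i j; simp [Matrix.diagonal_mul, Matrix.mul_diagonal, mul_comm]
  · simp
  · simp
  · simp

end embed

/-- Exponential decay of spherical matrix coefficients for `SL(d)`, `d ≥ 3`. -/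
theorem rep_decay {d : ℕ} (hd : 3 ≤ d) {H : Type*} [NormedAddCommGroup H] [InnerProductSpace ℝ H]
    [CompleteSpace H] {ρ : SLR d →* (H ≃ₗᵢ[ℝ] H)} (hρ : ∀ v, Continuous fun g => ρ g v) {v w : H}
    (hv : ∀ k ∈ Kd d, ρ k v = v) (hw : ∀ k ∈ Kd d, ρ k w = w)
    (hv0 : ∀ u, (∀ g, ρ g u = u) → inner ℝ u v = 0) (g : SLR d) :
    |inner ℝ w (ρ g v)| ≤ 63 * Real.exp (-(phi g / √d) / 6) * (‖w‖ * ‖v‖) := by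
  obtain ⟨n, rfl⟩ := Nat.exists_eq_add_of_le hd
  obtain ⟨x, hx, hsvd⟩ := exists_isSVD g
  set e : Fin 3 ⊕ Fin n ≃ Fin (3 + n) := finSumFinEquiv with he
  set l : Fin (3 + n) := ⟨2 + n, by omega⟩ with hl
  have e0 : ∀ i, e (Sum.inl 0) ≤ i := fun i => by
    rw [Fin.le_def]; simp [he]
  have el : ∀ i, i ≤ l := fun i => by rw [Fin.le_def]; simp [hl]; omega
  have hne1 : e (Sum.inl 0) ≠ e (Sum.inl 2) := e.injective.ne (by simp)
  have hne2 : e (Sum.inl 0) ≠ l := by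
    intro h; have := congrArg Fin.val h; simp [he, hl] at this; omega
  set σ := Equiv.swap (e (Sum.inl 2)) l with hσ
  set y := x ∘ σ with hy
  have hsy : IsSVD g y := hsvd.comp_perm σ
  have hy0 : ∀ i, y i ≤ y (e (Sum.inl 0)) := by
    intro i
    have : σ (e (Sum.inl 0)) = e (Sum.inl 0) := Equiv.swap_apply_of_ne_of_ne hne1 hne2
    simp only [hy, Function.comp]
    rw [this]; exact hx (e0 _)
  have hy2 : ∀ i, y (e (Sum.inl 2)) ≤ y i := by
    intro i
    have : σ (e (Sum.inl 2)) = l := Equiv.swap_apply_left _ _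
    simp only [hy, Function.comp]
    rw [this]; exact hx (el _)
  set p := y (e (Sum.inl 0)) with hp
  set q := y (e (Sum.inl 1)) with hq
  set r := y (e (Sum.inl 2)) with hr
  have hpr : phi g ≤ √((3 + n : ℕ)) * (p - r) := by
    rw [hsy.phi_eq]
    have hcard : (0 : ℝ) < ((3 + n : ℕ) : ℝ) := by positivity
    have hp0 : 0 ≤ p := by
      by_contra! h
      have : ∑ i, y i ≤ ∑ i : Fin (3 + n), p := Finset.sum_le_sum fun i _ => hy0 i
      rw [hsy.sum_zero, Finset.sum_const, Finset.card_univ, Fintype.card_fin, nsmul_eq_mul] at this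
      nlinarith
    have hr0 : r ≤ 0 := by
      by_contra! h
      have : ∑ i : Fin (3 + n), r ≤ ∑ i, y i := Finset.sum_le_sum fun i _ => hy2 i
      rw [hsy.sum_zero, Finset.sum_const, Finset.card_univ, Fintype.card_fin, nsmul_eq_mul] at this
      nlinarith
    refine en_le_of_abs_le (by linarith) fun i => ?_
    have := hy0 i; have := hy2 i
    rw [abs_le]; constructor <;> linarith
  obtain ⟨k, hk, k', hk', hg⟩ := hsy.exists_kak
  set m := (p + q + r) / 3 with hm
  set b : Fin n → ℝ := fun i => y (e (Sum.inr i)) with hb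
  have hdec : y = Sum.elim ![p - m, q - m, r - m] (0 : Fin n → ℝ) ∘ e.symm +
      Sum.elim (fun _ : Fin 3 => m) b ∘ e.symm := by
    ext i
    obtain ⟨j, rfl⟩ := e.surjective i
    simp only [Pi.add_apply, Function.comp, Equiv.symm_apply_apply]
    rcases j with j | j
    · fin_cases j <;> simp [hp, hq, hr]
    · simp [hb]
  have hsum : (p - m) + (q - m) + (r - m) = 0 := by rw [hm]; ring
  have hg2 : dg y = emb3 n (dg ![p - m, q - m, r - m]) * dg (Sum.elim (fun _ : Fin 3 => m) b ∘ e.symm) := by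
    rw [emb3_dg n hsum, ← dg_add, ← hdec]
  set B := dg (Sum.elim (fun _ : Fin 3 => m) b ∘ e.symm) with hB
  rw [hg, rep_mul, rep_mul, hv _ hk', rep_inner_inv, hw _ (inv_mem hk), hg2, rep_mul]
  have key := d3_decay (ρ := ρ.comp (emb3 n)) (v := ρ B v) (w := w)
    (fun v => (hρ v).comp (continuous_emb3 n)) (fun k hk => ?_) (fun k hk => hw _ (emb3_mem n hk)) ?_ hsum
    (by linarith [hy2 (e (Sum.inl 1))]) (by linarith [hy0 (e (Sum.inl 1))])
  · rw [rep_norm] at key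
    refine key.trans ?_
    gcongr
    rw [← hg2, show r - m = r - m from rfl]
    have : phi (k * dg y * k') / √((3 + n : ℕ)) ≤ p - r := by
      rw [← hg, div_le_iff₀ (by positivity), mul_comm]; exact hpr
    linarith
  · show ρ (emb3 n k) (ρ B v) = ρ B v
    rw [← rep_mul, ← emb3_dg_comm, rep_mul, hv _ (emb3_mem n hk)]
  · intro u hu
    have hu' : ρ (emb3 n (dg ![2, -1, -1])) u = u := hu
    rw [emb3_dg n (by norm_num)] at hu'
    have hfix := mautner hρ hu' (i₀ := e (Sum.inl 0)) (j₀ := e (Sum.inl 1)) (by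
      simp [← he]; norm_num)
    rw [rep_inner_inv, hfix]
    exact hv0 u hfix

section mixing2
variable {H : Type*} [NormedAddCommGroup H] [InnerProductSpace ℝ H]

theorem rep_fix_of_tendsto_tendsto {G : Type*} [Group G] [TopologicalSpace G] {ρ : G →* (H ≃ₗᵢ[ℝ] H)}
    (hρ : ∀ v, Continuous fun g => ρ g v) {v : H} {a b e : ℕ → G} {e₀ : G}
    (ha : ∀ n, ρ (a n) v = v) (hb : ∀ n, ρ (b n) v = v)
    (he : Filter.Tendsto (fun n => a n * e n * b n) Filter.atTop (nhds e₀))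
    (hlim : Filter.Tendsto e Filter.atTop (nhds 1)) : ρ e₀ v = v := by
  have h1 : ∀ n, ‖ρ (a n * e n * b n) v - v‖ = ‖ρ (e n) v - v‖ := by
    intro n
    rw [rep_mul, hb, rep_mul]
    conv_lhs => rw [← ha n]
    rw [ha n, show ρ (a n) (ρ (e n) v) - v = ρ (a n) (ρ (e n) v - v) by rw [map_sub, ha], rep_norm]
  have h2 : Filter.Tendsto (fun n => ‖ρ (e n) v - v‖) Filter.atTop (nhds 0) := by
    have := (((hρ v).tendsto 1).comp hlim).sub_const v |>.norm
    simpa [rep_one] using this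
  have h3 := ((((hρ v).tendsto e₀).comp he).sub_const v).norm
  have := tendsto_nhds_unique h3 (h2.congr fun n => (h1 n).symm)
  exact (sub_eq_zero.1 (norm_eq_zero.1 this))

/-- Upper unipotent matrices in `SL(2)`. -/
noncomputable def uu (x : ℝ) : SLR 2 := ⟨!![1, x; 0, 1], by simp [Matrix.det_fin_two]⟩

/-- Lower unipotent matrices in `SL(2)`. -/
noncomputable def ul (x : ℝ) : SLR 2 := ⟨!![1, 0; x, 1], by simp [Matrix.det_fin_two]⟩

theorem uu_val (x : ℝ) : (uu x : Matrix (Fin 2) (Fin 2) ℝ) = !![1, x; 0, 1] := rfl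

theorem ul_val (x : ℝ) : (ul x : Matrix (Fin 2) (Fin 2) ℝ) = !![1, 0; x, 1] := rfl

theorem uu_add (x y : ℝ) : uu (x + y) = uu x * uu y := by
  apply SLR.ext_val
  rw [SLR.val_mul, uu_val, uu_val, uu_val]
  ext i j; fin_cases i <;> fin_cases j <;> simp [Matrix.mul_apply, add_comm]

theorem uu_zero : uu 0 = 1 := by
  apply SLR.ext_val
  rw [uu_val]
  ext i j; fin_cases i <;> fin_cases j <;> simp

theorem uu_neg (x : ℝ) : uu (-x) = (uu x)⁻¹ := by
  rw [eq_inv_iff_mul_eq_one, ← uu_add, neg_add_cancel, uu_zero]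

theorem uu_pow (x : ℝ) (n : ℕ) : uu x ^ n = uu (n * x) := by
  induction n with
  | zero => simp [uu_zero]
  | succ n ih => rw [pow_succ, ih, ← uu_add]; congr 1; push_cast; ring

theorem continuous_uu : Continuous uu := by
  rw [SLR.continuous_iff]
  refine continuous_matrix fun i j => ?_
  fin_cases i <;> fin_cases j <;> simp [uu_val] <;> fun_prop

theorem continuous_ul : Continuous ul := by
  rw [SLR.continuous_iff]
  refine continuous_matrix fun i j => ?_
  fin_cases i <;> fin_cases j <;> simp [ul_val] <;> fun_prop

theorem ul_zero : ul 0 = 1 := by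
  apply SLR.ext_val
  rw [ul_val]
  ext i j; fin_cases i <;> fin_cases j <;> simp

theorem dg2_val (s : ℝ) : (dg ![s, -s] : Matrix (Fin 2) (Fin 2) ℝ) =
    !![Real.exp s, 0; 0, Real.exp (-s)] := by
  rw [dg_val_of_sum (by simp)]
  ext i j; fin_cases i <;> fin_cases j <;> simp

theorem uu_fix {ρ : SLR 2 →* (H ≃ₗᵢ[ℝ] H)} (hρ : ∀ v, Continuous fun g => ρ g v) {v : H}
    (h : ρ (uu 1) v = v) (g : SLR 2) : ρ g v = v := by
  have hn : ∀ n : ℕ, ρ (uu n) v = v := by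
    intro n
    have := (fixer ρ v).pow_mem (mem_fixer ρ |>.2 h) n
    rw [uu_pow, mul_one] at this; exact this
  have hdiag : ρ (dg ![Real.log 2, -Real.log 2]) v = v := by
    refine rep_fix_of_tendsto_tendsto hρ (a := fun n => uu (2 * (n + 1) : ℕ))
      (b := fun n => (uu (n + 1 : ℕ))⁻¹) (e := fun n => ul (1 / (2 * (n + 1) : ℕ)))
      (fun n => hn _) (fun n => rep_fix_inv ρ (hn _)) ?_ ?_
    · have e : ∀ n : ℕ, uu (2 * (n + 1) : ℕ) * ul (1 / (2 * (n + 1) : ℕ)) * (uu (n + 1 : ℕ))⁻¹ =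
          dg ![Real.log 2, -Real.log 2] * ul (1 / ((n : ℝ) + 1)) := by
        intro n
        rw [← uu_neg]
        apply SLR.ext_val
        simp only [SLR.val_mul]
        rw [uu_val, ul_val, uu_val, dg2_val, ul_val, Real.exp_neg, Real.exp_log two_pos]
        have : ((n : ℝ) + 1) ≠ 0 := by positivity
        ext i j; fin_cases i <;> fin_cases j <;> simp [Matrix.mul_apply, Fin.sum_univ_two] <;>
          field_simp <;> ring
      simp only [e]
      have := ((continuous_ul.tendsto 0).comp
        (tendsto_one_div_add_atTop_nhds_zero_nat (𝕜 := ℝ))).const_mul (dg ![Real.log 2, -Real.log 2])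
      rwa [ul_zero, mul_one] at this
    · have h1 : Filter.Tendsto (fun n : ℕ => (1 : ℝ) / (2 * (n + 1) : ℕ)) Filter.atTop (nhds 0) := by
        have := (tendsto_one_div_add_atTop_nhds_zero_nat (𝕜 := ℝ)).const_mul (1 / 2)
        rw [mul_zero] at this
        refine this.congr fun n => ?_
        push_cast; field_simp
      have := (continuous_ul.tendsto 0).comp h1
      rwa [ul_zero] at this
  refine mautner hρ hdiag (i₀ := 0) (j₀ := 1) ?_ g
  have := Real.log_pos one_lt_two
  simp; linarith

variable [CompleteSpace H]

theorem mixing_aux {ρ : SLR 2 →* (H ≃ₗᵢ[ℝ] H)} (hρ : ∀ v, Continuous fun g => ρ g v) {v w : H}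
    (hv : ∀ k ∈ Kd 2, ρ k v = v) (hw : ∀ k ∈ Kd 2, ρ k w = w)
    (hw0 : ∀ u, (∀ g, ρ g u = u) → inner ℝ u w = 0) {ε : ℝ} (hε : 0 < ε) :
    ∃ T : ℝ, ∀ g : SLR 2, T ≤ phi g → |inner ℝ w (ρ g v)| ≤ ε := by
  have herg := rep_ergodic ρ (uu (-1)) (z := w) (fun u hu => hw0 u (uu_fix hρ (by
    have := rep_fix_inv ρ hu; rwa [← uu_neg, neg_neg] at this)))
  set δ : ℝ := ε / (2 * (‖v‖ + ‖w‖ + 1)) with hδ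
  have hδ0 : 0 < δ := by positivity
  obtain ⟨N, hN, hN0⟩ := ((Metric.tendsto_nhds.1 herg δ hδ0).and (Filter.eventually_gt_atTop 0)).exists
  rw [dist_zero_right] at hN
  have hN0' : (0 : ℝ) < N := by exact_mod_cast hN0
  -- smallness of `u_x` near the identity
  have hcont : Filter.Tendsto (fun x => ρ (uu x) v) (nhds 0) (nhds v) := by
    have := ((hρ v).comp continuous_uu).tendsto 0
    simp only [Function.comp_apply, uu_zero, rep_one] at this
    exact this
  obtain ⟨r, hr, hball⟩ := Metric.eventually_nhds_iff.1 (Metric.tendsto_nhds.1 hcont δ hδ0)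
  refine ⟨|Real.log (N / r)|, fun g hg => ?_⟩
  obtain ⟨x, hx, hxs, hphi, k, hk, k', hk', rfl⟩ := exists_kak g
  rw [Fin.sum_univ_two] at hxs
  set s := x 0 with hs
  have hx1 : x 1 = -s := by linarith
  have hx10 : x 1 ≤ x 0 := hx (Fin.zero_le _)
  have hs0 : 0 ≤ s := by linarith
  have hxe : x = ![s, -s] := by ext i; fin_cases i <;> simp [hs, hx1]
  have hps : phi (k * dg x * k') ≤ 2 * s := by
    rw [hphi, en, Fin.sum_univ_two, hx1]
    refine Real.sqrt_le_iff.2 ⟨by linarith, by nlinarith⟩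
  have hls : Real.log (N / r) ≤ 2 * s := (le_abs_self _).trans (hg.trans hps)
  have hNr : N / r ≤ Real.exp (2 * s) := by
    rw [← Real.log_le_iff_le_exp (by positivity)]; exact hls
  rw [rep_mul, rep_mul, hv _ hk', rep_inner_inv, hw _ (inv_mem hk), hxe]
  set a := dg ![s, -s] with ha
  have hcomm : ∀ n : ℕ, a * uu (Real.exp (-(2 * s)) * n) = (uu (-1) ^ n)⁻¹ * a := by
    intro n
    rw [uu_pow, ← uu_neg]
    apply SLR.ext_val
    simp only [SLR.val_mul]
    rw [ha, dg2_val, uu_val, uu_val]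
    have e1 : Real.exp s * Real.exp (-(2 * s)) = Real.exp (-s) := by rw [← Real.exp_add]; ring_nf
    ext i j; fin_cases i <;> fin_cases j <;> simp [Matrix.mul_apply, Fin.sum_univ_two]
    rw [← mul_assoc, e1, mul_comm]
  have hsmall : ∀ n ∈ Finset.range N, ‖v - ρ (uu (Real.exp (-(2 * s)) * n)) v‖ ≤ δ := by
    intro n hn
    rw [← dist_eq_norm, dist_comm]
    refine (hball ?_).le
    rw [dist_zero_right, Real.norm_eq_abs, abs_of_nonneg (by positivity), Real.exp_neg,
      inv_mul_lt_iff₀ (Real.exp_pos _)]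
    have : (n : ℝ) < N := by exact_mod_cast Finset.mem_range.1 hn
    rw [div_le_iff₀ hr] at hNr
    linarith
  have h1 : ∀ n ∈ Finset.range N, |inner ℝ w (ρ a v) - inner ℝ (ρ (uu (-1) ^ n) w) (ρ a v)| ≤ ‖w‖ * δ := by
    intro n hn
    have : inner ℝ (ρ (uu (-1) ^ n) w) (ρ a v) = inner ℝ w (ρ a (ρ (uu (Real.exp (-(2 * s)) * n)) v)) := by
      rw [← rep_mul ρ a, hcomm, rep_mul, rep_inner_inv ρ (uu (-1) ^ n)⁻¹, inv_inv]
    rw [this, ← inner_sub_right, ← map_sub]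
    refine (rep_inner_le ρ _ _ _).trans ?_
    gcongr
    exact hsmall n hn
  have h2 : |inner ℝ ((N : ℝ)⁻¹ • ∑ n ∈ Finset.range N, ρ (uu (-1) ^ n) w) (ρ a v)| ≤ δ * ‖v‖ := by
    refine (abs_real_inner_le_norm _ _).trans ?_
    rw [rep_norm]; gcongr
  have h3 : |inner ℝ w (ρ a v) - inner ℝ ((N : ℝ)⁻¹ • ∑ n ∈ Finset.range N, ρ (uu (-1) ^ n) w) (ρ a v)| ≤
      ‖w‖ * δ := by
    have : inner ℝ w (ρ a v) - inner ℝ ((N : ℝ)⁻¹ • ∑ n ∈ Finset.range N, ρ (uu (-1) ^ n) w) (ρ a v) =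
        (N : ℝ)⁻¹ * ∑ n ∈ Finset.range N, (inner ℝ w (ρ a v) - inner ℝ (ρ (uu (-1) ^ n) w) (ρ a v)) := by
      rw [Finset.sum_sub_distrib, Finset.sum_const, Finset.card_range, nsmul_eq_mul, mul_sub,
        inv_mul_cancel_left₀ hN0'.ne', real_inner_smul_left, sum_inner]
    rw [this, abs_mul, abs_of_pos (inv_pos.2 hN0'), inv_mul_le_iff₀ hN0']
    refine (Finset.abs_sum_le_sum_abs _ _).trans ((Finset.sum_le_card_nsmul _ _ _ h1).trans ?_)
    simp
  have h4 : (‖w‖ + ‖v‖) * δ ≤ ε := by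
    rw [hδ, mul_div_assoc', div_le_iff₀ (by positivity)]
    nlinarith [norm_nonneg v, norm_nonneg w]
  rw [abs_le] at *
  constructor <;> nlinarith [h2.1, h2.2, h3.1, h3.2]

/-- Howe–Moore for spherical coefficients. -/
theorem mixing2 {ρ : SLR 2 →* (H ≃ₗᵢ[ℝ] H)} (hρ : ∀ v, Continuous fun g => ρ g v) {v w : H}
    (hv : ∀ k ∈ Kd 2, ρ k v = v) (hw : ∀ k ∈ Kd 2, ρ k w = w)
    (hv0 : ∀ u, (∀ g, ρ g u = u) → inner ℝ u v = 0) {ε : ℝ} (hε : 0 < ε) :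
    ∃ T : ℝ, ∀ g : SLR 2, T ≤ phi g → |inner ℝ w (ρ g v)| ≤ ε := by
  obtain ⟨T, hT⟩ := mixing_aux hρ hw hv hv0 hε
  refine ⟨T, fun g hg => ?_⟩
  rw [rep_inner_inv, real_inner_comm]
  exact hT _ (by rwa [phi_inv])

end mixing2

section Koopman

variable {G X : Type*} [Group G] [TopologicalSpace G] [IsTopologicalGroup G] [MeasurableSpace G]
  [BorelSpace G]
  [TopologicalSpace X] [R1Space X] [MeasurableSpace X] [BorelSpace X]
  [MulAction G X] [ContinuousSMul G X]
  (m : Measure X) [IsLocallyFiniteMeasure m] [m.InnerRegularCompactLTTop]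
  [SMulInvariantMeasure G X m]

/-- The Koopman representation of a measure preserving action on real `L²`. -/
noncomputable def koop : G →* (Lp ℝ 2 m ≃ₗᵢ[ℝ] Lp ℝ 2 m) where
  toFun g :=
    { toFun := fun f => DomMulAct.mk g⁻¹ • f
      invFun := fun f => DomMulAct.mk g • f
      left_inv := fun f => by
        show DomMulAct.mk g • DomMulAct.mk g⁻¹ • f = f
        rw [smul_smul, ← DomMulAct.mk_mul]; simp
      right_inv := fun f => by
        show DomMulAct.mk g⁻¹ • DomMulAct.mk g • f = f
        rw [smul_smul, ← DomMulAct.mk_mul]; simp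
      map_add' := fun f f' => DomMulAct.smul_Lp_add _ _ _
      map_smul' := fun c f => smul_comm _ _ _
      norm_map' := fun f => DomMulAct.norm_smul_Lp _ _ }
  map_one' := by
    ext1 f
    show DomMulAct.mk (1:G)⁻¹ • f = f
    simp
  map_mul' g h := by
    ext1 f
    show DomMulAct.mk (g * h)⁻¹ • f = DomMulAct.mk g⁻¹ • (DomMulAct.mk h⁻¹ • f)
    rw [smul_smul, ← DomMulAct.mk_mul, _root_.mul_inv_rev]

theorem koop_apply (g : G) (f : Lp ℝ 2 m) : koop m g f = DomMulAct.mk g⁻¹ • f := rfl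

theorem koop_ae (g : G) (f : Lp ℝ 2 m) : koop m g f =ᵐ[m] fun x => f (g⁻¹ • x) := by
  rw [koop_apply]
  exact DomMulAct.smul_Lp_ae_eq _ _

theorem koop_toLp (g : G) {f : X → ℝ} (hf : MemLp f 2 m) :
    koop m g (hf.toLp f) =ᵐ[m] fun x => f (g⁻¹ • x) := by
  refine (koop_ae m g _).trans ?_
  have h := hf.coeFn_toLp
  exact (measurePreserving_smul g⁻¹ m).quasiMeasurePreserving.ae_eq_comp h

theorem continuous_koop (f : Lp ℝ 2 m) : Continuous fun g : G => koop m g f := by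
  simp only [koop_apply]
  haveI : Fact ((2:ENNReal) ≠ ⊤) := ⟨by simp⟩
  have : Continuous fun g : G => DomMulAct.mk g⁻¹ :=
    DomMulAct.continuous_mk.comp continuous_inv
  exact this.smul continuous_const

theorem inner_koop_toLp (g : G) {f f' : X → ℝ} (hf : MemLp f 2 m) (hf' : MemLp f' 2 m) :
    inner ℝ (hf'.toLp f') (koop m g (hf.toLp f)) = ∫ x, f' x * f (g⁻¹ • x) ∂m := by
  rw [L2.inner_def]
  apply integral_congr_ae
  filter_upwards [koop_toLp m g hf, hf'.coeFn_toLp] with x h1 h2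
  rw [h1, h2]
  simp [mul_comm]

theorem koop_fix_of_invariant (g : G) {f : X → ℝ} (hf : MemLp f 2 m)
    (h : ∀ x, f (g⁻¹ • x) = f x) : koop m g (hf.toLp f) = hf.toLp f := by
  apply Lp.ext
  filter_upwards [koop_toLp m g hf, hf.coeFn_toLp] with x h1 h2
  rw [h1, h2, h]

theorem koop_const (hm : SigmaFinite m) [SecondCountableTopology G] [SecondCountableTopology X]
    (μ : Measure G) [SigmaFinite μ]
    (hN : ∀ (x : X) (N : Set X), MeasurableSet N → μ {g : G | g⁻¹ • x ∈ N} = 0 → m N = 0)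
    (u : Lp ℝ 2 m) (hu : ∀ g : G, koop m g u = u) : ∃ c : ℝ, u =ᵐ[m] fun _ => c := by
  rcases eq_or_ne m 0 with rfl | hm0
  · exact ⟨0, by simp [Filter.EventuallyEq]⟩
  have hme : Measurable (u : X → ℝ) := (Lp.stronglyMeasurable u).measurable
  have hmeas : MeasurableSet {q : G × X | u (q.1⁻¹ • q.2) = u q.2} := by
    apply measurableSet_eq_fun
    · exact hme.comp ((continuous_fst.inv.smul continuous_snd).measurable)
    · exact hme.comp measurable_snd
  have h1 : ∀ g : G, ∀ᵐ x ∂m, u (g⁻¹ • x) = u x := by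
    intro g
    have := koop_ae m g u
    rw [hu g] at this
    filter_upwards [this] with x hx using hx.symm
  have h2 : ∀ᵐ q ∂(μ.prod m), u (q.1⁻¹ • q.2) = u q.2 := by
    rw [Measure.ae_prod_iff_ae_ae hmeas]
    exact Filter.Eventually.of_forall h1
  have h3 : ∀ᵐ x ∂m, ∀ᵐ g ∂μ, u (g⁻¹ • x) = u x := by
    have := (Measure.ae_prod_iff_ae_ae hmeas).1 h2
    have h2' : ∀ᵐ q ∂(m.prod μ), u (q.2⁻¹ • q.1) = u q.1 := by
      rw [← Measure.prod_swap]
      exact (ae_map_iff measurable_swap.aemeasurable (measurable_swap.comp measurable_id hmeas)).2 h2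
    exact Measure.ae_ae_of_ae_prod h2'
  haveI : (ae m).NeBot := ae_neBot.2 hm0
  obtain ⟨x, hx⟩ := h3.exists
  refine ⟨u x, ?_⟩
  have := hN x {y | u y ≠ u x} (hme (measurableSet_singleton (u x)).compl) hx
  exact this

theorem koop_orth (hm : SigmaFinite m) [SecondCountableTopology G] [SecondCountableTopology X]
    (μ : Measure G) [SigmaFinite μ]
    (hN : ∀ (x : X) (N : Set X), MeasurableSet N → μ {g : G | g⁻¹ • x ∈ N} = 0 → m N = 0)
    {f : X → ℝ} (hf : MemLp f 2 m) (h0 : m Set.univ ≠ ⊤ → ∫ x, f x ∂m = 0)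
    (u : Lp ℝ 2 m) (hu : ∀ g : G, koop m g u = u) : inner ℝ u (hf.toLp f) = 0 := by
  obtain ⟨c, hc⟩ := koop_const m hm μ hN u hu
  by_cases htop : m Set.univ = ⊤
  · have hc0 : c = 0 := by
      by_contra hc0
      have := (memLp_congr_ae hc).1 (Lp.memLp u)
      rw [memLp_const_iff (by simp) (by simp)] at this
      rcases this with h | h
      · exact hc0 h
      · simp [htop] at h
    rw [L2.inner_def]
    rw [integral_congr_ae (g := fun _ => 0)]
    · simp
    filter_upwards [hc] with x hx
    rw [hx, hc0]; simp
  · rw [L2.inner_def]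
    rw [integral_congr_ae (g := fun x => c * f x)]
    · rw [integral_const_mul, h0 htop, mul_zero]
    filter_upwards [hc, hf.coeFn_toLp] with x hx hx2
    rw [hx, hx2]; simp [mul_comm]

end Koopman

open scoped Pointwise


section QuotientSpace

variable {G : Type*} [Group G] [TopologicalSpace G] [IsTopologicalGroup G] [PolishSpace G]
  [LocallyCompactSpace G] [MeasurableSpace G] [BorelSpace G]
  (L : Subgroup G)

theorem quotient_t2Space (hL : IsClosed (L : Set G)) : T2Space (G ⧸ L) := by
  rw [t2Space_iff_of_isOpenQuotientMap (QuotientGroup.isOpenQuotientMap_mk (N := L))]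
  have : {q : G × G | (q.1 : G ⧸ L) = (q.2 : G ⧸ L)} = (fun q : G × G => q.1⁻¹ * q.2) ⁻¹' (L : Set G) := by
    ext q
    simp [QuotientGroup.eq]
  rw [this]
  exact hL.preimage (by fun_prop)

variable (μ : Measure G) [IsLocallyFiniteMeasure μ] [μ.IsMulLeftInvariant] [μ.IsMulRightInvariant]
  (E : Set G)

/-- The measure on `G ⧸ L` defined by a fundamental domain. -/
noncomputable def quotMeasure : Measure (G ⧸ L) := (μ.restrict E).map QuotientGroup.mk

variable {E μ L}

theorem measurable_quotMk : Measurable (QuotientGroup.mk : G → G ⧸ L) :=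
  fun V hV => measurableSet_quotient.mp hV

theorem quotMeasure_apply {U : Set (G ⧸ L)} (hU : MeasurableSet U) :
    quotMeasure L μ E U = μ (QuotientGroup.mk ⁻¹' U ∩ E) := by
  rw [quotMeasure, Measure.map_apply measurable_quotMk hU, Measure.restrict_apply (measurable_quotMk hU)]

theorem quotMeasure_univ : quotMeasure L μ E Set.univ = μ E := by
  rw [quotMeasure_apply MeasurableSet.univ]; simp

variable [Countable L]

theorem quotMeasure_smulInvariant (hE : IsFundamentalDomain L.op E μ) [T2Space (G ⧸ L)] :
    SMulInvariantMeasure G (G ⧸ L) (quotMeasure L μ E) := by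
  haveI : HasFundamentalDomain L.op G μ := ⟨⟨E, hE⟩⟩
  haveI : Countable L.op := L.equivOp.symm.injective.countable
  haveI : QuotientMeasureEqMeasurePreimage μ (quotMeasure L μ E) :=
    hE.quotientMeasureEqMeasurePreimage_quotientMeasure
  exact QuotientMeasureEqMeasurePreimage.smulInvariantMeasure_quotient μ

/-- Unfolding. -/
theorem quotMeasure_lintegral (hE : IsFundamentalDomain L.op E μ) {k : G → ENNReal}
    (hk : Measurable k) {F : G ⧸ L → ENNReal} (hF : Measurable F)
    (h : ∀ g : G, F (g : G ⧸ L) = ∑' γ : L, k (g * γ)) :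
    ∫⁻ y, F y ∂(quotMeasure L μ E) = ∫⁻ g, k g ∂μ := by
  haveI : Countable L.op := L.equivOp.symm.injective.countable
  rw [quotMeasure, lintegral_map hF measurable_quotMk]
  simp only [h]
  rw [lintegral_tsum (f := fun (γ : L) (g : G) => k (g * γ)) (fun γ => (hk.comp (measurable_mul_const _)).aemeasurable)]
  rw [hE.lintegral_eq_tsum'']
  rw [← L.equivOp.tsum_eq]
  rfl

theorem quotMeasure_image_le (hE : IsFundamentalDomain L.op E μ) [BorelSpace (G ⧸ L)] {U : Set G} (hU : IsOpen U) :
    quotMeasure L μ E (QuotientGroup.mk '' U) ≤ μ U := by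
  haveI : Countable L.op := L.equivOp.symm.injective.countable
  have hm : MeasurableSet ((QuotientGroup.mk : G → G ⧸ L) '' U) :=
    (QuotientGroup.isOpenMap_coe U hU).measurableSet
  rw [quotMeasure_apply hm, hE.measure_eq_tsum U]
  have : (QuotientGroup.mk : G → G ⧸ L) ⁻¹' (QuotientGroup.mk '' U) ∩ E = ⋃ g : L.op, (g • U ∩ E) := by
    rw [← Set.iUnion_inter]
    congr 1
    ext x
    simp only [Set.mem_preimage, Set.mem_image, Set.mem_iUnion]
    constructor
    · rintro ⟨y, hy, e⟩
      rw [QuotientGroup.eq] at e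
      refine ⟨⟨MulOpposite.op (y⁻¹ * x), by simpa using e⟩, y, hy, ?_⟩
      show y * (y⁻¹ * x) = x
      group
    · rintro ⟨g, y, hy, rfl⟩
      refine ⟨y, hy, ?_⟩
      rw [QuotientGroup.eq]
      show y⁻¹ * (y * g.1.unop) ∈ L
      rw [inv_mul_cancel_left]
      exact g.2
  rw [this]
  exact measure_iUnion_le _

theorem quotMeasure_locallyFinite [BorelSpace (G ⧸ L)] (hE : IsFundamentalDomain L.op E μ) :
    IsLocallyFiniteMeasure (quotMeasure L μ E) := by
  constructor
  intro y
  obtain ⟨g, rfl⟩ := QuotientGroup.mk_surjective y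
  obtain ⟨U, hgU, hU, hlt⟩ := μ.exists_isOpen_measure_lt_top g
  exact ⟨_, (QuotientGroup.isOpenMap_coe U hU).mem_nhds ⟨g, hgU, rfl⟩,
    (quotMeasure_image_le hE hU).trans_lt hlt⟩

theorem quotMeasure_null (hE : IsFundamentalDomain L.op E μ) [BorelSpace (G ⧸ L)] (y : G ⧸ L) (N : Set (G ⧸ L))
    (hN : MeasurableSet N) (h : μ {g : G | g⁻¹ • y ∈ N} = 0) : quotMeasure L μ E N = 0 := by
  obtain ⟨x, rfl⟩ := QuotientGroup.mk_surjective y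
  rw [quotMeasure_apply hN]
  refine measure_mono_null Set.inter_subset_left ?_
  have e : {g : G | g⁻¹ • (x : G ⧸ L) ∈ N} = (fun g => g⁻¹ * x) ⁻¹' (QuotientGroup.mk ⁻¹' N) := rfl
  rw [e] at h
  have hm := measurable_quotMk (L := L) hN
  set A := (QuotientGroup.mk : G → G ⧸ L) ⁻¹' N
  have h1 : (fun g : G => g⁻¹ * x) ⁻¹' A = (fun g : G => g⁻¹) ⁻¹' ((fun g => g * x) ⁻¹' A) := rfl
  rw [h1, Set.inv_preimage, measure_inv_null, measure_preimage_mul_right] at h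
  exact h

end QuotientSpace

section lattice
variable {d : ℕ}

theorem SLR.isInvInvariant (hd : 2 ≤ d) (μ : Measure (SLR d)) [μ.IsHaarMeasure] :
    μ.IsInvInvariant := by
  haveI := SLR.isMulRightInvariant hd μ
  constructor
  have h1 := Measure.isMulLeftInvariant_eq_smul μ.inv μ
  set c := Measure.haarScalarFactor μ.inv μ
  set D := {g : SLR d | phi g ≤ 1} with hD
  have hc := isCompact_phi_le (d := d) 1
  have hinv : D⁻¹ = D := by
    ext g
    simp [hD, phi_inv]
  have hpos : μ D ≠ 0 := by
    refine (Measure.measure_pos_of_mem_nhds μ (x := (1 : SLR d)) ?_).ne'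
    have : D = phi ⁻¹' (Set.Iic 1) := rfl
    rw [this]
    apply (continuous_phi (d := d)).continuousAt.preimage_mem_nhds
    rw [phi_one]
    exact Iic_mem_nhds one_pos
  have hfin : μ D ≠ ⊤ := hc.measure_ne_top
  have h2 : μ D = c * μ D := by
    conv_lhs => rw [← hinv, ← Measure.inv_apply, h1]
    rfl
  have h3 : (c : ENNReal) = 1 := by
    have := (ENNReal.mul_left_inj hpos hfin (a := 1) (b := c)).1 (by rw [one_mul]; exact h2)
    exact this.symm
  rw [h1]
  have : c = 1 := by exact_mod_cast h3
  rw [this, one_smul]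

theorem toSLR_injective : Function.Injective (toSLR (d := d)) := by
  intro a b h
  apply Subtype.ext
  have h' : (toSLR a : Matrix (Fin d) (Fin d) ℝ) = toSLR b := by rw [h]
  ext i j
  have h2 := congrFun (congrFun h' i) j
  exact Int.cast_injective (α := ℝ) h2

/-- The image of the congruence subgroup in `SL(d,ℝ)`. -/
noncomputable def latt (d p : ℕ) : Subgroup (SLR d) := (congSubgroup d p).map toSLR

instance SLZ_countable : Countable (Matrix.SpecialLinearGroup (Fin d) ℤ) :=
  by
  haveI : Countable (Matrix (Fin d) (Fin d) ℤ) := inferInstanceAs (Countable (Fin d → Fin d → ℤ))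
  exact (Subtype.val_injective (p := fun A : Matrix (Fin d) (Fin d) ℤ => A.det = 1)).countable

instance {p : ℕ} : Countable (latt d p) := by
  have : Function.Surjective (fun x : congSubgroup d p => (⟨toSLR x.1, ⟨x.1, x.2, rfl⟩⟩ : latt d p)) := by
    rintro ⟨_, x, hx, rfl⟩
    exact ⟨⟨x, hx⟩, rfl⟩
  exact this.countable

theorem isClosed_toSLR_image (S : Set (Matrix.SpecialLinearGroup (Fin d) ℤ)) :
    IsClosed (toSLR '' S) := by
  have hemb : Topology.IsClosedEmbedding (fun A : Fin d → Fin d → ℤ => fun i j => (A i j : ℝ)) :=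
    Topology.IsClosedEmbedding.piMap fun _ => Topology.IsClosedEmbedding.piMap fun _ =>
      Int.isClosedEmbedding_coe_real
  have hc : IsClosed ((fun A : Fin d → Fin d → ℤ => fun i j => (A i j : ℝ)) ''
      ((fun g : Matrix.SpecialLinearGroup (Fin d) ℤ => (g : Matrix (Fin d) (Fin d) ℤ)) '' S)) :=
    hemb.isClosedMap _ (isClosed_discrete _)
  have := hc.preimage (SLR.continuous_val (d := d))
  convert this using 1
  ext g
  constructor
  · rintro ⟨x, hx, rfl⟩
    exact ⟨_, ⟨x, hx, rfl⟩, rfl⟩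
  · rintro ⟨_, ⟨x, hx, rfl⟩, h⟩
    exact ⟨x, hx, Subtype.ext h⟩

theorem isClosed_latt (p : ℕ) : IsClosed (latt d p : Set (SLR d)) := isClosed_toSLR_image _

instance {p : ℕ} : T2Space (SLR d ⧸ latt d p) := quotient_t2Space _ (isClosed_latt p)

instance {p : ℕ} [NeZero p] : (congSubgroup d p).FiniteIndex := by
  unfold congSubgroup
  haveI : Finite (Matrix.SpecialLinearGroup (Fin d) (ZMod p)) :=
    Subtype.finite
  infer_instance

instance {p : ℕ} : Countable (Matrix.SpecialLinearGroup (Fin d) ℤ ⧸ congSubgroup d p) :=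
  QuotientGroup.mk_surjective.countable

variable {μ : Measure (SLR d)} {F₀ : Set (SLR d)}

/-- A fundamental domain for the right action of the congruence subgroup. -/
noncomputable def cosetDom (p : ℕ) (F₀ : Set (SLR d)) : Set (SLR d) :=
  ⋃ q : Matrix.SpecialLinearGroup (Fin d) ℤ ⧸ congSubgroup d p,
    {x : SLR d | toSLR q.out * x⁻¹ ∈ F₀}

theorem aedisjoint_translates (hd : 2 ≤ d) [μ.IsHaarMeasure]
    (hF₀ : IsFundamentalDomain (toSLR (d := d)).range F₀ μ)
    {a b : Matrix.SpecialLinearGroup (Fin d) ℤ} (hab : a ≠ b) :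
    AEDisjoint μ {x : SLR d | toSLR a * x⁻¹ ∈ F₀} {x : SLR d | toSLR b * x⁻¹ ∈ F₀} := by
  haveI := SLR.isInvInvariant hd μ
  have h1 := @hF₀.aedisjoint (⟨toSLR a, a, rfl⟩⁻¹) (⟨toSLR b, b, rfl⟩⁻¹) (by
    intro h
    exact hab (toSLR_injective (congrArg Subtype.val (inv_injective h))))
  have h2 := AEDisjoint.preimage h1 (Measure.measurePreserving_inv μ).quasiMeasurePreserving
  convert h2 using 1
  all_goals
    ext x
    simp only [Set.mem_setOf_eq, Set.mem_preimage, Set.mem_smul_set_iff_inv_smul_mem, inv_inv]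
    rfl

theorem cosetDom_isFundamentalDomain (hd : 2 ≤ d) [μ.IsHaarMeasure]
    (hF₀ : IsFundamentalDomain (toSLR (d := d)).range F₀ μ) (p : ℕ) :
    IsFundamentalDomain (latt d p).op (cosetDom p F₀) μ := by
  haveI := SLR.isInvInvariant hd μ
  haveI := SLR.isMulRightInvariant hd μ
  have hmp : ∀ a : SLR d, MeasurePreserving (fun x => a * x⁻¹) μ μ := fun a =>
    (measurePreserving_mul_left μ a).comp (Measure.measurePreserving_inv μ)
  constructor
  · exact NullMeasurableSet.iUnion fun q => hF₀.nullMeasurableSet.preimage (hmp _).quasiMeasurePreserving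
  · have := (Measure.measurePreserving_inv μ).quasiMeasurePreserving.ae hF₀.ae_covers
    filter_upwards [this] with x hx
    obtain ⟨⟨_, l, rfl⟩, hl⟩ := hx
    set q : Matrix.SpecialLinearGroup (Fin d) ℤ ⧸ congSubgroup d p := (QuotientGroup.mk l) with hq
    have hm : q.out⁻¹ * l ∈ congSubgroup d p := by
      rw [← QuotientGroup.eq]
      simp [hq]
    refine ⟨⟨MulOpposite.op (toSLR (q.out⁻¹ * l))⁻¹, ?_⟩, ?_⟩
    · show (toSLR (q.out⁻¹ * l))⁻¹ ∈ latt d p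
      exact inv_mem ⟨_, hm, rfl⟩
    · refine Set.mem_iUnion.2 ⟨q, ?_⟩
      show toSLR q.out * (x * (toSLR (q.out⁻¹ * l))⁻¹)⁻¹ ∈ F₀
      have : toSLR q.out * (x * (toSLR (q.out⁻¹ * l))⁻¹)⁻¹ = toSLR l * x⁻¹ := by
        rw [map_mul, map_inv]; group
      rw [this]
      exact hl
  · have key : ∀ (γ : Matrix.SpecialLinearGroup (Fin d) ℤ) (hγ : toSLR γ ∈ latt d p),
        (⟨MulOpposite.op (toSLR γ), hγ⟩ : (latt d p).op) • cosetDom p F₀ =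
        ⋃ q : Matrix.SpecialLinearGroup (Fin d) ℤ ⧸ congSubgroup d p,
        {x : SLR d | toSLR (q.out * γ) * x⁻¹ ∈ F₀} := by
      intro γ hγ
      ext x
      rw [Set.mem_smul_set_iff_inv_smul_mem, cosetDom, Set.mem_iUnion, Set.mem_iUnion]
      refine exists_congr fun q => ?_
      show toSLR q.out * (x * (toSLR γ)⁻¹)⁻¹ ∈ F₀ ↔ _
      rw [Set.mem_setOf_eq, map_mul, _root_.mul_inv_rev, inv_inv, mul_assoc]
    rintro ⟨a, ha⟩ ⟨b, hb⟩ hab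
    obtain ⟨γ, hγ, hγa⟩ := ha
    obtain ⟨γ', hγ', hγb⟩ := hb
    obtain rfl : a = MulOpposite.op (toSLR γ) := by rw [hγa]; rfl
    obtain rfl : b = MulOpposite.op (toSLR γ') := by rw [hγb]; rfl
    have hne : γ ≠ γ' := by
      rintro rfl
      exact hab rfl
    have e1 := key γ ⟨γ, hγ, rfl⟩
    have e2 := key γ' ⟨γ', hγ', rfl⟩
    show AEDisjoint μ ((⟨MulOpposite.op (toSLR γ), ⟨γ, hγ, rfl⟩⟩ : (latt d p).op) • cosetDom p F₀) ((⟨MulOpposite.op (toSLR γ'), ⟨γ', hγ', rfl⟩⟩ : (latt d p).op) • cosetDom p F₀)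
    erw [e1, e2]
    rw [AEDisjoint.iUnion_left_iff]
    intro q
    rw [AEDisjoint.iUnion_right_iff]
    intro q'
    apply aedisjoint_translates hd hF₀
    intro h
    have e : q = q' := by
      have h3 : (q.out : Matrix.SpecialLinearGroup (Fin d) ℤ ⧸ congSubgroup d p) = q'.out := by
        rw [QuotientGroup.eq]
        have : q.out⁻¹ * q'.out = γ * γ'⁻¹ := by
          rw [inv_mul_eq_iff_eq_mul, ← mul_assoc, h, mul_inv_cancel_right]
        rw [this]
        exact mul_mem hγ (inv_mem hγ')
      simpa using h3
    rw [e] at h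
    exact hne (mul_left_cancel h)

theorem measure_cosetDom (hd : 2 ≤ d) [μ.IsHaarMeasure]
    (hF₀ : IsFundamentalDomain (toSLR (d := d)).range F₀ μ) (p : ℕ) [NeZero p] :
    μ (cosetDom p F₀) = (congSubgroup d p).index * μ F₀ := by
  haveI := SLR.isInvInvariant hd μ
  have hmp : ∀ a : SLR d, MeasurePreserving (fun x => a * x⁻¹) μ μ := fun a =>
    (measurePreserving_mul_left μ a).comp (Measure.measurePreserving_inv μ)
  rw [cosetDom, measure_iUnion₀]
  · have : ∀ q : Matrix.SpecialLinearGroup (Fin d) ℤ ⧸ congSubgroup d p,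
        μ {x : SLR d | toSLR q.out * x⁻¹ ∈ F₀} = μ F₀ := fun q =>
      (hmp _).measure_preimage hF₀.nullMeasurableSet
    simp only [this]
    rw [ENNReal.tsum_const, Subgroup.index, ENat.card_eq_coe_natCard]
    simp
  · intro q q' hqq
    apply aedisjoint_translates hd hF₀
    intro h
    apply hqq
    rw [← Quotient.out_eq q, ← Quotient.out_eq q', h]
  · exact fun q => hF₀.nullMeasurableSet.preimage (hmp _).quasiMeasurePreserving

end lattice

section automorphize
variable {G : Type*} [Group G] (L : Subgroup G)

/-- The sum of `k` over the cosets of `L`. -/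
noncomputable def cosetSum (k : G → ENNReal) (y : G ⧸ L) : ENNReal :=
  Quotient.liftOn' y (fun g => ∑' γ : L, k (g * γ)) (by
    intro a b h
    rw [QuotientGroup.leftRel_apply] at h
    rw [← (Equiv.mulLeft (⟨a⁻¹ * b, h⟩ : L)).tsum_eq (fun γ : L => k (a * γ))]
    refine tsum_congr fun γ => ?_
    congr 1
    show a * (a⁻¹ * b * γ) = b * γ
    group)

theorem measurable_cosetSum [Countable L] [MeasurableSpace G] [MeasurableMul₂ G] {k : G → ENNReal}
    (hk : Measurable k) : Measurable (cosetSum L k) := by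
  apply measurable_from_quotient.2
  show Measurable fun g : G => ∑' γ : L, k (g * γ)
  exact Measurable.ennreal_tsum fun γ => hk.comp (measurable_mul_const _)

end automorphize

section counting
variable {d : ℕ}

/-- The number of points of a coset of the congruence subgroup in the ball of radius `t`. -/
noncomputable def cnt (d p : ℕ) (γ : Matrix.SpecialLinearGroup (Fin d) ℤ) (t : ℝ) : ℝ :=
  Nat.card {x : Matrix.SpecialLinearGroup (Fin d) ℤ |
              (∃ δ ∈ congSubgroup d p, x = γ * δ) ∧ phi (toSLR x) ≤ t}

theorem abs_entry_le_norm (A : Matrix (Fin d) (Fin d) ℝ) (i j : Fin d) : |A i j| ≤ ‖A‖ := by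
  have := Matrix.l2_opNorm_mulVec A (EuclideanSpace.single j 1)
  have h2 := (PiLp.norm_apply_le _ i).trans this
  simpa using h2

theorem finite_phi_toSLR_le (t : ℝ) :
    {x : Matrix.SpecialLinearGroup (Fin d) ℤ | phi (toSLR x) ≤ t}.Finite := by
  have hsub : {x : Matrix.SpecialLinearGroup (Fin d) ℤ | phi (toSLR x) ≤ t} ⊆
      (fun x : Matrix.SpecialLinearGroup (Fin d) ℤ => fun i j => (x : Matrix (Fin d) (Fin d) ℤ) i j) ⁻¹'
      (Set.pi Set.univ fun _ : Fin d => Set.pi Set.univ fun _ : Fin d =>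
        Set.Icc (-⌈Real.exp t⌉) ⌈Real.exp t⌉) := by
    intro x hx i _ j _
    have h1 : |((toSLR x : Matrix (Fin d) (Fin d) ℝ) i j)| ≤ Real.exp t := by
      exact (abs_entry_le_norm _ i j).trans ((norm_le_exp_phi _).trans (Real.exp_le_exp.2 hx))
    have h2 : |((x : Matrix (Fin d) (Fin d) ℤ) i j : ℝ)| ≤ Real.exp t := h1
    rw [abs_le] at h2
    have h3 := Int.le_ceil (Real.exp t)
    constructor
    · have : ((-⌈Real.exp t⌉ : ℤ) : ℝ) ≤ ((x : Matrix (Fin d) (Fin d) ℤ) i j : ℝ) := by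
        push_cast; linarith
      exact_mod_cast this
    · have : ((x : Matrix (Fin d) (Fin d) ℤ) i j : ℝ) ≤ ((⌈Real.exp t⌉ : ℤ) : ℝ) := by
        linarith
      exact_mod_cast this
  refine Set.Finite.subset (Set.Finite.preimage ?_ ?_) hsub
  · intro a _ b _ h
    exact Subtype.ext h
  · exact Set.Finite.pi fun _ => Set.Finite.pi fun _ => Set.finite_Icc (-⌈Real.exp t⌉) ⌈Real.exp t⌉

end counting

section correlation
variable {G X : Type*} [Group G] [TopologicalSpace G] [IsTopologicalGroup G] [MeasurableSpace G]
  [BorelSpace G]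
  [TopologicalSpace X] [R1Space X] [MeasurableSpace X] [BorelSpace X]
  [MulAction G X] [ContinuousSMul G X]
  (m : Measure X) [IsLocallyFiniteMeasure m] [m.InnerRegularCompactLTTop]
  [SMulInvariantMeasure G X m]

/-- A bounded probability density. -/
structure IsBddDensity (B : ℝ) (f : X → ℝ) : Prop where
  meas : Measurable f
  nonneg : ∀ x, 0 ≤ f x
  le : ∀ x, f x ≤ B
  int : Integrable f m
  int_eq : ∫ x, f x ∂m = 1

variable {m} {B : ℝ} {f f' : X → ℝ}

theorem IsBddDensity.memLp (hf : IsBddDensity m B f) : MemLp f 2 m := by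
  rw [memLp_two_iff_integrable_sq hf.meas.aestronglyMeasurable]
  refine Integrable.mono' (hf.int.const_mul B) (hf.meas.pow_const 2).aestronglyMeasurable ?_
  refine Filter.Eventually.of_forall fun x => ?_
  rw [Real.norm_of_nonneg (sq_nonneg _), sq]
  exact mul_le_mul_of_nonneg_right (hf.le x) (hf.nonneg x)

theorem IsBddDensity.measure_ne_zero (hf : IsBddDensity m B f) : m Set.univ ≠ 0 := by
  intro h
  rw [Measure.measure_univ_eq_zero] at h
  have := hf.int_eq
  rw [h] at this
  simp at this

theorem memLp_const_inv : MemLp (fun _ : X => ((m Set.univ).toReal)⁻¹) 2 m := by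
  by_cases h : m Set.univ = ⊤
  · simp [h]
  · haveI : IsFiniteMeasure m := ⟨lt_top_iff_ne_top.2 h⟩
    exact memLp_const _

theorem IsBddDensity.memLp_sub (hf : IsBddDensity m B f) :
    MemLp (fun x => f x - ((m Set.univ).toReal)⁻¹) 2 m := hf.memLp.sub memLp_const_inv

theorem IsBddDensity.integral_sub (hf : IsBddDensity m B f) (h : m Set.univ ≠ ⊤) :
    ∫ x, (f x - ((m Set.univ).toReal)⁻¹) ∂m = 0 := by
  haveI : IsFiniteMeasure m := ⟨lt_top_iff_ne_top.2 h⟩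
  rw [MeasureTheory.integral_sub hf.int (integrable_const _), hf.int_eq, integral_const, smul_eq_mul,
    Measure.real, mul_inv_cancel₀, sub_self]
  exact (ENNReal.toReal_pos hf.measure_ne_zero h).ne'

theorem IsBddDensity.integral_mul_sub (hf : IsBddDensity m B f) (hf' : IsBddDensity m B f') :
    ∫ x, (f' x - ((m Set.univ).toReal)⁻¹) * (f x - ((m Set.univ).toReal)⁻¹) ∂m =
     ∫ x, f' x * f x ∂m - ((m Set.univ).toReal)⁻¹ := by
  by_cases h : m Set.univ = ⊤
  · simp [h]
  · haveI : IsFiniteMeasure m := ⟨lt_top_iff_ne_top.2 h⟩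
    have h1 : Integrable (fun x => f' x * f x) m := by
      exact hf'.memLp.integrable_mul hf.memLp
    have h2 : ∀ x, (f' x - ((m Set.univ).toReal)⁻¹) * (f x - ((m Set.univ).toReal)⁻¹) =
      f' x * f x - ((m Set.univ).toReal)⁻¹ * f' x  - ((m Set.univ).toReal)⁻¹ * (f x - ((m Set.univ).toReal)⁻¹)  := by
      intro x; ring
    simp only [h2]
    have h3 := (hf.int.sub (integrable_const ((m Set.univ).toReal)⁻¹)).const_mul ((m Set.univ).toReal)⁻¹
    rw [MeasureTheory.integral_sub (f := fun x => f' x * f x - ((m Set.univ).toReal)⁻¹ * f' x)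
      (g := fun x => ((m Set.univ).toReal)⁻¹ * (f x - ((m Set.univ).toReal)⁻¹)) (h1.sub (hf'.int.const_mul _)) h3,
      MeasureTheory.integral_sub h1 (hf'.int.const_mul _), integral_const_mul, integral_const_mul, hf.integral_sub h,
      hf'.int_eq]
    ring

theorem IsBddDensity.smul (hf : IsBddDensity m B f) (g : G) : IsBddDensity m B (fun x => f (g • x)) where
  meas := hf.meas.comp (measurable_const_smul g)
  nonneg x := hf.nonneg _
  le x := hf.le _
  int := (measurePreserving_smul g m).integrable_comp_of_integrable hf.int
  int_eq := by
    rw [← hf.int_eq]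
    exact (measurePreserving_smul g m).integral_comp (measurableEmbedding_const_smul g) f

theorem IsBddDensity.norm_le (hf : IsBddDensity m B f) : ‖hf.memLp_sub.toLp _‖ ^ 2 ≤ B := by
  rw [← real_inner_self_eq_norm_sq, L2.inner_def]
  have : ∫ x, inner ℝ (hf.memLp_sub.toLp _ x) (hf.memLp_sub.toLp _ x) ∂m =
     ∫ x, (f x - ((m Set.univ).toReal)⁻¹) * (f x - ((m Set.univ).toReal)⁻¹) ∂m := by
    apply integral_congr_ae
    filter_upwards [hf.memLp_sub.coeFn_toLp] with x h1
    rw [h1]; simp [sq]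
  rw [this, hf.integral_mul_sub hf]
  have h1 : ∫ x, f x * f x ∂m ≤ ∫ x, B * f x ∂m := by
    refine integral_mono (hf.memLp.integrable_mul hf.memLp) (hf.int.const_mul B) fun x => ?_
    exact mul_le_mul_of_nonneg_right (hf.le x) (hf.nonneg x)
  rw [integral_const_mul, hf.int_eq, mul_one] at h1
  have : 0 ≤ ((m Set.univ).toReal)⁻¹ := by positivity
  linarith

theorem IsBddDensity.inner_koop (hf : IsBddDensity m B f) (hf' : IsBddDensity m B f') (g : G) :
    inner ℝ (hf'.memLp_sub.toLp _) (koop m g (hf.memLp_sub.toLp _)) =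
     ∫ x, f' x * f (g⁻¹ • x) ∂m - ((m Set.univ).toReal)⁻¹ := by
  rw [inner_koop_toLp]
  exact (hf.smul g⁻¹).integral_mul_sub hf'

end correlation

section smoothing
variable {d : ℕ} (μ : Measure (SLR d)) [μ.IsHaarMeasure]

theorem measurableSet_phi_le (t : ℝ) : MeasurableSet {g : SLR d | phi g ≤ t} :=
  measurableSet_le continuous_phi.measurable measurable_const

/-- The volume of the ball of radius `t`. -/
noncomputable def vol (t : ℝ) : ℝ := (μ {g : SLR d | phi g ≤ t}).toReal

theorem measure_ball_ne_top (t : ℝ) : μ {g : SLR d | phi g ≤ t} ≠ ⊤ :=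
  (isCompact_phi_le t).measure_ne_top

theorem measure_ball_pos {t : ℝ} (ht : 0 < t) : μ {g : SLR d | phi g ≤ t} ≠ 0 := by
  refine (Measure.measure_pos_of_mem_nhds μ (x := (1 : SLR d)) ?_).ne'
  have : {g : SLR d | phi g ≤ t} = phi ⁻¹' (Set.Iic t) := rfl
  rw [this]
  apply (continuous_phi (d := d)).continuousAt.preimage_mem_nhds
  rw [phi_one]
  exact Iic_mem_nhds ht

theorem vol_pos {t : ℝ} (ht : 0 < t) : 0 < vol μ t :=
  ENNReal.toReal_pos (measure_ball_pos μ ht) (measure_ball_ne_top μ t)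

theorem vol_mono {s t : ℝ} (h : s ≤ t) : vol μ s ≤ vol μ t :=
  ENNReal.toReal_mono (measure_ball_ne_top μ t) (measure_mono fun g hg => le_trans hg h)

/-- The normalised indicator of a small ball. -/
noncomputable def bump (η : ℝ) (g : SLR d) : ENNReal :=
  {g : SLR d | phi g ≤ η}.indicator (fun _ => (μ {g : SLR d | phi g ≤ η})⁻¹) g

variable {μ} {η : ℝ}

theorem measurable_bump : Measurable (bump (d := d) μ η) :=
  measurable_const.indicator (measurableSet_phi_le η)

theorem lintegral_bump (hη : 0 < η) : ∫⁻ g, bump (d := d) μ η g ∂μ = 1 := by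
  unfold bump
  rw [lintegral_indicator_const (measurableSet_phi_le η)]
  exact ENNReal.inv_mul_cancel (measure_ball_pos μ hη) (measure_ball_ne_top μ η)

theorem bump_of_le {g : SLR d} (h : phi g ≤ η) : bump μ η g = (μ {g : SLR d | phi g ≤ η})⁻¹ :=
  Set.indicator_of_mem (s := {g : SLR d | phi g ≤ η}) h _

theorem bump_of_not_le {g : SLR d} (h : ¬ phi g ≤ η) : bump μ η g = 0 :=
  Set.indicator_of_notMem (s := {g : SLR d | phi g ≤ η}) h _

theorem bump_le (g : SLR d) : bump μ η g ≤ (μ {g : SLR d | phi g ≤ η})⁻¹ := by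
  by_cases h : phi g ≤ η
  · rw [bump_of_le h]
  · rw [bump_of_not_le h]; exact zero_le

theorem bump_congr {g h : SLR d} (e : phi g = phi h) : bump μ η g = bump μ η h := by
  by_cases hh : phi h ≤ η
  · rw [bump_of_le hh, bump_of_le (e.trans_le hh)]
  · rw [bump_of_not_le hh, bump_of_not_le (by rwa [e])]

theorem phi_two_sided (g x u : SLR d) : |phi (g * x * u) - phi x| ≤ √d * phi g + √d * phi u := by
  have h1 := phi_mul_sub_le (g * x) u
  have h2 := phi_mul_sub_le x⁻¹ g⁻¹
  rw [← _root_.mul_inv_rev, phi_inv, phi_inv, phi_inv] at h2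
  rw [abs_le] at *
  constructor <;> linarith

/-- The smoothed indicator function of a ball. -/
noncomputable def smooth (μ : Measure (SLR d)) (η T : ℝ) (x : SLR d) : ENNReal :=
  ∫⁻ g, bump μ η g * ∫⁻ u, bump μ η u * {g : SLR d | phi g ≤ T}.indicator 1 (g * x * u⁻¹) ∂μ ∂μ

theorem smooth_le (hη : 0 < η) (T : ℝ) (x : SLR d) :
    smooth μ η T x ≤ {g : SLR d | phi g ≤ T + 2 * √d * η}.indicator 1 x := by
  by_cases hx : phi x ≤ T + 2 * √d * η
  · rw [Set.indicator_of_mem (s := {g : SLR d | phi g ≤ T + 2 * √d * η}) hx]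
    calc smooth μ η T x ≤ ∫⁻ g, bump μ η g * ∫⁻ u, bump μ η u * 1 ∂μ ∂μ := by
          refine lintegral_mono fun g => mul_le_mul_right (lintegral_mono fun u => mul_le_mul_right ?_ _) _
          exact Set.indicator_le_self' (fun _ _ => zero_le) _
      _ = 1 := by simp [lintegral_bump hη]
  · rw [Set.indicator_of_notMem (s := {g : SLR d | phi g ≤ T + 2 * √d * η}) hx]
    refine le_of_eq ?_
    rw [smooth, lintegral_eq_zero_of_ae_eq_zero]
    refine Filter.Eventually.of_forall fun g => ?_
    by_cases hg : phi g ≤ η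
    swap
    · simp [bump_of_not_le hg]
    have : ∫⁻ u, bump μ η u * {g : SLR d | phi g ≤ T}.indicator 1 (g * x * u⁻¹) ∂μ = 0 := by
      rw [lintegral_eq_zero_of_ae_eq_zero]
      refine Filter.Eventually.of_forall fun u => ?_
      by_cases hu : phi u ≤ η
      swap
      · simp [bump_of_not_le hu]
      have h1 := phi_two_sided g x u⁻¹
      rw [phi_inv, abs_le] at h1
      have hd : 0 ≤ √(d:ℝ) := Real.sqrt_nonneg _
      have h2 := mul_le_mul_of_nonneg_left hg hd
      have h3 := mul_le_mul_of_nonneg_left hu hd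
      have : ¬ phi (g * x * u⁻¹) ≤ T := by
        intro h
        apply hx
        linarith
      show bump μ η u * {g : SLR d | phi g ≤ T}.indicator 1 (g * x * u⁻¹) = 0
      rw [Set.indicator_of_notMem (s := {g : SLR d | phi g ≤ T}) this, mul_zero]
    show bump μ η g * _ = 0
    rw [this, mul_zero]

theorem le_smooth (hη : 0 < η) (T : ℝ) (x : SLR d) :
    {g : SLR d | phi g ≤ T - 2 * √d * η}.indicator 1 x ≤ smooth μ η T x := by
  by_cases hx : phi x ≤ T - 2 * √d * η
  · rw [Set.indicator_of_mem (s := {g : SLR d | phi g ≤ T - 2 * √d * η}) hx]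
    refine le_of_eq ?_
    have key : ∀ g : SLR d, ∀ u : SLR d, bump μ η g * (bump μ η u * {g : SLR d | phi g ≤ T}.indicator 1 (g * x * u⁻¹)) = bump μ η g * bump μ η u := by
      intro g u
      by_cases hg : phi g ≤ η
      swap
      · simp [bump_of_not_le hg]
      by_cases hu : phi u ≤ η
      swap
      · simp [bump_of_not_le hu]
      have h1 := phi_two_sided g x u⁻¹
      rw [phi_inv, abs_le] at h1
      have hd : 0 ≤ √(d:ℝ) := Real.sqrt_nonneg _
      have h2 := mul_le_mul_of_nonneg_left hg hd
      have h3 := mul_le_mul_of_nonneg_left hu hd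
      have : phi (g * x * u⁻¹) ≤ T := by linarith
      rw [Set.indicator_of_mem (s := {g : SLR d | phi g ≤ T}) this]
      simp
    have h2 : ∀ g : SLR d, bump μ η g * ∫⁻ u, bump μ η u * {g : SLR d | phi g ≤ T}.indicator 1 (g * x * u⁻¹) ∂μ = bump μ η g := by
      intro g
      rw [← lintegral_const_mul' _ _ (by
        refine ne_top_of_le_ne_top ?_ (bump_le g)
        exact ENNReal.inv_ne_top.2 (measure_ball_pos μ hη))]
      simp only [key]
      rw [lintegral_const_mul _ measurable_bump, lintegral_bump hη, mul_one]
    rw [smooth]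
    simp only [h2, lintegral_bump hη]
    rfl
  · rw [Set.indicator_of_notMem (s := {g : SLR d | phi g ≤ T - 2 * √d * η}) hx]
    exact zero_le

theorem tsum_indicator_cnt (p : ℕ) (γ : Matrix.SpecialLinearGroup (Fin d) ℤ) (S : ℝ) :
    ∑' l : latt d p, {g : SLR d | phi g ≤ S}.indicator (1 : SLR d → ENNReal) (toSLR γ * l) = ENNReal.ofReal (cnt d p γ S) := by
  let e : congSubgroup d p ≃* latt d p := (congSubgroup d p).equivMapOfInjective toSLR (toSLR_injective (d := d))
  rw [← e.toEquiv.tsum_eq]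
  have h1 : ∀ δ : congSubgroup d p, {g : SLR d | phi g ≤ S}.indicator (1 : SLR d → ENNReal) (toSLR γ * (e.toEquiv δ)) =
     {δ : congSubgroup d p | phi (toSLR (γ * δ.1)) ≤ S}.indicator 1 δ := by
    intro δ
    have : (((e.toEquiv δ) : latt d p) : SLR d) = toSLR δ.1 := rfl
    rw [this, ← map_mul]
    rfl
  simp only [h1]
  rw [← tsum_subtype {δ : congSubgroup d p | phi (toSLR (γ * δ.1)) ≤ S} (1 : congSubgroup d p → ENNReal)]
  have h2 := ENNReal.tsum_set_one {δ : congSubgroup d p | phi (toSLR (γ * δ.1)) ≤ S}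
  simp only [Pi.one_apply]
  rw [h2]
  set A := {x : Matrix.SpecialLinearGroup (Fin d) ℤ |
              (∃ δ ∈ congSubgroup d p, x = γ * δ) ∧ phi (toSLR x) ≤ S} with hA
  have hAf : A.Finite := (finite_phi_toSLR_le S).subset fun x hx => hx.2
  have h3 : (fun δ : congSubgroup d p => γ * δ.1) '' {δ : congSubgroup d p | phi (toSLR (γ * δ.1)) ≤ S} = A := by
    ext x
    constructor
    · rintro ⟨δ, hδ, rfl⟩
      exact ⟨⟨δ.1, δ.2, rfl⟩, hδ⟩
    · rintro ⟨⟨δ, hδ, rfl⟩, h⟩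
      exact ⟨⟨δ, hδ⟩, h, rfl⟩
  have h4 : Function.Injective (fun δ : congSubgroup d p => γ * δ.1) := by
    intro a b h
    exact Subtype.ext (mul_left_cancel h)
  rw [← h4.encard_image, h3, cnt, ← hA, Nat.card_coe_set_eq, ← hAf.cast_ncard_eq, ENNReal.ofReal_natCast]
  simp

end smoothing

section density
variable {d : ℕ} (μ : Measure (SLR d)) [μ.IsHaarMeasure]

/-- The density on the quotient given by the translates of a small ball. -/
noncomputable def dens (p : ℕ) (η : ℝ) (b : SLR d) : SLR d ⧸ latt d p → ENNReal :=
  cosetSum (latt d p) (fun g => bump μ η (g * b⁻¹))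

/-- The pointwise bound for `dens`. -/
noncomputable def densBd (η : ℝ) : ℝ :=
  Nat.card {x : Matrix.SpecialLinearGroup (Fin d) ℤ | phi (toSLR x) ≤ (1 + √d) * η} / vol μ η

variable {μ} {η : ℝ} {p : ℕ}

theorem measurable_dens (b : SLR d) : Measurable (dens μ p η b) :=
  measurable_cosetSum _ (measurable_bump.comp (measurable_mul_const _))

theorem dens_mk (b g : SLR d) : dens μ p η b (g : SLR d ⧸ latt d p) = ∑' γ : latt d p, bump μ η (g * γ * b⁻¹) := rfl

theorem dens_le (hη : 0 < η) (β : Matrix.SpecialLinearGroup (Fin d) ℤ) (y : SLR d ⧸ latt d p) :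
    dens μ p η (toSLR β) y ≤ ENNReal.ofReal (densBd μ η) := by
  obtain ⟨g, rfl⟩ := QuotientGroup.mk_surjective y
  rw [dens_mk]
  set b := toSLR β
  set c := (μ {g : SLR d | phi g ≤ η})⁻¹
  set A := {γ : latt d p | phi (g * (γ : SLR d) * b⁻¹) ≤ η}
  set S0 := {x : Matrix.SpecialLinearGroup (Fin d) ℤ | phi (toSLR x) ≤ (1 + √d) * η} with hS0
  have hS0f : S0.Finite := finite_phi_toSLR_le _
  have h1 : ∀ γ : latt d p, bump μ η (g * (γ : SLR d) * b⁻¹) = c * A.indicator 1 γ := by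
    intro γ
    by_cases h : γ ∈ A
    · rw [Set.indicator_of_mem h, bump_of_le h]; simp [c]
    · rw [Set.indicator_of_notMem h, bump_of_not_le h]; simp
  simp only [h1]
  rw [ENNReal.tsum_mul_left, ← tsum_subtype A (1 : latt d p → ENNReal)]
  simp only [Pi.one_apply]
  rw [ENNReal.tsum_set_one]
  have h2 : A.encard ≤ S0.encard := by
    by_cases hA : A.Nonempty
    · obtain ⟨γ₁, hγ₁⟩ := hA
      have hinj : Function.Injective (fun γ : latt d p => b * (γ₁ : SLR d)⁻¹ * γ * b⁻¹) := by
        intro u v h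
        exact Subtype.ext (mul_left_cancel (mul_right_cancel h))
      rw [← hinj.encard_image]
      refine le_trans (Set.encard_le_encard ?_) (Set.encard_image_le toSLR S0)
      rintro _ ⟨γ, hγ, rfl⟩
      obtain ⟨x, hx, hxe⟩ := γ.2
      obtain ⟨x₁, hx₁, hxe₁⟩ := γ₁.2
      have he : toSLR (β * x₁⁻¹ * x * β⁻¹) = b * (γ₁ : SLR d)⁻¹ * γ * b⁻¹ := by
        rw [map_mul, map_mul, map_mul, map_inv, map_inv, hxe, hxe₁]
      refine ⟨_, ?_, he⟩
      show phi (toSLR (β * x₁⁻¹ * x * β⁻¹)) ≤ (1 + √d) * η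
      have he2 : toSLR (β * x₁⁻¹ * x * β⁻¹) = (g * (γ₁ : SLR d) * b⁻¹)⁻¹ * (g * (γ : SLR d) * b⁻¹) := by
        rw [he]; group
      rw [he2]
      have h3 := (abs_le.1 (phi_mul_sub_le (g * (γ₁ : SLR d) * b⁻¹)⁻¹ (g * (γ : SLR d) * b⁻¹))).2
      rw [phi_inv] at h3
      have h4 : √(d:ℝ) * phi (g * (γ : SLR d) * b⁻¹) ≤ √d * η := mul_le_mul_of_nonneg_left hγ (Real.sqrt_nonneg _)
      have h5 : phi (g * (γ₁ : SLR d) * b⁻¹) ≤ η := hγ₁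
      linarith
    · rw [Set.not_nonempty_iff_eq_empty.1 hA]; simp
  calc c * ((A.encard : ENat) : ENNReal) ≤ c * ((S0.encard : ENat) : ENNReal) := by gcongr
    _ = ENNReal.ofReal (densBd μ η) := by
      rw [densBd, ENNReal.ofReal_div_of_pos (vol_pos μ hη), Nat.card_coe_set_eq, ENNReal.ofReal_natCast, vol,
        ENNReal.ofReal_toReal (measure_ball_ne_top μ η), ← hS0, ← hS0f.cast_ncard_eq, mul_comm, div_eq_mul_inv]
      simp [c]

theorem densBd_nonneg : 0 ≤ densBd (d := d) μ η := by
  unfold densBd vol; positivity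

theorem dens_smul (b : SLR d) {k : SLR d} (hk : k ∈ Kd d) (y : SLR d ⧸ latt d p) :
    dens μ p η b (k • y) = dens μ p η b y := by
  obtain ⟨g, rfl⟩ := QuotientGroup.mk_surjective y
  show dens μ p η b ((k * g : SLR d) : SLR d ⧸ latt d p) = _
  rw [dens_mk, dens_mk]
  refine tsum_congr fun γ => bump_congr ?_
  rw [mul_assoc, mul_assoc, phi_mul_left hk, mul_assoc]

variable {E : Set (SLR d)}

theorem lintegral_dens (hd : 2 ≤ d) (hE : IsFundamentalDomain (latt d p).op E μ) (hη : 0 < η) (b : SLR d) :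
    ∫⁻ y, dens μ p η b y ∂(quotMeasure (latt d p) μ E) = 1 := by
  haveI := SLR.isMulRightInvariant hd μ
  rw [quotMeasure_lintegral hE (measurable_bump.comp (measurable_mul_const b⁻¹)) (measurable_dens b) (fun g => dens_mk b g),
   ← lintegral_bump (μ := μ) hη]
  exact lintegral_mul_right_eq_self (bump μ η) b⁻¹

theorem lintegral_dens_mul (hd : 2 ≤ d) (hE : IsFundamentalDomain (latt d p).op E μ) (a h : SLR d) :
    ∫⁻ y, dens μ p η a y * dens μ p η 1 (h⁻¹ • y) ∂(quotMeasure (latt d p) μ E) =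
     ∑' γ : latt d p, ∫⁻ g, bump μ η g * bump μ η (h⁻¹ * g * (a * γ)) ∂μ := by
  haveI := SLR.isMulRightInvariant hd μ
  have hm1 : Measurable fun y : SLR d ⧸ latt d p => dens μ p η 1 (h⁻¹ • y) :=
    (measurable_dens 1).comp (measurable_const_smul _)
  have hm2 : Measurable fun g : SLR d => dens μ p η 1 (h⁻¹ • (g : SLR d ⧸ latt d p)) := hm1.comp measurable_quotMk
  rw [quotMeasure_lintegral hE (k := fun g => bump μ η (g * a⁻¹) * dens μ p η 1 (h⁻¹ • (g : SLR d ⧸ latt d p)))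
    ((measurable_bump.comp (measurable_mul_const a⁻¹)).mul hm2) (F := fun y => dens μ p η a y * dens μ p η 1 (h⁻¹ • y))
      ((measurable_dens a).mul hm1)]
  · rw [← lintegral_mul_right_eq_self _ a]
    have : ∀ g : SLR d, bump μ η (g * a * a⁻¹) * dens μ p η 1 (h⁻¹ • ((g * a : SLR d) : SLR d ⧸ latt d p)) =
      ∑' γ : latt d p, bump μ η g * bump μ η (h⁻¹ * g * (a * γ)) := by
      intro g
      rw [mul_inv_cancel_right]
      show bump μ η g * dens μ p η 1 ((h⁻¹ * (g * a) : SLR d) : SLR d ⧸ latt d p) = _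
      rw [dens_mk, ENNReal.tsum_mul_left]
      congr 1
      refine tsum_congr fun γ => ?_
      congr 1
      group
    simp only [this]
    rw [lintegral_tsum]
    intro γ
    exact (measurable_bump.mul (measurable_bump.comp ((measurable_const_mul _).mul_const _))).aemeasurable
  · intro g
    show dens μ p η a g * dens μ p η 1 (h⁻¹ • (g : SLR d ⧸ latt d p)) = _
    rw [dens_mk, ← ENNReal.tsum_mul_right]
    refine tsum_congr fun γ => ?_
    congr 2
    show h⁻¹ • (g : SLR d ⧸ latt d p) = h⁻¹ • ((g * γ : SLR d) : SLR d ⧸ latt d p)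
    congr 1
    rw [QuotientGroup.eq]
    simp

theorem setLIntegral_dens (hd : 2 ≤ d) (hE : IsFundamentalDomain (latt d p).op E μ) (a : SLR d) (T : ℝ) :
    ∫⁻ h in {g : SLR d | phi g ≤ T}, ∫⁻ y, dens μ p η a y * dens μ p η 1 (h⁻¹ • y) ∂(quotMeasure (latt d p) μ E) ∂μ =
    ∑' γ : latt d p, smooth μ η T (a * γ) := by
  haveI := SLR.isMulRightInvariant hd μ
  haveI := SLR.isInvInvariant hd μ
  simp only [lintegral_dens_mul hd hE]
  rw [lintegral_tsum]
  swap
  · intro γ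
    refine Measurable.aemeasurable ?_
    refine Measurable.lintegral_prod_right' (f := fun q : SLR d × SLR d => bump μ η q.2 * bump μ η (q.1⁻¹ * q.2 * (a * γ))) ?_
    exact (measurable_bump.comp measurable_snd).mul (measurable_bump.comp ((measurable_fst.inv.mul measurable_snd).mul_const _))
  refine tsum_congr fun γ => ?_
  set x := a * (γ : SLR d)
  rw [← lintegral_indicator (measurableSet_phi_le T)]
  have h1 : ∀ h : SLR d, {g : SLR d | phi g ≤ T}.indicator (fun h => ∫⁻ g, bump μ η g * bump μ η (h⁻¹ * g * x) ∂μ) h =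
     ∫⁻ g, {g : SLR d | phi g ≤ T}.indicator 1 h * (bump μ η g * bump μ η (h⁻¹ * g * x)) ∂μ := by
    intro h
    by_cases hh : h ∈ {g : SLR d | phi g ≤ T}
    · rw [Set.indicator_of_mem hh]; simp only [Set.indicator_of_mem hh]; simp
    · rw [Set.indicator_of_notMem hh]; simp only [Set.indicator_of_notMem hh]; simp
  simp only [h1]
  have hmi : Measurable ({g : SLR d | phi g ≤ T}.indicator (1 : SLR d → ENNReal)) :=
    measurable_one.indicator (measurableSet_phi_le T)
  rw [lintegral_lintegral_swap]
  swap
  · refine Measurable.aemeasurable ?_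
    exact (hmi.comp measurable_fst).mul ((measurable_bump.comp measurable_snd).mul
      (measurable_bump.comp ((measurable_fst.inv.mul measurable_snd).mul_const _)))
  rw [smooth]
  refine lintegral_congr fun g => ?_
  have hmp : MeasurePreserving (fun u : SLR d => g * x * u⁻¹) μ μ :=
    (measurePreserving_mul_left μ (g * x)).comp (Measure.measurePreserving_inv μ)
  rw [← hmp.lintegral_comp]
  · rw [← lintegral_const_mul]
    · refine lintegral_congr fun u => ?_
      have : (g * x * u⁻¹)⁻¹ * g * x = u := by group
      rw [this]
      ring
    · exact measurable_bump.mul (hmi.comp (measurable_inv.const_mul _))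
  · exact hmi.mul ((measurable_bump.comp ((measurable_inv.mul_const _).mul_const _)).const_mul _)

end density

section sandwich
variable {d : ℕ} {μ : Measure (SLR d)} [μ.IsHaarMeasure] {η : ℝ} {p : ℕ} {E : Set (SLR d)}

theorem dens_isBddDensity (hd : 2 ≤ d) (hE : IsFundamentalDomain (latt d p).op E μ) (hη : 0 < η)
    (β : Matrix.SpecialLinearGroup (Fin d) ℤ) :
    IsBddDensity (quotMeasure (latt d p) μ E) (densBd μ η) (fun y => (dens μ p η (toSLR β) y).toReal) := by
  have hitg : ∫⁻ y, dens μ p η (toSLR β) y ∂(quotMeasure (latt d p) μ E) = 1 := lintegral_dens hd hE hη _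
  refine ⟨(measurable_dens _).ennreal_toReal, fun _ => ENNReal.toReal_nonneg, fun y => ?_, ?_, ?_⟩
  · exact ENNReal.toReal_le_of_le_ofReal densBd_nonneg (dens_le hη β y)
  · apply integrable_toReal_of_lintegral_ne_top (measurable_dens _).aemeasurable
    rw [hitg]; simp
  · rw [integral_toReal (measurable_dens _).aemeasurable, hitg]
    · simp
    · exact Filter.Eventually.of_forall fun y => (dens_le hη β y).trans_lt ENNReal.ofReal_lt_top

theorem cnt_sandwich (hd : 2 ≤ d) {F₀ : Set (SLR d)} (hF₀ : IsFundamentalDomain (toSLR (d := d)).range F₀ μ)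
    (hp : p.Prime) (γ : Matrix.SpecialLinearGroup (Fin d) ℤ) (hη : 0 < η) :
    ∃ φ : SLR d → ℝ, Continuous φ ∧ (∀ h, |φ h| ≤ densBd μ η) ∧
      (3 ≤ d → ∀ h, |φ h| ≤ 63 * Real.exp (-(phi h / √d) / 6) * densBd μ η) ∧
      (d = 2 → ∀ ε > 0, ∃ T₀, ∀ h, T₀ ≤ phi h → |φ h| ≤ ε) ∧
      ∀ T, cnt d p γ (T - 2 * √d * η) ≤
          vol μ T * (1 / ((congSubgroup d p).index * (μ F₀).toReal)) + ∫ h in {g : SLR d | phi g ≤ T}, φ h ∂μ ∧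
        vol μ T * (1 / ((congSubgroup d p).index * (μ F₀).toReal)) + ∫ h in {g : SLR d | phi g ≤ T}, φ h ∂μ ≤
         cnt d p γ (T + 2 * √d * η) := by
  haveI : NeZero p := ⟨hp.ne_zero⟩
  haveI := SLR.isMulRightInvariant hd μ
  have hE := cosetDom_isFundamentalDomain hd hF₀ p
  set m := quotMeasure (latt d p) μ (cosetDom p F₀) with hm
  haveI : SMulInvariantMeasure (SLR d) (SLR d ⧸ latt d p) m := quotMeasure_smulInvariant hE
  haveI : IsLocallyFiniteMeasure m := quotMeasure_locallyFinite hE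
  have hmu : m Set.univ = (congSubgroup d p).index * μ F₀ := by
    rw [hm, quotMeasure_univ, measure_cosetDom hd hF₀ p]
  set c₀ : ℝ := 1 / ((congSubgroup d p).index * (μ F₀).toReal) with hc₀
  have hc : ((m Set.univ).toReal)⁻¹ = c₀ := by
    rw [hmu, hc₀, ENNReal.toReal_mul, one_div]; simp
  set B := densBd (d := d) μ η with hB
  have hf1 := dens_isBddDensity (μ := μ) (p := p) hd hE hη 1
  have hfa := dens_isBddDensity (μ := μ) (p := p) hd hE hη γ
  rw [← hm] at hf1 hfa
  set v := hf1.memLp_sub.toLp _ with hv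
  set w := hfa.memLp_sub.toLp _ with hw
  set φ : SLR d → ℝ := fun h => inner ℝ w (koop m h v) with hφ
  have hφe : ∀ h, φ h = ∫ y, (dens μ p η (toSLR γ) y).toReal * (dens μ p η (toSLR 1) (h⁻¹ • y)).toReal ∂m - c₀ := by
    intro h
    rw [← hc]
    exact hf1.inner_koop hfa h
  have hcont : Continuous φ := continuous_const.inner (continuous_koop m v)
  have hvB : ‖v‖ ^ 2 ≤ B := hf1.norm_le
  have hwB : ‖w‖ ^ 2 ≤ B := hfa.norm_le
  have hvw : ‖w‖ * ‖v‖ ≤ B := by nlinarith [sq_nonneg (‖w‖ - ‖v‖)]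
  have hK : ∀ β : Matrix.SpecialLinearGroup (Fin d) ℤ, ∀ hf : MemLp (fun y => (dens μ p η (toSLR β) y).toReal - ((m Set.univ).toReal)⁻¹) 2 m,
      ∀ k ∈ Kd d, koop m k (hf.toLp _) = hf.toLp _ := by
    intro β hf k hk
    apply koop_fix_of_invariant
    intro y
    rw [dens_smul _ (inv_mem hk)]
  have h0 : ∀ u, (∀ g : SLR d, koop m g u = u) → inner ℝ u v = 0 := by
    intro u hu
    refine koop_orth (G := SLR d) m inferInstance μ (fun y N hN h => quotMeasure_null hE y N hN h) hf1.memLp_sub (fun h => hf1.integral_sub h) u hu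
  have hpos : ∀ h, 0 ≤ φ h + c₀ := by
    intro h
    rw [hφe, sub_add_cancel]
    positivity
  have hlin : ∀ h : SLR d, ENNReal.ofReal (φ h + c₀) = ∫⁻ y, dens μ p η (toSLR γ) y * dens μ p η 1 (h⁻¹ • y) ∂m := by
    intro h
    rw [hφe, sub_add_cancel, map_one, ofReal_integral_eq_lintegral_ofReal]
    · refine lintegral_congr fun y => ?_
      rw [ENNReal.ofReal_mul ENNReal.toReal_nonneg, ENNReal.ofReal_toReal, ENNReal.ofReal_toReal]
      · have := dens_le (μ := μ) (p := p) hη 1 (h⁻¹ • y)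
        rw [map_one] at this
        exact ne_top_of_le_ne_top ENNReal.ofReal_ne_top this
      · exact ne_top_of_le_ne_top ENNReal.ofReal_ne_top (dens_le (μ := μ) (p := p) hη γ y)
    · have := hfa.memLp.integrable_mul (hf1.smul h⁻¹).memLp
      rw [map_one] at this
      exact this
    · exact Filter.Eventually.of_forall fun y => by positivity
  refine ⟨φ, hcont, ?_, ?_, ?_, ?_⟩
  · intro h
    exact (rep_inner_le _ _ _ _).trans hvw
  · intro h3 h
    refine (rep_decay h3 (continuous_koop m) (hK 1 hf1.memLp_sub) (hK γ hfa.memLp_sub) h0 h).trans ?_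
    gcongr
  · rintro rfl ε hε
    exact mixing2 (continuous_koop m) (hK 1 hf1.memLp_sub) (hK γ hfa.memLp_sub) h0 hε
  · intro T
    set D := {g : SLR d | phi g ≤ T} with hD
    have hDint : IntegrableOn φ D μ := hcont.continuousOn.integrableOn_compact (isCompact_phi_le T)
    have hDc : IntegrableOn (fun _ => c₀) D μ := integrableOn_const (measure_ball_ne_top μ T)
    have h1 : vol μ T * c₀ + ∫ h in D, φ h ∂μ = ∫ h in D, (φ h + c₀) ∂μ := by
      rw [integral_add hDint hDc, setIntegral_const, add_comm]
      rfl
    have h2 : ENNReal.ofReal (vol μ T * c₀ + ∫ h in D, φ h ∂μ) = ∑' l : latt d p, smooth μ η T (toSLR γ * l) := by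
      rw [h1, ofReal_integral_eq_lintegral_ofReal (f := fun h => φ h + c₀) (hDint.add hDc) (Filter.Eventually.of_forall fun h => hpos h),
        ← setLIntegral_dens hd hE]
      refine lintegral_congr fun h => hlin h
    have h3 : 0 ≤ vol μ T * c₀ + ∫ h in D, φ h ∂μ := by
      rw [h1]
      exact integral_nonneg fun h => hpos h
    constructor
    · rw [← ENNReal.ofReal_le_ofReal_iff h3, h2, ← tsum_indicator_cnt]
      exact ENNReal.tsum_le_tsum fun l => le_smooth hη T _
    · rw [← ENNReal.ofReal_le_ofReal_iff (by unfold cnt; positivity), h2, ← tsum_indicator_cnt]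
      exact ENNReal.tsum_le_tsum fun l => smooth_le hη T _

end sandwich

section volume
variable {d : ℕ}

theorem phi_inv_mul_le {A B : SLR d} {r : ℝ} (hA : phi A ≤ r) (hB : phi B ≤ r) :
    phi (A⁻¹ * B) ≤ √d * (Real.exp r * ‖(A : Matrix (Fin d) (Fin d) ℝ) - B‖) := by
  have key : ∀ A B : SLR d, phi A ≤ r → ‖((A⁻¹ * B : SLR d) : Matrix (Fin d) (Fin d) ℝ) - 1‖ ≤
      Real.exp r * ‖(A : Matrix (Fin d) (Fin d) ℝ) - B‖ := by
    intro A B hA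
    have : ((A⁻¹ * B : SLR d) : Matrix (Fin d) (Fin d) ℝ) - 1 =
       ((A⁻¹ : SLR d) : Matrix (Fin d) (Fin d) ℝ) * ((B : Matrix (Fin d) (Fin d) ℝ) - A) := by
      rw [mul_sub, ← SLR.val_mul, ← SLR.val_mul, inv_mul_cancel]; rfl
    rw [this, norm_sub_rev]
    refine (norm_mul_le _ _).trans ?_
    gcongr
    refine (norm_le_exp_phi _).trans (Real.exp_le_exp.2 ?_)
    rwa [phi_inv]
  refine phi_le_norm_sub_one (key A B hA) ?_
  have := key B A hB
  rw [_root_.mul_inv_rev, inv_inv, norm_sub_rev (A : Matrix (Fin d) (Fin d) ℝ)]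
  exact this

/-- A one parameter group conjugate into the diagonal group. -/
noncomputable def conjDg (k : SLR d) (y : Fin d → ℝ) (s : ℝ) : SLR d := k⁻¹ * dg (s • y) * k

theorem conjDg_add (k : SLR d) (y : Fin d → ℝ) (s t : ℝ) : conjDg k y (s + t) = conjDg k y s * conjDg k y t := by
  rw [conjDg, conjDg, conjDg, add_smul, dg_add]; group

theorem phi_conjDg {k : SLR d} (hk : k ∈ Kd d) {y : Fin d → ℝ} (hy : ∑ i, y i = 0) (s : ℝ) :
    phi (conjDg k y s) = |s| * en y := by
  rw [conjDg, phi_mul_right hk, phi_mul_left (inv_mem hk), phi_dg, en_smul]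
  simp [← Finset.mul_sum, hy]

theorem norm_Kd_le {k : SLR d} (hk : k ∈ Kd d) : ‖(k : Matrix (Fin d) (Fin d) ℝ)‖ ≤ 1 := by
  have := norm_le_exp_phi k
  rwa [phi_of_mem_Kd hk, Real.exp_zero] at this

theorem norm_conjDg_sub_le {k k' : SLR d} (hk : k ∈ Kd d) (hk' : k' ∈ Kd d) {y y' : Fin d → ℝ}
    (hy : ∑ i, y i = 0) (hy' : ∑ i, y' i = 0) (hy1 : en y ≤ 1) (hy1' : en y' ≤ 1) {δ s : ℝ} (hs : 0 ≤ s) (hs1 : s ≤ 1)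
    (hkk : ‖(k : Matrix (Fin d) (Fin d) ℝ) - k'‖ ≤ δ) (hyy : ‖y - y'‖ ≤ δ) :
    ‖(conjDg k y s : Matrix (Fin d) (Fin d) ℝ) - conjDg k' y' s‖ ≤ 10 * (s * δ) := by
  have hδ : 0 ≤ δ := (norm_nonneg _).trans hyy
  have hv : ∀ {z : Fin d → ℝ}, ∑ i, z i = 0 → (dg (s • z) : Matrix (Fin d) (Fin d) ℝ) = diagonal fun i => Real.exp (s * z i) := by
    intro z hz
    rw [dg_val_of_sum]
    · rfl
    · simp [← Finset.mul_sum, hz]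
  set D := (dg (s • y) : Matrix (Fin d) (Fin d) ℝ) - 1 with hD
  set D' := (dg (s • y') : Matrix (Fin d) (Fin d) ℝ) - 1 with hD'
  have hsy : ∀ {z : Fin d → ℝ}, en z ≤ 1 → ∀ i, |s * z i| ≤ s := by
    intro z hz i
    rw [abs_mul, abs_of_nonneg hs]
    have := (abs_apply_le_en z i).trans hz
    nlinarith
  have hDn : ‖D'‖ ≤ 2 * s := by
    rw [hD', hv hy', ← diagonal_one, diagonal_sub, Matrix.l2_opNorm_diagonal]
    refine (pi_norm_le_iff_of_nonneg (by positivity)).2 fun i => ?_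
    have := hsy hy1' i
    refine (Real.abs_exp_sub_one_le (this.trans hs1)).trans ?_
    linarith
  have hDD : ‖D - D'‖ ≤ 6 * (s * δ) := by
    rw [hD, hD', sub_sub_sub_cancel_right, hv hy, hv hy', diagonal_sub, Matrix.l2_opNorm_diagonal]
    refine (pi_norm_le_iff_of_nonneg (by positivity)).2 fun i => ?_
    show |Real.exp (s * y i) - Real.exp (s * y' i)| ≤ _
    have e1 : Real.exp (s * y i) - Real.exp (s * y' i) = Real.exp (s * y' i) * (Real.exp (s * (y i - y' i)) - 1) := by
      rw [mul_sub, mul_one, ← Real.exp_add]; ring_nf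
    have h1 : |y i - y' i| ≤ δ := (norm_le_pi_norm (y - y') i).trans hyy
    have h2 := abs_le.1 (hsy hy1 i)
    have h3 := abs_le.1 (hsy hy1' i)
    have h4 : Real.exp (s * y' i) ≤ 3 :=
      (Real.exp_le_exp.2 (h3.2.trans hs1)).trans Real.exp_one_lt_three.le
    by_cases h5 : |s * (y i - y' i)| ≤ 1
    · rw [e1, abs_mul, abs_of_pos (Real.exp_pos _)]
      have h6 := Real.abs_exp_sub_one_le h5
      rw [abs_mul, abs_of_nonneg hs] at h6
      have h7 : s * |y i - y' i| ≤ s * δ := mul_le_mul_of_nonneg_left h1 hs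
      nlinarith [abs_nonneg (Real.exp (s * (y i - y' i)) - 1), Real.exp_pos (s * y' i)]
    · push Not at h5
      have h4' : Real.exp (s * y i) ≤ 3 :=
        (Real.exp_le_exp.2 (h2.2.trans hs1)).trans Real.exp_one_lt_three.le
      rw [abs_mul, abs_of_nonneg hs] at h5
      have h7 : s * |y i - y' i| ≤ s * δ := mul_le_mul_of_nonneg_left h1 hs
      rw [abs_le]
      constructor <;> nlinarith [Real.exp_pos (s * y i), Real.exp_pos (s * y' i)]
  have hki : ‖((k⁻¹ : SLR d) : Matrix (Fin d) (Fin d) ℝ) - (k'⁻¹ : SLR d)‖ ≤ δ := by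
    have : ((k⁻¹ : SLR d) : Matrix (Fin d) (Fin d) ℝ) - (k'⁻¹ : SLR d) =
      ((k⁻¹ : SLR d) : Matrix (Fin d) (Fin d) ℝ) * ((k' : Matrix (Fin d) (Fin d) ℝ) - k) * (k'⁻¹ : SLR d) := by
      rw [mul_sub, sub_mul, ← SLR.val_mul, ← SLR.val_mul, ← SLR.val_mul, ← SLR.val_mul, mul_inv_cancel_right,
        inv_mul_cancel, one_mul]
    rw [this]
    refine (norm_mul_le _ _).trans ?_
    have h1 := norm_Kd_le (inv_mem hk')
    have h2 := norm_mul_le ((k⁻¹ : SLR d) : Matrix (Fin d) (Fin d) ℝ) ((k' : Matrix (Fin d) (Fin d) ℝ) - k)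
    have h3 := norm_Kd_le (inv_mem hk)
    rw [norm_sub_rev (k' : Matrix (Fin d) (Fin d) ℝ)] at h2
    nlinarith [norm_nonneg (((k⁻¹ : SLR d) : Matrix (Fin d) (Fin d) ℝ) * ((k' : Matrix (Fin d) (Fin d) ℝ) - k)),
      norm_nonneg ((k : Matrix (Fin d) (Fin d) ℝ) - k')]
  have e2 : ∀ (k : SLR d) (y : Fin d → ℝ), (conjDg k y s : Matrix (Fin d) (Fin d) ℝ) = 1 +
      ((k⁻¹ : SLR d) : Matrix (Fin d) (Fin d) ℝ) * ((dg (s • y) : Matrix (Fin d) (Fin d) ℝ) - 1) * k := by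
    intro k y
    rw [conjDg, mul_sub, sub_mul, mul_one, ← SLR.val_mul, ← SLR.val_mul, ← SLR.val_mul, inv_mul_cancel]
    show _ = 1 + (_ - 1)
    abel
  have e3 : (conjDg k y s : Matrix (Fin d) (Fin d) ℝ) - conjDg k' y' s =
     ((k⁻¹ : SLR d) : Matrix (Fin d) (Fin d) ℝ) * (D - D') * k +
      (((k⁻¹ : SLR d) : Matrix (Fin d) (Fin d) ℝ) - (k'⁻¹ : SLR d)) * D' * k +
       ((k'⁻¹ : SLR d) : Matrix (Fin d) (Fin d) ℝ) * D' * ((k : Matrix (Fin d) (Fin d) ℝ) - k') := by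
    rw [e2, e2, ← hD, ← hD']; noncomm_ring
  have tri : ∀ (A B C : Matrix (Fin d) (Fin d) ℝ) (a b c : ℝ), ‖A‖ ≤ a → ‖B‖ ≤ b → ‖C‖ ≤ c → ‖A * B * C‖ ≤ a * b * c := by
    intro A B C a b c ha hb hc
    refine (norm_mul_le _ _).trans (mul_le_mul ((norm_mul_le _ _).trans ?_) hc (norm_nonneg _) ?_)
    · exact mul_le_mul ha hb (norm_nonneg _) ((norm_nonneg _).trans ha)
    · exact mul_nonneg ((norm_nonneg _).trans ha) ((norm_nonneg _).trans hb)
  rw [e3]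
  refine (norm_add_le _ _).trans ((add_le_add (norm_add_le _ _) le_rfl).trans ?_)
  have t1 := tri _ _ _ _ _ _ (norm_Kd_le (inv_mem hk)) hDD (norm_Kd_le hk)
  have t2 := tri _ _ _ _ _ _ hki hDn (norm_Kd_le hk)
  have t3 := tri _ _ _ _ _ _ (norm_Kd_le (inv_mem hk')) hDn hkk
  linarith

theorem isCompact_Kd : IsCompact (Kd d : Set (SLR d)) := by
  refine (isCompact_phi_le (d := d) 0).of_isClosed_subset ?_ fun k hk => (phi_of_mem_Kd hk).le
  have : (Kd d : Set (SLR d)) = {g : SLR d | (g : Matrix (Fin d) (Fin d) ℝ)ᵀ * g = 1} := by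
    ext g; exact mem_Kd
  rw [this]
  refine isClosed_eq ?_ continuous_const
  exact (SLR.continuous_val.matrix_transpose).mul SLR.continuous_val

theorem phi_mul_conjDg_le {g k₁ k' k : SLR d} {x y : Fin d → ℝ} (hx : ∑ i, x i = 0)
    (hk₁ : k₁ ∈ Kd d) (hk' : k' ∈ Kd d) (hg : g = k₁ * dg x * k') (hk : k ∈ Kd d) (hy : ∑ i, y i = 0) (hy1 : en y ≤ 1)
    (hx2 : 1 / 2 ≤ en x) (hd : 0 < d)
    (hkk : ‖(k' : Matrix (Fin d) (Fin d) ℝ) - k‖ ≤ 1 / (60 * d))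
    (hyy : ‖-(en x)⁻¹ • x - y‖ ≤ 1 / (60 * d)) {s : ℝ} (hs : 0 ≤ s) (hs1 : s ≤ 1 / 2) :
    phi (g * conjDg k y s) ≤ phi g - s / 2 := by
  set z := -(en x)⁻¹ • x with hz
  have hx0 : 0 < en x := by linarith
  have hz0 : ∑ i, z i = 0 := by simp [hz, ← Finset.mul_sum, hx]
  have hz1 : en z = 1 := by
    rw [hz, en_smul, abs_neg, abs_of_pos (inv_pos.2 hx0)]; field_simp
  have hphig : phi g = en x := by rw [hg, phi_mul_right hk', phi_mul_left hk₁, phi_dg hx]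
  have h1 : phi (g * conjDg k' z s) = en x - s := by
    have : g * conjDg k' z s = k₁ * dg (x + s • z) * k' := by
      rw [hg, conjDg, dg_add]; group
    rw [this, phi_mul_right hk', phi_mul_left hk₁, phi_dg]
    · have : x + s • z = (1 - s * (en x)⁻¹) • x := by
        rw [hz, smul_smul, sub_smul, one_smul]; simp; abel
      rw [this, en_smul, abs_of_nonneg, sub_mul, one_mul, mul_assoc, inv_mul_cancel₀ hx0.ne', mul_one]
      rw [sub_nonneg, ← div_eq_mul_inv, div_le_one hx0]; linarith
    · simp [Finset.sum_add_distrib, ← Finset.mul_sum, hx, hz0]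
  have h2 : g * conjDg k y s = (g * conjDg k' z s) * ((conjDg k' z s)⁻¹ * conjDg k y s) := by group
  have h3 := phi_mul_le (g * conjDg k' z s) ((conjDg k' z s)⁻¹ * conjDg k y s)
  rw [← h2, h1] at h3
  have h4 : phi ((conjDg k' z s)⁻¹ * conjDg k y s) ≤ √d * (Real.exp (1/2) * (10 * (s * (1 / (60 * d))))) := by
    refine (phi_inv_mul_le (r := 1/2) ?_ ?_).trans ?_
    · rw [phi_conjDg hk' hz0, hz1, abs_of_nonneg hs]; linarith
    · rw [phi_conjDg hk hy, abs_of_nonneg hs]; nlinarith [en_nonneg y]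
    · gcongr
      exact norm_conjDg_sub_le hk' hk hz0 hy hz1.le hy1 hs (by linarith) hkk hyy
  have h5 : √(d:ℝ) * (√d * (Real.exp (1/2) * (10 * (s * (1 / (60 * d)))))) = Real.exp (1/2) * s / 6 := by
    rw [← mul_assoc, Real.mul_self_sqrt (by positivity)]
    have : (d:ℝ) ≠ 0 := by positivity
    field_simp; ring
  have h6 : Real.exp (1/2) ≤ 3 := (Real.exp_le_exp.2 (by norm_num)).trans Real.exp_one_lt_three.le
  have h7 := mul_le_mul_of_nonneg_left h4 (Real.sqrt_nonneg (d:ℝ))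
  rw [h5] at h7
  rw [hphig]
  nlinarith

/-- A finite set of one parameter groups such that every group element of radius at least `1/2`
can be moved inwards by one of them. -/
theorem exists_directions (hd : 0 < d) : ∃ t : Finset (SLR d × (Fin d → ℝ)), ∀ g : SLR d, 1 / 2 ≤ phi g →
    ∃ q ∈ t, ∀ s : ℝ, 0 ≤ s → s ≤ 1 / 2 → phi (g * conjDg q.1 q.2 s) ≤ phi g - s / 2 := by
  set Y := {y : Fin d → ℝ | ∑ i, y i = 0 ∧ en y ≤ 1}
  have hYc : IsCompact Y := by
    refine (isCompact_closedBall (0 : Fin d → ℝ) 1).of_isClosed_subset ?_ ?_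
    · have h1 : IsClosed {y : Fin d → ℝ | en y ≤ 1} := by
        refine isClosed_le ?_ continuous_const
        unfold en
        fun_prop
      exact IsClosed.inter (isClosed_eq (by fun_prop) continuous_const) h1
    · rintro y ⟨_, hy⟩
      rw [mem_closedBall_zero_iff]
      exact (pi_norm_le_iff_of_nonneg zero_le_one).2 fun i => (abs_apply_le_en y i).trans hy
  set P : Set (Matrix (Fin d) (Fin d) ℝ × (Fin d → ℝ)) := ((fun g : SLR d => (g : Matrix (Fin d) (Fin d) ℝ)) '' (Kd d : Set (SLR d))) ×ˢ Y
  have hP : IsCompact P := (isCompact_Kd.image SLR.continuous_val).prod hYc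
  have hδ : (0:ℝ) < 1 / (60 * d) := by positivity
  obtain ⟨t, htP, htf, ht⟩ := hP.finite_cover_balls hδ
  have hsel : ∀ q ∈ t, ∃ k ∈ Kd d, (k : Matrix (Fin d) (Fin d) ℝ) = q.1 := fun q hq => (htP hq).1
  choose! K hK hKe using hsel
  refine ⟨htf.toFinset.image fun q => (K q, q.2), fun g hg => ?_⟩
  obtain ⟨x, -, hx0, hgx, k₁, hk₁, k', hk', rfl⟩ := exists_kak g
  rw [hgx] at hg
  have hx' : 0 < en x := by linarith
  have hmem : ((k' : Matrix (Fin d) (Fin d) ℝ), -(en x)⁻¹ • x) ∈ P := by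
    refine ⟨⟨k', hk', rfl⟩, ?_, ?_⟩
    · simp [← Finset.mul_sum, hx0]
    · show en (-(en x)⁻¹ • x) ≤ 1
      rw [en_smul, abs_neg, abs_of_pos (inv_pos.2 hx'), inv_mul_cancel₀ hx'.ne']
  obtain ⟨q, hq, hball⟩ := Set.mem_iUnion₂.1 (ht hmem)
  refine ⟨(K q, q.2), Finset.mem_image.2 ⟨q, htf.mem_toFinset.2 hq, rfl⟩, fun s hs hs1 => ?_⟩
  rw [Metric.mem_ball, dist_eq_norm, Prod.norm_def, max_lt_iff] at hball
  refine phi_mul_conjDg_le hx0 hk₁ hk' rfl (hK q hq) (htP hq).2.1 (htP hq).2.2 hg hd ?_ ?_ hs hs1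
  · rw [hKe q hq]; exact hball.1.le
  · exact hball.2.le

end volume

section volume
variable {d : ℕ} (μ : Measure (SLR d)) [μ.IsHaarMeasure]

theorem vol_nonneg (t : ℝ) : 0 ≤ vol μ t := ENNReal.toReal_nonneg

theorem shell_piece_le [μ.IsMulRightInvariant] (q : SLR d × (Fin d → ℝ)) {t η : ℝ} (hη : 0 < η) (J : ℕ)
    (hJ : 4 * η * J ≤ 1) :
    J * (μ {g : SLR d | (t < phi g ∧ phi g ≤ t + η) ∧
      ∀ s : ℝ, 0 ≤ s → s ≤ 1 / 2 → phi (g * conjDg q.1 q.2 s) ≤ phi g - s / 2}) ≤ μ {g : SLR d | phi g ≤ t} := by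
  set S := {g : SLR d | (t < phi g ∧ phi g ≤ t + η) ∧
      ∀ s : ℝ, 0 ≤ s → s ≤ 1 / 2 → phi (g * conjDg q.1 q.2 s) ≤ phi g - s / 2} with hS
  have hSm : MeasurableSet S := by
    have h1 : MeasurableSet {g : SLR d | t < phi g ∧ phi g ≤ t + η} :=
      (measurableSet_lt measurable_const continuous_phi.measurable).inter (measurableSet_phi_le _)
    have h2 : IsClosed {g : SLR d | ∀ s : ℝ, 0 ≤ s → s ≤ 1 / 2 → phi (g * conjDg q.1 q.2 s) ≤ phi g - s / 2} := by
      simp only [Set.setOf_forall]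
      refine isClosed_iInter fun s => isClosed_iInter fun _ => isClosed_iInter fun _ => ?_
      exact isClosed_le (continuous_phi.comp (continuous_mul_const _)) (continuous_phi.sub continuous_const)
    exact h1.inter h2.measurableSet
  set r : ℕ → SLR d := fun j => conjDg q.1 q.2 (2 * η * (j + 1)) with hr
  set T : ℕ → Set (SLR d) := fun j => (fun g => g * (r j)⁻¹) ⁻¹' S with hT
  have hTm : ∀ j, MeasurableSet (T j) := fun j => measurable_mul_const _ hSm
  have hbd : ∀ j ∈ Finset.range J, 2 * η * ((j:ℝ) + 1) ≤ 1 / 2 := by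
    intro j hj
    have : (j:ℝ) + 1 ≤ J := by exact_mod_cast Finset.mem_range.1 hj
    nlinarith
  have hlt : ∀ i j : ℕ, j ∈ Finset.range J → i < j → Disjoint (T i) (T j) := by
    intro i j hj hij
    rw [Set.disjoint_left]
    intro g hgi hgj
    have hgi' : g * (r i)⁻¹ ∈ S := hgi
    have hgj' : g * (r j)⁻¹ ∈ S := hgj
    have hij' : (i:ℝ) + 1 ≤ j := by exact_mod_cast hij
    have hb := hbd j hj
    have e : r j = conjDg q.1 q.2 (2 * η * (j - i)) * r i := by
      rw [hr]; simp only; rw [← conjDg_add]; congr 1; ring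
    have := hgj'.2 (2 * η * (j - i)) (by nlinarith) (by nlinarith [Nat.cast_nonneg (α := ℝ) i])
    have e2 : g * (r j)⁻¹ * conjDg q.1 q.2 (2 * η * (j - i)) = g * (r i)⁻¹ := by
      rw [e]; group
    rw [e2] at this
    have h1 := hgi'.1.1
    have h2 := hgj'.1.2
    nlinarith
  have hdisj : Set.PairwiseDisjoint (↑(Finset.range J)) T := by
    intro i hi j hj hij
    rcases lt_or_gt_of_ne hij with h | h
    · exact hlt i j hj h
    · exact (hlt j i hi h).symm
  have hsub : (⋃ j ∈ Finset.range J, T j) ⊆ {g : SLR d | phi g ≤ t} := by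
    intro g hg
    obtain ⟨j, hj, hgj⟩ := Set.mem_iUnion₂.1 hg
    have hgj' : g * (r j)⁻¹ ∈ S := hgj
    have := hgj'.2 (2 * η * (j + 1)) (by positivity) (hbd j hj)
    have e2 : g * (r j)⁻¹ * conjDg q.1 q.2 (2 * η * (j + 1)) = g := by
      rw [hr]; simp
    rw [e2] at this
    have h2 := hgj'.1.2
    show phi g ≤ t
    nlinarith [Nat.cast_nonneg (α := ℝ) j]
  have := measure_mono (μ := μ) hsub
  rw [measure_biUnion_finset hdisj fun j _ => hTm j] at this
  refine le_trans (le_of_eq ?_) this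
  have h3 : ∀ j ∈ Finset.range J, μ (T j) = μ S := fun j _ => measure_preimage_mul_right μ _ _
  rw [Finset.sum_congr rfl h3]
  simp

theorem vol_add_le (hd : 2 ≤ d) : ∃ C : ℝ, 0 < C ∧ ∀ t η : ℝ, 1 / 2 ≤ t → 0 < η → η ≤ 1 / 8 →
    vol μ (t + η) ≤ (1 + C * η) * vol μ t := by
  haveI := SLR.isMulRightInvariant hd μ
  obtain ⟨dirs, hdirs⟩ := exists_directions (d := d) (by omega)
  refine ⟨8 * (dirs.card + 1), by positivity, fun t η ht hη hη8 => ?_⟩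
  set S : SLR d × (Fin d → ℝ) → Set (SLR d) := fun q => {g : SLR d | (t < phi g ∧ phi g ≤ t + η) ∧
      ∀ s : ℝ, 0 ≤ s → s ≤ 1 / 2 → phi (g * conjDg q.1 q.2 s) ≤ phi g - s / 2}
  set J := ⌊1 / (4 * η)⌋₊ with hJ
  have hJ1 : (J:ℝ) ≤ 1 / (4 * η) := Nat.floor_le (by positivity)
  have hJ2 : 1 / (4 * η) < J + 1 := Nat.lt_floor_add_one _
  have hJ3 : 4 * η * J ≤ 1 := by
    rw [le_div_iff₀ (by positivity)] at hJ1; linarith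
  have hJ4 : 1 ≤ 8 * η * J := by
    rw [div_lt_iff₀ (by positivity)] at hJ2; nlinarith
  have hfin : ∀ q, μ (S q) ≠ ⊤ := fun q =>
    ne_top_of_le_ne_top (measure_ball_ne_top μ (t + η)) (measure_mono fun g hg => hg.1.2)
  have hpiece : ∀ q, (μ (S q)).toReal ≤ 8 * η * vol μ t := by
    intro q
    have := ENNReal.toReal_mono (measure_ball_ne_top μ t) (shell_piece_le μ q (t := t) hη J hJ3)
    rw [ENNReal.toReal_mul, ENNReal.toReal_natCast] at this
    have h2 : 8 * η * (J * (μ (S q)).toReal) ≤ 8 * η * vol μ t := by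
      have : (J * (μ (S q)).toReal) ≤ vol μ t := this
      gcongr
    have h3 : 0 ≤ (μ (S q)).toReal := ENNReal.toReal_nonneg
    nlinarith
  have hcov : {g : SLR d | phi g ≤ t + η} ⊆ {g : SLR d | phi g ≤ t} ∪ ⋃ q ∈ dirs, S q := by
    intro g hg
    by_cases h : phi g ≤ t
    · exact Or.inl h
    · right
      push Not at h
      obtain ⟨q, hq, hq2⟩ := hdirs g (by linarith)
      exact Set.mem_iUnion₂.2 ⟨q, hq, ⟨h, hg⟩, hq2⟩
  have h1 : μ {g : SLR d | phi g ≤ t + η} ≤ μ {g : SLR d | phi g ≤ t} + ∑ q ∈ dirs, μ (S q) :=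
    (measure_mono hcov).trans ((measure_union_le _ _).trans (add_le_add le_rfl (measure_biUnion_finset_le _ _)))
  have hsumfin : ∑ q ∈ dirs, μ (S q) ≠ ⊤ := ENNReal.sum_ne_top.2 fun q _ => hfin q
  have h2 := ENNReal.toReal_mono (ENNReal.add_ne_top.2 ⟨measure_ball_ne_top μ t, hsumfin⟩) h1
  rw [ENNReal.toReal_add (measure_ball_ne_top μ t) hsumfin, ENNReal.toReal_sum fun q _ => hfin q] at h2
  have h3 : ∑ q ∈ dirs, (μ (S q)).toReal ≤ dirs.card * (8 * η * vol μ t) := by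
    rw [← nsmul_eq_mul]
    exact Finset.sum_le_card_nsmul _ _ _ fun q _ => hpiece q
  have h4 : vol μ (t + η) ≤ vol μ t + dirs.card * (8 * η * vol μ t) := h2.trans (add_le_add le_rfl h3)
  have h5 : 0 ≤ η * vol μ t := mul_nonneg hη.le (vol_nonneg μ t)
  nlinarith

theorem exists_norm_le_entries (hd : d ≠ 0) : ∃ C : ℝ, 0 < C ∧ ∀ (M : Matrix (Fin d) (Fin d) ℝ) (δ : ℝ),
    (∀ i j, |M i j| ≤ δ) → ‖M‖ ≤ C * δ := by
  refine ⟨(∑ i : Fin d, ∑ j : Fin d, ‖(Matrix.single i j (1:ℝ) : Matrix (Fin d) (Fin d) ℝ)‖) + 1, by positivity, fun M δ h => ?_⟩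
  have hδ : 0 ≤ δ := (abs_nonneg _).trans (h ⟨0, by omega⟩ ⟨0, by omega⟩)
  rw [add_mul, Finset.sum_mul, one_mul]
  refine le_trans ?_ (le_add_of_nonneg_right hδ)
  conv_lhs => rw [Matrix.matrix_eq_sum_single M]
  refine (norm_sum_le _ _).trans (Finset.sum_le_sum fun i _ => ?_)
  rw [Finset.sum_mul]
  refine (norm_sum_le _ _).trans (Finset.sum_le_sum fun j _ => ?_)
  have : Matrix.single i j (M i j) = M i j • (Matrix.single i j (1:ℝ) : Matrix (Fin d) (Fin d) ℝ) := by
    rw [Matrix.smul_single]; simp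
  rw [this, norm_smul, mul_comm]
  exact mul_le_mul_of_nonneg_left (h i j) (norm_nonneg _)

theorem vol_small_ge (hd : d ≠ 0) : ∃ c : ℝ, 0 < c ∧ ∀ η : ℝ, 0 < η → η ≤ 1 → c * η ^ (d * d) ≤ vol μ η := by
  classical
  set e := Real.exp 1 with he
  have he0 : 0 < e := Real.exp_pos 1
  obtain ⟨C, hC0, hC⟩ := exists_norm_le_entries hd
  have hsd : 0 < √(d:ℝ) := Real.sqrt_pos.2 (by positivity)
  set c₁ : ℝ := 1 / (√d * e * C) with hc₁
  have hc₁0 : 0 < c₁ := by positivity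
  have hv1 := vol_pos μ (t := 1) (d := d) one_pos
  set B : ℝ := 2 * (e / c₁ + 1) + 1 with hB
  have hB0 : 0 < B := by positivity
  refine ⟨vol (d := d) μ 1 / B ^ (d * d), by positivity, fun η hη hη1 => ?_⟩
  set δ := c₁ * η with hδ
  have hδ0 : 0 < δ := by positivity
  set cell : SLR d → (Fin d → Fin d → ℤ) := fun g i j => ⌊(g : Matrix (Fin d) (Fin d) ℝ) i j / δ⌋ with hcell
  set N : ℕ := ⌈e / δ⌉₊ with hN
  set S : Finset (Fin d → Fin d → ℤ) := Fintype.piFinset fun _ => Fintype.piFinset fun _ => Finset.Icc (-(N:ℤ)) N with hS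
  have hcard : (S.card : ℝ) = (2 * N + 1) ^ (d * d) := by
    rw [hS, Fintype.card_piFinset]
    simp only [Fintype.card_piFinset, Int.card_Icc, Finset.prod_const, Finset.card_univ, Fintype.card_fin]
    rw [pow_mul]
    have : ((N:ℤ) + 1 - -(N:ℤ)).toNat = 2 * N + 1 := by omega
    rw [this]; push_cast; rfl
  have hclose : ∀ g h : SLR d, phi g ≤ 1 → phi h ≤ 1 → cell g = cell h → phi (g⁻¹ * h) ≤ η := by
    intro g h hg hh e1
    refine (phi_inv_mul_le hg hh).trans ?_
    have : ‖(g : Matrix (Fin d) (Fin d) ℝ) - h‖ ≤ C * δ := by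
      refine hC _ _ fun i j => ?_
      have e2 : ⌊(g : Matrix (Fin d) (Fin d) ℝ) i j / δ⌋ = ⌊(h : Matrix (Fin d) (Fin d) ℝ) i j / δ⌋ := congrFun (congrFun e1 i) j
      have := (Int.abs_sub_lt_one_of_floor_eq_floor e2).le
      rw [← sub_div, abs_div, abs_of_pos hδ0, div_le_one hδ0] at this
      exact this
    calc _ ≤ √d * (e * (C * δ)) := by gcongr
      _ = η := by rw [hδ, hc₁]; field_simp
  have hmem : ∀ g : SLR d, phi g ≤ 1 → cell g ∈ S := by
    intro g hg
    rw [hS, Fintype.mem_piFinset]; intro i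
    rw [Fintype.mem_piFinset]; intro j
    have h1 : |(g : Matrix (Fin d) (Fin d) ℝ) i j| ≤ e :=
      (abs_entry_le_norm _ i j).trans ((norm_le_exp_phi g).trans (Real.exp_le_exp.2 hg))
    have h2 := abs_le.1 h1
    have h3 : e / δ ≤ N := Nat.le_ceil _
    rw [Finset.mem_Icc, Int.le_floor]
    constructor
    · push_cast
      have : -(e / δ) ≤ (g : Matrix (Fin d) (Fin d) ℝ) i j / δ := by
        rw [← neg_div]; gcongr; exact h2.1
      linarith
    · have : (g : Matrix (Fin d) (Fin d) ℝ) i j / δ ≤ e / δ := by gcongr; exact h2.2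
      have h4 := (Int.floor_le ((g : Matrix (Fin d) (Fin d) ℝ) i j / δ)).trans (this.trans h3)
      exact_mod_cast h4
  have hpiece : ∀ q ∈ S, μ {g : SLR d | phi g ≤ 1 ∧ cell g = q} ≤ μ {g : SLR d | phi g ≤ η} := by
    intro q _
    by_cases hne : ∃ g : SLR d, phi g ≤ 1 ∧ cell g = q
    · obtain ⟨g, hg, hgq⟩ := hne
      rw [← measure_preimage_mul μ g⁻¹ {g : SLR d | phi g ≤ η}]
      exact measure_mono fun h hh => hclose g h hg hh.1 (hgq.trans hh.2.symm)
    · have : {g : SLR d | phi g ≤ 1 ∧ cell g = q} = ∅ := Set.eq_empty_iff_forall_notMem.2 fun g hg => hne ⟨g, hg⟩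
      rw [this]; simp
  have hcov : {g : SLR d | phi g ≤ 1} ⊆ ⋃ q ∈ S, {g : SLR d | phi g ≤ 1 ∧ cell g = q} := fun g hg =>
    Set.mem_iUnion₂.2 ⟨cell g, hmem g hg, hg, rfl⟩
  have h1 : μ {g : SLR d | phi g ≤ 1} ≤ S.card * μ {g : SLR d | phi g ≤ η} := by
    refine (measure_mono hcov).trans ((measure_biUnion_finset_le _ _).trans ?_)
    rw [← nsmul_eq_mul]
    exact Finset.sum_le_card_nsmul _ _ _ hpiece
  have h2 : vol μ 1 ≤ S.card * vol μ η := by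
    have := ENNReal.toReal_mono (ENNReal.mul_ne_top (ENNReal.natCast_ne_top _) (measure_ball_ne_top μ η)) h1
    rwa [ENNReal.toReal_mul, ENNReal.toReal_natCast] at this
  have h3 : (2 * N + 1 : ℝ) ≤ B / η := by
    have : (N:ℝ) < e / δ + 1 := Nat.ceil_lt_add_one (by positivity)
    rw [le_div_iff₀ hη, hB]
    have h5 : e / δ * η = e / c₁ := by rw [hδ]; field_simp
    nlinarith
  rw [hcard] at h2
  have hvη := vol_nonneg (d := d) μ η
  have h4 : vol μ 1 ≤ (B / η) ^ (d * d) * vol μ η := h2.trans (by gcongr)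
  rw [div_pow] at h4
  have hp := pow_pos hη (d * d)
  have hq := pow_pos hB0 (d * d)
  rw [div_mul_eq_mul_div, div_le_iff₀ hq]
  rw [div_mul_eq_mul_div, le_div_iff₀ hp] at h4
  linarith

end volume

section volumeGrowth
variable {d : ℕ}

theorem exists_phi_eq (hd : 2 ≤ d) {s : ℝ} (hs : 0 ≤ s) : ∃ h : SLR d, phi h = s := by
  set i : Fin d := ⟨0, by omega⟩
  set j : Fin d := ⟨1, by omega⟩
  have hij : j ≠ i := by simp [i, j]
  set y : Fin d → ℝ := Pi.single i 1 - Pi.single j 1 with hy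
  have hys : ∑ k, y k = 0 := by simp [hy]
  have hyi : y i = 1 := by simp [hy, hij.symm]
  have h1 : 1 ≤ en y := by have := abs_apply_le_en y i; rwa [hyi, abs_one] at this
  refine ⟨dg ((s / en y) • y), ?_⟩
  rw [phi_dg (by simp [← Finset.mul_sum, hys]), en_smul, abs_of_nonneg (by positivity)]
  field_simp

theorem SLR.noncompactSpace (hd : 2 ≤ d) : NoncompactSpace (SLR d) := by
  refine ⟨fun hc => ?_⟩
  obtain ⟨M, hM⟩ := (hc.image (continuous_phi (d := d))).bddAbove
  obtain ⟨h, hh⟩ := exists_phi_eq hd (s := |M| + 1) (by positivity)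
  have := hM ⟨h, Set.mem_univ _, rfl⟩
  rw [hh] at this
  linarith [le_abs_self M]

variable (μ : Measure (SLR d)) [μ.IsHaarMeasure]

theorem vol_le_exp_mul (hd : 3 ≤ d) (r : ℝ) {s : ℝ} (hs : 0 ≤ s) :
    vol μ r ≤ 63 ^ 2 * Real.exp (-(s / √d) / 3) * vol μ (r + √d * s) := by
  haveI := SLR.isMulRightInvariant (by omega) μ
  haveI := SLR.isInvInvariant (by omega) μ
  haveI := SLR.noncompactSpace (d := d) (by omega)
  obtain ⟨h, hh⟩ := exists_phi_eq (d := d) (by omega) hs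
  have hL : ∀ t, MemLp ({g : SLR d | phi g ≤ t}.indicator fun _ => (1:ℝ)) 2 μ := fun t =>
    memLp_indicator_const 2 (measurableSet_phi_le t) 1 (Or.inr (measure_ball_ne_top μ t))
  have hK : ∀ t, ∀ k ∈ Kd d, koop μ k ((hL t).toLp _) = (hL t).toLp _ := by
    intro t k hk
    apply koop_fix_of_invariant
    intro x
    have : phi (k⁻¹ • x) = phi x := phi_mul_left (inv_mem hk)
    simp only [Set.indicator, Set.mem_setOf_eq, this]
  have h0 : ∀ u, (∀ g : SLR d, koop μ g u = u) → inner ℝ u ((hL r).toLp _) = 0 := by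
    intro u hu
    refine koop_orth (G := SLR d) μ inferInstance μ (fun x N hN h => ?_) (hL r)
      (fun h => absurd (measure_univ_of_isMulLeftInvariant μ) h) u hu
    have e : {g : SLR d | g⁻¹ • x ∈ N} = ((· * x) ⁻¹' N)⁻¹ := by ext g; rfl
    rwa [e, Measure.measure_inv, measure_preimage_mul_right] at h
  have hn : ∀ t, ‖(hL t).toLp _‖ ^ 2 = vol μ t := by
    intro t
    rw [← real_inner_self_eq_norm_sq]
    have := inner_koop_toLp μ (1 : SLR d) (hL t) (hL t)
    rw [map_one] at this
    refine this.trans ?_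
    have e : ∀ x : SLR d, ({g : SLR d | phi g ≤ t}.indicator (fun _ => (1:ℝ)) x) *
       ({g : SLR d | phi g ≤ t}.indicator (fun _ => (1:ℝ)) ((1 : SLR d)⁻¹ • x)) = {g : SLR d | phi g ≤ t}.indicator (fun _ => (1:ℝ)) x := by
      intro x
      by_cases hx : phi x ≤ t <;> simp [Set.indicator, hx]
    simp_rw [e]
    rw [integral_indicator (measurableSet_phi_le t), setIntegral_const]
    simp [vol, Measure.real]
  set t := r + √d * s with ht
  have hin : inner ℝ ((hL t).toLp _) (koop μ h ((hL r).toLp _)) = vol μ r := by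
    rw [inner_koop_toLp]
    have e : ∀ x : SLR d, ({g : SLR d | phi g ≤ t}.indicator (fun _ => (1:ℝ)) x) *
       ({g : SLR d | phi g ≤ r}.indicator (fun _ => (1:ℝ)) (h⁻¹ • x)) =
         {g : SLR d | phi g ≤ r}.indicator (fun _ => (1:ℝ)) (h⁻¹ * x) := by
      intro x
      by_cases hx : phi (h⁻¹ * x) ≤ r
      · have h2 : phi x ≤ t := by
          have := phi_mul_le (h⁻¹ * x)⁻¹ h⁻¹
          rw [phi_inv, phi_inv, hh, ← _root_.mul_inv_rev, phi_inv, mul_inv_cancel_left] at this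
          linarith
        simp [Set.indicator, hx, h2]
      · simp [Set.indicator, hx]
    simp_rw [e]
    rw [integral_mul_left_eq_self (fun x => {g : SLR d | phi g ≤ r}.indicator (fun _ => (1:ℝ)) x) h⁻¹,
      integral_indicator (measurableSet_phi_le r), setIntegral_const]
    simp [vol, Measure.real]
  have key := rep_decay hd (continuous_koop μ) (hK r) (hK t) h0 h
  rw [hin, hh, abs_of_nonneg (vol_nonneg μ r)] at key
  have hv := vol_nonneg μ r
  have hv' := vol_nonneg μ t
  have key2 := pow_le_pow_left₀ hv key 2
  rw [mul_pow, mul_pow, mul_pow, hn, hn, ← Real.exp_nat_mul] at key2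
  have e1 : ((2:ℕ):ℝ) * (-(s / √d) / 6) = -(s / √d) / 3 := by push_cast; ring
  rw [e1] at key2
  rcases hv.eq_or_lt with h | h
  · rw [← h]; positivity
  · refine le_of_mul_le_mul_right (a := vol μ r) ?_ h
    nlinarith

end volumeGrowth

section higherRank
variable {d : ℕ} (μ : Measure (SLR d)) [μ.IsHaarMeasure]

theorem setIntegral_exp_phi_le (hd : 3 ≤ d) {T : ℝ} (hT : 0 ≤ T) :
    ∫ h in {g : SLR d | phi g ≤ T}, Real.exp (-(phi h / √d) / 6) ∂μ ≤
      (63 ^ 2 + 1) * Real.exp (-(T / (12 * d))) * vol μ T := by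
  have hd0 : (0:ℝ) < d := by positivity
  have hd1 : (1:ℝ) ≤ d := by exact_mod_cast (by omega : 1 ≤ d)
  have hsd : 0 < √(d:ℝ) := Real.sqrt_pos.2 hd0
  have hsq : √(d:ℝ) * √d = d := Real.mul_self_sqrt hd0.le
  have hsd1 : √(d:ℝ) ≤ d := by nlinarith [Real.one_le_sqrt.2 hd1]
  set D := {g : SLR d | phi g ≤ T} with hD
  set D' := {g : SLR d | phi g ≤ T / 2} with hD'
  have hsub : D' ⊆ D := fun g (hg : phi g ≤ T / 2) => show phi g ≤ T by linarith
  set b := Real.exp (-(T / (12 * √d))) with hb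
  have hpt : ∀ h, Real.exp (-(phi h / √d) / 6) ≤ D'.indicator (fun _ => (1:ℝ)) h + b := by
    intro h
    by_cases hh : phi h ≤ T / 2
    · have h1 : h ∈ D' := hh
      rw [Set.indicator_of_mem h1]
      have : Real.exp (-(phi h / √d) / 6) ≤ 1 := by
        rw [Real.exp_le_one_iff]
        have := phi_nonneg h
        have : 0 ≤ phi h / √d := by positivity
        linarith
      have := Real.exp_pos (-(T / (12 * √d)))
      linarith
    · have h1 : h ∉ D' := hh
      rw [Set.indicator_of_notMem h1, zero_add]
      push Not at hh
      refine Real.exp_le_exp.2 ?_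
      have : T / (12 * √d) = (T / 2) / √d / 6 := by field_simp; ring
      rw [this, neg_div]
      gcongr
  have hi : IntegrableOn (D'.indicator fun _ => (1:ℝ)) D μ :=
    (integrable_indicator_iff (measurableSet_phi_le _)).2 (integrableOn_const (measure_ball_ne_top μ _)) |>.integrableOn
  have hib : IntegrableOn (fun _ => b) D μ := integrableOn_const (measure_ball_ne_top μ _)
  have h1 : ∫ h in D, Real.exp (-(phi h / √d) / 6) ∂μ ≤ ∫ h in D, (D'.indicator (fun _ => (1:ℝ)) h + b) ∂μ := by
    apply integral_mono
    · refine Continuous.continuousOn ?_ |>.integrableOn_compact (isCompact_phi_le T)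
      have := continuous_phi (d := d)
      fun_prop
    · exact hi.add hib
    · exact hpt
  have h2 : ∫ h in D, (D'.indicator (fun _ => (1:ℝ)) h + b) ∂μ = vol μ (T / 2) + b * vol μ T := by
    rw [integral_add hi hib, setIntegral_const, setIntegral_indicator (measurableSet_phi_le _), setIntegral_const,
      Set.inter_eq_self_of_subset_right hsub]
    simp [vol, Measure.real, D', D, mul_comm]
  rw [h2] at h1
  refine h1.trans ?_
  have h3 := vol_le_exp_mul μ hd (T / 2) (s := T / (2 * √d)) (by positivity)
  have e1 : T / 2 + √d * (T / (2 * √d)) = T := by field_simp; ring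
  have e2 : -(T / (2 * √d) / √d) / 3 = -(T / (6 * d)) := by
    have hsq2 : (√(d:ℝ)) ^ 2 = d := Real.sq_sqrt hd0.le
    rw [neg_div, div_div, div_div]; congr 2; linear_combination 6 * hsq
  rw [e1, e2] at h3
  have hv := vol_nonneg (d := d) μ T
  have h4 : Real.exp (-(T / (6 * d))) ≤ Real.exp (-(T / (12 * d))) := by
    refine Real.exp_le_exp.2 (neg_le_neg ?_); gcongr; norm_num
  have h5 : b ≤ Real.exp (-(T / (12 * d))) := by
    refine Real.exp_le_exp.2 (neg_le_neg ?_); gcongr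
  calc _ ≤ 63 ^ 2 * Real.exp (-(T / (12 * d))) * vol μ T + Real.exp (-(T / (12 * d))) * vol μ T := by gcongr; exact h3.trans (by gcongr)
    _ = _ := by ring

theorem densBd_le (hd : d ≠ 0) : ∃ C : ℝ, 0 < C ∧ ∀ η : ℝ, 0 < η → η ≤ 1 → densBd (d := d) μ η ≤ C * (η ^ (d * d))⁻¹ := by
  obtain ⟨c, hc, hv⟩ := vol_small_ge μ hd
  set N := Nat.card {x : Matrix.SpecialLinearGroup (Fin d) ℤ | phi (toSLR x) ≤ (1 + √d)} with hN
  refine ⟨(N + 1) / c, by positivity, fun η hη hη1 => ?_⟩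
  have h1 : Nat.card {x : Matrix.SpecialLinearGroup (Fin d) ℤ | phi (toSLR x) ≤ (1 + √d) * η} ≤ N := by
    refine Nat.card_mono (finite_phi_toSLR_le _) fun x hx => ?_
    refine le_trans (show phi (toSLR x) ≤ (1 + √d) * η from hx) ?_
    have : 0 ≤ √(d:ℝ) := Real.sqrt_nonneg _
    nlinarith
  have h2 : (Nat.card {x : Matrix.SpecialLinearGroup (Fin d) ℤ | phi (toSLR x) ≤ (1 + √d) * η} : ℝ) ≤ N + 1 := by
    have : (Nat.card {x : Matrix.SpecialLinearGroup (Fin d) ℤ | phi (toSLR x) ≤ (1 + √d) * η} : ℝ) ≤ N := by exact_mod_cast h1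
    linarith
  unfold densBd
  calc _ ≤ (N + 1) / vol (d := d) μ η := by
        have := vol_nonneg (d := d) μ η
        gcongr
    _ ≤ (N + 1) / (c * η ^ (d * d)) := by
        gcongr; exact hv η hη hη1
    _ = _ := by field_simp

set_option maxHeartbeats 1000000 in
theorem cnt_asymptotic_of_three_le (hd : 3 ≤ d) {F₀ : Set (SLR d)}
    (hF₀ : IsFundamentalDomain (toSLR (d := d)).range F₀ μ) :
    ∃ ε : ℝ, 0 < ε ∧ ∃ C : ℝ, 0 < C ∧ ∀ (p : ℕ), p.Prime → ∀ (γ : Matrix.SpecialLinearGroup (Fin d) ℤ), ∀ t : ℝ, 1 < t →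
      |cnt d p γ t - vol μ t / ((congSubgroup d p).index * (μ F₀).toReal)| ≤ C * vol μ t * Real.exp (-ε * t) := by
  have hd0 : (0:ℝ) < d := by positivity
  obtain ⟨C₁, hC₁, hdens⟩ := densBd_le μ (d := d) (by omega)
  obtain ⟨C₂, hC₂, hadd⟩ := vol_add_le μ (d := d) (by omega)
  set n : ℕ := d * d with hn
  have hn0 : (0:ℝ) < n := by positivity
  set a : ℝ := 1 / (12 * d) with ha
  have ha0 : 0 < a := by positivity
  set κ : ℝ := a / (2 * n) with hκ
  have hκ0 : 0 < κ := by positivity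
  set s : ℝ := 2 * √d with hs
  have hs0 : 0 < s := by positivity
  have hs1 : 1 ≤ s := by
    have : 1 ≤ √(d:ℝ) := Real.one_le_sqrt.2 (by exact_mod_cast (by omega : 1 ≤ d))
    linarith
  set η₀ : ℝ := 1 / (8 * s) with hη₀
  have hη₀0 : 0 < η₀ := by positivity
  have hη₀1 : η₀ ≤ 1 := by
    rw [hη₀, div_le_one (by positivity)]; linarith
  set M : ℝ := 1 / (μ F₀).toReal with hM
  have hM0 : 0 ≤ M := by positivity
  set E : ℝ := 63 * (C₁ * (η₀ ^ n)⁻¹) * ((63 ^ 2 + 1) * Real.exp (a / 8)) * (1 + C₂ / 8) with hE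
  have hE0 : 0 < E := by positivity
  refine ⟨min κ (a / 2), by positivity, M * C₂ * (1 / 8) + E, by positivity, fun p hp γ t ht => ?_⟩
  set η := η₀ * Real.exp (-κ * t) with hη
  have hη0 : 0 < η := by positivity
  have hexp1 : Real.exp (-κ * t) ≤ 1 := Real.exp_le_one_iff.2 (by nlinarith)
  have hηη : η ≤ η₀ := by nlinarith
  have hη1 : η ≤ 1 := hηη.trans hη₀1
  have hsη : s * η = 1 / 8 * Real.exp (-κ * t) := by rw [hη, hη₀]; field_simp
  have hsη8 : s * η ≤ 1 / 8 := by rw [hsη]; linarith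
  have hsη0 : 0 < s * η := by positivity
  set c₀ : ℝ := 1 / ((congSubgroup d p).index * (μ F₀).toReal) with hc₀
  have hc₀0 : 0 ≤ c₀ := by positivity
  have hc₀M : c₀ ≤ M := by
    rw [hc₀, one_div, _root_.mul_inv, hM, one_div]
    refine mul_le_of_le_one_left (by positivity) ?_
    rcases Nat.eq_zero_or_pos (congSubgroup d p).index with h | h
    · rw [h]; simp
    · exact inv_le_one_of_one_le₀ (by exact_mod_cast h)
  obtain ⟨φ, hφc, -, hφ3, -, hsand⟩ := cnt_sandwich (by omega) hF₀ hp γ hη0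
  have hB : densBd (d := d) μ η ≤ C₁ * (η₀ ^ n)⁻¹ * Real.exp (a / 2 * t) := by
    refine (hdens η hη0 hη1).trans (le_of_eq ?_)
    rw [hη, mul_pow, _root_.mul_inv, ← Real.exp_nat_mul, ← Real.exp_neg, mul_assoc]
    congr 3
    rw [hκ]; field_simp
  have hB0 := densBd_nonneg (d := d) (μ := μ) (η := η)
  have hV0 := vol_nonneg (d := d) μ t
  have hVT : ∀ T, T ≤ t + s * η → vol (d := d) μ T ≤ (1 + C₂ / 8) * vol μ t := by
    intro T hT
    refine (vol_mono μ hT).trans ((hadd t (s * η) (by linarith) hsη0 hsη8).trans ?_)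
    gcongr
    nlinarith
  have hitg : ∀ T, t - s * η ≤ T → T ≤ t + s * η → |∫ h in {g : SLR d | phi g ≤ T}, φ h ∂μ| ≤ E * (vol μ t * Real.exp (-(a / 2) * t)) := by
    intro T hT1 hT2
    have h1 : |∫ h in {g : SLR d | phi g ≤ T}, φ h ∂μ| ≤
        ∫ h in {g : SLR d | phi g ≤ T}, Real.exp (-(phi h / √d) / 6) * (63 * densBd (d := d) μ η) ∂μ := by
      rw [← Real.norm_eq_abs]
      refine norm_integral_le_of_norm_le ?_ (Filter.Eventually.of_forall fun h => ?_)
      · refine Continuous.continuousOn ?_ |>.integrableOn_compact (isCompact_phi_le T)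
        have := continuous_phi (d := d)
        fun_prop
      · rw [Real.norm_eq_abs]
        refine (hφ3 hd h).trans (le_of_eq ?_)
        ring
    rw [integral_mul_const] at h1
    have h2 := setIntegral_exp_phi_le μ hd (T := T) (by linarith)
    have h3 : Real.exp (-(T / (12 * d))) ≤ Real.exp (a / 8) * Real.exp (-a * t) := by
      rw [← Real.exp_add]
      refine Real.exp_le_exp.2 ?_
      have : T / (12 * d) = a * T := by rw [ha]; ring
      rw [this]
      nlinarith
    calc _ ≤ ((63 ^ 2 + 1) * (Real.exp (a / 8) * Real.exp (-a * t)) * ((1 + C₂ / 8) * vol (d := d) μ t)) *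
          (63 * (C₁ * (η₀ ^ n)⁻¹ * Real.exp (a / 2 * t))) := by
          refine h1.trans ?_
          refine mul_le_mul (h2.trans ?_) (by gcongr) (by positivity) (by positivity)
          have := hVT T hT2
          have := vol_nonneg (d := d) μ T
          gcongr
      _ = E * (vol μ t * (Real.exp (-a * t) * Real.exp (a / 2 * t))) := by rw [hE]; ring
      _ = _ := by rw [← Real.exp_add]; congr 3; ring_nf
  have hm : Real.exp (-(a / 2) * t) ≤ Real.exp (-(min κ (a / 2)) * t) := by
    refine Real.exp_le_exp.2 ?_
    have := min_le_right κ (a / 2)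
    nlinarith
  have hm' : Real.exp (-κ * t) ≤ Real.exp (-(min κ (a / 2)) * t) := by
    refine Real.exp_le_exp.2 ?_
    have := min_le_left κ (a / 2)
    nlinarith
  have hEb : E * (vol μ t * Real.exp (-(a / 2) * t)) ≤ E * (vol μ t * Real.exp (-(min κ (a / 2)) * t)) := by gcongr
  have hd1 : c₀ * (C₂ * (s * η) * vol μ t) ≤ M * C₂ * (1 / 8) * (vol μ t * Real.exp (-(min κ (a / 2)) * t)) := by
    rw [hsη]
    calc _ ≤ M * (C₂ * (1 / 8 * Real.exp (-(min κ (a / 2)) * t)) * vol μ t) := by gcongr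
      _ = _ := by ring
  have hmain : vol μ t / ((congSubgroup d p).index * (μ F₀).toReal) = vol μ t * c₀ := by rw [hc₀, mul_one_div]
  rw [hmain, abs_le]
  constructor
  · obtain ⟨-, h2⟩ := hsand (t - s * η)
    rw [sub_add_cancel] at h2
    have h3 := (abs_le.1 (hitg (t - s * η) le_rfl (by linarith))).1
    have h4 := hadd (t - s * η) (s * η) (by linarith) hsη0 hsη8
    rw [sub_add_cancel] at h4
    have h5 : vol (d := d) μ (t - s * η) ≤ vol μ t := vol_mono μ (by linarith)
    have h6 : C₂ * (s * η) * vol (d := d) μ (t - s * η) ≤ C₂ * (s * η) * vol μ t := by gcongr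
    have h7 : vol μ t * c₀ - c₀ * (C₂ * (s * η) * vol μ t) ≤ vol (d := d) μ (t - s * η) * c₀ := by
      have : vol μ t - C₂ * (s * η) * vol μ t ≤ vol (d := d) μ (t - s * η) := by linarith only [h4, h6]
      have := mul_le_mul_of_nonneg_right this hc₀0
      linarith only [this]
    linarith only [h2, h3, h7, hd1, hEb]
  · obtain ⟨h1, -⟩ := hsand (t + s * η)
    rw [add_sub_cancel_right] at h1
    have h3 := (abs_le.1 (hitg (t + s * η) (by linarith) le_rfl)).2
    have h4 := hadd t (s * η) (by linarith) hsη0 hsη8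
    have h7 : vol (d := d) μ (t + s * η) * c₀ ≤ vol μ t * c₀ + c₀ * (C₂ * (s * η) * vol μ t) := by
      have := mul_le_mul_of_nonneg_right h4 hc₀0
      linarith only [this]
    linarith only [h1, h3, h7, hd1, hEb]

end higherRank

section divisors

theorem card_divisors_le_rpow {ε : ℝ} (hε : 0 < ε) (hε1 : ε ≤ 1) :
    ∃ C : ℝ, 1 ≤ C ∧ ∀ n : ℕ, n ≠ 0 → (n.divisors.card : ℝ) ≤ C * (n:ℝ) ^ ε := by
  have hl : 0 < Real.log 2 := Real.log_pos one_lt_two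
  have hl1 : Real.log 2 ≤ 1 := by linarith [Real.log_two_lt_d9]
  set c : ℝ := 1 / (ε * Real.log 2) with hc
  have hc1 : 1 ≤ c := by
    rw [hc, le_div_iff₀ (by positivity), one_mul]; nlinarith
  set N : ℕ := ⌈(2:ℝ) ^ (1 / ε)⌉₊ with hN
  refine ⟨c ^ N, one_le_pow₀ hc1, fun n hn => ?_⟩
  rw [Nat.card_divisors hn]
  have hprod : (n:ℝ) ^ ε = ∏ x ∈ n.primeFactors, ((x:ℝ) ^ n.factorization x) ^ ε := by
    rw [Real.finset_prod_rpow _ _ fun i _ => by positivity]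
    congr 1
    conv_lhs => rw [← Nat.prod_factorization_pow_eq_self hn]
    rw [Finsupp.prod]; push_cast; rfl
  have key : ∀ x ∈ n.primeFactors, ((n.factorization x + 1 : ℕ) : ℝ) ≤
      (if x < N then c else 1) * ((x:ℝ) ^ n.factorization x) ^ ε := by
    intro x hx
    have hx2 : (2:ℝ) ≤ x := by exact_mod_cast (Nat.prime_of_mem_primeFactors hx).two_le
    set k := n.factorization x
    push_cast
    rw [← Real.rpow_natCast, ← Real.rpow_mul (by positivity), mul_comm (k:ℝ), Real.rpow_mul (by positivity), Real.rpow_natCast]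
    split_ifs with h
    · have h1 : (2:ℝ) ^ ε ≤ (x:ℝ) ^ ε := Real.rpow_le_rpow (by norm_num) hx2 hε.le
      have h2 : 1 + k * (ε * Real.log 2) ≤ ((2:ℝ) ^ ε) ^ k := by
        rw [Real.rpow_def_of_pos two_pos, ← Real.exp_nat_mul]
        have := Real.add_one_le_exp ((k:ℝ) * (Real.log 2 * ε))
        linarith
      have h3 : ((2:ℝ) ^ ε) ^ k ≤ ((x:ℝ) ^ ε) ^ k := by gcongr
      have h4 : (k:ℝ) + 1 ≤ c * (1 + k * (ε * Real.log 2)) := by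
        rw [hc]
        have : 1 / (ε * Real.log 2) * (1 + k * (ε * Real.log 2)) = 1 / (ε * Real.log 2) + k := by field_simp
        rw [this]; linarith
      exact h4.trans (by gcongr; exact h2.trans h3)
    · push Not at h
      have h1 : (2:ℝ) ≤ (x:ℝ) ^ ε := by
        have h5 : (2:ℝ) ^ (1 / ε) ≤ x := (Nat.le_ceil _).trans (by exact_mod_cast h)
        calc (2:ℝ) = ((2:ℝ) ^ (1 / ε)) ^ ε := by
              rw [← Real.rpow_mul (by norm_num)]; field_simp; simp
          _ ≤ _ := Real.rpow_le_rpow (by positivity) h5 hε.le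
      rw [one_mul]
      have h2 : (k:ℝ) + 1 ≤ 2 ^ k := by exact_mod_cast Nat.lt_two_pow_self (n := k)
      exact h2.trans (by gcongr)
  rw [hprod]
  rw [Nat.cast_prod]
  refine (Finset.prod_le_prod (g := fun x : ℕ => (if x < N then c else 1) * ((x:ℝ) ^ n.factorization x) ^ ε)
    (fun i _ => by positivity) fun x hx => key x hx).trans ?_
  rw [Finset.prod_mul_distrib]
  gcongr
  · rw [Finset.prod_ite]
    simp only [Finset.prod_const, one_pow, mul_one]
    refine pow_le_pow_right₀ hc1 ?_
    refine (Finset.card_le_card (t := Finset.range N) fun x hx => ?_).trans (Finset.card_range N).le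
    exact Finset.mem_range.2 (Finset.mem_filter.1 hx).2

theorem le_card_divisors_mul_totient (n : ℕ) : n ≤ n.divisors.card * n.totient := by
  conv_lhs => rw [← Nat.sum_totient n]
  rcases Nat.eq_zero_or_pos n with rfl | hn
  · simp
  rw [← smul_eq_mul]
  refine Finset.sum_le_card_nsmul _ _ _ fun m hm => ?_
  exact Nat.le_of_dvd (Nat.totient_pos.2 hn) (Nat.totient_dvd_of_dvd (Nat.dvd_of_mem_divisors hm))

theorem sum_Icc_inv_le (n : ℕ) : ∑ k ∈ Finset.Icc 1 n, (1:ℝ) / k ≤ 1 + Real.log n := by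
  have := harmonic_le_one_add_log n
  rw [harmonic_eq_sum_Icc] at this
  push_cast at this
  simpa [one_div] using this

theorem sum_gcd_rpow_div_le (a : ℕ) (ha : a ≠ 0) :
    ∑ n ∈ Finset.Icc 1 a, ((Nat.gcd n a : ℝ) ^ (1/4:ℝ)) / n ≤ a.divisors.card * (1 + Real.log a) := by
  have h1 : ∀ n ∈ Finset.Icc 1 a, ((Nat.gcd n a : ℝ) ^ (1/4:ℝ)) / n ≤
      ∑ g ∈ a.divisors, if g ∣ n then (g:ℝ) / n else 0 := by
    intro n hn
    have hn1 := (Finset.mem_Icc.1 hn).1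
    have hg : Nat.gcd n a ∈ a.divisors := Nat.mem_divisors.2 ⟨Nat.gcd_dvd_right _ _, ha⟩
    refine le_trans ?_ (Finset.single_le_sum (f := fun g => if g ∣ n then (g:ℝ) / n else 0) (fun g _ => ?_) hg)
    · show _ ≤ if Nat.gcd n a ∣ n then ((Nat.gcd n a : ℕ):ℝ) / n else 0
      rw [if_pos (Nat.gcd_dvd_left _ _)]
      gcongr
      have : (1:ℝ) ≤ Nat.gcd n a := by exact_mod_cast Nat.gcd_pos_of_pos_left _ (by omega)
      calc _ ≤ (Nat.gcd n a : ℝ) ^ (1:ℝ) := Real.rpow_le_rpow_of_exponent_le this (by norm_num)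
        _ = _ := Real.rpow_one _
    · split_ifs <;> positivity
  refine (Finset.sum_le_sum h1).trans ?_
  rw [Finset.sum_comm, ← nsmul_eq_mul]
  refine Finset.sum_le_card_nsmul _ _ _ fun g hg => ?_
  have hg0 : 0 < g := Nat.pos_of_mem_divisors hg
  rw [← Finset.sum_filter]
  refine le_trans ?_ (sum_Icc_inv_le a)
  have hinj : ∀ x ∈ (Finset.Icc 1 a).filter (g ∣ ·), ∀ y ∈ (Finset.Icc 1 a).filter (g ∣ ·), x / g = y / g → x = y := by
    intro x hx y hy h
    have h1 := (Finset.mem_filter.1 hx).2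
    have h2 := (Finset.mem_filter.1 hy).2
    rw [← Nat.div_mul_cancel h1, ← Nat.div_mul_cancel h2, h]
  calc _ = ∑ n ∈ (Finset.Icc 1 a).filter (g ∣ ·), (1:ℝ) / ((n / g : ℕ)) := by
        refine Finset.sum_congr rfl fun n hn => ?_
        have h2 := (Finset.mem_filter.1 hn).2
        rw [Nat.cast_div h2 (by positivity), one_div_div]
    _ = ∑ m ∈ ((Finset.Icc 1 a).filter (g ∣ ·)).image (· / g), (1:ℝ) / m := by
        rw [Finset.sum_image hinj]
    _ ≤ _ := by
        refine Finset.sum_le_sum_of_subset_of_nonneg ?_ fun _ _ _ => by positivity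
        intro m hm
        obtain ⟨n, hn, rfl⟩ := Finset.mem_image.1 hm
        obtain ⟨hn1, hn2⟩ := Finset.mem_filter.1 hn
        rw [Finset.mem_Icc] at hn1 ⊢
        exact ⟨Nat.div_pos (Nat.le_of_dvd hn1.1 hn2) hg0, (Nat.div_le_self _ _).trans hn1.2⟩

end divisors

section kloosterman

variable {a : ℕ} [NeZero a]

/-- `gcd (h, a)` for a residue `h` modulo `a`. -/
def zgcd (h : ZMod a) : ℕ := Nat.gcd h.val a

theorem zgcd_pos (h : ZMod a) : 0 < zgcd h := Nat.gcd_pos_of_pos_right _ (NeZero.pos a)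

theorem card_mul_eq_zero_le (h : ZMod a) : (Finset.univ.filter fun u : ZMod a => h * u = 0).card ≤ zgcd h := by
  refine (Finset.card_le_card ?_).trans (IsAddCyclic.card_nsmul_eq_zero_le (α := ZMod a) (zgcd_pos h))
  intro u hu
  have hu' := (Finset.mem_filter.1 hu).2
  refine Finset.mem_filter.2 ⟨Finset.mem_univ _, ?_⟩
  have h1 := congrArg (Int.cast : ℤ → ZMod a) (Nat.gcd_eq_gcd_ab h.val a)
  push_cast at h1
  rw [ZMod.natCast_self, zero_mul, add_zero, ZMod.natCast_zmod_val] at h1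
  rw [nsmul_eq_mul, zgcd, h1]
  linear_combination ((h.val.gcdA a : ℤ) : ZMod a) * hu'

theorem card_mul_eq_le (h c : ZMod a) : (Finset.univ.filter fun u : ZMod a => h * u = c).card ≤ zgcd h := by
  rcases (Finset.univ.filter fun u : ZMod a => h * u = c).eq_empty_or_nonempty with h0 | ⟨u0, hu0⟩
  · rw [h0]; simp
  refine le_trans ?_ (card_mul_eq_zero_le h)
  refine Finset.card_le_card_of_injOn (fun u => u - u0) (fun u hu => ?_) (fun x _ y _ hxy => sub_left_injective hxy)
  have h1 := (Finset.mem_filter.1 hu).2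
  have h2 := (Finset.mem_filter.1 hu0).2
  simp only [Finset.coe_filter, Finset.mem_univ, true_and, Set.mem_setOf_eq]
  rw [mul_sub, h1, h2, sub_self]

theorem zgcd_mul_le (x y : ZMod a) : zgcd (x * y) ≤ zgcd x * zgcd y := by
  rw [zgcd, ZMod.val_mul, ← Nat.gcd_rec]
  rw [zgcd, zgcd, Nat.gcd_comm x.val, Nat.gcd_comm y.val]
  exact Nat.le_of_dvd (Nat.mul_pos (Nat.gcd_pos_of_pos_left _ (NeZero.pos a)) (Nat.gcd_pos_of_pos_left _ (NeZero.pos a))) (Nat.gcd_mul_right_dvd_mul_gcd _ _ _)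

theorem zgcd_natCast (n : ℕ) : zgcd (n : ZMod a) = Nat.gcd n a := by
  rw [zgcd, ZMod.val_natCast, ← Nat.gcd_rec, Nat.gcd_comm]

theorem sum_zgcd_le : ∑ h : ZMod a, zgcd h ≤ a.divisors.card * a := by
  have ha : a ≠ 0 := NeZero.ne a
  calc ∑ h : ZMod a, zgcd h ≤ ∑ h : ZMod a, ∑ g ∈ a.divisors, if g ∣ h.val then g else 0 := by
        refine Finset.sum_le_sum fun h _ => ?_
        have hg : zgcd h ∈ a.divisors := Nat.mem_divisors.2 ⟨Nat.gcd_dvd_right _ _, ha⟩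
        refine le_trans ?_ (Finset.single_le_sum (f := fun g => if g ∣ h.val then g else 0) (fun g _ => Nat.zero_le _) hg)
        show _ ≤ if zgcd h ∣ h.val then zgcd h else 0
        rw [if_pos (show zgcd h ∣ h.val from Nat.gcd_dvd_left _ _)]
    _ = ∑ g ∈ a.divisors, g * (Finset.univ.filter fun h : ZMod a => g ∣ h.val).card := by
        rw [Finset.sum_comm]
        refine Finset.sum_congr rfl fun g _ => ?_
        rw [← Finset.sum_filter, Finset.sum_const, smul_eq_mul, mul_comm]
    _ ≤ _ := by
        rw [← smul_eq_mul]
        refine Finset.sum_le_card_nsmul _ _ _ fun g hg => ?_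
        obtain ⟨m, hm⟩ := Nat.dvd_of_mem_divisors hg
        have hm0 : 0 < m := Nat.pos_of_ne_zero fun h => ha (by rw [hm, h, mul_zero])
        have : (Finset.univ.filter fun h : ZMod a => g ∣ h.val).card ≤ m := by
          refine (Finset.card_le_card ?_).trans (IsAddCyclic.card_nsmul_eq_zero_le (α := ZMod a) hm0)
          intro h hh
          obtain ⟨r, hr⟩ := (Finset.mem_filter.1 hh).2
          refine Finset.mem_filter.2 ⟨Finset.mem_univ _, ?_⟩
          rw [← ZMod.natCast_zmod_val h, hr, nsmul_eq_mul, ← Nat.cast_mul, ZMod.natCast_eq_zero_iff]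
          exact ⟨r, by conv_rhs => rw [hm]
                       ring⟩
        calc _ ≤ g * m := Nat.mul_le_mul_left _ this
          _ = a := hm.symm

open ZMod in
/-- The Kloosterman sum modulo `a`. -/
noncomputable def kl (h k : ZMod a) : ℂ := ∑ u : (ZMod a)ˣ, stdAddChar (h * (u : ZMod a) + k * ((u⁻¹ : (ZMod a)ˣ) : ZMod a))

theorem kl_mul (h k : ZMod a) (v : (ZMod a)ˣ) : kl (h * (v : ZMod a)) (k * ((v⁻¹ : (ZMod a)ˣ) : ZMod a)) = kl h k := by
  rw [kl, kl]
  refine Fintype.sum_equiv (Equiv.mulLeft v) _ _ fun u => ?_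
  simp only [Equiv.coe_mulLeft, _root_.mul_inv_rev, Units.val_mul]
  congr 1; ring

theorem sum_normSq_eq {P : Type*} [Fintype P] (f g : P → ZMod a) :
    ∑ h : ZMod a, ∑ k : ZMod a, ‖∑ q, ZMod.stdAddChar (h * f q + k * g q)‖ ^ 2 =
      (a:ℝ) ^ 2 * (Finset.univ.filter fun r : P × P => f r.1 = f r.2 ∧ g r.1 = g r.2).card := by
  have key : ∀ x : ZMod a, ∑ h : ZMod a, ZMod.stdAddChar (h * x) = if x = 0 then (a:ℂ) else 0 := by
    intro x
    have := AddChar.sum_mulShift (ψ := ZMod.stdAddChar (N := a)) x (ZMod.isPrimitive_stdAddChar a)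
    simpa using this
  have h1 : ∀ h k : ZMod a, ((‖∑ q, ZMod.stdAddChar (h * f q + k * g q)‖ ^ 2 : ℝ) : ℂ) =
      ∑ r : P × P, ZMod.stdAddChar (h * (f r.1 - f r.2)) * ZMod.stdAddChar (k * (g r.1 - g r.2)) := by
    intro h k
    push_cast
    rw [← Complex.mul_conj', map_sum, Finset.sum_mul_sum, ← Finset.sum_product', Finset.univ_product_univ]
    refine Finset.sum_congr rfl fun r _ => ?_
    rw [← AddChar.map_neg_eq_conj, ← AddChar.map_add_eq_mul, ← AddChar.map_add_eq_mul]
    congr 1; ring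
  have h2 : ((∑ h : ZMod a, ∑ k : ZMod a, ‖∑ q, ZMod.stdAddChar (h * f q + k * g q)‖ ^ 2 : ℝ) : ℂ) =
      (((a:ℝ) ^ 2 * (Finset.univ.filter fun r : P × P => f r.1 = f r.2 ∧ g r.1 = g r.2).card : ℝ) : ℂ) := by
    rw [Complex.ofReal_sum]
    simp_rw [Complex.ofReal_sum, h1]
    calc _ = ∑ r : P × P, (∑ h : ZMod a, ZMod.stdAddChar (h * (f r.1 - f r.2))) * ∑ k : ZMod a, ZMod.stdAddChar (k * (g r.1 - g r.2)) := by
          simp_rw [Finset.sum_mul_sum]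
          rw [Finset.sum_comm]
          conv_rhs => rw [Finset.sum_comm]
          conv_lhs => rw [Finset.sum_comm]
          refine Finset.sum_congr rfl fun h _ => ?_
          rw [Finset.sum_comm]
      _ = ∑ r : P × P, if f r.1 = f r.2 ∧ g r.1 = g r.2 then (a:ℂ) ^ 2 else 0 := by
          refine Finset.sum_congr rfl fun r _ => ?_
          rw [key, key]
          simp only [sub_eq_zero]
          by_cases h1 : f r.1 = f r.2 <;> by_cases h2 : g r.1 = g r.2 <;> simp [h1, h2, sq]
      _ = _ := by
          rw [← Finset.sum_filter, Finset.sum_const, nsmul_eq_mul]; push_cast; ring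
  exact_mod_cast h2

theorem kl_energy_le : (Finset.univ.filter fun r : ((ZMod a)ˣ × (ZMod a)ˣ) × ((ZMod a)ˣ × (ZMod a)ˣ) =>
    (r.1.1 : ZMod a) + (r.1.2 : ZMod a) = (r.2.1 : ZMod a) + (r.2.2 : ZMod a) ∧
    ((r.1.1⁻¹ : (ZMod a)ˣ) : ZMod a) + ((r.1.2⁻¹ : (ZMod a)ˣ) : ZMod a) =
      ((r.2.1⁻¹ : (ZMod a)ˣ) : ZMod a) + ((r.2.2⁻¹ : (ZMod a)ˣ) : ZMod a)).card ≤ 2 * (a.divisors.card * a) ^ 2 := by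
  have h2 : zgcd (2 : ZMod a) ≤ 2 := by
    have := zgcd_natCast (a := a) 2
    push_cast at this
    rw [this]; exact Nat.gcd_le_left _ two_pos
  calc _ ≤ (Finset.univ.filter fun r : (ZMod a × ZMod a) × ZMod a => 2 * (r.1.1 * r.1.2) * r.2 = r.1.1 * r.1.2 * (r.1.1 + r.1.2)).card := by
        refine Finset.card_le_card_of_injOn (fun r => (((r.1.1 : ZMod a) - r.2.1, (r.2.1 : ZMod a) - r.1.2), (r.1.1 : ZMod a))) ?_ ?_
        · rintro ⟨⟨x1, x2⟩, ⟨y1, y2⟩⟩ hr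
          obtain ⟨-, e1, e2⟩ := Finset.mem_filter.1 hr
          simp only at e1 e2
          simp only [Finset.coe_filter, Finset.mem_univ, true_and, Set.mem_setOf_eq]
          have i1 := Units.mul_inv x1
          have i2 := Units.mul_inv x2
          have i3 := Units.mul_inv y1
          have i4 := Units.mul_inv y2
          generalize (x1 : ZMod a) = X1 at *
          generalize (x2 : ZMod a) = X2 at *
          generalize (y1 : ZMod a) = Y1 at *
          generalize (y2 : ZMod a) = Y2 at *
          generalize ((x1⁻¹ : (ZMod a)ˣ) : ZMod a) = X1' at *
          generalize ((x2⁻¹ : (ZMod a)ˣ) : ZMod a) = X2' at *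
          generalize ((y1⁻¹ : (ZMod a)ˣ) : ZMod a) = Y1' at *
          generalize ((y2⁻¹ : (ZMod a)ˣ) : ZMod a) = Y2' at *
          have hY : Y2 = X1 + X2 - Y1 := by linear_combination -e1
          have k1 : X1' + X2' = (X1 + X2) * (X1' * X2') := by linear_combination -X2' * i1 - X1' * i2
          have k2 : Y1' + Y2' = (Y1 + Y2) * (Y1' * Y2') := by linear_combination -Y2' * i3 - Y1' * i4
          have k3 : (X1 + X2) * (Y1 * Y2 - X1 * X2) = 0 := by
            have : (X1 + X2) * (X1' * X2') = (X1 + X2) * (Y1' * Y2') := by rw [← k1, e2, k2, e1]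
            have m1 : X1 * X2 * (X1' * X2') = 1 := by linear_combination X2 * X2' * i1 + i2
            have m2 : Y1 * Y2 * (Y1' * Y2') = 1 := by linear_combination Y2 * Y2' * i3 + i4
            linear_combination (X1 * X2 * Y1 * Y2) * this - (X1 + X2) * Y1 * Y2 * m1 + (X1 + X2) * X1 * X2 * m2
          rw [hY] at k3
          linear_combination k3
        · rintro ⟨⟨x1, x2⟩, ⟨y1, y2⟩⟩ hr ⟨⟨x1', x2'⟩, ⟨y1', y2'⟩⟩ hr' h
          simp only [Finset.coe_filter, Finset.mem_univ, true_and, Set.mem_setOf_eq] at hr hr'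
          simp only [Prod.mk.injEq] at h
          obtain ⟨⟨h1, h2⟩, h3⟩ := h
          have a1 : y1 = y1' := Units.ext (by linear_combination h3 - h1)
          have a2 : x2 = x2' := Units.ext (by linear_combination h3 - h1 - h2)
          have a3 : y2 = y2' := Units.ext (by linear_combination hr'.1 - hr.1 + h1 - h2 + h3 - h1 + h2 + (h3 - h1 - h2) - (h3 - h1))
          rw [Units.ext h3, a1, a2, a3]
    _ = ∑ q : ZMod a × ZMod a, (Finset.univ.filter fun x : ZMod a => 2 * (q.1 * q.2) * x = q.1 * q.2 * (q.1 + q.2)).card := by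
        simp_rw [Finset.card_filter]
        rw [← Finset.univ_product_univ, Finset.sum_product]
    _ ≤ ∑ q : ZMod a × ZMod a, 2 * (zgcd q.1 * zgcd q.2) := by
        refine Finset.sum_le_sum fun q _ => (card_mul_eq_le _ _).trans ((zgcd_mul_le _ _).trans ?_)
        exact Nat.mul_le_mul h2 (zgcd_mul_le _ _)
    _ = 2 * (∑ h : ZMod a, zgcd h) ^ 2 := by
        rw [← Finset.mul_sum, sq, Finset.sum_mul_sum, ← Finset.univ_product_univ, Finset.sum_product]
    _ ≤ _ := by gcongr; exact sum_zgcd_le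

theorem sum_kl_le : ∑ h : ZMod a, ∑ k : ZMod a, ‖kl h k‖ ^ 4 ≤ 2 * (a:ℝ) ^ 4 * (a.divisors.card:ℝ) ^ 2 := by
  have h1 := sum_normSq_eq (a := a) (fun q : (ZMod a)ˣ × (ZMod a)ˣ => (q.1 : ZMod a) + (q.2 : ZMod a))
    (fun q => ((q.1⁻¹ : (ZMod a)ˣ) : ZMod a) + ((q.2⁻¹ : (ZMod a)ˣ) : ZMod a))
  have h2 : ∀ h k : ZMod a, ∑ q : (ZMod a)ˣ × (ZMod a)ˣ, ZMod.stdAddChar (h * ((q.1 : ZMod a) + (q.2 : ZMod a)) +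
      k * (((q.1⁻¹ : (ZMod a)ˣ) : ZMod a) + ((q.2⁻¹ : (ZMod a)ˣ) : ZMod a))) = kl h k ^ 2 := by
    intro h k
    rw [sq, kl, Finset.sum_mul_sum, ← Finset.univ_product_univ, Finset.sum_product]
    refine Finset.sum_congr rfl fun x _ => Finset.sum_congr rfl fun y _ => ?_
    rw [← AddChar.map_add_eq_mul]; congr 1; ring
  simp_rw [h2] at h1
  have h3 : ∀ h k : ZMod a, ‖kl h k‖ ^ 4 = ‖kl h k ^ 2‖ ^ 2 := fun h k => by rw [norm_pow, ← pow_mul]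
  simp_rw [h3]
  rw [h1]
  have h4 := kl_energy_le (a := a)
  have h5 : ((Finset.univ.filter fun r : ((ZMod a)ˣ × (ZMod a)ˣ) × ((ZMod a)ˣ × (ZMod a)ˣ) =>
    (r.1.1 : ZMod a) + (r.1.2 : ZMod a) = (r.2.1 : ZMod a) + (r.2.2 : ZMod a) ∧
    ((r.1.1⁻¹ : (ZMod a)ˣ) : ZMod a) + ((r.1.2⁻¹ : (ZMod a)ˣ) : ZMod a) =
      ((r.2.1⁻¹ : (ZMod a)ˣ) : ZMod a) + ((r.2.2⁻¹ : (ZMod a)ˣ) : ZMod a)).card : ℝ) ≤ 2 * (a.divisors.card * a) ^ 2 := by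
    exact_mod_cast h4
  calc _ ≤ (a:ℝ) ^ 2 * (2 * (a.divisors.card * a) ^ 2) := by gcongr
    _ = _ := by ring

theorem kl_pow_le (h k : ZMod a) : ‖kl h k‖ ^ 4 ≤ 2 * (a:ℝ) ^ 3 * (a.divisors.card:ℝ) ^ 3 * zgcd h := by
  have ha : 0 < (a:ℝ) := by exact_mod_cast NeZero.pos a
  have h1 : (a.totient : ℝ) * ‖kl h k‖ ^ 4 ≤ zgcd h * (2 * (a:ℝ) ^ 4 * (a.divisors.card:ℝ) ^ 2) := by
    calc (a.totient : ℝ) * ‖kl h k‖ ^ 4 = ∑ v : (ZMod a)ˣ, ‖kl (h * (v : ZMod a)) (k * ((v⁻¹ : (ZMod a)ˣ) : ZMod a))‖ ^ 4 := by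
          simp_rw [kl_mul]
          rw [Finset.sum_const, nsmul_eq_mul, Finset.card_univ, ZMod.card_units_eq_totient]
      _ = ∑ q : ZMod a × ZMod a, ∑ v ∈ Finset.univ.filter (fun v : (ZMod a)ˣ => (h * (v : ZMod a), k * ((v⁻¹ : (ZMod a)ˣ) : ZMod a)) = q), ‖kl q.1 q.2‖ ^ 4 := by
          rw [← Finset.sum_fiberwise (Finset.univ) (fun v : (ZMod a)ˣ => (h * (v : ZMod a), k * ((v⁻¹ : (ZMod a)ˣ) : ZMod a)))]
          refine Finset.sum_congr rfl fun q _ => Finset.sum_congr rfl fun v hv => ?_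
          rw [← (Finset.mem_filter.1 hv).2]
      _ ≤ ∑ q : ZMod a × ZMod a, zgcd h * ‖kl q.1 q.2‖ ^ 4 := by
          refine Finset.sum_le_sum fun q _ => ?_
          rw [Finset.sum_const, nsmul_eq_mul]
          gcongr
          refine le_trans ?_ (card_mul_eq_le h q.1)
          refine Finset.card_le_card_of_injOn (fun v => (v : ZMod a)) (fun v hv => ?_) (fun x _ y _ hxy => Units.ext hxy)
          simp only [Finset.coe_filter, Finset.mem_univ, true_and, Set.mem_setOf_eq] at hv ⊢
          rw [← hv]
      _ = zgcd h * ∑ h : ZMod a, ∑ k : ZMod a, ‖kl h k‖ ^ 4 := by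
          rw [← Finset.mul_sum, ← Finset.univ_product_univ, Finset.sum_product]
      _ ≤ _ := by gcongr; exact sum_kl_le
  have h2 : (a:ℝ) ≤ a.divisors.card * a.totient := by exact_mod_cast le_card_divisors_mul_totient a
  have h3 : (a:ℝ) * ‖kl h k‖ ^ 4 ≤ a * (2 * (a:ℝ) ^ 3 * (a.divisors.card:ℝ) ^ 3 * zgcd h) := by
    calc _ ≤ a.divisors.card * a.totient * ‖kl h k‖ ^ 4 := by gcongr
      _ = a.divisors.card * (a.totient * ‖kl h k‖ ^ 4) := by ring
      _ ≤ a.divisors.card * (zgcd h * (2 * (a:ℝ) ^ 4 * (a.divisors.card:ℝ) ^ 2)) := by gcongr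
      _ = _ := by ring
  exact le_of_mul_le_mul_left h3 ha

theorem kl_comm (h k : ZMod a) : kl h k = kl k h := by
  rw [kl, kl]
  refine Fintype.sum_equiv (Equiv.inv _) _ _ fun u => ?_
  simp only [Equiv.inv_apply, inv_inv]
  rw [add_comm]

theorem kl_zero_zero : kl (0 : ZMod a) 0 = a.totient := by
  simp [kl, ZMod.card_units_eq_totient]

end kloosterman

section box

variable {a : ℕ} [NeZero a]

theorem zgcd_mul_unit (h : ZMod a) (l : (ZMod a)ˣ) : zgcd (h * (l : ZMod a)) = zgcd h := by
  have hu : ∀ l : (ZMod a)ˣ, zgcd (l : ZMod a) = 1 := fun l => ZMod.val_coe_unit_coprime l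
  refine le_antisymm ?_ ?_
  · have := zgcd_mul_le h (l : ZMod a)
    rwa [hu, mul_one] at this
  · have := zgcd_mul_le (h * (l : ZMod a)) ((l⁻¹ : (ZMod a)ˣ) : ZMod a)
    rwa [hu, mul_one, mul_assoc, Units.mul_inv, mul_one] at this

theorem zgcd_neg (h : ZMod a) : zgcd (-h) = zgcd h := by
  have := zgcd_mul_unit h (-1)
  simpa using this

/-- Bound for a linear exponential sum over an interval of length at most `a`. -/
noncomputable def expBd (w : ZMod a) : ℝ := if w = 0 then (a:ℝ) else a / 2 * (1 / (w.val : ℝ)) + a / 2 * (1 / ((-w).val : ℝ))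

theorem expBd_nonneg (w : ZMod a) : 0 ≤ expBd w := by
  unfold expBd; split_ifs <;> positivity

theorem norm_stdAddChar_sub_one_inv_le {w : ZMod a} (hw : w ≠ 0) :
    2 / ‖ZMod.stdAddChar w - 1‖ ≤ a / 2 * (1 / (w.val : ℝ)) + a / 2 * (1 / ((-w).val : ℝ)) := by
  have ha : (0:ℝ) < a := by exact_mod_cast NeZero.pos a
  have hn : 0 < w.val := ZMod.val_pos.2 hw
  have hn' : w.val < a := ZMod.val_lt w
  have e1 : (((-w).val : ℕ) : ℝ) = a - w.val := by
    rw [ZMod.neg_val, if_neg hw, Nat.cast_sub hn'.le]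
  rw [e1]
  have e2 : ‖ZMod.stdAddChar w - 1‖ = 2 * Real.sin (Real.pi * (w.val / a)) := by
    rw [ZMod.stdAddChar_apply, ZMod.toCircle_apply]
    have := Complex.norm_exp_I_mul_ofReal_sub_one (2 * Real.pi * (w.val / a))
    have h3 : (2 * Real.pi * Complex.I * w.val / a : ℂ) = Complex.I * ((2 * Real.pi * (w.val / a) : ℝ) : ℂ) := by
      push_cast; ring
    rw [h3, this, Real.norm_eq_abs, abs_of_nonneg]
    · congr 2; ring
    · refine mul_nonneg two_pos.le (Real.sin_nonneg_of_nonneg_of_le_pi (by positivity) ?_)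
      have : (w.val : ℝ) / a ≤ 1 := by rw [div_le_one ha]; exact_mod_cast hn'.le
      nlinarith [Real.pi_pos]
  have hw0 : (0:ℝ) < w.val := by exact_mod_cast hn
  have hw1 : (0:ℝ) < a - w.val := by rw [sub_pos]; exact_mod_cast hn'
  rw [e2, mul_comm (2:ℝ) (Real.sin _), ← div_div, div_right_comm, div_self two_ne_zero]
  rcases le_total ((w.val : ℝ) / a) (1/2) with h | h
  · have h1 := Real.mul_le_sin (x := Real.pi * (w.val / a)) (by positivity) (by nlinarith [Real.pi_pos])
    have h2 : 2 / Real.pi * (Real.pi * (w.val / a)) = 2 * w.val / a := by field_simp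
    rw [h2] at h1
    calc 1 / Real.sin (Real.pi * (w.val / a)) ≤ 1 / (2 * w.val / a) := one_div_le_one_div_of_le (by positivity) h1
      _ = a / 2 * (1 / w.val) := by field_simp
      _ ≤ _ := by have : 0 ≤ a / 2 * (1 / ((a:ℝ) - w.val)) := by positivity
                  linarith
  · have hlt : (w.val : ℝ) / a ≤ 1 := by rw [div_le_one ha]; exact_mod_cast hn'.le
    have h1 := Real.mul_le_sin (x := Real.pi - Real.pi * (w.val / a)) (by nlinarith [Real.pi_pos]) (by nlinarith [Real.pi_pos])
    have h2 : 2 / Real.pi * (Real.pi - Real.pi * (w.val / a)) = 2 * (a - w.val) / a := by field_simp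
    rw [h2, Real.sin_pi_sub] at h1
    calc 1 / Real.sin (Real.pi * (w.val / a)) ≤ 1 / (2 * (a - w.val) / a) := one_div_le_one_div_of_le (by positivity) h1
      _ = a / 2 * (1 / (a - w.val)) := by field_simp
      _ ≤ _ := by have : 0 ≤ a / 2 * (1 / (w.val : ℝ)) := by positivity
                  linarith

theorem norm_sum_Ico_le (w : ZMod a) (i : ℤ) {m : ℕ} (hm : m ≤ a) :
    ‖∑ x ∈ Finset.Ico i (i + m), ZMod.stdAddChar (w * (x : ZMod a))‖ ≤ expBd w := by
  unfold expBd
  split_ifs with hw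
  · subst hw
    simp only [zero_mul, AddChar.map_zero_eq_one, Finset.sum_const, Int.card_Ico]
    simpa using (by exact_mod_cast hm : (m:ℝ) ≤ a)
  · have h1 : ∑ x ∈ Finset.Ico i (i + m), ZMod.stdAddChar (w * (x : ZMod a)) =
        ZMod.stdAddChar (w * (i : ZMod a)) * ∑ j ∈ Finset.range m, (ZMod.stdAddChar w : ℂ) ^ j := by
      rw [Finset.mul_sum]
      refine (Finset.sum_bij (fun (j : ℕ) _ => i + (j:ℤ)) ?_ ?_ ?_ ?_).symm
      · intro j hj; rw [Finset.mem_range] at hj; rw [Finset.mem_Ico]; omega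
      · intro j _ j' _ h; simpa using h
      · intro x hx
        rw [Finset.mem_Ico] at hx
        exact ⟨(x - i).toNat, Finset.mem_range.2 (by omega), by omega⟩
      · intro j _
        rw [← AddChar.map_nsmul_eq_pow, ← AddChar.map_add_eq_mul]
        congr 1; push_cast; rw [nsmul_eq_mul]; ring
    have hne : (ZMod.stdAddChar w : ℂ) ≠ 1 := by
      intro h
      exact hw (ZMod.injective_stdAddChar (by rw [h, AddChar.map_zero_eq_one]))
    rw [h1, norm_mul, AddChar.norm_apply, one_mul, geom_sum_eq hne, norm_div]
    refine le_trans ?_ (norm_stdAddChar_sub_one_inv_le hw)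
    gcongr
    refine (norm_sub_le _ _).trans ?_
    rw [norm_pow, AddChar.norm_apply]; norm_num

theorem sum_ne_zero_val_le (f : ℕ → ℝ) (hf : ∀ n, 0 ≤ f n) :
    ∑ w ∈ Finset.univ.filter (fun w : ZMod a => w ≠ 0), f w.val ≤ ∑ n ∈ Finset.Icc 1 a, f n := by
  rw [← Finset.sum_image (f := f) (g := fun w : ZMod a => w.val) (fun x _ y _ h => ZMod.val_injective a h)]
  refine Finset.sum_le_sum_of_subset_of_nonneg ?_ fun _ _ _ => hf _
  intro n hn
  obtain ⟨w, hw, rfl⟩ := Finset.mem_image.1 hn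
  exact Finset.mem_Icc.2 ⟨ZMod.val_pos.2 (Finset.mem_filter.1 hw).2, (ZMod.val_lt w).le⟩

theorem sum_expBd_aux (f : ZMod a → ℝ) (hf : ∀ w, f (-w) = f w) :
    ∑ w ∈ Finset.univ.filter (fun w : ZMod a => w ≠ 0), expBd w * f w =
      a * ∑ w ∈ Finset.univ.filter (fun w : ZMod a => w ≠ 0), f w / w.val := by
  have h1 : ∑ w ∈ Finset.univ.filter (fun w : ZMod a => w ≠ 0), f w / (-w).val =
      ∑ w ∈ Finset.univ.filter (fun w : ZMod a => w ≠ 0), f w / w.val := by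
    refine Finset.sum_nbij' (fun w => -w) (fun w => -w) ?_ ?_ ?_ ?_ ?_
    · simp
    · simp
    · simp
    · simp
    · intro w _; rw [hf]
  have h2 : ∑ w ∈ Finset.univ.filter (fun w : ZMod a => w ≠ 0), expBd w * f w =
      a / 2 * ∑ w ∈ Finset.univ.filter (fun w : ZMod a => w ≠ 0), f w / w.val +
      a / 2 * ∑ w ∈ Finset.univ.filter (fun w : ZMod a => w ≠ 0), f w / (-w).val := by
    rw [Finset.mul_sum, Finset.mul_sum, ← Finset.sum_add_distrib]
    refine Finset.sum_congr rfl fun w hw => ?_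
    rw [expBd, if_neg (Finset.mem_filter.1 hw).2]; ring
  rw [h2, h1]; ring

theorem sum_expBd_le : ∑ w ∈ Finset.univ.filter (fun w : ZMod a => w ≠ 0), expBd w ≤ a * (1 + Real.log a) := by
  have h := sum_expBd_aux (a := a) (fun _ => 1) (fun _ => rfl)
  simp only [mul_one] at h
  rw [h]
  gcongr
  refine (sum_ne_zero_val_le (fun n => 1 / (n:ℝ)) fun n => by positivity).trans (sum_Icc_inv_le a)

theorem sum_expBd_zgcd_le : ∑ w ∈ Finset.univ.filter (fun w : ZMod a => w ≠ 0), expBd w * (zgcd w : ℝ) ^ (1/4:ℝ) ≤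
    a * (a.divisors.card * (1 + Real.log a)) := by
  rw [sum_expBd_aux (a := a) (fun w => (zgcd w : ℝ) ^ (1/4:ℝ)) (fun w => by simp only [zgcd_neg])]
  gcongr
  refine (sum_ne_zero_val_le (fun n => (Nat.gcd n a : ℝ) ^ (1/4:ℝ) / (n:ℝ)) fun n => by positivity).trans
    (sum_gcd_rpow_div_le a (NeZero.ne a))

end box

section box

variable {a : ℕ} [NeZero a]

/-- Points of a box on the hyperbola `(β + λ x) (γ + λ y) = -1` modulo `a`. -/
noncomputable def boxCnt (β γ : ZMod a) (l : (ZMod a)ˣ) (i j : ℤ) (m n : ℕ) : ℕ :=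
  ((Finset.Ico i (i + m) ×ˢ Finset.Ico j (j + n)).filter fun q : ℤ × ℤ =>
    (β + (l : ZMod a) * (q.1 : ZMod a)) * (γ + (l : ZMod a) * (q.2 : ZMod a)) = -1).card

theorem boxCnt_fourier (β γ : ZMod a) (l : (ZMod a)ˣ) (i j : ℤ) (m n : ℕ) :
    ((a:ℂ) ^ 2 * (boxCnt β γ l i j m n : ℂ)) = ∑ q : ZMod a × ZMod a,
      (∑ x ∈ Finset.Ico i (i + m), ZMod.stdAddChar (-(q.1 * (β + (l : ZMod a) * (x : ZMod a))))) *
      (∑ y ∈ Finset.Ico j (j + n), ZMod.stdAddChar (q.2 * (γ + (l : ZMod a) * (y : ZMod a)))) * kl q.1 q.2 := by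
  have key : ∀ x : ZMod a, ∑ h : ZMod a, ZMod.stdAddChar (h * x) = if x = 0 then (a:ℂ) else 0 := by
    intro x
    have := AddChar.sum_mulShift (ψ := ZMod.stdAddChar (N := a)) x (ZMod.isPrimitive_stdAddChar a)
    simpa using this
  symm
  calc _ = ∑ q : ZMod a × ZMod a, ∑ x ∈ Finset.Ico i (i + m), ∑ y ∈ Finset.Ico j (j + n), ∑ u : (ZMod a)ˣ,
        ZMod.stdAddChar (q.1 * ((u : ZMod a) - (β + (l : ZMod a) * (x : ZMod a)))) *
        ZMod.stdAddChar (q.2 * (((u⁻¹ : (ZMod a)ˣ) : ZMod a) + (γ + (l : ZMod a) * (y : ZMod a)))) := by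
        refine Finset.sum_congr rfl fun q _ => ?_
        rw [Finset.sum_mul_sum, kl, Finset.sum_mul]
        refine Finset.sum_congr rfl fun x _ => ?_
        rw [Finset.sum_mul]
        refine Finset.sum_congr rfl fun y _ => ?_
        rw [Finset.mul_sum]
        refine Finset.sum_congr rfl fun u _ => ?_
        rw [← AddChar.map_add_eq_mul, ← AddChar.map_add_eq_mul, ← AddChar.map_add_eq_mul]
        congr 1; ring
    _ = ∑ x ∈ Finset.Ico i (i + m), ∑ y ∈ Finset.Ico j (j + n), ∑ u : (ZMod a)ˣ,
        if (u : ZMod a) = β + (l : ZMod a) * (x : ZMod a) ∧ ((u⁻¹ : (ZMod a)ˣ) : ZMod a) + (γ + (l : ZMod a) * (y : ZMod a)) = 0 then (a:ℂ) ^ 2 else 0 := by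
        rw [Finset.sum_comm]
        refine Finset.sum_congr rfl fun x _ => ?_
        rw [Finset.sum_comm]
        refine Finset.sum_congr rfl fun y _ => ?_
        rw [Finset.sum_comm]
        refine Finset.sum_congr rfl fun u _ => ?_
        rw [← Finset.univ_product_univ, Finset.sum_product]
        simp only
        rw [← Finset.sum_mul_sum, key, key]
        simp only [sub_eq_zero]
        by_cases h1 : (u : ZMod a) = β + (l : ZMod a) * (x : ZMod a) <;>
          by_cases h2 : ((u⁻¹ : (ZMod a)ˣ) : ZMod a) + (γ + (l : ZMod a) * (y : ZMod a)) = 0 <;> simp [h1, h2, sq]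
    _ = ∑ x ∈ Finset.Ico i (i + m), ∑ y ∈ Finset.Ico j (j + n),
        if (β + (l : ZMod a) * (x : ZMod a)) * (γ + (l : ZMod a) * (y : ZMod a)) = -1 then (a:ℂ) ^ 2 else 0 := by
        refine Finset.sum_congr rfl fun x _ => Finset.sum_congr rfl fun y _ => ?_
        generalize β + (l : ZMod a) * (x : ZMod a) = s
        generalize γ + (l : ZMod a) * (y : ZMod a) = t
        split_ifs with h
        · have hst : s * (-t) = 1 := by linear_combination -h
          have hts : (-t) * s = 1 := by linear_combination -h
          set u0 : (ZMod a)ˣ := ⟨s, -t, hst, hts⟩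
          rw [Finset.sum_eq_single u0]
          · rw [if_pos]
            exact ⟨rfl, show -t + t = 0 by ring⟩
          · intro u _ hu
            rw [if_neg]
            rintro ⟨h1, -⟩
            exact hu (Units.ext h1)
          · simp
        · refine Finset.sum_eq_zero fun u _ => if_neg ?_
          rintro ⟨h1, h2⟩
          refine h ?_
          rw [← h1]
          linear_combination (u : ZMod a) * h2 - Units.mul_inv u
    _ = _ := by
        rw [← Finset.sum_product' (f := fun x y : ℤ => if (β + (l : ZMod a) * (x : ZMod a)) * (γ + (l : ZMod a) * (y : ZMod a)) = -1 then (a:ℂ) ^ 2 else 0),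
          ← Finset.sum_filter, Finset.sum_const, nsmul_eq_mul, boxCnt, mul_comm]

theorem expBd_neg (w : ZMod a) : expBd (-w) = expBd w := by
  unfold expBd
  rw [neg_neg]; simp only [neg_eq_zero]; rw [add_comm (_ * _)]

theorem boxCnt_sub_le (β γ : ZMod a) (l : (ZMod a)ˣ) (i j : ℤ) {m n : ℕ} (hm : m ≤ a) (hn : n ≤ a) :
    (a:ℝ) ^ 2 * |(boxCnt β γ l i j m n : ℝ) - a.totient * m * n / (a:ℝ) ^ 2| ≤
      (2 * (a:ℝ) ^ 3 * (a.divisors.card:ℝ) ^ 3) ^ (1/4:ℝ) *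
        ((a * (a.divisors.card * (1 + Real.log a))) * (a * (3 + Real.log a))) := by
  have ha : (0:ℝ) < a := by exact_mod_cast NeZero.pos a
  have hBpos : 0 ≤ 2 * (a:ℝ) ^ 3 * (a.divisors.card:ℝ) ^ 3 := by positivity
  set F : ZMod a → ℂ := fun h => ∑ x ∈ Finset.Ico i (i + m), ZMod.stdAddChar (-(h * (β + (l : ZMod a) * (x : ZMod a))))
  set G : ZMod a → ℂ := fun k => ∑ y ∈ Finset.Ico j (j + n), ZMod.stdAddChar (k * (γ + (l : ZMod a) * (y : ZMod a)))
  set E : ZMod a → ℝ := fun h => expBd (h * (l : ZMod a))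
  have hE : ∀ h, 0 ≤ E h := fun h => expBd_nonneg _
  set B := (2 * (a:ℝ) ^ 3 * (a.divisors.card:ℝ) ^ 3) ^ (1/4:ℝ)
  have hB : 0 ≤ B := by positivity
  set Z : ZMod a → ℝ := fun h => (zgcd h : ℝ) ^ (1/4:ℝ)
  have hZ : ∀ h, 0 ≤ Z h := fun h => by positivity
  have hF : ∀ h, ‖F h‖ ≤ E h := by
    intro h
    have : F h = ZMod.stdAddChar (-(h * β)) * ∑ x ∈ Finset.Ico i (i + m), ZMod.stdAddChar (-(h * (l : ZMod a)) * (x : ZMod a)) := by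
      rw [Finset.mul_sum]
      refine Finset.sum_congr rfl fun x _ => ?_
      rw [← AddChar.map_add_eq_mul]; congr 1; ring
    rw [this, norm_mul, AddChar.norm_apply, one_mul]
    exact (norm_sum_Ico_le _ i hm).trans (expBd_neg _).le
  have hG : ∀ h, ‖G h‖ ≤ E h := by
    intro h
    have : G h = ZMod.stdAddChar (h * γ) * ∑ x ∈ Finset.Ico j (j + n), ZMod.stdAddChar ((h * (l : ZMod a)) * (x : ZMod a)) := by
      rw [Finset.mul_sum]
      refine Finset.sum_congr rfl fun x _ => ?_
      rw [← AddChar.map_add_eq_mul]; congr 1; ring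
    rw [this, norm_mul, AddChar.norm_apply, one_mul]
    exact norm_sum_Ico_le _ j hn
  have hkl : ∀ h k : ZMod a, ‖kl h k‖ ≤ B * Z h := by
    intro h k
    have h1 := kl_pow_le h k
    have h2 : ‖kl h k‖ = (‖kl h k‖ ^ 4) ^ (1/4:ℝ) := by
      rw [← Real.rpow_natCast, ← Real.rpow_mul (norm_nonneg _)]; norm_num
    have h3 : B * Z h = (2 * (a:ℝ) ^ 3 * (a.divisors.card:ℝ) ^ 3 * (zgcd h : ℝ)) ^ (1/4:ℝ) :=
      (Real.mul_rpow hBpos (Nat.cast_nonneg _)).symm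
    rw [h2, h3]
    exact Real.rpow_le_rpow (pow_nonneg (norm_nonneg _) 4) h1 (by norm_num)
  have h00 : F 0 * G 0 * kl (0 : ZMod a) 0 = (m:ℂ) * n * a.totient := by
    simp only [F, G, zero_mul, neg_zero, AddChar.map_zero_eq_one, kl_zero_zero, Finset.sum_const, Int.card_Ico]
    simp
  have hre : ∀ f : ZMod a → ℝ, ∑ h : ZMod a, (if h ≠ 0 then f (h * (l : ZMod a)) else 0) = ∑ w ∈ Finset.univ.filter (fun w : ZMod a => w ≠ 0), f w := by
    intro f
    rw [Finset.sum_filter]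
    refine Fintype.sum_equiv (Units.mulRight l) _ _ fun h => ?_
    show (if h ≠ 0 then f (h * (l : ZMod a)) else 0) = if h * (l : ZMod a) ≠ 0 then f (h * (l : ZMod a)) else 0
    simp only [ne_eq, Units.mul_left_eq_zero]
  set S1 := ∑ h : ZMod a, (if h ≠ 0 then E h * Z h else 0) with hS1
  set S0 := ∑ h : ZMod a, (if h ≠ 0 then E h else 0) with hS0
  have hS1le : S1 ≤ a * (a.divisors.card * (1 + Real.log a)) := by
    have : S1 = ∑ w ∈ Finset.univ.filter (fun w : ZMod a => w ≠ 0), expBd w * (zgcd w : ℝ) ^ (1/4:ℝ) := by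
      rw [← hre]
      refine Finset.sum_congr rfl fun h _ => ?_
      simp only [E, Z, zgcd_mul_unit]
    rw [this]; exact sum_expBd_zgcd_le
  have hS0le : S0 ≤ a * (1 + Real.log a) := by
    have : S0 = _ := hre expBd
    rw [this]; exact sum_expBd_le
  have hS1n : 0 ≤ S1 := Finset.sum_nonneg fun h _ => by split_ifs; exacts [mul_nonneg (hE h) (hZ h), le_rfl]
  have hE0 : E 0 = a := by
    show expBd ((0 : ZMod a) * (l : ZMod a)) = a
    rw [zero_mul, expBd, if_pos rfl]
  have hsumE : ∑ h : ZMod a, E h = a + S0 := by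
    rw [← hE0, hS0, ← Finset.sum_filter, Finset.filter_ne', Finset.add_sum_erase _ _ (Finset.mem_univ _)]
  have hmain : (a:ℂ) ^ 2 * (boxCnt β γ l i j m n : ℂ) - (m:ℂ) * n * a.totient =
      ∑ q ∈ Finset.univ.filter (fun q : ZMod a × ZMod a => q ≠ 0), F q.1 * G q.2 * kl q.1 q.2 := by
    rw [boxCnt_fourier, ← h00, Finset.filter_ne', sub_eq_iff_eq_add',
      ← Finset.add_sum_erase _ _ (Finset.mem_univ (0 : ZMod a × ZMod a))]
    rfl
  have hle : ‖(a:ℂ) ^ 2 * (boxCnt β γ l i j m n : ℂ) - (m:ℂ) * n * a.totient‖ ≤ B * (S1 * (a + S0) + a * S1) := by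
    rw [hmain]
    refine (norm_sum_le _ _).trans ?_
    have hpt : ∀ q ∈ Finset.univ.filter (fun q : ZMod a × ZMod a => q ≠ 0), ‖F q.1 * G q.2 * kl q.1 q.2‖ ≤
        B * ((if q.1 ≠ 0 then E q.1 * Z q.1 else 0) * E q.2 + (if q.1 = 0 then (a:ℝ) else 0) * (if q.2 ≠ 0 then E q.2 * Z q.2 else 0)) := by
      rintro ⟨h, k⟩ hq
      have hq' := (Finset.mem_filter.1 hq).2
      simp only
      rw [norm_mul, norm_mul]
      by_cases hh : h = 0
      · subst hh
        have hk : k ≠ 0 := fun hk => hq' (by rw [hk]; rfl)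
        rw [if_neg (by simp), if_pos rfl, if_pos hk, zero_mul, zero_add, ← hE0]
        calc _ ≤ E 0 * E k * (B * Z k) := by
              gcongr
              · exact mul_nonneg (hE _) (hE _)
              · exact hE _
              · exact hF _
              · exact hG _
              · rw [kl_comm]; exact hkl _ _
          _ = _ := by ring
      · rw [if_pos hh, if_neg hh, zero_mul, add_zero]
        calc _ ≤ E h * E k * (B * Z h) := by
              gcongr
              · exact mul_nonneg (hE _) (hE _)
              · exact hE _
              · exact hF _
              · exact hG _
              · exact hkl _ _
          _ = _ := by ring
    refine (Finset.sum_le_sum hpt).trans ?_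
    refine (Finset.sum_le_sum_of_subset_of_nonneg (Finset.filter_subset _ _) fun q _ _ => ?_).trans ?_
    · refine mul_nonneg hB (add_nonneg (mul_nonneg ?_ (hE _)) (mul_nonneg ?_ ?_)) <;> split_ifs
      · exact mul_nonneg (hE _) (hZ _)
      · exact le_rfl
      · exact ha.le
      · exact le_rfl
      · exact mul_nonneg (hE _) (hZ _)
      · exact le_rfl
    · refine le_of_eq ?_
      rw [← Finset.mul_sum, Finset.sum_add_distrib, ← Finset.univ_product_univ, Finset.sum_product, Finset.sum_product]
      simp only
      rw [← Finset.sum_mul_sum, hsumE]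
      have h3 : ∑ x : ZMod a, ∑ y : ZMod a, (if x = 0 then (a:ℝ) else 0) * (if y ≠ 0 then E y * Z y else 0) = a * S1 := by
        have h4 : ∀ x : ZMod a, ∑ y : ZMod a, (if x = 0 then (a:ℝ) else 0) * (if y ≠ 0 then E y * Z y else 0) = (if x = 0 then (a:ℝ) else 0) * S1 :=
          fun x => (Finset.mul_sum _ _ _).symm
        rw [Finset.sum_congr rfl fun x _ => h4 x, ← Finset.sum_mul]
        congr 1
        simp
      rw [h3]
  have hcast : ‖(a:ℂ) ^ 2 * (boxCnt β γ l i j m n : ℂ) - (m:ℂ) * n * a.totient‖ =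
      (a:ℝ) ^ 2 * |(boxCnt β γ l i j m n : ℝ) - a.totient * m * n / (a:ℝ) ^ 2| := by
    have : (a:ℂ) ^ 2 * (boxCnt β γ l i j m n : ℂ) - (m:ℂ) * n * a.totient =
      (((a:ℝ) ^ 2 * ((boxCnt β γ l i j m n : ℝ) - a.totient * m * n / (a:ℝ) ^ 2) : ℝ) : ℂ) := by
      have ha' : (a:ℂ) ≠ 0 := by exact_mod_cast ha.ne'
      push_cast; field_simp
    rw [this, Complex.norm_real, Real.norm_eq_abs, abs_mul, abs_of_nonneg (by positivity : (0:ℝ) ≤ (a:ℝ) ^ 2)]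
  rw [← hcast]
  refine hle.trans ?_
  gcongr
  calc S1 * (a + S0) + a * S1 = S1 * (2 * a + S0) := by ring
    _ ≤ S1 * (a * (3 + Real.log a)) := by
        gcongr; linarith
    _ ≤ _ := by
        gcongr

end box

theorem boxCnt_asymp : ∃ C : ℝ, 0 < C ∧ ∀ (a : ℕ) [NeZero a] (β γ : ZMod a) (l : (ZMod a)ˣ) (i j : ℤ) (m n : ℕ),
    m ≤ a → n ≤ a → |(boxCnt β γ l i j m n : ℝ) - a.totient * m * n / (a:ℝ) ^ 2| ≤ C * (a:ℝ) ^ (7/8:ℝ) := by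
  obtain ⟨C, hC1, hC⟩ := card_divisors_le_rpow (ε := 1/32) (by norm_num) (by norm_num)
  refine ⟨2 * (C ^ 2 * (33 * (99))), by positivity, ?_⟩
  intro a _ β γ l i j m n hm hn
  have ha1 : (1:ℝ) ≤ a := by exact_mod_cast NeZero.pos a
  have ha : (0:ℝ) < a := by linarith
  have h := boxCnt_sub_le β γ l i j hm hn
  have hτ := hC a (NeZero.ne a)
  have hτ1 : (1:ℝ) ≤ a.divisors.card := by
    exact_mod_cast Finset.card_pos.2 ⟨1, Nat.one_mem_divisors.2 (NeZero.ne a)⟩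
  have hL : Real.log a ≤ 32 * (a:ℝ) ^ (1/32:ℝ) := by
    have := Real.log_le_rpow_div ha.le (ε := 1/32) (by norm_num)
    linarith
  have hL0 : 0 ≤ Real.log a := Real.log_nonneg ha1
  have hp1 : (1:ℝ) ≤ (a:ℝ) ^ (1/32:ℝ) := Real.one_le_rpow ha1 (by norm_num)
  set P := (a:ℝ) ^ (1/32:ℝ)
  set T := (a.divisors.card : ℝ)
  have hB : (2 * (a:ℝ) ^ 3 * T ^ 3) ^ (1/4:ℝ) ≤ 2 * (a:ℝ) ^ (3/4:ℝ) * T := by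
    have h1 : 2 * (a:ℝ) ^ 3 * T ^ 3 ≤ 2 ^ 4 * (a:ℝ) ^ 3 * T ^ 4 := by
      gcongr <;> norm_num
    refine (Real.rpow_le_rpow (by positivity) h1 (by norm_num)).trans (le_of_eq ?_)
    rw [Real.mul_rpow (by positivity) (by positivity), Real.mul_rpow (by positivity) (by positivity),
      ← Real.rpow_natCast, ← Real.rpow_natCast, ← Real.rpow_natCast, ← Real.rpow_mul (by positivity),
      ← Real.rpow_mul (by positivity), ← Real.rpow_mul (by positivity)]
    norm_num
  have h78 : (a:ℝ) ^ (3/4:ℝ) * P ^ 4 = (a:ℝ) ^ (7/8:ℝ) := by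
    rw [← Real.rpow_natCast P, ← Real.rpow_mul ha.le, ← Real.rpow_add ha]; norm_num
  have ha2 : (0:ℝ) < (a:ℝ) ^ 2 := by positivity
  refine le_of_mul_le_mul_left (h.trans ?_) ha2
  calc _ ≤ 2 * (a:ℝ) ^ (3/4:ℝ) * (C * P) * ((a * ((C * P) * (33 * P))) * (a * (99 * P))) := by
        have e1 : (2 * (a:ℝ) ^ 3 * T ^ 3) ^ (1/4:ℝ) ≤ 2 * (a:ℝ) ^ (3/4:ℝ) * (C * P) := hB.trans (by gcongr)
        gcongr
        · linarith
        · linarith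
    _ = (a:ℝ) ^ 2 * (2 * (C ^ 2 * (33 * 99)) * ((a:ℝ) ^ (3/4:ℝ) * P ^ 4)) := by ring
    _ = _ := by rw [h78]

section totient

variable {p : ℕ} [Fact p.Prime]

theorem card_filter_Ioc_add_eq_one (r : ZMod p) (N : ℕ) :
    ((Finset.Ioc N (N + p)).filter fun m : ℕ => (m : ZMod p) = r).card = 1 := by
  have hp : 0 < p := (Fact.out : p.Prime).pos
  have h1 := Nat.Ioc_filter_modEq_card N (N + p) hp r.val
  have h2 : (Finset.Ioc N (N + p)).filter (fun m : ℕ => (m : ZMod p) = r) =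
      (Finset.Ioc N (N + p)).filter (fun m : ℕ => m ≡ r.val [MOD p]) := by
    refine Finset.filter_congr fun m _ => ?_
    rw [← ZMod.natCast_eq_natCast_iff, ZMod.natCast_zmod_val]
  rw [h2]
  have h3 : (((N + p : ℕ) : ℚ) - r.val) / p = (N - r.val) / p + 1 := by
    have : (p:ℚ) ≠ 0 := by exact_mod_cast hp.ne'
    push_cast; field_simp; ring
  rw [h3, Int.floor_add_one] at h1
  have h4 : (((Finset.Ioc N (N + p)).filter (fun m : ℕ => m ≡ r.val [MOD p])).card : ℤ) = 1 := by
    rw [h1]; simp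
  exact_mod_cast h4

theorem abs_sum_filter_sub_le (r : ZMod p) (N : ℕ) :
    |(∑ m ∈ (Finset.Icc 1 N).filter (fun m : ℕ => (m : ZMod p) = r), (m:ℝ)) - (N:ℝ) ^ 2 / (2 * p)| ≤ (N:ℝ) := by
  have hp : 0 < p := (Fact.out : p.Prime).pos
  have hp' : (0:ℝ) < p := by exact_mod_cast hp
  have hIcc : ∀ N : ℕ, Finset.Icc 1 N = Finset.Ioc 0 N := fun N => by ext; simp; omega
  rw [hIcc]
  induction N using Nat.strong_induction_on with
  | _ N ih =>
    rcases lt_or_ge N p with h | h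
    · have hc : ((Finset.Ioc 0 N).filter (fun m : ℕ => (m : ZMod p) = r)).card ≤ 1 := by
        rw [← card_filter_Ioc_add_eq_one r 0]
        refine Finset.card_le_card (Finset.filter_subset_filter _ (Finset.Ioc_subset_Ioc_right (by omega)))
      have h0 : 0 ≤ ∑ m ∈ (Finset.Ioc 0 N).filter (fun m : ℕ => (m : ZMod p) = r), (m:ℝ) :=
        Finset.sum_nonneg fun _ _ => by positivity
      have h1 : ∑ m ∈ (Finset.Ioc 0 N).filter (fun m : ℕ => (m : ZMod p) = r), (m:ℝ) ≤ N := by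
        have := Finset.sum_le_card_nsmul ((Finset.Ioc 0 N).filter (fun m : ℕ => (m : ZMod p) = r)) (fun m => (m:ℝ)) N
          (fun m hm => by exact_mod_cast (Finset.mem_Ioc.1 (Finset.mem_filter.1 hm).1).2)
        refine this.trans ?_
        rw [nsmul_eq_mul]
        have : (((Finset.Ioc 0 N).filter (fun m : ℕ => (m : ZMod p) = r)).card : ℝ) ≤ 1 := by exact_mod_cast hc
        nlinarith [(Nat.cast_nonneg N : (0:ℝ) ≤ N)]
      have h2 : (N:ℝ) ^ 2 / (2 * p) ≤ N := by
        rw [div_le_iff₀ (by positivity)]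
        have : (N:ℝ) ≤ p := by exact_mod_cast h.le
        nlinarith [(Nat.cast_nonneg N : (0:ℝ) ≤ N)]
      have h3 : 0 ≤ (N:ℝ) ^ 2 / (2 * p) := by positivity
      rw [abs_le]; constructor <;> linarith
    · obtain ⟨M, rfl⟩ := Nat.exists_eq_add_of_le' h
      have h1 := ih M (by omega)
      obtain ⟨w, hw⟩ := Finset.card_eq_one.1 (card_filter_Ioc_add_eq_one r M)
      have hw' : w ∈ Finset.Ioc M (M + p) := (Finset.mem_filter.1 (hw ▸ Finset.mem_singleton_self w)).1
      have h2 : ∑ m ∈ (Finset.Ioc 0 (M + p)).filter (fun m : ℕ => (m : ZMod p) = r), (m:ℝ) =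
          ∑ m ∈ (Finset.Ioc 0 M).filter (fun m : ℕ => (m : ZMod p) = r), (m:ℝ) + w := by
        rw [← Finset.Ioc_union_Ioc_eq_Ioc (Nat.zero_le M) (Nat.le_add_right M p), Finset.filter_union, Finset.sum_union, hw,
          Finset.sum_singleton]
        refine Finset.disjoint_filter_filter (Finset.disjoint_left.2 fun x hx hx' => ?_)
        rw [Finset.mem_Ioc] at hx hx'; omega
      rw [h2]
      rw [Finset.mem_Ioc] at hw'
      have h3 : (M:ℝ) ≤ w := by exact_mod_cast hw'.1.le
      have h4 : (w:ℝ) ≤ M + p := by exact_mod_cast hw'.2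
      have h5 : (((M + p : ℕ)):ℝ) ^ 2 / (2 * p) = (M:ℝ) ^ 2 / (2 * p) + M + p / 2 := by
        push_cast; field_simp; ring
      rw [h5]
      push_cast
      rw [abs_le] at h1 ⊢
      constructor <;> linarith [h1.1, h1.2]

/-- The density of the totient function in a residue class prime to `p`. -/
noncomputable def totDens (p : ℕ) : ℝ := (∑' e : ℕ, if p ∣ e then (0:ℝ) else (ArithmeticFunction.moebius e : ℝ) / (e:ℝ) ^ 2) / (2 * p)

theorem sum_totient_eq (r : ZMod p) (hr : r ≠ 0) (n : ℕ) :
    ∑ a ∈ (Finset.Icc 1 n).filter (fun a : ℕ => (a : ZMod p) = r), (a.totient : ℝ) =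
      ∑ e ∈ (Finset.Icc 1 n).filter (fun e => ¬ p ∣ e), (ArithmeticFunction.moebius e : ℝ) *
        ∑ m ∈ (Finset.Icc 1 (n / e)).filter (fun m : ℕ => (m : ZMod p) = r / e), (m : ℝ) := by
  have h1 : ∀ a : ℕ, 0 < a → ∑ x ∈ a.divisorsAntidiagonal, (ArithmeticFunction.moebius x.1 : ℝ) * (x.2 : ℝ) = a.totient :=
    (ArithmeticFunction.sum_eq_iff_sum_mul_moebius_eq (f := fun a => (a.totient : ℝ)) (g := fun a => (a:ℝ))).1
      fun n hn => by exact_mod_cast Nat.sum_totient n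
  calc _ = ∑ a ∈ (Finset.Icc 1 n).filter (fun a : ℕ => (a : ZMod p) = r), ∑ x ∈ a.divisorsAntidiagonal, (ArithmeticFunction.moebius x.1 : ℝ) * (x.2 : ℝ) := by
        refine Finset.sum_congr rfl fun a ha => (h1 a ?_).symm
        exact (Finset.mem_Icc.1 (Finset.mem_filter.1 ha).1).1
    _ = _ := by
        simp_rw [Finset.mul_sum]
        rw [Finset.sum_sigma', Finset.sum_sigma']
        refine Finset.sum_bij' (fun x _ => ⟨x.2.1, x.2.2⟩) (fun y _ => ⟨y.1 * y.2, (y.1, y.2)⟩) ?_ ?_ ?_ ?_ ?_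
        · rintro ⟨a, e, m⟩ h
          simp only [Finset.mem_sigma, Finset.mem_filter, Finset.mem_Icc, Nat.mem_divisorsAntidiagonal] at h ⊢
          obtain ⟨⟨⟨h1, h2⟩, h3⟩, rfl, h5⟩ := h
          have he : 0 < e := Nat.pos_of_ne_zero fun h => h5 (by rw [h, zero_mul])
          have hm : 0 < m := Nat.pos_of_ne_zero fun h => h5 (by rw [h, mul_zero])
          have hpe : ¬ p ∣ e := by
            intro hpe
            apply hr
            rw [← h3, Nat.cast_mul, (ZMod.natCast_eq_zero_iff e p).2 hpe, zero_mul]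
          have hpe' : (e : ZMod p) ≠ 0 := fun h => hpe ((ZMod.natCast_eq_zero_iff e p).1 h)
          refine ⟨⟨⟨he, by nlinarith⟩, hpe⟩, ⟨hm, (Nat.le_div_iff_mul_le he).2 (by linarith [mul_comm e m])⟩, ?_⟩
          rw [eq_div_iff hpe', ← h3]; push_cast; ring
        · rintro ⟨e, m⟩ h
          simp only [Finset.mem_sigma, Finset.mem_filter, Finset.mem_Icc, Nat.mem_divisorsAntidiagonal] at h ⊢
          obtain ⟨⟨⟨h1, h2⟩, h3⟩, ⟨h4, h5⟩, h6⟩ := h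
          have hpe' : (e : ZMod p) ≠ 0 := fun h => h3 ((ZMod.natCast_eq_zero_iff e p).1 h)
          rw [Nat.le_div_iff_mul_le h1] at h5
          refine ⟨⟨⟨Nat.mul_pos h1 h4, by linarith [mul_comm e m]⟩, ?_⟩, trivial, (Nat.mul_pos h1 h4).ne'⟩
          push_cast; rw [h6]; field_simp
        · rintro ⟨a, e, m⟩ h
          simp only [Finset.mem_sigma, Nat.mem_divisorsAntidiagonal] at h
          obtain ⟨_, rfl, _⟩ := h
          rfl
        · rintro ⟨e, m⟩ _; rfl
        · rintro ⟨a, e, m⟩ _; rfl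

theorem tail_aux {n : ℕ} (hn : 0 < n) (N : ℕ) : ∑ i ∈ Finset.range N, (1:ℝ) / ((i + (n + 1) : ℕ) : ℝ) ^ 2 ≤ 1 / n := by
  have hn' : (0:ℝ) < n := by exact_mod_cast hn
  have : ∑ i ∈ Finset.range N, (1:ℝ) / ((i + (n + 1) : ℕ) : ℝ) ^ 2 ≤ 1 / n - 1 / (n + N) := by
    induction N with
    | zero => simp
    | succ N ih =>
      rw [Finset.sum_range_succ]
      refine (add_le_add_left ih _).trans ?_
      have : (1:ℝ) / ((N + (n + 1) : ℕ) : ℝ) ^ 2 ≤ 1 / (n + N) - 1 / (n + N + 1) := by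
        rw [div_sub_div _ _ (by positivity) (by positivity), div_le_div_iff₀ (by positivity) (by positivity)]
        push_cast
        nlinarith [(Nat.cast_nonneg N : (0:ℝ) ≤ N)]
      have h3 : ((N + 1 : ℕ) : ℝ) = N + 1 := by push_cast; rfl
      rw [h3, show (n:ℝ) + ((N:ℝ) + 1) = n + N + 1 by ring]
      linarith only [this]
  have h2 : (0:ℝ) ≤ 1 / (n + N) := by positivity
  linarith

theorem abs_sum_totient_sub_le (r : ZMod p) (hr : r ≠ 0) {n : ℕ} (hn : 0 < n) :
    |∑ a ∈ (Finset.Icc 1 n).filter (fun a : ℕ => (a : ZMod p) = r), (a.totient : ℝ) - totDens p * (n:ℝ) ^ 2| ≤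
      2 * n * (1 + Real.log n) + n := by
  have hp : 0 < p := (Fact.out : p.Prime).pos
  have hp' : (1:ℝ) ≤ p := by exact_mod_cast hp
  have hn' : (0:ℝ) < n := by exact_mod_cast hn
  set f : ℕ → ℝ := fun e => if p ∣ e then (0:ℝ) else (ArithmeticFunction.moebius e : ℝ) / (e:ℝ) ^ 2 with hf
  have hμ : ∀ e : ℕ, |(ArithmeticFunction.moebius e : ℝ)| ≤ 1 := fun e => by
    exact_mod_cast ArithmeticFunction.abs_moebius_le_one (n := e)
  have hfb : ∀ e, |f e| ≤ 1 / (e:ℝ) ^ 2 := by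
    intro e
    simp only [hf]
    split_ifs
    · rw [abs_zero]; positivity
    · rw [abs_div, abs_of_nonneg (by positivity : (0:ℝ) ≤ (e:ℝ) ^ 2)]
      gcongr; exact hμ e
  have hsum : Summable f := Summable.of_norm_bounded (Real.summable_one_div_nat_pow.2 one_lt_two) hfb
  have htail : |∑' i : ℕ, f (i + (n + 1))| ≤ 1 / n := by
    have h1 : Summable fun i => ‖f (i + (n+1))‖ := ((summable_nat_add_iff (n+1)).2 hsum).norm
    refine (norm_tsum_le_tsum_norm h1).trans ?_
    refine Real.tsum_le_of_sum_range_le (fun i => norm_nonneg _) fun N => ?_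
    exact (Finset.sum_le_sum fun i _ => hfb _).trans (tail_aux hn N)
  have hsplit := hsum.sum_add_tsum_nat_add (n + 1)
  have hrange : ∑ e ∈ Finset.range (n+1), f e = ∑ e ∈ (Finset.Icc 1 n).filter (fun e => ¬ p ∣ e), (ArithmeticFunction.moebius e : ℝ) / (e:ℝ) ^ 2 := by
    rw [Finset.sum_filter]
    rw [Finset.sum_range_succ', ← Finset.sum_image (f := f) (g := fun k => k + 1) (by intro x _ y _ h; simpa using h)]
    have : f 0 = 0 := by simp [hf]
    rw [this, add_zero]
    have him : (Finset.range n).image (fun k => k + 1) = Finset.Icc 1 n := by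
      ext x; simp only [Finset.mem_image, Finset.mem_range, Finset.mem_Icc]
      constructor
      · rintro ⟨k, hk, rfl⟩; omega
      · intro h; exact ⟨x - 1, by omega, by omega⟩
    rw [him]
    refine Finset.sum_congr rfl fun e _ => ?_
    simp only [hf]
    split_ifs <;> rfl
  have hkey : |∑ a ∈ (Finset.Icc 1 n).filter (fun a : ℕ => (a : ZMod p) = r), (a.totient : ℝ) -
      (n:ℝ) ^ 2 / (2 * p) * ∑ e ∈ (Finset.Icc 1 n).filter (fun e => ¬ p ∣ e), (ArithmeticFunction.moebius e : ℝ) / (e:ℝ) ^ 2| ≤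
        2 * n * (1 + Real.log n) := by
    rw [sum_totient_eq r hr, Finset.mul_sum, ← Finset.sum_sub_distrib]
    refine (Finset.abs_sum_le_sum_abs _ _).trans ?_
    calc _ ≤ ∑ e ∈ (Finset.Icc 1 n).filter (fun e => ¬ p ∣ e), 2 * n * (1 / (e:ℝ)) := by
          refine Finset.sum_le_sum fun e he => ?_
          have he1 : 1 ≤ e := (Finset.mem_Icc.1 (Finset.mem_filter.1 he).1).1
          have he' : (0:ℝ) < e := by exact_mod_cast he1
          have h1 := abs_sum_filter_sub_le (r / (e : ZMod p)) (n / e)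
          set S := ∑ m ∈ (Finset.Icc 1 (n / e)).filter (fun m : ℕ => (m : ZMod p) = r / e), (m : ℝ)
          set q : ℝ := ((n / e : ℕ) : ℝ)
          have hq1 : q ≤ n / e := Nat.cast_div_le
          have hq2 : (n:ℝ) / e ≤ q + 1 := by
            rw [div_le_iff₀ he']
            have := Nat.lt_div_mul_add he1 (a := n)
            have h5 : (n:ℝ) ≤ ((n / e : ℕ) : ℝ) * e + e := by exact_mod_cast this.le
            linarith
          have hq0 : 0 ≤ q := by positivity
          have h2 : |S - ((n:ℝ) / e) ^ 2 / (2 * p)| ≤ 2 * ((n:ℝ) / e) := by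
            have h3 : |q ^ 2 / (2 * p) - ((n:ℝ) / e) ^ 2 / (2 * p)| ≤ (n:ℝ) / e := by
              rw [← sub_div, abs_div, abs_of_pos (by positivity : (0:ℝ) < 2 * p), div_le_iff₀ (by positivity), abs_le]
              constructor <;> nlinarith
            have h4 : S - ((n:ℝ) / e) ^ 2 / (2 * p) = (S - q ^ 2 / (2 * p)) + (q ^ 2 / (2 * p) - ((n:ℝ) / e) ^ 2 / (2 * p)) := by ring
            rw [h4]
            refine (abs_add_le _ _).trans ?_
            linarith
          have h6 : (ArithmeticFunction.moebius e : ℝ) * S - (n:ℝ) ^ 2 / (2 * p) * ((ArithmeticFunction.moebius e : ℝ) / (e:ℝ) ^ 2) =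
              (ArithmeticFunction.moebius e : ℝ) * (S - ((n:ℝ) / e) ^ 2 / (2 * p)) := by
            field_simp
          rw [h6, abs_mul]
          calc _ ≤ 1 * (2 * ((n:ℝ) / e)) := by gcongr; exact hμ e
            _ = _ := by ring
      _ ≤ ∑ e ∈ Finset.Icc 1 n, 2 * n * (1 / (e:ℝ)) :=
          Finset.sum_le_sum_of_subset_of_nonneg (Finset.filter_subset _ _) fun _ _ _ => by positivity
      _ ≤ _ := by rw [← Finset.mul_sum]; gcongr; exact sum_Icc_inv_le n
  have hfin : |(n:ℝ) ^ 2 / (2 * p) * (∑ e ∈ (Finset.Icc 1 n).filter (fun e => ¬ p ∣ e), (ArithmeticFunction.moebius e : ℝ) / (e:ℝ) ^ 2) - totDens p * (n:ℝ) ^ 2| ≤ (n:ℝ) := by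
    have h1 : (n:ℝ) ^ 2 / (2 * p) * (∑ e ∈ (Finset.Icc 1 n).filter (fun e => ¬ p ∣ e), (ArithmeticFunction.moebius e : ℝ) / (e:ℝ) ^ 2) - totDens p * (n:ℝ) ^ 2 =
        -((n:ℝ) ^ 2 / (2 * p) * ∑' i : ℕ, f (i + (n + 1))) := by
      rw [totDens, ← hsplit, hrange]; ring
    rw [h1, abs_neg, abs_mul, abs_of_nonneg (by positivity : (0:ℝ) ≤ (n:ℝ) ^ 2 / (2 * p))]
    calc _ ≤ (n:ℝ) ^ 2 / (1 * 1) * (1 / n) := by gcongr; linarith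
      _ = n := by field_simp
  refine (abs_sub_le _ _ _).trans (add_le_add hkey hfin)

theorem abs_tsum_le_two {f : ℕ → ℝ} (h0 : f 0 = 0) (hfb : ∀ e, |f e| ≤ 1 / (e:ℝ) ^ 2) : |∑' e, f e| ≤ 2 := by
  have hs : Summable f := Summable.of_norm_bounded (Real.summable_one_div_nat_pow.2 one_lt_two) hfb
  have hsum : Summable fun e => ‖f e‖ := hs.norm
  refine (norm_tsum_le_tsum_norm hsum).trans ?_
  refine Real.tsum_le_of_sum_range_le (fun i => norm_nonneg _) fun N => ?_
  refine (Finset.sum_le_sum_of_subset_of_nonneg (Finset.range_mono (Nat.le_add_right N 2)) fun _ _ _ => norm_nonneg _).trans ?_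
  rw [Finset.sum_range_succ', Finset.sum_range_succ', h0, norm_zero, add_zero]
  have h1 : ‖f (0 + 1)‖ ≤ 1 := by simpa using hfb (0 + 1)
  have h2 : ∑ i ∈ Finset.range N, ‖f (i + 1 + 1)‖ ≤ 1 := by
    have h3 := tail_aux (n := 1) one_pos N
    rw [Nat.cast_one, div_one] at h3
    refine (Finset.sum_le_sum fun i _ => ?_).trans h3
    rw [← add_assoc]
    exact hfb (i + 1 + 1)
  linarith

variable (p) in
theorem abs_totDens_le : |totDens p| ≤ 1 := by
  have hp : 2 ≤ p := (Fact.out : p.Prime).two_le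
  have hp' : (2:ℝ) ≤ p := by exact_mod_cast hp
  have h1 := abs_tsum_le_two (f := fun e : ℕ => if p ∣ e then (0:ℝ) else (ArithmeticFunction.moebius e : ℝ) / (e:ℝ) ^ 2)
    (if_pos (dvd_zero p)) fun e => by
      have hμ : |(ArithmeticFunction.moebius e : ℝ)| ≤ 1 := by
        exact_mod_cast ArithmeticFunction.abs_moebius_le_one (n := e)
      split_ifs
      · rw [abs_zero]; positivity
      · rw [abs_div, abs_of_nonneg (by positivity : (0:ℝ) ≤ (e:ℝ) ^ 2)]
        gcongr
  rw [totDens, abs_div, abs_of_pos (by linarith : (0:ℝ) < 2 * p), div_le_one (by linarith)]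
  linarith

end totient

section cells

/-- The integer `b` satisfies `i / M ≤ b / a < (i + 1) / M`. -/
def InCell (M : ℕ) (i a b : ℤ) : Prop := i * a ≤ M * b ∧ M * b < (i + 1) * a

variable {p : ℕ} [Fact p.Prime]

theorem exists_cell_eq_Ico (p : ℕ) [Fact p.Prime] {M a : ℕ} (hM : 0 < M) (ha : 0 < a) (i r : ℤ) :
    ∃ (k : ℤ) (m : ℕ), (∀ x : ℤ, InCell M i a (r + p * x) ↔ x ∈ Finset.Ico k (k + m)) ∧
      |(m:ℝ) - (a:ℝ) / (M * p)| ≤ (1:ℝ) ∧ m ≤ a := by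
  have hp : (2:ℝ) ≤ p := by exact_mod_cast (Fact.out : p.Prime).two_le
  have hM' : (1:ℝ) ≤ M := by exact_mod_cast hM
  have ha' : (1:ℝ) ≤ a := by exact_mod_cast ha
  have hMp : (2:ℝ) ≤ M * p := by nlinarith
  set z : ℝ := ((i * a - M * r : ℤ) : ℝ) / (M * p) with hz
  set w : ℝ := (((i + 1) * a - M * r : ℤ) : ℝ) / (M * p) with hw
  have hzw : w = z + a / (M * p) := by rw [hz, hw, ← add_div]; push_cast; ring
  have h0 : 0 < (a:ℝ) / (M * p) := by positivity
  have hle : ⌈z⌉ ≤ ⌈w⌉ := Int.ceil_le_ceil (by linarith)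
  obtain ⟨m, hm⟩ := Int.le.dest hle
  have hm' : (⌈z⌉ : ℝ) + m = ⌈w⌉ := by exact_mod_cast hm
  have h1 : |(m:ℝ) - (a:ℝ) / (M * p)| ≤ (1:ℝ) := by
    have h3 := Int.le_ceil z
    have h4 := Int.ceil_lt_add_one z
    have h5 := Int.le_ceil w
    have h6 := Int.ceil_lt_add_one w
    rw [abs_le]; constructor <;> linarith
  refine ⟨⌈z⌉, m, fun x => ?_, h1, ?_⟩
  · rw [hm, Finset.mem_Ico, Int.ceil_le, Int.lt_ceil, hz, hw, div_le_iff₀ (by linarith), lt_div_iff₀ (by linarith), InCell]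
    have e1 : (x:ℝ) * (M * p) = ((x * (M * p) : ℤ) : ℝ) := by push_cast; ring
    rw [e1, Int.cast_le, Int.cast_lt]
    constructor <;> rintro ⟨h2, h3⟩ <;> constructor <;> linarith
  · have h2 : (a:ℝ) / (M * p) ≤ a / 2 := by gcongr
    have h3 : (2:ℝ) * m ≤ a + 2 := by linarith [(abs_le.1 h1).2]
    have h4 : 2 * m ≤ a + 2 := by exact_mod_cast h3
    rcases Nat.lt_or_ge a 2 with h | h
    · have h5 : (a:ℝ) ≤ 1 := by exact_mod_cast (by omega : a ≤ 1)
      have h6 : (2:ℝ) * m ≤ 3 := by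
        have : (a:ℝ) / (M * p) ≤ 1 / 2 := by gcongr
        linarith [(abs_le.1 h1).2]
      have h7 : 2 * m ≤ 3 := by exact_mod_cast h6
      omega
    · omega

/-- Upper left, upper right and lower left entries of the integral unimodular matrices with positive upper left entry
lying in a given class modulo `p`. -/
def trip (p : ℕ) (α β γ : ZMod p) : Set (ℕ × ℤ × ℤ) :=
  {t | 0 < t.1 ∧ (t.1 : ZMod p) = α ∧ (t.2.1 : ZMod p) = β ∧ (t.2.2 : ZMod p) = γ ∧ (t.1 : ℤ) ∣ 1 + t.2.1 * t.2.2}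

theorem exists_fiber_count : ∃ C : ℝ, 0 < C ∧ ∀ (p : ℕ) [Fact p.Prime] (α β γ : ZMod p), α ≠ 0 → ∀ (M : ℕ), 0 < M →
    ∀ (i j : ℤ) (a : ℕ), 0 < a → (a : ZMod p) = α →
    ∃ S : Finset (ℕ × ℤ × ℤ), (∀ t, t ∈ S ↔ t ∈ trip p α β γ ∧ t.1 = a ∧ InCell M i t.1 t.2.1 ∧ InCell M j t.1 t.2.2) ∧
      |(S.card : ℝ) - a.totient / ((M:ℝ) * p) ^ 2| ≤ C * (a:ℝ) ^ (7/8:ℝ) := by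
  obtain ⟨C, hC, hbox⟩ := boxCnt_asymp
  refine ⟨C + 3, by linarith, ?_⟩
  intro p _ α β γ hα M hM i j a ha haα
  have hp : (2:ℝ) ≤ p := by exact_mod_cast (Fact.out : p.Prime).two_le
  have hp0 : (p:ℤ) ≠ 0 := by exact_mod_cast (Fact.out : p.Prime).ne_zero
  haveI : NeZero a := ⟨ha.ne'⟩
  have ha' : (1:ℝ) ≤ a := by exact_mod_cast ha
  have hM' : (1:ℝ) ≤ M := by exact_mod_cast hM
  obtain ⟨k, m, hk, hm, hma⟩ := exists_cell_eq_Ico p hM ha i β.val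
  obtain ⟨l, n, hl, hn, hna⟩ := exists_cell_eq_Ico p hM ha j γ.val
  have hcop : p.Coprime a := by
    rw [(Fact.out : p.Prime).coprime_iff_not_dvd]
    intro h
    exact hα (haα ▸ (ZMod.natCast_eq_zero_iff a p).2 h)
  set u : (ZMod a)ˣ := ZMod.unitOfCoprime p hcop with hu
  have hu' : (u : ZMod a) = (p : ZMod a) := ZMod.coe_unitOfCoprime p hcop
  set Q := ((Finset.Ico k (k + m) ×ˢ Finset.Ico l (l + n)).filter fun q : ℤ × ℤ =>
    (((β.val : ℕ) : ZMod a) + (u : ZMod a) * (q.1 : ZMod a)) * (((γ.val : ℕ) : ZMod a) + (u : ZMod a) * (q.2 : ZMod a)) = -1) with hQ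
  have hQc : Q.card = boxCnt ((β.val : ℕ) : ZMod a) ((γ.val : ℕ) : ZMod a) u k l m n := rfl
  set g : ℤ × ℤ → ℕ × ℤ × ℤ := fun q => (a, (β.val : ℤ) + p * q.1, (γ.val : ℤ) + p * q.2) with hg
  have hgi : Function.Injective g := by
    rintro ⟨x, y⟩ ⟨x', y'⟩ h
    simp only [hg, Prod.mk.injEq, true_and, add_right_inj] at h
    exact Prod.ext (mul_left_cancel₀ hp0 h.1) (mul_left_cancel₀ hp0 h.2)
  have hres : ∀ (r : ZMod p) (b : ℤ), (b : ZMod p) = r ↔ ∃ x : ℤ, b = (r.val : ℤ) + p * x := by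
    intro r b
    have e : ((r.val : ℤ) : ZMod p) = r := by simp
    constructor
    · intro h
      have := (ZMod.intCast_eq_intCast_iff_dvd_sub (r.val : ℤ) b p).1 (by rw [e, h])
      obtain ⟨x, hx⟩ := this
      exact ⟨x, by linarith⟩
    · rintro ⟨x, rfl⟩
      push_cast; simp
  refine ⟨Q.image g, ?_, ?_⟩
  · rintro ⟨a', b, c⟩
    rw [Finset.mem_image]
    simp only [trip, Set.mem_setOf_eq, hQ, Finset.mem_filter, Finset.mem_product, hg, Prod.exists, Prod.mk.injEq]
    have hdvd : ∀ x y : ℤ, (((β.val : ℕ) : ZMod a) + (u : ZMod a) * (x : ZMod a)) * (((γ.val : ℕ) : ZMod a) + (u : ZMod a) * (y : ZMod a)) = -1 ↔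
        (a:ℤ) ∣ 1 + ((β.val : ℤ) + p * x) * ((γ.val : ℤ) + p * y) := by
      intro x y
      rw [← ZMod.intCast_zmod_eq_zero_iff_dvd, hu', eq_neg_iff_add_eq_zero, add_comm]
      push_cast
      rfl
    constructor
    · rintro ⟨x, y, ⟨⟨hx, hy⟩, hxy⟩, rfl, rfl, rfl⟩
      exact ⟨⟨ha, haα, (hres _ _).2 ⟨x, rfl⟩, (hres _ _).2 ⟨y, rfl⟩, (hdvd x y).1 hxy⟩, rfl, (hk x).2 hx, (hl y).2 hy⟩
    · rintro ⟨⟨_, _, h1, h2, h3⟩, rfl, h5, h6⟩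
      obtain ⟨x, rfl⟩ := (hres _ _).1 h1
      obtain ⟨y, rfl⟩ := (hres _ _).1 h2
      exact ⟨x, y, ⟨⟨(hk x).1 h5, (hl y).1 h6⟩, (hdvd x y).2 h3⟩, rfl, rfl, rfl⟩
  · rw [Finset.card_image_of_injective _ hgi, hQc]
    have h1 := hbox a ((β.val : ℕ) : ZMod a) ((γ.val : ℕ) : ZMod a) u k l m n hma hna
    have hpow : (1:ℝ) ≤ (a:ℝ) ^ (7/8:ℝ) := Real.one_le_rpow ha' (by norm_num)
    set x : ℝ := (a:ℝ) / (M * p) with hx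
    have hx0 : 0 ≤ x := by positivity
    have hxa : x ≤ a := div_le_self (by linarith) (by nlinarith)
    have hm1 : (m:ℝ) ≤ a := by exact_mod_cast hma
    have hn1 : (n:ℝ) ≤ a := by exact_mod_cast hna
    have h2 : |(a.totient:ℝ) * m * n / (a:ℝ) ^ 2 - a.totient / ((M:ℝ) * p) ^ 2| ≤ (3:ℝ) := by
      have e : (a.totient:ℝ) * m * n / (a:ℝ) ^ 2 - a.totient / ((M:ℝ) * p) ^ 2 = a.totient * ((m - x) * n + x * (n - x)) / (a:ℝ) ^ 2 := by
        rw [hx]; field_simp; ring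
      rw [e, abs_div, abs_mul, abs_of_nonneg (by positivity : (0:ℝ) ≤ (a:ℝ) ^ 2), abs_of_nonneg (by positivity : (0:ℝ) ≤ (a.totient:ℝ)),
        div_le_iff₀ (by positivity)]
      have h3 : |((m:ℝ) - x) * n + x * (n - x)| ≤ 2 * (a:ℝ) := by
        refine (abs_add_le _ _).trans ?_
        rw [abs_mul, abs_mul, abs_of_nonneg hx0, abs_of_nonneg (by positivity : (0:ℝ) ≤ (n:ℝ))]
        nlinarith [abs_nonneg ((m:ℝ) - x), abs_nonneg ((n:ℝ) - x)]
      have h4 : (a.totient:ℝ) ≤ a := by exact_mod_cast Nat.totient_le a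
      calc (a.totient:ℝ) * |((m:ℝ) - x) * n + x * (n - x)| ≤ a * (2 * a) := by gcongr
        _ ≤ _ := by nlinarith
    refine (abs_sub_le _ _ _).trans ((add_le_add h1 h2).trans ?_)
    linarith

theorem exists_cell_count : ∃ C : ℝ, 0 < C ∧ ∀ (p : ℕ) [Fact p.Prime] (α β γ : ZMod p), α ≠ 0 → ∀ (M : ℕ), 0 < M →
    ∀ (i j : ℤ) (n : ℕ),
    ∃ S : Finset (ℕ × ℤ × ℤ), (∀ t, t ∈ S ↔ t ∈ trip p α β γ ∧ t.1 ≤ n ∧ InCell M i t.1 t.2.1 ∧ InCell M j t.1 t.2.2) ∧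
      |(S.card : ℝ) - totDens p * (n:ℝ) ^ 2 / ((M:ℝ) * p) ^ 2| ≤ C * (n:ℝ) ^ (15/8:ℝ) := by
  obtain ⟨C, hC, hfib⟩ := exists_fiber_count
  refine ⟨C + 6, by linarith, ?_⟩
  intro p _ α β γ hα M hM i j n
  have hp : (2:ℝ) ≤ p := by exact_mod_cast (Fact.out : p.Prime).two_le
  have hM' : (1:ℝ) ≤ M := by exact_mod_cast hM
  set A := (Finset.Icc 1 n).filter (fun a : ℕ => (a : ZMod p) = α) with hA
  have hAm : ∀ a, a ∈ A ↔ (1 ≤ a ∧ a ≤ n) ∧ (a : ZMod p) = α := fun a => by rw [hA, Finset.mem_filter, Finset.mem_Icc]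
  have hf : ∀ a : ℕ, ∃ S : Finset (ℕ × ℤ × ℤ), a ∈ A → (∀ t, t ∈ S ↔ t ∈ trip p α β γ ∧ t.1 = a ∧ InCell M i t.1 t.2.1 ∧ InCell M j t.1 t.2.2) ∧
      |(S.card : ℝ) - a.totient / ((M:ℝ) * p) ^ 2| ≤ C * (a:ℝ) ^ (7/8:ℝ) := by
    intro a
    by_cases h : a ∈ A
    · obtain ⟨S, hS⟩ := hfib p α β γ hα M hM i j a ((hAm a).1 h).1.1 ((hAm a).1 h).2
      exact ⟨S, fun _ => hS⟩
    · exact ⟨∅, fun h' => absurd h' h⟩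
  choose F hF using hf
  refine ⟨A.biUnion F, fun t => ?_, ?_⟩
  · rw [Finset.mem_biUnion]
    constructor
    · rintro ⟨a, ha, ht⟩
      obtain ⟨h1, h2, h3⟩ := ((hF a ha).1 t).1 ht
      exact ⟨h1, h2 ▸ ((hAm a).1 ha).1.2, h3⟩
    · rintro ⟨h1, h2, h3⟩
      have hm : t.1 ∈ A := (hAm _).2 ⟨⟨h1.1, h2⟩, h1.2.1⟩
      exact ⟨t.1, hm, ((hF _ hm).1 t).2 ⟨h1, rfl, h3⟩⟩
  · rcases Nat.eq_zero_or_pos n with rfl | hn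
    · have : A = ∅ := by rw [hA]; simp
      rw [this]; simp
    have hn' : (1:ℝ) ≤ n := by exact_mod_cast hn
    have hn0 : (0:ℝ) < n := by linarith
    have hcard : (A.biUnion F).card = ∑ a ∈ A, (F a).card := by
      refine Finset.card_biUnion fun a ha b hb hab => Finset.disjoint_left.2 fun t ht ht' => hab ?_
      exact ((((hF a ha).1 t).1 ht).2.1).symm.trans (((hF b hb).1 t).1 ht').2.1
    have h1 : |((A.biUnion F).card : ℝ) - (∑ a ∈ A, (a.totient : ℝ)) / ((M:ℝ) * p) ^ 2| ≤ C * (n:ℝ) ^ (15/8:ℝ) := by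
      rw [hcard, Nat.cast_sum, Finset.sum_div, ← Finset.sum_sub_distrib]
      refine (Finset.abs_sum_le_sum_abs _ _).trans ?_
      calc _ ≤ ∑ a ∈ A, C * (n:ℝ) ^ (7/8:ℝ) := by
            refine Finset.sum_le_sum fun a ha => (hF a ha).2.trans ?_
            have : (a:ℝ) ≤ n := by exact_mod_cast ((hAm a).1 ha).1.2
            gcongr
        _ = A.card * (C * (n:ℝ) ^ (7/8:ℝ)) := by rw [Finset.sum_const, nsmul_eq_mul]
        _ ≤ n * (C * (n:ℝ) ^ (7/8:ℝ)) := by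
            have : (A.card:ℝ) ≤ n := by exact_mod_cast (Finset.card_filter_le _ _).trans (by simp)
            gcongr
        _ = _ := by
            rw [show (15/8:ℝ) = 1 + 7/8 by norm_num, Real.rpow_add hn0, Real.rpow_one]; ring
    have hlog : Real.log n ≤ 8 / 7 * (n:ℝ) ^ (7/8:ℝ) := by
      have := Real.log_le_rpow_div hn0.le (show (0:ℝ) < 7/8 by norm_num)
      linarith
    have hpow : (1:ℝ) ≤ (n:ℝ) ^ (7/8:ℝ) := Real.one_le_rpow hn' (by norm_num)
    have h2 : |(∑ a ∈ A, (a.totient : ℝ)) / ((M:ℝ) * p) ^ 2 - totDens p * (n:ℝ) ^ 2 / ((M:ℝ) * p) ^ 2| ≤ 6 * (n:ℝ) ^ (15/8:ℝ) := by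
      rw [← sub_div, abs_div, abs_of_nonneg (by positivity : (0:ℝ) ≤ ((M:ℝ) * p) ^ 2)]
      refine (div_le_self (abs_nonneg _) (one_le_pow₀ (by nlinarith))).trans ((abs_sum_totient_sub_le α hα hn).trans ?_)
      rw [show (15/8:ℝ) = 1 + 7/8 by norm_num, Real.rpow_add hn0, Real.rpow_one]
      nlinarith
    refine (abs_sub_le _ _ _).trans ((add_le_add h1 h2).trans ?_)
    linarith

end cells

section weights

/-- The square of the Euclidean norm of the unimodular matrix with the given first three entries. -/
noncomputable def nsq (t : ℕ × ℤ × ℤ) : ℝ :=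
  (t.1:ℝ) ^ 2 + (t.2.1:ℝ) ^ 2 + (t.2.2:ℝ) ^ 2 + ((1 + (t.2.1:ℝ) * t.2.2) / t.1) ^ 2

/-- The mean of `1 / (1 + x²)` over the interval `[i / M, (i + 1) / M]`. -/
noncomputable def wt (M : ℕ) (i : ℤ) : ℝ := M * (Real.arctan (((i + 1 : ℤ) : ℝ) / M) - Real.arctan ((i : ℝ) / M))

theorem inv_one_add_sq_sub_le (x y : ℝ) : |1 / (1 + x ^ 2) - 1 / (1 + y ^ 2)| ≤ |y - x| := by
  have h : 1 / (1 + x ^ 2) - 1 / (1 + y ^ 2) = (y - x) * (x + y) / ((1 + x ^ 2) * (1 + y ^ 2)) := by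
    field_simp; ring
  rw [h, abs_div, abs_mul, abs_of_pos (by positivity : 0 < (1 + x ^ 2) * (1 + y ^ 2)), div_le_iff₀ (by positivity)]
  have h2 : |x + y| ≤ (1 + x ^ 2) * (1 + y ^ 2) := by
    rw [abs_le]
    constructor <;> nlinarith [sq_nonneg (x * y), sq_nonneg (x - 1), sq_nonneg (y - 1), sq_nonneg (x + 1), sq_nonneg (y + 1)]
  gcongr

theorem exists_wt_eq {M : ℕ} (hM : 0 < M) (i : ℤ) : ∃ x : ℝ, (i:ℝ) < M * x ∧ (M:ℝ) * x < i + 1 ∧ wt M i = 1 / (1 + x ^ 2) := by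
  have hM' : (0:ℝ) < M := by exact_mod_cast hM
  have hlt : (i : ℝ) / M < ((i + 1 : ℤ) : ℝ) / M := by push_cast; gcongr; linarith
  obtain ⟨c, ⟨h1, h2⟩, h3⟩ := exists_hasDerivAt_eq_slope Real.arctan (fun x => 1 / (1 + x ^ 2)) hlt
    Real.continuous_arctan.continuousOn (fun x _ => Real.hasDerivAt_arctan x)
  rw [div_lt_iff₀ hM'] at h1
  rw [lt_div_iff₀ hM'] at h2
  push_cast at h2
  refine ⟨c, by linarith, by linarith, ?_⟩
  rw [h3, wt]
  push_cast
  field_simp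
  ring

theorem wt_nonneg {M : ℕ} (hM : 0 < M) (i : ℤ) : 0 ≤ wt M i := by
  obtain ⟨x, _, _, h⟩ := exists_wt_eq hM i
  rw [h]; positivity

theorem wt_le_one {M : ℕ} (hM : 0 < M) (i : ℤ) : wt M i ≤ 1 := by
  obtain ⟨x, _, _, h⟩ := exists_wt_eq hM i
  rw [h, div_le_one (by positivity)]; nlinarith [sq_nonneg x]

theorem wt_sub_le {M : ℕ} (hM : 0 < M) {i : ℤ} {a : ℕ} (ha : 0 < a) {b : ℤ} (h : InCell M i a b) :
    |wt M i - 1 / (1 + ((b:ℝ) / a) ^ 2)| ≤ 1 / (M:ℝ) := by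
  obtain ⟨x, h1, h2, hx⟩ := exists_wt_eq hM i
  have hM' : (0:ℝ) < M := by exact_mod_cast hM
  have ha' : (0:ℝ) < a := by exact_mod_cast ha
  rw [hx]
  refine (inv_one_add_sq_sub_le _ _).trans ?_
  have h3 : (i:ℝ) ≤ M * ((b:ℝ) / a) := by
    rw [← mul_div_assoc, le_div_iff₀ ha']; exact_mod_cast h.1
  have h4 : M * ((b:ℝ) / a) < i + 1 := by
    rw [← mul_div_assoc, div_lt_iff₀ ha']; exact_mod_cast h.2
  have h5 : |((b:ℝ) / a - x) * M| ≤ 1 := by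
    rw [abs_le]; constructor <;> linarith
  rw [abs_mul, abs_of_pos hM'] at h5
  rwa [le_div_iff₀ hM']

theorem sum_wt (M : ℕ) (hM : 0 < M) (U : ℕ) : ∑ i ∈ Finset.Ico (-(U * M : ℤ)) (U * M), wt M i = M * (2 * Real.arctan U) := by
  have hM' : (M:ℝ) ≠ 0 := by exact_mod_cast hM.ne'
  have key : ∀ n : ℕ, ∑ i ∈ Finset.Ico (-(n : ℤ)) n, wt M i = M * (2 * Real.arctan ((n:ℝ) / M)) := by
    intro n
    induction n with
    | zero => simp
    | succ n ih =>
      have h : Finset.Ico (-((n+1:ℕ):ℤ)) ((n+1:ℕ):ℤ) = insert (-((n:ℤ)+1)) (insert (n:ℤ) (Finset.Ico (-(n:ℤ)) n)) := by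
        ext x; simp only [Finset.mem_insert, Finset.mem_Ico]; push_cast; omega
      rw [h, Finset.sum_insert (by simp), Finset.sum_insert (by simp), ih, wt, wt]
      have e1 : ((-((n:ℤ)+1) : ℤ) : ℝ) / M = -(((n+1:ℕ):ℝ) / M) := by push_cast; ring
      have e2 : ((-((n:ℤ)+1) + 1 : ℤ) : ℝ) / M = -((n:ℝ) / M) := by push_cast; ring
      have e3 : (((n:ℤ) + 1 : ℤ) : ℝ) / M = ((n+1:ℕ):ℝ) / M := by push_cast; ring
      have e4 : (((n:ℤ) : ℤ) : ℝ) / M = (n:ℝ) / M := by push_cast; ring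
      rw [e1, e2, e3, e4, Real.arctan_neg, Real.arctan_neg]
      ring
  have := key (U * M)
  push_cast at this
  rw [this, mul_div_assoc, div_self hM', mul_one]

theorem nsq_cell {U M : ℕ} (hM : 0 < M) {i j : ℤ} {t : ℕ × ℤ × ℤ} (ha : 0 < t.1)
    (hi : i ∈ Finset.Ico (-(U * M : ℤ)) (U * M)) (hj : j ∈ Finset.Ico (-(U * M : ℤ)) (U * M))
    (h1 : InCell M i t.1 t.2.1) (h2 : InCell M j t.1 t.2.2) {Y : ℝ} (hY : 0 ≤ Y) :
    (nsq t ≤ Y → (t.1:ℝ) ^ 2 ≤ Y * (wt M i * wt M j) + (2 * Y / M + 2 * U ^ 2 + 1)) ∧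
    ((t.1:ℝ) ^ 2 ≤ Y * (wt M i * wt M j) - (2 * Y / M + 2 * U ^ 2 + 1) → nsq t ≤ Y) := by
  obtain ⟨a, b, c⟩ := t
  simp only at *
  have hM' : (0:ℝ) < M := by exact_mod_cast hM
  have hMz : (0:ℤ) < M := by exact_mod_cast hM
  have haz : (0:ℤ) < a := by exact_mod_cast ha
  have ha' : (1:ℝ) ≤ a := by exact_mod_cast ha
  have hbd : ∀ {i b : ℤ}, i ∈ Finset.Ico (-(U * M : ℤ)) (U * M) → InCell M i a b → |(b:ℝ) / a| ≤ U := by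
    intro i b hi h
    rw [Finset.mem_Ico] at hi
    have h5 : (M:ℤ) * (-(U * a)) ≤ M * b := by nlinarith [h.1]
    have h6 : (M:ℤ) * b ≤ M * (U * a) := by nlinarith [h.2]
    have h7 := le_of_mul_le_mul_left h5 hMz
    have h8 := le_of_mul_le_mul_left h6 hMz
    rw [abs_div, abs_of_pos (by linarith : (0:ℝ) < a), div_le_iff₀ (by linarith), abs_le]
    constructor
    · exact_mod_cast h7
    · exact_mod_cast h8
  have hu := hbd hi h1
  have hv := hbd hj h2
  have hwu := wt_sub_le hM ha h1
  have hwv := wt_sub_le hM ha h2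
  have hw0 := wt_nonneg hM i
  have hw1 := wt_le_one hM i
  set w := wt M i
  set w' := wt M j
  set u := (b:ℝ) / a with hu'
  set v := (c:ℝ) / a with hv'
  have hnsq : nsq (a, b, c) = (a:ℝ) ^ 2 * ((1 + u ^ 2) * (1 + v ^ 2)) + 2 * (u * v) + (1 / (a:ℝ)) ^ 2 := by
    rw [nsq, hu', hv']; field_simp; ring
  have huv : |u * v| ≤ (U:ℝ) ^ 2 := by rw [abs_mul, sq]; gcongr
  have hP : (1:ℝ) ≤ (1 + u ^ 2) * (1 + v ^ 2) := by nlinarith [sq_nonneg u, sq_nonneg v, mul_nonneg (sq_nonneg u) (sq_nonneg v)]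
  have hq : |w * w' - 1 / ((1 + u ^ 2) * (1 + v ^ 2))| ≤ 2 / (M:ℝ) := by
    have e : w * w' - 1 / ((1 + u ^ 2) * (1 + v ^ 2)) = w * (w' - 1 / (1 + v ^ 2)) + (w - 1 / (1 + u ^ 2)) * (1 / (1 + v ^ 2)) := by
      field_simp; ring
    have h5 : 1 / (1 + v ^ 2) ≤ 1 := by rw [div_le_one (by positivity)]; nlinarith [sq_nonneg v]
    have h6 : 0 ≤ 1 / (1 + v ^ 2) := by positivity
    rw [e]
    refine (abs_add_le _ _).trans ?_
    rw [abs_mul, abs_mul, abs_of_nonneg hw0, abs_of_nonneg h6]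
    calc _ ≤ 1 * (1 / (M:ℝ)) + 1 / (M:ℝ) * 1 := by gcongr
      _ = _ := by ring
  have ha2 : (1 / (a:ℝ)) ^ 2 ≤ 1 := by
    apply pow_le_one₀ (by positivity)
    rw [div_le_one (by linarith)]; exact ha'
  have ha3 : 0 ≤ (1 / (a:ℝ)) ^ 2 := by positivity
  rw [hnsq]
  set P := (1 + u ^ 2) * (1 + v ^ 2)
  have hP0 : 0 < P := by linarith
  have hPq : P * (1 / P) = 1 := by field_simp
  have hq1 : 1 / P ≤ 1 := by rw [div_le_one hP0]; exact hP
  have hq0 : 0 < 1 / P := by positivity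
  set q := 1 / P
  have hYM : Y * (2 / (M:ℝ)) = 2 * Y / M := by ring
  obtain ⟨hq2, hq3⟩ := abs_le.1 hq
  obtain ⟨hs1, hs2⟩ := abs_le.1 huv
  have hU2 : (0:ℝ) ≤ (U:ℝ) ^ 2 := by positivity
  constructor
  · intro h
    have h5 : (a:ℝ) ^ 2 * P ≤ Y + 2 * U ^ 2 := by linarith
    have h6 : (a:ℝ) ^ 2 ≤ (Y + 2 * U ^ 2) * q := by
      calc (a:ℝ) ^ 2 = (a:ℝ) ^ 2 * P * q := by rw [mul_assoc, hPq, mul_one]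
        _ ≤ _ := by gcongr
    have h7 : Y * q ≤ Y * (w * w' + 2 / M) := by gcongr; linarith
    have h8 : (U:ℝ) ^ 2 * q ≤ U ^ 2 := mul_le_of_le_one_right hU2 hq1
    nlinarith
  · intro h
    have h7 : Y * (w * w') ≤ Y * (q + 2 / M) := by gcongr; linarith
    have h6 : (a:ℝ) ^ 2 ≤ Y * q - (2 * U ^ 2 + 1) := by nlinarith
    have h5 : (a:ℝ) ^ 2 * P ≤ (Y * q - (2 * U ^ 2 + 1)) * P := by gcongr
    have h8 : (Y * q - (2 * U ^ 2 + 1)) * P = Y - (2 * U ^ 2 + 1) * P := by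
      rw [sub_mul, mul_assoc, mul_comm q, hPq, mul_one]
    have h9 : (2 * (U:ℝ) ^ 2 + 1) * 1 ≤ (2 * U ^ 2 + 1) * P := by gcongr
    linarith

theorem floor_sqrt_sq_bounds (Z : ℝ) : Z - 2 * √Z ≤ (⌊√Z⌋₊ : ℝ) ^ 2 ∧ (⌊√Z⌋₊ : ℝ) ^ 2 ≤ max Z 0 := by
  have h1 := Nat.floor_le (Real.sqrt_nonneg Z)
  have h2 := Nat.lt_floor_add_one √Z
  have h3 : (0:ℝ) ≤ ⌊√Z⌋₊ := by positivity
  rcases le_total Z 0 with h | h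
  · have : √Z = 0 := Real.sqrt_eq_zero_of_nonpos h
    rw [this]; simp [h]
  · have h4 := Real.sq_sqrt h
    constructor
    · nlinarith
    · refine le_trans ?_ (le_max_left _ _)
      nlinarith

theorem exists_cell_nsq_count : ∃ C : ℝ, 0 < C ∧ ∀ (p : ℕ) [Fact p.Prime] (α β γ : ZMod p), α ≠ 0 →
    ∀ (U M : ℕ), 0 < M → ∀ R : ℝ, 1 ≤ R → (U:ℝ) ≤ R → ∀ i ∈ Finset.Ico (-(U * M : ℤ)) (U * M), ∀ j ∈ Finset.Ico (-(U * M : ℤ)) (U * M),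
    ∃ S : Finset (ℕ × ℤ × ℤ), (∀ t, t ∈ S ↔ t ∈ trip p α β γ ∧ nsq t ≤ R ^ 2 ∧ InCell M i t.1 t.2.1 ∧ InCell M j t.1 t.2.2) ∧
      |(S.card : ℝ) - totDens p / (p:ℝ) ^ 2 * R ^ 2 * (wt M i * wt M j) / (M:ℝ) ^ 2| ≤
        C * (R ^ (15/8:ℝ) + (R ^ 2 / M + U ^ 2 + R) / (M:ℝ) ^ 2) := by
  obtain ⟨C, hC, hcell⟩ := exists_cell_count
  refine ⟨9 * C + 7, by linarith, ?_⟩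
  intro p _ α β γ hα U M hM R hR hUR i hi j hj
  have hp : (2:ℝ) ≤ p := by exact_mod_cast (Fact.out : p.Prime).two_le
  have hM' : (1:ℝ) ≤ M := by exact_mod_cast hM
  set W := wt M i * wt M j with hW
  have hW0 : 0 ≤ W := mul_nonneg (wt_nonneg hM i) (wt_nonneg hM j)
  have hW1 : W ≤ 1 := mul_le_one₀ (wt_le_one hM i) (wt_nonneg hM j) (wt_le_one hM j)
  set E : ℝ := 2 * R ^ 2 / M + 2 * U ^ 2 + 1 with hE
  have hE0 : 0 ≤ E := by positivity
  have hU2 : (U:ℝ) ^ 2 ≤ R ^ 2 := by gcongr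
  have hE1 : E ≤ 5 * R ^ 2 := by
    have : 2 * R ^ 2 / M ≤ 2 * R ^ 2 := div_le_self (by positivity) hM'
    nlinarith
  set ρ := totDens p / (p:ℝ) ^ 2 with hρ
  have hρ1 : |ρ| ≤ 1 := by
    rw [hρ, abs_div, abs_of_nonneg (by positivity : (0:ℝ) ≤ (p:ℝ) ^ 2)]
    exact (div_le_self (abs_nonneg _) (one_le_pow₀ (by linarith))).trans (abs_totDens_le p)
  have key : ∀ Z : ℝ, R ^ 2 * W - E ≤ Z → Z ≤ R ^ 2 * W + E → ∀ S : Finset (ℕ × ℤ × ℤ),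
      |(S.card : ℝ) - totDens p * (⌊√Z⌋₊:ℝ) ^ 2 / ((M:ℝ) * p) ^ 2| ≤ C * (⌊√Z⌋₊:ℝ) ^ (15/8:ℝ) →
      |(S.card : ℝ) - ρ * R ^ 2 * W / (M:ℝ) ^ 2| ≤ (9 * C + 7) * (R ^ (15/8:ℝ) + (R ^ 2 / M + U ^ 2 + R) / (M:ℝ) ^ 2) := by
    intro Z hZ1 hZ2 S hS
    obtain ⟨h1, h2⟩ := floor_sqrt_sq_bounds Z
    have hRW : R ^ 2 * W ≤ R ^ 2 := mul_le_of_le_one_right (by positivity) hW1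
    have hRW0 : 0 ≤ R ^ 2 * W := by positivity
    have hsq : √Z ≤ 3 * R := by
      rw [Real.sqrt_le_left (by linarith)]; nlinarith
    have hn : (⌊√Z⌋₊:ℝ) ≤ 3 * R := (Nat.floor_le (Real.sqrt_nonneg Z)).trans hsq
    set n : ℝ := (⌊√Z⌋₊:ℝ)
    have hn0 : 0 ≤ n := by positivity
    have h3 : max Z 0 ≤ R ^ 2 * W + E := max_le hZ2 (by linarith)
    have h4 : |n ^ 2 - R ^ 2 * W| ≤ E + 6 * R := by
      rw [abs_le]; constructor <;> linarith
    have h5 : n ^ (15/8:ℝ) ≤ 9 * R ^ (15/8:ℝ) := by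
      calc n ^ (15/8:ℝ) ≤ (3 * R) ^ (15/8:ℝ) := by gcongr
        _ = 3 ^ (15/8:ℝ) * R ^ (15/8:ℝ) := Real.mul_rpow (by norm_num) (by linarith)
        _ ≤ 3 ^ (2:ℝ) * R ^ (15/8:ℝ) := by gcongr <;> norm_num
        _ = _ := by norm_num
    have h6 : |totDens p * n ^ 2 / ((M:ℝ) * p) ^ 2 - ρ * R ^ 2 * W / (M:ℝ) ^ 2| ≤ (E + 6 * R) / (M:ℝ) ^ 2 := by
      have e : totDens p * n ^ 2 / ((M:ℝ) * p) ^ 2 - ρ * R ^ 2 * W / (M:ℝ) ^ 2 = ρ * (n ^ 2 - R ^ 2 * W) / (M:ℝ) ^ 2 := by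
        rw [hρ]; field_simp
      rw [e, abs_div, abs_mul, abs_of_nonneg (by positivity : (0:ℝ) ≤ (M:ℝ) ^ 2)]
      gcongr
      calc _ ≤ 1 * (E + 6 * R) := by gcongr
        _ = _ := one_mul _
    refine (abs_sub_le _ _ _).trans ((add_le_add hS h6).trans ?_)
    have h7 : (E + 6 * R) / (M:ℝ) ^ 2 ≤ 7 * ((R ^ 2 / M + U ^ 2 + R) / (M:ℝ) ^ 2) := by
      rw [← mul_div_assoc]
      gcongr
      have e : 2 * R ^ 2 / (M:ℝ) = 2 * (R ^ 2 / M) := by ring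
      have : 0 ≤ R ^ 2 / (M:ℝ) := by positivity
      rw [hE, e]
      nlinarith [sq_nonneg (U:ℝ)]
    have h8 : 0 ≤ R ^ (15/8:ℝ) := by positivity
    have h9 : 0 ≤ (R ^ 2 / M + U ^ 2 + R) / (M:ℝ) ^ 2 := by positivity
    have h10 := mul_le_mul_of_nonneg_left h5 hC.le
    have h11 := mul_nonneg hC.le h9
    linarith
  obtain ⟨Sp, hSp, hSp'⟩ := hcell p α β γ hα M hM i j ⌊√(R ^ 2 * W + E)⌋₊
  obtain ⟨Sm, hSm, hSm'⟩ := hcell p α β γ hα M hM i j ⌊√(R ^ 2 * W - E)⌋₊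
  classical
  have hmem : ∀ t, t ∈ Sp.filter (fun t => nsq t ≤ R ^ 2) ↔
      t ∈ trip p α β γ ∧ nsq t ≤ R ^ 2 ∧ InCell M i t.1 t.2.1 ∧ InCell M j t.1 t.2.2 := by
    intro t
    rw [Finset.mem_filter, hSp]
    constructor
    · rintro ⟨⟨h1, _, h3, h4⟩, h5⟩
      exact ⟨h1, h5, h3, h4⟩
    · rintro ⟨h1, h2, h3, h4⟩
      refine ⟨⟨h1, ?_, h3, h4⟩, h2⟩
      exact Nat.le_floor (Real.le_sqrt_of_sq_le ((nsq_cell hM h1.1 hi hj h3 h4 (sq_nonneg R)).1 h2))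
  refine ⟨_, hmem, ?_⟩
  have hA := key _ (by linarith) le_rfl Sp hSp'
  have hB := key _ le_rfl (by linarith) Sm hSm'
  have hle1 : ((Sp.filter (fun t => nsq t ≤ R ^ 2)).card:ℝ) ≤ Sp.card := by exact_mod_cast Finset.card_filter_le _ _
  have hle2 : (Sm.card:ℝ) ≤ ((Sp.filter (fun t => nsq t ≤ R ^ 2)).card:ℝ) := by
    refine Nat.cast_le.2 (Finset.card_le_card fun t ht => (hmem t).2 ?_)
    obtain ⟨h1, h2, h3, h4⟩ := (hSm t).1 ht
    refine ⟨h1, (nsq_cell hM h1.1 hi hj h3 h4 (sq_nonneg R)).2 ?_, h3, h4⟩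
    have h5 : (t.1:ℝ) ≤ √(R ^ 2 * W - E) := (Nat.le_floor_iff (Real.sqrt_nonneg _)).1 h2
    have h6 : (1:ℝ) ≤ t.1 := by exact_mod_cast h1.1
    have h7 : 0 < R ^ 2 * W - E := Real.sqrt_pos.1 (by linarith)
    calc (t.1:ℝ) ^ 2 ≤ √(R ^ 2 * W - E) ^ 2 := by gcongr
      _ = _ := Real.sq_sqrt h7.le
  rw [abs_le] at hA hB ⊢
  constructor <;> linarith [hA.1, hA.2, hB.1, hB.2]

end weights

section fixedEntry

theorem card_le_of_forall_snd {S : Finset (ℕ × ℤ × ℤ)} {a : ℕ} (ha : 0 < a) {n : ℕ} {b : ℤ} (hb : b ≠ 0)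
    (hS : ∀ t ∈ S, t.1 = a ∧ t.2.1 = b ∧ ∃ d : ℤ, (a:ℤ) * d = 1 + t.2.1 * t.2.2 ∧ |d| ≤ n) :
    S.card ≤ 2 * n / b.natAbs + 1 := by
  have hb' : 0 < |b| := abs_pos.2 hb
  have ha' : (a:ℤ) ≠ 0 := by exact_mod_cast ha.ne'
  have hd : ∀ t : ℕ × ℤ × ℤ, ∃ d : ℤ, t ∈ S → (a:ℤ) * d = 1 + b * t.2.2 ∧ |d| ≤ n := by
    intro t
    by_cases h : t ∈ S
    · obtain ⟨_, h2, d, h3, h4⟩ := hS t h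
      exact ⟨d, fun _ => ⟨h2 ▸ h3, h4⟩⟩
    · exact ⟨0, fun h' => absurd h' h⟩
  choose d hd using hd
  have := Finset.card_le_card_of_injOn (s := S) (t := Finset.range (2 * n / b.natAbs + 1)) (fun t => ((d t + n) / |b|).toNat) ?_ ?_
  · simpa using this
  · intro t ht
    have h1 := abs_le.1 (hd t ht).2
    simp only [Finset.coe_range, Set.mem_Iio]
    have h2 : (d t + n) / |b| ≤ (2 * n) / |b| := Int.ediv_le_ediv hb' (by linarith)
    have h3 : ((2 * n : ℤ)) / |b| = ((2 * n / b.natAbs : ℕ) : ℤ) := by push_cast; rfl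
    rw [h3] at h2
    exact Nat.lt_succ_of_le (Int.toNat_le.2 h2)
  · intro t ht s hs hts
    obtain ⟨h1, h2⟩ := hd t ht
    obtain ⟨h3, h4⟩ := hd s hs
    have e1 : 0 ≤ (d t + n) / |b| := Int.ediv_nonneg (by linarith [(abs_le.1 h2).1]) hb'.le
    have e2 : 0 ≤ (d s + n) / |b| := Int.ediv_nonneg (by linarith [(abs_le.1 h4).1]) hb'.le
    have e3 : (d t + n) / |b| = (d s + n) / |b| := by simp only at hts; omega
    have hcop : IsCoprime b (a:ℤ) := ⟨-t.2.2, d t, by linarith⟩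
    have hdvd : b ∣ d t - d s := by
      refine hcop.dvd_of_dvd_mul_left (?_ : b ∣ (a:ℤ) * (d t - d s))
      exact ⟨t.2.2 - s.2.2, by linarith⟩
    have hlt : |d t - d s| < |b| := by
      have e4 := Int.mul_ediv_self_le (x := d t + n) hb'.ne'
      have e5 := Int.lt_mul_ediv_self_add (x := d t + n) hb'
      have e6 := Int.mul_ediv_self_le (x := d s + n) hb'.ne'
      have e7 := Int.lt_mul_ediv_self_add (x := d s + n) hb'
      rw [e3] at e4 e5
      rw [abs_lt]; constructor <;> linarith
    have h0 : d t = d s := sub_eq_zero.1 (Int.eq_zero_of_abs_lt_dvd ((abs_dvd b _).2 hdvd) hlt)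
    have h5 : b * t.2.2 = b * s.2.2 := by rw [h0] at h1; linarith
    obtain ⟨p1, p2, _⟩ := hS t ht
    obtain ⟨q1, q2, _⟩ := hS s hs
    exact Prod.ext (p1.trans q1.symm) (Prod.ext (p2.trans q2.symm) (mul_left_cancel₀ hb h5))

theorem card_le_of_forall_fst {S : Finset (ℕ × ℤ × ℤ)} {a : ℕ} (ha : 0 < a) {R : ℝ} (hR : 1 ≤ R)
    (hS : ∀ t ∈ S, t.1 = a ∧ (a:ℤ) ∣ 1 + t.2.1 * t.2.2 ∧ nsq t ≤ R ^ 2) : (S.card:ℝ) ≤ 9 * R * (1 + Real.log R) := by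
  classical
  have ha' : (0:ℝ) < a := by exact_mod_cast ha
  set n := ⌊R⌋₊ with hn
  have hn1 : 0 < n := Nat.floor_pos.2 hR
  have hnR : (n:ℝ) ≤ R := Nat.floor_le (by linarith)
  have hitg : ∀ z : ℤ, (z:ℝ) ^ 2 ≤ R ^ 2 → |z| ≤ n := by
    intro z hz
    have h1 : |(z:ℝ)| ≤ R := abs_le_of_sq_le_sq hz (by linarith)
    have h2 : ((z.natAbs : ℕ) : ℝ) ≤ R := by rwa [Nat.cast_natAbs, Int.cast_abs]
    have h3 := Nat.le_floor h2
    have : |z| = (z.natAbs : ℤ) := (Int.natCast_natAbs z).symm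
    rw [this]; exact_mod_cast h3
  have hbd : ∀ t ∈ S, |t.2.1| ≤ n ∧ |t.2.2| ≤ n ∧ ∃ d : ℤ, (a:ℤ) * d = 1 + t.2.1 * t.2.2 ∧ |d| ≤ n := by
    intro t ht
    obtain ⟨h1, ⟨d, h2⟩, h3⟩ := hS t ht
    have e : (1 + (t.2.1:ℝ) * t.2.2) / t.1 = d := by
      rw [h1, div_eq_iff ha'.ne']
      have : ((1 + t.2.1 * t.2.2 : ℤ) : ℝ) = ((a * d : ℤ) : ℝ) := by rw [h2]
      push_cast at this; linarith
    rw [nsq, e] at h3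
    have p1 := sq_nonneg (t.1:ℝ)
    have p2 := sq_nonneg (t.2.1:ℝ)
    have p3 := sq_nonneg (t.2.2:ℝ)
    have p4 := sq_nonneg (d:ℝ)
    exact ⟨hitg _ (by linarith), hitg _ (by linarith), d, h2.symm, hitg _ (by linarith)⟩
  have hfib : ∀ k ∈ Finset.Icc 1 n, (((S.filter fun t => t.2.1.natAbs = k).card : ℕ) : ℝ) ≤ 2 * (2 * n * (1 / (k:ℝ)) + 1) := by
    intro k hk
    have hk1 := (Finset.mem_Icc.1 hk).1
    have hsub : (S.filter fun t => t.2.1.natAbs = k) ⊆ (S.filter fun t => t.2.1 = k) ∪ (S.filter fun t => t.2.1 = -k) := by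
      intro t ht
      rw [Finset.mem_filter] at ht
      rw [Finset.mem_union, Finset.mem_filter, Finset.mem_filter]
      rcases Int.natAbs_eq t.2.1 with h | h
      · left; exact ⟨ht.1, by rw [h, ht.2]⟩
      · right; exact ⟨ht.1, by rw [h, ht.2]⟩
    have h1 : ∀ b : ℤ, b.natAbs = k → (((S.filter fun t => t.2.1 = b).card : ℕ) : ℝ) ≤ 2 * n * (1 / (k:ℝ)) + 1 := by
      intro b hb
      have h2 := card_le_of_forall_snd (S := S.filter fun t => t.2.1 = b) ha (n := n) (b := b) (by rintro rfl; simp at hb; omega)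
        fun t ht => ⟨(hS t (Finset.mem_filter.1 ht).1).1, (Finset.mem_filter.1 ht).2, (hbd t (Finset.mem_filter.1 ht).1).2.2⟩
      rw [hb] at h2
      have h3 : ((2 * n / k : ℕ) : ℝ) ≤ ((2 * n : ℕ) : ℝ) / k := Nat.cast_div_le
      have h4 : (((S.filter fun t => t.2.1 = b).card : ℕ) : ℝ) ≤ ((2 * n / k : ℕ) : ℝ) + 1 := by exact_mod_cast h2
      push_cast at h3
      have e : 2 * (n:ℝ) * (1 / (k:ℝ)) = 2 * n / k := by ring
      linarith
    have h2 : (((S.filter fun t => t.2.1.natAbs = k).card : ℕ) : ℝ) ≤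
        ((S.filter fun t => t.2.1 = (k:ℤ)).card : ℝ) + ((S.filter fun t => t.2.1 = (-(k:ℤ))).card : ℝ) := by
      exact_mod_cast (Finset.card_le_card hsub).trans (Finset.card_union_le _ _)
    have h3 := h1 k (by simp)
    have h4 := h1 (-k) (by simp)
    linarith
  have h0 : (((S.filter fun t => t.2.1.natAbs = 0).card : ℕ) : ℝ) ≤ 2 * n + 1 := by
    have := Finset.card_le_card_of_injOn (s := S.filter fun t => t.2.1.natAbs = 0) (t := Finset.Icc (-n : ℤ) n) (fun t => t.2.2) ?_ ?_
    · rw [Int.card_Icc] at this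
      have h2 : (S.filter fun t => t.2.1.natAbs = 0).card ≤ 2 * n + 1 := by omega
      exact_mod_cast h2
    · intro t ht
      have := (hbd t (Finset.mem_filter.1 ht).1).2.1
      rw [Finset.coe_Icc, Set.mem_Icc]
      exact abs_le.1 this
    · intro t ht s hs hts
      have ht := Finset.mem_filter.1 ht
      have hs := Finset.mem_filter.1 hs
      exact Prod.ext ((hS t ht.1).1.trans (hS s hs.1).1.symm) (Prod.ext ((Int.natAbs_eq_zero.1 ht.2).trans (Int.natAbs_eq_zero.1 hs.2).symm) hts)
  have hcard : S.card = ∑ k ∈ Finset.range (n + 1), (S.filter fun t => t.2.1.natAbs = k).card := by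
    refine Finset.card_eq_sum_card_fiberwise fun t ht => ?_
    have := abs_le.1 (hbd t ht).1
    simp only [Finset.coe_range, Set.mem_Iio]
    omega
  have hIcc : Finset.range (n + 1) = insert 0 (Finset.Icc 1 n) := by ext; simp; omega
  rw [hcard, hIcc, Finset.sum_insert (by simp), Nat.cast_add, Nat.cast_sum]
  have hsum : ∑ k ∈ Finset.Icc 1 n, (((S.filter fun t => t.2.1.natAbs = k).card : ℕ) : ℝ) ≤ 4 * n * (1 + Real.log n) + 2 * n := by
    refine (Finset.sum_le_sum hfib).trans ?_
    rw [← Finset.mul_sum, Finset.sum_add_distrib, ← Finset.mul_sum]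
    have := mul_le_mul_of_nonneg_left (sum_Icc_inv_le n) (by positivity : (0:ℝ) ≤ 4 * n)
    simp only [Finset.sum_const, Nat.card_Icc, nsmul_eq_mul]
    push_cast [Nat.add_sub_cancel]
    linarith
  have hlog : Real.log n ≤ Real.log R := Real.log_le_log (by exact_mod_cast hn1) hnR
  have hlogn : 0 ≤ Real.log n := Real.log_nonneg (by exact_mod_cast hn1)
  have h5 : (n:ℝ) * (1 + Real.log n) ≤ R * (1 + Real.log R) := by gcongr
  nlinarith

end fixedEntry

section total

theorem abs_two_arctan_sq_sub_le {U : ℕ} (hU : 0 < U) : |(2 * Real.arctan U) ^ 2 - Real.pi ^ 2| ≤ 16 / (U:ℝ) := by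
  have hU' : (0:ℝ) < U := by exact_mod_cast hU
  have h1 := Real.arctan_inv_of_pos hU'
  have h2 : Real.arctan ((U:ℝ)⁻¹) ≤ (U:ℝ)⁻¹ := by
    have := Real.le_tan (Real.arctan_nonneg.2 (by positivity : 0 ≤ (U:ℝ)⁻¹)) (Real.arctan_lt_pi_div_two _)
    rwa [Real.tan_arctan] at this
  have h3 := Real.arctan_nonneg.2 (by positivity : 0 ≤ (U:ℝ)⁻¹)
  have h4 := Real.arctan_lt_pi_div_two (U:ℝ)
  have h5 := Real.arctan_nonneg.2 hU'.le
  have h6 := Real.pi_le_four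
  set x := Real.arctan (U:ℝ)
  have e : (2 * x) ^ 2 - Real.pi ^ 2 = -((Real.pi - 2 * x) * (Real.pi + 2 * x)) := by ring
  rw [e, abs_neg, abs_of_nonneg (by apply mul_nonneg <;> linarith), div_eq_mul_inv]
  calc (Real.pi - 2 * x) * (Real.pi + 2 * x) ≤ (2 * (U:ℝ)⁻¹) * 8 := by gcongr <;> linarith
    _ = _ := by ring

theorem exists_nsq_count_aux : ∃ C : ℝ, 0 < C ∧ ∀ (p : ℕ) [Fact p.Prime] (α β γ : ZMod p), α ≠ 0 →
    ∀ R : ℝ, 1 ≤ R → ∀ U : ℕ, 0 < U → (U:ℝ) ^ 80 ≤ R →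
    ∃ S : Finset (ℕ × ℤ × ℤ), (∀ t, t ∈ S ↔ t ∈ trip p α β γ ∧ nsq t ≤ R ^ 2) ∧
      |(S.card : ℝ) - totDens p / (p:ℝ) ^ 2 * Real.pi ^ 2 * R ^ 2| ≤ C * (R ^ 2 * (1 + Real.log R) / U) := by
  classical
  obtain ⟨C, hC, hcell⟩ := exists_cell_nsq_count
  refine ⟨16 * C + 25, by linarith, ?_⟩
  intro p _ α β γ hα R hR U hU hUR
  have hp : (2:ℝ) ≤ p := by exact_mod_cast (Fact.out : p.Prime).two_le
  have hU' : (1:ℝ) ≤ U := by exact_mod_cast hU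
  have hlog := Real.log_nonneg hR
  set ρ := totDens p / (p:ℝ) ^ 2 with hρ
  have hρ1 : |ρ| ≤ 1 := by
    rw [hρ, abs_div, abs_of_nonneg (by positivity : (0:ℝ) ≤ (p:ℝ) ^ 2)]
    exact (div_le_self (abs_nonneg _) (one_le_pow₀ (by linarith))).trans (abs_totDens_le p)
  have hfin : {t : ℕ × ℤ × ℤ | t ∈ trip p α β γ ∧ nsq t ≤ R ^ 2}.Finite := by
    set n := ⌈R⌉₊
    have hn : R ≤ n := Nat.le_ceil R
    have hz : ∀ z : ℤ, (z:ℝ) ^ 2 ≤ R ^ 2 → z ∈ Set.Icc (-n : ℤ) n := by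
      intro z hz
      obtain ⟨h1, h2⟩ := abs_le.1 (abs_le_of_sq_le_sq hz (by linarith))
      constructor
      · have : (-n:ℝ) ≤ z := by linarith
        exact_mod_cast this
      · have : (z:ℝ) ≤ n := by linarith
        exact_mod_cast this
    refine Set.Finite.subset ((Set.finite_Icc 0 n).prod ((Set.finite_Icc (-n : ℤ) n).prod (Set.finite_Icc (-n : ℤ) n))) ?_
    rintro t ⟨_, h⟩
    rw [nsq] at h
    have p1 := sq_nonneg (t.1:ℝ)
    have p2 := sq_nonneg (t.2.1:ℝ)
    have p3 := sq_nonneg (t.2.2:ℝ)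
    have p4 := sq_nonneg ((1 + (t.2.1:ℝ) * t.2.2) / t.1)
    have h1 := hz t.1 (by push_cast; linarith)
    exact ⟨⟨Nat.zero_le _, by exact_mod_cast h1.2⟩, hz _ (by linarith), hz _ (by linarith)⟩
  obtain ⟨S, hS⟩ : ∃ S : Finset (ℕ × ℤ × ℤ), ∀ t, t ∈ S ↔ t ∈ trip p α β γ ∧ nsq t ≤ R ^ 2 :=
    ⟨hfin.toFinset, fun t => by rw [Set.Finite.mem_toFinset]; rfl⟩
  refine ⟨S, hS, ?_⟩
  set M := U ^ 3 with hM
  have hM0 : 0 < M := by positivity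
  have hMz : (0:ℤ) < M := by exact_mod_cast hM0
  set I := Finset.Ico (-(U * M : ℤ)) (U * M) with hI
  set f : ℕ × ℤ × ℤ → ℤ × ℤ := fun t => (M * t.2.1 / t.1, M * t.2.2 / t.1) with hf
  have hfc : ∀ (a : ℕ) (b i : ℤ), 0 < a → ((M:ℤ) * b / a = i ↔ InCell M i a b) := by
    intro a b i ha
    rw [Int.ediv_eq_iff_of_pos (by exact_mod_cast ha), InCell, add_mul, one_mul]
  choose! F hF hF' using fun i (hi : i ∈ I) j (hj : j ∈ I) => hcell p α β γ hα U M hM0 R hR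
    ((le_self_pow₀ hU' (by norm_num)).trans hUR) i hi j hj
  have hin : ((S.filter fun t => f t ∈ I ×ˢ I).card : ℝ) = ∑ i ∈ I, ∑ j ∈ I, ((F i j).card : ℝ) := by
    rw [Finset.card_eq_sum_card_fiberwise (s := S.filter fun t => f t ∈ I ×ˢ I) (f := f) (t := I ×ˢ I) fun t ht => (Finset.mem_filter.1 ht).2, Finset.sum_product,
      Nat.cast_sum]
    refine Finset.sum_congr rfl fun i hi => ?_
    rw [Nat.cast_sum]
    refine Finset.sum_congr rfl fun j hj => ?_
    congr 2
    ext t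
    rw [Finset.mem_filter, Finset.mem_filter, hS, hF i hi j hj, Finset.mem_product]
    simp only [hf, Prod.mk.injEq]
    constructor
    · rintro ⟨⟨⟨h1, h2⟩, _⟩, h3, h4⟩
      exact ⟨h1, h2, (hfc _ _ _ h1.1).1 h3, (hfc _ _ _ h1.1).1 h4⟩
    · rintro ⟨h1, h2, h3, h4⟩
      have h3' := (hfc _ _ _ h1.1).2 h3
      have h4' := (hfc _ _ _ h1.1).2 h4
      exact ⟨⟨⟨h1, h2⟩, by rw [h3']; exact hi, by rw [h4']; exact hj⟩, h3', h4'⟩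
  have hout : ((S.filter fun t => ¬ f t ∈ I ×ˢ I).card : ℝ) ≤ R / U * (9 * R * (1 + Real.log R)) := by
    have hsmall : ∀ t ∈ S.filter fun t => ¬ f t ∈ I ×ˢ I, t.1 ∈ Finset.Icc 1 ⌊R / U⌋₊ := by
      intro t ht
      rw [Finset.mem_filter, hS, Finset.mem_product] at ht
      obtain ⟨⟨h1, h2⟩, h3⟩ := ht
      have ha : (0:ℤ) < t.1 := by exact_mod_cast h1.1
      have hb : ∀ b : ℤ, (b:ℝ) ^ 2 ≤ R ^ 2 → (M:ℤ) * b / t.1 ∉ I → (t.1:ℝ) ≤ R / U := by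
        intro b hb h
        rw [hI, Finset.mem_Ico, not_and_or, not_le, not_lt, Int.ediv_lt_iff_lt_mul ha, Int.le_ediv_iff_mul_le ha] at h
        have h5 : (U:ℤ) * t.1 ≤ |b| := by
          rcases h with h | h
          · have : (M:ℤ) * (U * t.1) ≤ M * (-b) := by nlinarith
            exact (le_of_mul_le_mul_left this hMz).trans (neg_le_abs b)
          · have : (M:ℤ) * (U * t.1) ≤ M * b := by nlinarith
            exact (le_of_mul_le_mul_left this hMz).trans (le_abs_self b)
        have h6 : (U:ℝ) * t.1 ≤ |(b:ℝ)| := by exact_mod_cast h5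
        rw [le_div_iff₀ (by linarith)]
        linarith [abs_le_of_sq_le_sq hb (by linarith)]
      rw [Finset.mem_Icc]
      refine ⟨h1.1, Nat.le_floor ?_⟩
      rw [nsq] at h2
      have p1 := sq_nonneg (t.1:ℝ)
      have p2 := sq_nonneg (t.2.1:ℝ)
      have p3 := sq_nonneg (t.2.2:ℝ)
      have p4 := sq_nonneg ((1 + (t.2.1:ℝ) * t.2.2) / t.1)
      rcases not_and_or.1 h3 with h | h
      · exact hb _ (by linarith) h
      · exact hb _ (by linarith) h
    rw [Finset.card_eq_sum_card_fiberwise (s := S.filter fun t => ¬ f t ∈ I ×ˢ I) (f := fun t : ℕ × ℤ × ℤ => t.1) (t := Finset.Icc 1 ⌊R / U⌋₊) (fun t ht => hsmall t ht), Nat.cast_sum]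
    calc _ ≤ ∑ a ∈ Finset.Icc 1 ⌊R / U⌋₊, 9 * R * (1 + Real.log R) := by
          refine Finset.sum_le_sum fun a ha => card_le_of_forall_fst (Finset.mem_Icc.1 ha).1 hR fun t ht => ?_
          obtain ⟨h1, rfl⟩ := Finset.mem_filter.1 ht
          obtain ⟨h3, h4⟩ := (hS t).1 (Finset.mem_filter.1 h1).1
          exact ⟨rfl, h3.2.2.2.2, h4⟩
      _ = ⌊R / U⌋₊ * (9 * R * (1 + Real.log R)) := by
          rw [Finset.sum_const, Nat.card_Icc, Nat.add_sub_cancel, nsmul_eq_mul]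
      _ ≤ _ := by
          gcongr; exact Nat.floor_le (by positivity)
  have hsplit : (S.card : ℝ) = ((S.filter fun t => f t ∈ I ×ˢ I).card : ℝ) + ((S.filter fun t => ¬ f t ∈ I ×ˢ I).card : ℝ) := by
    exact_mod_cast (Finset.card_filter_add_card_filter_not (s := S) (fun t => f t ∈ I ×ˢ I)).symm
  have hmain : ∑ i ∈ I, ∑ j ∈ I, ρ * R ^ 2 * (wt M i * wt M j) / (M:ℝ) ^ 2 = ρ * R ^ 2 * (2 * Real.arctan U) ^ 2 := by
    have h1 : ∑ i ∈ I, ∑ j ∈ I, ρ * R ^ 2 * (wt M i * wt M j) / (M:ℝ) ^ 2 = ρ * R ^ 2 / (M:ℝ) ^ 2 * ((∑ i ∈ I, wt M i) * ∑ j ∈ I, wt M j) := by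
      rw [Finset.sum_mul_sum, Finset.mul_sum]
      refine Finset.sum_congr rfl fun i _ => ?_
      rw [Finset.mul_sum]
      refine Finset.sum_congr rfl fun j _ => ?_
      ring
    have hM' : (M:ℝ) ≠ 0 := by positivity
    rw [h1, sum_wt M hM0 U]; field_simp
  have hIcard : (I.card : ℝ) = 2 * U * M := by
    rw [hI, Int.card_Ico]
    have : ((U * M : ℤ) - -(U * M : ℤ)).toNat = 2 * U * M := by
      have : (U * M : ℤ) - -(U * M : ℤ) = ((2 * U * M : ℕ) : ℤ) := by push_cast; ring
      rw [this, Int.toNat_natCast]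
    rw [this]; push_cast; ring
  set δ := R ^ (15/8:ℝ) + (R ^ 2 / M + U ^ 2 + R) / (M:ℝ) ^ 2 with hδ
  have herr : |∑ i ∈ I, ∑ j ∈ I, ((F i j).card : ℝ) - ρ * R ^ 2 * (2 * Real.arctan U) ^ 2| ≤ (2 * U * M) * ((2 * U * M) * (C * δ)) := by
    rw [← hmain, ← Finset.sum_sub_distrib]
    refine (Finset.abs_sum_le_sum_abs _ _).trans ?_
    calc _ ≤ ∑ i ∈ I, (2 * U * M) * (C * δ) := by
          refine Finset.sum_le_sum fun i hi => ?_
          rw [← Finset.sum_sub_distrib]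
          refine (Finset.abs_sum_le_sum_abs _ _).trans ((Finset.sum_le_sum fun j hj => hF' i hi j hj).trans ?_)
          rw [Finset.sum_const, nsmul_eq_mul, hIcard]
      _ = _ := by rw [Finset.sum_const, nsmul_eq_mul, hIcard]
  have hU0 : (0:ℝ) < U := by linarith
  have hpowU : ∀ k : ℕ, k ≤ 80 → (U:ℝ) ^ k ≤ R := fun k hk => (pow_le_pow_right₀ hU' hk).trans hUR
  have hδ' : (2 * U * M) * ((2 * U * M) * (C * δ)) ≤ 16 * C * (R ^ 2 / U) := by
    have e : (2 * U * M) * ((2 * U * M) * (C * δ)) = 4 * C * (U ^ 8 * R ^ (15/8:ℝ) + (R ^ 2 / U + U ^ 4 + U ^ 2 * R)) := by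
      rw [hδ, hM]; push_cast; field_simp; ring
    have q1 : (U:ℝ) ^ 8 * R ^ (15/8:ℝ) ≤ R ^ 2 / U := by
      rw [le_div_iff₀ hU0]
      have : (U:ℝ) ^ 9 ≤ R ^ (1/8:ℝ) := by
        rw [← Real.rpow_natCast, Nat.cast_ofNat]
        rw [show (9:ℝ) = 72 * (1/8) by norm_num, Real.rpow_mul hU0.le]
        refine Real.rpow_le_rpow (by positivity) ?_ (by norm_num)
        have := hpowU 72 (by norm_num)
        rw [← Real.rpow_natCast, Nat.cast_ofNat] at this
        exact this
      calc (U:ℝ) ^ 8 * R ^ (15/8:ℝ) * U = R ^ (15/8:ℝ) * U ^ 9 := by ring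
        _ ≤ R ^ (15/8:ℝ) * R ^ (1/8:ℝ) := by gcongr
        _ = R ^ 2 := by
            rw [← Real.rpow_add (by linarith), ← Real.rpow_natCast]; norm_num
    have q2 : (U:ℝ) ^ 4 ≤ R ^ 2 / U := by
      rw [le_div_iff₀ hU0]
      calc (U:ℝ) ^ 4 * U = U ^ 5 := by ring
        _ ≤ R := hpowU 5 (by norm_num)
        _ ≤ R ^ 2 := le_self_pow₀ hR (by norm_num)
    have q3 : (U:ℝ) ^ 2 * R ≤ R ^ 2 / U := by
      rw [le_div_iff₀ hU0]
      calc (U:ℝ) ^ 2 * R * U = U ^ 3 * R := by ring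
        _ ≤ R * R := by gcongr; exact hpowU 3 (by norm_num)
        _ = R ^ 2 := by ring
    rw [e]
    calc _ ≤ 4 * C * (R ^ 2 / U + (R ^ 2 / U + R ^ 2 / U + R ^ 2 / U)) := by gcongr
      _ = _ := by ring
  have harc : |ρ * R ^ 2 * (2 * Real.arctan U) ^ 2 - ρ * Real.pi ^ 2 * R ^ 2| ≤ 16 * (R ^ 2 / U) := by
    have e : ρ * R ^ 2 * (2 * Real.arctan U) ^ 2 - ρ * Real.pi ^ 2 * R ^ 2 = ρ * (R ^ 2 * ((2 * Real.arctan U) ^ 2 - Real.pi ^ 2)) := by ring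
    rw [e, abs_mul, abs_mul, abs_of_nonneg (sq_nonneg R)]
    calc _ ≤ 1 * (R ^ 2 * (16 / (U:ℝ))) := by gcongr; exact abs_two_arctan_sq_sub_le hU
      _ = _ := by ring
  have hX : R ^ 2 / U ≤ R ^ 2 * (1 + Real.log R) / U := by
    gcongr; nlinarith [sq_nonneg R]
  have hX' : R / U * (9 * R * (1 + Real.log R)) = 9 * (R ^ 2 * (1 + Real.log R) / U) := by ring
  rw [hX'] at hout
  have hout0 : (0:ℝ) ≤ ((S.filter fun t => ¬ f t ∈ I ×ˢ I).card : ℝ) := by positivity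
  rw [hsplit, hin]
  have hCX := mul_le_mul_of_nonneg_left hX hC.le
  rw [abs_le] at herr harc ⊢
  constructor <;> linarith [herr.1, herr.2, harc.1, harc.2]

theorem exists_nsq_count : ∃ C : ℝ, 0 < C ∧ ∀ (p : ℕ) [Fact p.Prime] (α β γ : ZMod p), α ≠ 0 →
    ∀ R : ℝ, 1 ≤ R →
    ∃ S : Finset (ℕ × ℤ × ℤ), (∀ t, t ∈ S ↔ t ∈ trip p α β γ ∧ nsq t ≤ R ^ 2) ∧
      |(S.card : ℝ) - totDens p / (p:ℝ) ^ 2 * Real.pi ^ 2 * R ^ 2| ≤ C * R ^ (2 - 1/160:ℝ) := by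
  obtain ⟨C, hC, h⟩ := exists_nsq_count_aux
  refine ⟨C * 322, by linarith, ?_⟩
  intro p _ α β γ hα R hR
  have hR0 : 0 < R := by linarith
  set U := ⌊R ^ (1/80:ℝ)⌋₊ with hU
  have hone : (1:ℝ) ≤ R ^ (1/80:ℝ) := Real.one_le_rpow hR (by norm_num)
  have hU0 : 0 < U := Nat.floor_pos.2 hone
  have hU1 : (U:ℝ) ≤ R ^ (1/80:ℝ) := Nat.floor_le (by linarith)
  have hU2 : R ^ (1/80:ℝ) ≤ 2 * U := by
    have h1 := Nat.lt_floor_add_one (R ^ (1/80:ℝ))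
    have h2 : (1:ℝ) ≤ U := by exact_mod_cast hU0
    linarith
  have hUR : (U:ℝ) ^ 80 ≤ R := by
    calc (U:ℝ) ^ 80 ≤ (R ^ (1/80:ℝ)) ^ 80 := by gcongr
      _ = R := by rw [← Real.rpow_natCast, ← Real.rpow_mul hR0.le]; norm_num
  obtain ⟨S, hS, hS'⟩ := h p α β γ hα R hR U hU0 hUR
  refine ⟨S, hS, hS'.trans ?_⟩
  rw [mul_assoc]
  gcongr
  rw [div_le_iff₀ (by exact_mod_cast hU0)]
  have hlog : 1 + Real.log R ≤ 161 * R ^ (1/160:ℝ) := by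
    have h1 := Real.log_le_rpow_div hR0.le (show (0:ℝ) < 1/160 by norm_num)
    have h2 : (1:ℝ) ≤ R ^ (1/160:ℝ) := Real.one_le_rpow hR (by norm_num)
    linarith
  calc R ^ 2 * (1 + Real.log R) ≤ R ^ 2 * (161 * R ^ (1/160:ℝ)) := by gcongr
    _ = 161 * R ^ (2 - 1/160:ℝ) * R ^ (1/80:ℝ) := by
        rw [mul_assoc, ← Real.rpow_add hR0, ← Real.rpow_natCast R 2]
        rw [mul_left_comm, ← Real.rpow_add hR0]; norm_num
    _ ≤ 161 * R ^ (2 - 1/160:ℝ) * (2 * U) := by gcongr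
    _ = _ := by ring

end total

section planeCount

/-- The sum of the squares of the entries. -/
def fsq (A : Matrix (Fin 2) (Fin 2) ℝ) : ℝ := A 0 0 ^ 2 + A 0 1 ^ 2 + A 1 0 ^ 2 + A 1 1 ^ 2

theorem phi_le_iff_fsq_le (g : SLR 2) {t : ℝ} (ht : 0 ≤ t) :
    phi g ≤ t ↔ fsq g ≤ 2 * Real.cosh (√2 * t) := by
  obtain ⟨x, -, hx⟩ := exists_isSVD g
  have h0 := hx.sum_zero
  have htr := hx.trace
  rw [Matrix.trace_fin_two] at htr
  rw [Fin.sum_univ_two] at h0 htr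
  have h1 : x 1 = - x 0 := by linarith
  rw [h1] at htr
  have hf : fsq g = 2 * Real.cosh (2 * x 0) := by
    rw [Real.cosh_eq]
    simp [Matrix.mul_apply, Fin.sum_univ_two] at htr
    rw [fsq]
    linear_combination htr
  have hphi : phi g = √2 * |x 0| := by
    rw [hx.phi_eq, en, Fin.sum_univ_two, h1, show x 0 ^ 2 + (-x 0) ^ 2 = 2 * x 0 ^ 2 by ring,
      Real.sqrt_mul (by norm_num), Real.sqrt_sq_eq_abs]
  have h2 : √2 * √2 = (2:ℝ) := Real.mul_self_sqrt (by norm_num)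
  have h3 : (0:ℝ) < √2 := by positivity
  rw [hf, mul_le_mul_iff_right₀ (by norm_num : (0:ℝ) < 2), Real.cosh_le_cosh, hphi, abs_mul, abs_mul, abs_of_pos h3, abs_of_nonneg ht,
    abs_of_pos (by norm_num : (0:ℝ) < 2)]
  nth_rewrite 2 [← h2]
  rw [mul_assoc, mul_le_mul_iff_right₀ h3]

/-- Reduction modulo `p`. -/
noncomputable def redMod (p : ℕ) : Matrix.SpecialLinearGroup (Fin 2) ℤ →* Matrix.SpecialLinearGroup (Fin 2) (ZMod p) :=
  Matrix.SpecialLinearGroup.map (n := Fin 2) (Int.castRingHom (ZMod p))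

theorem redMod_apply (p : ℕ) (x : Matrix.SpecialLinearGroup (Fin 2) ℤ) (i j : Fin 2) :
    redMod p x i j = ((x i j : ℤ) : ZMod p) := rfl

theorem exists_mem_congSubgroup_iff (p : ℕ) (x γ : Matrix.SpecialLinearGroup (Fin 2) ℤ) :
    (∃ δ ∈ congSubgroup 2 p, x = γ * δ) ↔ redMod p x = redMod p γ := by
  constructor
  · rintro ⟨δ, hδ, rfl⟩
    have : redMod p δ = 1 := hδ
    rw [map_mul, this, mul_one]
  · intro h
    refine ⟨γ⁻¹ * x, ?_, by group⟩
    show redMod p (γ⁻¹ * x) = 1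
    rw [map_mul, h, ← map_mul, inv_mul_cancel, map_one]

/-- The integral points of the ball in a class modulo `p` whose upper left entry is positive. -/
def posPts (p : ℕ) (g : Matrix.SpecialLinearGroup (Fin 2) (ZMod p)) (Y : ℝ) : Set (Matrix.SpecialLinearGroup (Fin 2) ℤ) :=
  {x | redMod p x = g ∧ 0 < x 0 0 ∧ fsq (toSLR x : SLR 2) ≤ Y}

theorem toSLR_apply (x : Matrix.SpecialLinearGroup (Fin 2) ℤ) (i j : Fin 2) :
    (toSLR x : SLR 2) i j = ((x i j : ℤ) : ℝ) := rfl

theorem ncard_posPts {p : ℕ} [Fact p.Prime] {g : Matrix.SpecialLinearGroup (Fin 2) (ZMod p)} (hg : g 0 0 ≠ 0) {Y : ℝ}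
    {S : Finset (ℕ × ℤ × ℤ)} (hS : ∀ t, t ∈ S ↔ t ∈ trip p (g 0 0) (g 0 1) (g 1 0) ∧ nsq t ≤ Y) :
    (posPts p g Y).ncard = S.card := by
  have hdet : ∀ x : Matrix.SpecialLinearGroup (Fin 2) ℤ, x 0 0 * x 1 1 = 1 + x 0 1 * x 1 0 := by
    intro x
    have := x.det_coe
    rw [Matrix.det_fin_two] at this
    linarith
  have hgdet : g 0 0 * g 1 1 = 1 + g 0 1 * g 1 0 := by
    have := g.det_coe
    rw [Matrix.det_fin_two] at this
    linear_combination this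
  have hd : ∀ x : Matrix.SpecialLinearGroup (Fin 2) ℤ, 0 < x 0 0 → (1 + (x 0 1 : ℝ) * x 1 0) / x 0 0 = x 1 1 := by
    intro x hx
    have : ((x 0 0 : ℤ) : ℝ) ≠ 0 := by exact_mod_cast hx.ne'
    rw [div_eq_iff this]
    exact_mod_cast (by rw [← hdet x, mul_comm] : 1 + x 0 1 * x 1 0 = x 1 1 * x 0 0)
  rw [← Set.ncard_coe_finset]
  refine Set.ncard_congr (fun x _ => ((x 0 0).toNat, x 0 1, x 1 0)) ?_ ?_ ?_
  · rintro x ⟨rfl, h2, h3⟩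
    have hz : (((x 0 0).toNat : ℕ) : ℤ) = x 0 0 := Int.toNat_of_nonneg h2.le
    have hz' : (((x 0 0).toNat : ℕ) : ℝ) = x 0 0 := by exact_mod_cast hz
    rw [Finset.mem_coe, hS]
    refine ⟨⟨by show 0 < (x 0 0).toNat; omega, ?_, rfl, rfl, ?_⟩, ?_⟩
    · show (((x 0 0).toNat : ℕ) : ZMod p) = _
      rw [redMod_apply, ← hz, Int.cast_natCast, hz]
    · show (((x 0 0).toNat : ℕ) : ℤ) ∣ 1 + x 0 1 * x 1 0
      rw [hz, ← hdet x]; exact dvd_mul_right _ _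
    · refine le_of_eq_of_le ?_ h3
      simp only [nsq, fsq, toSLR_apply, hz', hd x h2]
  · rintro x y ⟨-, hx, -⟩ ⟨-, hy, -⟩ h
    simp only [Prod.mk.injEq] at h
    obtain ⟨h1, h2, h3⟩ := h
    have h1' : x 0 0 = y 0 0 := by omega
    have h4 : x 1 1 = y 1 1 := by
      have e1 := hdet x
      rw [h1', h2, h3, ← hdet y] at e1
      exact mul_left_cancel₀ hy.ne' e1
    ext i j
    fin_cases i <;> fin_cases j <;> assumption
  · rintro ⟨a, b, c⟩ ht
    rw [Finset.mem_coe, hS] at ht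
    obtain ⟨⟨h1, h2, h3, h4, k, hk⟩, h6⟩ := ht
    simp only at h1 h2 h3 h4 hk
    have ha : (0:ℤ) < a := by exact_mod_cast h1
    have hk' : 1 + (b:ℝ) * c = a * k := by exact_mod_cast hk
    have hkp : 1 + (b:ZMod p) * c = a * k := by exact_mod_cast congrArg (Int.cast (R := ZMod p)) hk
    have ha' : (a:ℝ) ≠ 0 := by exact_mod_cast h1.ne'
    obtain ⟨x, hx⟩ : ∃ x : Matrix.SpecialLinearGroup (Fin 2) ℤ, (x : Matrix (Fin 2) (Fin 2) ℤ) = !![(a:ℤ), b; c, k] :=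
      ⟨⟨!![(a:ℤ), b; c, k], by rw [Matrix.det_fin_two_of]; linarith⟩, rfl⟩
    have x00 : x 0 0 = a := congrFun₂ hx 0 0
    have x01 : x 0 1 = b := congrFun₂ hx 0 1
    have x10 : x 1 0 = c := congrFun₂ hx 1 0
    have x11 : x 1 1 = k := congrFun₂ hx 1 1
    refine ⟨x, ⟨?_, by rw [x00]; exact ha, ?_⟩, by simp [x00, x01, x10]⟩
    · ext i j
      rw [redMod_apply]
      fin_cases i <;> fin_cases j
      · show ((x 0 0 : ℤ) : ZMod p) = _
        rw [x00, Int.cast_natCast]; exact h2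
      · show ((x 0 1 : ℤ) : ZMod p) = _
        rw [x01]; exact h3
      · show ((x 1 0 : ℤ) : ZMod p) = _
        rw [x10]; exact h4
      · show ((x 1 1 : ℤ) : ZMod p) = g 1 1
        rw [x11]
        have : g 0 0 * ((k : ℤ) : ZMod p) = g 0 0 * g 1 1 := by
          rw [hgdet, ← h2, ← h3, ← h4, hkp]
        exact mul_left_cancel₀ hg this
    · refine le_of_eq_of_le ?_ h6
      simp only [nsq, fsq, toSLR_apply, hk', x00, x01, x10, x11]
      rw [mul_div_cancel_left₀ _ ha', Int.cast_natCast]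

theorem finite_fsq_le (Y : ℝ) : {x : Matrix.SpecialLinearGroup (Fin 2) ℤ | fsq (toSLR x : SLR 2) ≤ Y}.Finite := by
  refine (finite_phi_toSLR_le (d := 2) |Y|).subset fun x hx => ?_
  have hx' : fsq (toSLR x : SLR 2) ≤ Y := hx
  refine (phi_le_iff_fsq_le _ (abs_nonneg Y)).2 (hx'.trans ?_)
  have h1 : 1 ≤ √(2:ℝ) := Real.one_le_sqrt.2 (by norm_num)
  have h2 := Real.add_one_le_exp (√2 * |Y|)
  have h3 := Real.exp_pos (-(√2 * |Y|))
  have h4 := le_abs_self Y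
  have h5 := abs_nonneg Y
  rw [Real.cosh_eq]
  nlinarith

theorem cnt_eq_of_ne_zero {p : ℕ} [Fact p.Prime] {γ : Matrix.SpecialLinearGroup (Fin 2) ℤ}
    (hγ : redMod p γ 0 0 ≠ 0) {t : ℝ} (ht : 0 ≤ t) :
    cnt 2 p γ t = (posPts p (redMod p γ) (2 * Real.cosh (√2 * t))).ncard +
      (posPts p (-redMod p γ) (2 * Real.cosh (√2 * t))).ncard := by
  set Y := 2 * Real.cosh (√2 * t)
  have hneg : (posPts p (-redMod p γ) Y).ncard = ((fun x => -x) '' posPts p (-redMod p γ) Y).ncard :=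
    (Set.ncard_image_of_injective _ neg_injective).symm
  have hrn : ∀ x, redMod p (-x) = - redMod p x := by
    intro x; ext i j
    rw [redMod_apply, Matrix.SpecialLinearGroup.coe_neg, Matrix.SpecialLinearGroup.coe_neg, Matrix.neg_apply, Matrix.neg_apply, redMod_apply, Int.cast_neg]
  have hfn : ∀ x, fsq (toSLR (-x) : SLR 2) = fsq (toSLR x : SLR 2) := by
    intro x
    simp [fsq, toSLR_apply]
  have hfin : ∀ g, (posPts p g Y).Finite := fun g => (finite_fsq_le Y).subset fun x hx => hx.2.2
  rw [cnt, hneg, ← Nat.cast_add, ← Set.ncard_union_eq (hs := hfin _) (ht := (hfin _).image _)]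
  · rw [Nat.card_coe_set_eq]
    congr 2
    ext x
    rw [Set.mem_setOf_eq, exists_mem_congSubgroup_iff, phi_le_iff_fsq_le _ ht, Set.mem_union, Set.mem_image]
    constructor
    · rintro ⟨h1, h2⟩
      have h0 : x 0 0 ≠ 0 := by
        intro h
        rw [← h1, redMod_apply, h] at hγ
        exact hγ (Int.cast_zero)
      rcases lt_or_gt_of_ne h0 with h | h
      · refine Or.inr ⟨-x, ⟨by rw [hrn, h1], ?_, by rwa [hfn]⟩, neg_neg x⟩
        rw [Matrix.SpecialLinearGroup.coe_neg, Matrix.neg_apply]; linarith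
      · exact Or.inl ⟨h1, h, h2⟩
    · rintro (⟨h1, -, h2⟩ | ⟨y, ⟨h1, -, h2⟩, rfl⟩)
      · exact ⟨h1, h2⟩
      · exact ⟨by rw [hrn, h1, neg_neg], by rwa [hfn]⟩
  · rw [Set.disjoint_left]
    rintro _ ⟨-, h, -⟩ ⟨y, ⟨-, h', -⟩, rfl⟩
    rw [Matrix.SpecialLinearGroup.coe_neg, Matrix.neg_apply] at h
    linarith

/-- The quarter turn. -/
def quarter : Matrix.SpecialLinearGroup (Fin 2) ℤ := ⟨!![0, -1; 1, 0], by simp [Matrix.det_fin_two_of]⟩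

theorem quarter_val : (quarter : Matrix (Fin 2) (Fin 2) ℤ) = !![0, -1; 1, 0] := rfl

theorem cnt_quarter_mul (p : ℕ) (γ : Matrix.SpecialLinearGroup (Fin 2) ℤ) (t : ℝ) :
    cnt 2 p (quarter * γ) t = cnt 2 p γ t := by
  have hK : toSLR quarter ∈ Kd 2 := by
    rw [mem_Kd]
    ext i j
    fin_cases i <;> fin_cases j <;> simp [Matrix.mul_apply, Fin.sum_univ_two, toSLR_apply, quarter_val]
  symm
  rw [cnt, cnt, Nat.card_coe_set_eq, Nat.card_coe_set_eq, ← Set.ncard_image_of_injective _ (mul_right_injective quarter)]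
  congr 2
  ext x
  rw [Set.mem_image]
  simp only [Set.mem_setOf_eq, exists_mem_congSubgroup_iff]
  constructor
  swap
  · rintro ⟨h1, h2⟩
    refine ⟨quarter⁻¹ * x, ⟨by rw [map_mul, h1, map_mul, map_inv, inv_mul_cancel_left], ?_⟩, by group⟩
    rw [map_mul, map_inv, phi_mul_left (inv_mem hK)]; exact h2
  · rintro ⟨y, ⟨h1, h2⟩, rfl⟩
    exact ⟨by rw [map_mul, h1, map_mul], by rw [map_mul, phi_mul_left hK]; exact h2⟩

theorem cnt_two_asymp : ∃ C : ℝ, 0 < C ∧ ∀ (p : ℕ) [Fact p.Prime] (γ : Matrix.SpecialLinearGroup (Fin 2) ℤ) (t : ℝ), 0 ≤ t →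
    |cnt 2 p γ t - 2 * totDens p / (p:ℝ) ^ 2 * Real.pi ^ 2 * (2 * Real.cosh (√2 * t))| ≤
      C * (2 * Real.cosh (√2 * t)) ^ (1 - 1/320:ℝ) := by
  obtain ⟨C, hC, h⟩ := exists_nsq_count
  refine ⟨2 * C, by linarith, ?_⟩
  intro p _ γ t ht
  wlog hγ : redMod p γ 0 0 ≠ 0 generalizing γ
  · rw [← cnt_quarter_mul]
    refine this _ ?_
    rw [not_not] at hγ
    intro h0
    have := (redMod p γ).det_coe
    rw [Matrix.det_fin_two, hγ, zero_mul, zero_sub] at this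
    have h1 : redMod p (quarter * γ) 0 0 = - redMod p γ 1 0 := by
      simp [redMod_apply, quarter_val, Matrix.mul_apply, Fin.sum_univ_two]
    rw [h0, eq_comm, neg_eq_zero] at h1
    rw [h1, mul_zero, neg_zero] at this
    exact zero_ne_one this
  set Y := 2 * Real.cosh (√2 * t) with hY
  have hY1 : 1 ≤ Y := by have := Real.one_le_cosh (√2 * t); linarith
  have hsq : √Y ^ 2 = Y := Real.sq_sqrt (by linarith)
  have hpw : √Y ^ (2 - 1/160:ℝ) = Y ^ (1 - 1/320:ℝ) := by
    rw [Real.sqrt_eq_rpow, ← Real.rpow_mul (by linarith)]; norm_num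
  have hγ' : (-redMod p γ) 0 0 ≠ 0 := by
    rw [Matrix.SpecialLinearGroup.coe_neg, Matrix.neg_apply]; exact neg_ne_zero.2 hγ
  obtain ⟨S, hS, h1⟩ := h p _ (redMod p γ 0 1) (redMod p γ 1 0) hγ _ (Real.one_le_sqrt.2 hY1)
  obtain ⟨S', hS', h2⟩ := h p _ ((-redMod p γ) 0 1) ((-redMod p γ) 1 0) hγ' _ (Real.one_le_sqrt.2 hY1)
  rw [hsq] at hS hS' h1 h2
  rw [hpw] at h1 h2
  rw [cnt_eq_of_ne_zero hγ ht, ncard_posPts hγ hS, ncard_posPts hγ' hS']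
  rw [abs_le] at *
  constructor
  · linarith [h1.1, h2.1, show 2 * totDens p / (p:ℝ) ^ 2 * Real.pi ^ 2 * Y = 2 * (totDens p / (p:ℝ) ^ 2 * Real.pi ^ 2 * Y) by ring]
  · linarith [h1.2, h2.2, show 2 * totDens p / (p:ℝ) ^ 2 * Real.pi ^ 2 * Y = 2 * (totDens p / (p:ℝ) ^ 2 * Real.pi ^ 2 * Y) by ring]

end planeCount

section coneMeasure

/-- Normalization to determinant one of the transpose of a matrix given by its rows. -/
noncomputable def unimod (A : Fin 2 → Fin 2 → ℝ) : SLR 2 :=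
  if h : 0 < A 0 0 * A 1 1 - A 0 1 * A 1 0 then
    ⟨(√(A 0 0 * A 1 1 - A 0 1 * A 1 0))⁻¹ • !![A 0 0, A 1 0; A 0 1, A 1 1], by
      rw [Matrix.det_smul, Fintype.card_fin, Matrix.det_fin_two_of, inv_pow, Real.sq_sqrt h.le, mul_comm (A 1 0)]
      exact inv_mul_cancel₀ h.ne'⟩
  else 1

theorem unimod_val {A : Fin 2 → Fin 2 → ℝ} (h : 0 < A 0 0 * A 1 1 - A 0 1 * A 1 0) :
    (unimod A : Matrix (Fin 2) (Fin 2) ℝ) = (√(A 0 0 * A 1 1 - A 0 1 * A 1 0))⁻¹ • !![A 0 0, A 1 0; A 0 1, A 1 1] := by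
  have e : unimod A = _ := dif_pos h
  exact congrArg (fun g : SLR 2 => (g : Matrix (Fin 2) (Fin 2) ℝ)) e

theorem measurable_unimod : Measurable unimod := by
  have hU : MeasurableSet {A : Fin 2 → Fin 2 → ℝ | 0 < A 0 0 * A 1 1 - A 0 1 * A 1 0} :=
    measurableSet_lt measurable_const (by fun_prop)
  refine measurable_of_restrict_of_restrict_compl hU ?_ ?_
  · refine Continuous.measurable (SLR.continuous_iff.2 ?_)
    have : (fun x : {A : Fin 2 → Fin 2 → ℝ | 0 < A 0 0 * A 1 1 - A 0 1 * A 1 0} =>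
        ((Set.domRestrict _ unimod x : SLR 2) : Matrix (Fin 2) (Fin 2) ℝ)) =
        fun x => (√(x.1 0 0 * x.1 1 1 - x.1 0 1 * x.1 1 0))⁻¹ • !![x.1 0 0, x.1 1 0; x.1 0 1, x.1 1 1] :=
      funext fun x => unimod_val x.2
    rw [this]
    have hc : ∀ i j, Continuous fun x : {A : Fin 2 → Fin 2 → ℝ | 0 < A 0 0 * A 1 1 - A 0 1 * A 1 0} => x.1 i j :=
      fun i j => (continuous_apply_apply i j).comp continuous_subtype_val
    have hdet : Continuous fun x : {A : Fin 2 → Fin 2 → ℝ | 0 < A 0 0 * A 1 1 - A 0 1 * A 1 0} =>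
      √(x.1 0 0 * x.1 1 1 - x.1 0 1 * x.1 1 0) :=
      Real.continuous_sqrt.comp (((hc 0 0).mul (hc 1 1)).sub ((hc 0 1).mul (hc 1 0)))
    refine Continuous.smul (hdet.inv₀ fun x => (Real.sqrt_pos.2 x.2).ne') ?_
    refine continuous_matrix fun i j => ?_
    fin_cases i <;> fin_cases j
    exacts [hc 0 0, hc 1 0, hc 0 1, hc 1 1]
  · have : Set.domRestrict {A : Fin 2 → Fin 2 → ℝ | 0 < A 0 0 * A 1 1 - A 0 1 * A 1 0}ᶜ unimod = fun _ => 1 :=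
      funext fun x => dif_neg x.2
    rw [this]; exact measurable_const

/-- Matrices of determinant in `(0,1]`. -/
def unitCone : Set (Fin 2 → Fin 2 → ℝ) :=
  {A | 0 < A 0 0 * A 1 1 - A 0 1 * A 1 0 ∧ A 0 0 * A 1 1 - A 0 1 * A 1 0 ≤ 1}

theorem measurableSet_unitCone : MeasurableSet unitCone := by
  have h1 : MeasurableSet {A : Fin 2 → Fin 2 → ℝ | 0 < A 0 0 * A 1 1 - A 0 1 * A 1 0} :=
    measurableSet_lt measurable_const (by fun_prop)
  have h2 : MeasurableSet {A : Fin 2 → Fin 2 → ℝ | A 0 0 * A 1 1 - A 0 1 * A 1 0 ≤ 1} :=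
    measurableSet_le (by fun_prop) measurable_const
  exact h1.inter h2

/-- The cone measure. -/
noncomputable def coneMeasure : Measure (SLR 2) := (volume.restrict unitCone).map unimod

theorem coneMeasure_apply {s : Set (SLR 2)} (hs : MeasurableSet s) :
    coneMeasure s = volume (unimod ⁻¹' s ∩ unitCone) := by
  rw [coneMeasure, Measure.map_apply measurable_unimod hs, Measure.restrict_apply (measurable_unimod hs)]

theorem measurePreserving_rows (g : SLR 2) :
    MeasurePreserving (fun (A : Fin 2 → Fin 2 → ℝ) i => (g : Matrix (Fin 2) (Fin 2) ℝ) *ᵥ A i) := by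
  refine volume_preserving_pi fun _ => ?_
  have hdet : (g : Matrix (Fin 2) (Fin 2) ℝ).det = 1 := g.det_coe
  refine ⟨by fun_prop, ?_⟩
  have := Real.map_matrix_volume_pi_eq_smul_volume_pi (M := (g : Matrix (Fin 2) (Fin 2) ℝ)) (by rw [hdet]; exact one_ne_zero)
  rw [hdet] at this
  rw [inv_one, abs_one, ENNReal.ofReal_one, one_smul] at this
  exact this

instance : coneMeasure.IsMulLeftInvariant := by
  refine ⟨fun g => ?_⟩
  have hg : g 0 0 * g 1 1 - g 0 1 * g 1 0 = 1 := by
    have := g.det_coe; rwa [Matrix.det_fin_two] at this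
  have hd : ∀ A : Fin 2 → Fin 2 → ℝ, ((g : Matrix (Fin 2) (Fin 2) ℝ) *ᵥ A 0) 0 * ((g : Matrix (Fin 2) (Fin 2) ℝ) *ᵥ A 1) 1 -
      ((g : Matrix (Fin 2) (Fin 2) ℝ) *ᵥ A 0) 1 * ((g : Matrix (Fin 2) (Fin 2) ℝ) *ᵥ A 1) 0 = A 0 0 * A 1 1 - A 0 1 * A 1 0 := by
    intro A
    simp only [Matrix.mulVec, dotProduct, Fin.sum_univ_two]
    linear_combination (A 0 0 * A 1 1 - A 0 1 * A 1 0) * hg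
  ext s hs
  have hm := measurable_const_mul g hs
  rw [Measure.map_apply (measurable_const_mul g) hs, coneMeasure_apply hm, coneMeasure_apply hs,
    ← (measurePreserving_rows g).measure_preimage ((measurable_unimod hs).inter measurableSet_unitCone).nullMeasurableSet]
  congr 1
  ext A
  simp only [Set.mem_inter_iff, Set.mem_preimage, unitCone, Set.mem_setOf_eq, hd]
  refine and_congr_left fun h => ?_
  suffices g * unimod A = unimod fun i => (g : Matrix (Fin 2) (Fin 2) ℝ) *ᵥ A i by rw [this]
  apply SLR.ext_val
  rw [SLR.val_mul, unimod_val h.1, unimod_val (by rw [hd]; exact h.1), hd, Matrix.mul_smul]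
  congr 1
  ext i j
  fin_cases i <;> fin_cases j <;> simp [Matrix.mul_apply, Matrix.mulVec, dotProduct, Fin.sum_univ_two]

theorem fsq_unimod {A : Fin 2 → Fin 2 → ℝ} (h : 0 < A 0 0 * A 1 1 - A 0 1 * A 1 0) (Y : ℝ) :
    fsq (unimod A) ≤ Y ↔ A 0 0 ^ 2 + A 0 1 ^ 2 + A 1 0 ^ 2 + A 1 1 ^ 2 ≤ Y * (A 0 0 * A 1 1 - A 0 1 * A 1 0) := by
  rw [unimod_val h, ← div_le_iff₀ h]
  have e : fsq ((√(A 0 0 * A 1 1 - A 0 1 * A 1 0))⁻¹ • !![A 0 0, A 1 0; A 0 1, A 1 1]) =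
      (A 0 0 ^ 2 + A 0 1 ^ 2 + A 1 0 ^ 2 + A 1 1 ^ 2) / (A 0 0 * A 1 1 - A 0 1 * A 1 0) := by
    simp only [fsq, Matrix.smul_apply, smul_eq_mul, mul_pow, inv_pow, Real.sq_sqrt h.le]
    simp
    ring
  rw [e]

/-- Coordinates in which the determinant is diagonal. -/
noncomputable def splitCoord : (Fin 2 → Fin 2 → ℝ) ≃ₗ[ℝ] ℂ × ℂ where
  toFun A := (⟨A 0 0 + A 1 1, A 0 1 - A 1 0⟩, ⟨A 0 0 - A 1 1, A 0 1 + A 1 0⟩)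
  map_add' A B := by refine Prod.ext (Complex.ext ?_ ?_) (Complex.ext ?_ ?_) <;> simp [-Prod.mk_add_mk] <;> ring_nf
  map_smul' c A := by refine Prod.ext (Complex.ext ?_ ?_) (Complex.ext ?_ ?_) <;> simp <;> ring_nf
  invFun z := ![![(z.1.re + z.2.re) / 2, (z.1.im + z.2.im) / 2], ![(z.2.im - z.1.im) / 2, (z.1.re - z.2.re) / 2]]
  left_inv A := by ext i j; fin_cases i <;> fin_cases j <;> simp
  right_inv z := by ext <;> simp <;> ring_nf

/-- The ball in diagonal coordinates. -/
def splitBall (Y : ℝ) : Set (ℂ × ℂ) :=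
  {z | 0 < ‖z.1‖ ^ 2 - ‖z.2‖ ^ 2 ∧ ‖z.1‖ ^ 2 - ‖z.2‖ ^ 2 ≤ 4 ∧ 2 * (‖z.1‖ ^ 2 + ‖z.2‖ ^ 2) ≤ Y * (‖z.1‖ ^ 2 - ‖z.2‖ ^ 2)}

theorem measurableSet_splitBall (Y : ℝ) : MeasurableSet (splitBall Y) := by
  have h1 : MeasurableSet {z : ℂ × ℂ | 0 < ‖z.1‖ ^ 2 - ‖z.2‖ ^ 2} := measurableSet_lt measurable_const (by fun_prop)
  have h2 : MeasurableSet {z : ℂ × ℂ | ‖z.1‖ ^ 2 - ‖z.2‖ ^ 2 ≤ 4} := measurableSet_le (by fun_prop) measurable_const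
  have h3 : MeasurableSet {z : ℂ × ℂ | 2 * (‖z.1‖ ^ 2 + ‖z.2‖ ^ 2) ≤ Y * (‖z.1‖ ^ 2 - ‖z.2‖ ^ 2)} :=
    measurableSet_le (by fun_prop) (by fun_prop)
  exact h1.inter (h2.inter h3)

theorem volume_splitBall {Y : ℝ} (hY : 2 < Y) :
    volume (splitBall Y) = ENNReal.ofReal (Y - 2) * ∫⁻ w : ℂ, ENNReal.ofReal (4 * (1 - ‖w‖ ^ 2) * Real.pi) := by
  have hY0 : 0 < Y - 2 := by linarith
  have hs : 0 < √(Y - 2) := Real.sqrt_pos.2 hY0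
  have hslice : ∀ w : ℂ, volume ((fun z : ℂ => (z, w)) ⁻¹' splitBall Y) =
      ENNReal.ofReal (4 * (1 - ‖(√(Y - 2))⁻¹ • w‖ ^ 2) * Real.pi) := by
    intro w
    have hq := sq_nonneg ‖w‖
    have hnw : ‖(√(Y - 2))⁻¹ • w‖ ^ 2 = ‖w‖ ^ 2 / (Y - 2) := by
      rw [norm_smul, mul_pow, norm_inv, inv_pow, Real.norm_eq_abs, sq_abs, Real.sq_sqrt hY0.le]; ring
    set r := √(‖w‖ ^ 2 * (Y + 2) / (Y - 2)) with hr
    set R := √(‖w‖ ^ 2 + 4) with hR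
    have hr2 : r ^ 2 = ‖w‖ ^ 2 * (Y + 2) / (Y - 2) := Real.sq_sqrt (div_nonneg (mul_nonneg hq (by linarith)) hY0.le)
    have hR2 : R ^ 2 = ‖w‖ ^ 2 + 4 := Real.sq_sqrt (by positivity)
    have hr0 : 0 ≤ r := Real.sqrt_nonneg _
    have hR0 : 0 ≤ R := Real.sqrt_nonneg _
    have hmem : ∀ z : ℂ, 2 * (‖z‖ ^ 2 + ‖w‖ ^ 2) ≤ Y * (‖z‖ ^ 2 - ‖w‖ ^ 2) ↔ r ≤ ‖z‖ := by
      intro z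
      rw [← sq_le_sq₀ hr0 (norm_nonneg z), hr2, div_le_iff₀ hY0]
      constructor <;> intro h <;> linarith
    have hmem' : ∀ z : ℂ, ‖z‖ ^ 2 - ‖w‖ ^ 2 ≤ 4 ↔ ‖z‖ ≤ R := by
      intro z
      rw [← sq_le_sq₀ (norm_nonneg z) hR0, hR2]
      constructor <;> intro h <;> linarith
    have hsq : (fun z : ℂ => (z, w)) ⁻¹' splitBall Y =ᵐ[volume] (Metric.closedBall (0:ℂ) R \ Metric.ball 0 r : Set ℂ) := by
      have h0 : ∀ᵐ z : ℂ, z ≠ 0 := by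
        rw [ae_iff]; simp
      filter_upwards [h0] with z hz
      refine propext ?_
      show (0 < ‖z‖ ^ 2 - ‖w‖ ^ 2 ∧ ‖z‖ ^ 2 - ‖w‖ ^ 2 ≤ 4 ∧ 2 * (‖z‖ ^ 2 + ‖w‖ ^ 2) ≤ Y * (‖z‖ ^ 2 - ‖w‖ ^ 2)) ↔
        z ∈ Metric.closedBall (0:ℂ) R ∧ z ∉ Metric.ball (0:ℂ) r
      rw [mem_closedBall_zero_iff, mem_ball_zero_iff, not_lt, ← hmem, ← hmem']
      refine ⟨fun h => h.2, fun h => ⟨?_, h⟩⟩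
      have : 0 < ‖z‖ ^ 2 := by have := norm_pos_iff.2 hz; positivity
      by_contra hle
      nlinarith [h.2]
    rw [measure_congr hsq, hnw]
    rcases le_or_gt r R with h | h
    · rw [measure_sdiff ((Metric.ball_subset_closedBall).trans (Metric.closedBall_subset_closedBall h))
        measurableSet_ball.nullMeasurableSet measure_ball_lt_top.ne, Complex.volume_closedBall, Complex.volume_ball,
        ← ENNReal.ofReal_coe_nnreal, NNReal.coe_real_pi, ← ENNReal.ofReal_pow hR0, ← ENNReal.ofReal_pow hr0,
        ← ENNReal.ofReal_mul (by positivity), ← ENNReal.ofReal_mul (by positivity), ← ENNReal.ofReal_sub _ (by positivity), hr2, hR2]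
      congr 1
      field_simp
      ring
    · rw [Set.diff_eq_empty.2 (Metric.closedBall_subset_ball h), measure_empty, eq_comm, ENNReal.ofReal_eq_zero]
      have := (sq_lt_sq₀ hR0 hr0).2 h
      rw [hR2, hr2, lt_div_iff₀ hY0] at this
      have h2 : 1 ≤ ‖w‖ ^ 2 / (Y - 2) := by rw [le_div_iff₀ hY0]; linarith
      have := Real.pi_pos
      nlinarith
  rw [Measure.volume_eq_prod, Measure.prod_apply_symm (measurableSet_splitBall Y), lintegral_congr hslice]
  have h1 := Measure.map_addHaar_smul (volume : Measure ℂ) (inv_ne_zero hs.ne')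
  have h2 := lintegral_map (μ := (volume : Measure ℂ)) (f := fun w : ℂ => ENNReal.ofReal (4 * (1 - ‖w‖ ^ 2) * Real.pi))
    (g := fun w => (√(Y - 2))⁻¹ • w) (by fun_prop) (by fun_prop)
  rw [← h2, h1, lintegral_smul_measure, Complex.finrank_real_complex, inv_pow, inv_inv, Real.sq_sqrt hY0.le, abs_of_pos hY0, smul_eq_mul]

theorem exists_vol_two (μ : Measure (SLR 2)) [μ.IsHaarMeasure] :
    ∃ κ : ℝ, 0 < κ ∧ ∀ t, 0 < t → vol μ t = κ * (2 * Real.cosh (√2 * t) - 2) := by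
  set K := ∫⁻ w : ℂ, ENNReal.ofReal (4 * (1 - ‖w‖ ^ 2) * Real.pi) with hK
  have hKt : K ≠ ⊤ := by
    have h1 : K ≤ ∫⁻ w : ℂ, (Metric.closedBall (0:ℂ) 1).indicator (fun _ => ENNReal.ofReal (4 * Real.pi)) w := by
      refine lintegral_mono fun w => ?_
      have := Real.pi_pos
      by_cases h : w ∈ Metric.closedBall (0:ℂ) 1
      · rw [Set.indicator_of_mem h]
        refine ENNReal.ofReal_le_ofReal ?_
        nlinarith [sq_nonneg ‖w‖]
      · rw [Set.indicator_of_notMem h]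
        rw [mem_closedBall_zero_iff, not_le] at h
        rw [ENNReal.ofReal_eq_zero.2]
        have : 1 - ‖w‖ ^ 2 ≤ 0 := by nlinarith only [h]
        exact mul_nonpos_of_nonpos_of_nonneg (by linarith) Real.pi_pos.le
    rw [lintegral_indicator measurableSet_closedBall, setLIntegral_const] at h1
    exact (h1.trans_lt (ENNReal.mul_lt_top ENNReal.ofReal_lt_top measure_closedBall_lt_top)).ne
  have hK0 : K ≠ 0 := by
    rw [hK, Ne, lintegral_eq_zero_iff (by fun_prop)]
    intro h
    have h1 := (Continuous.ae_eq_iff_eq volume (f := fun w : ℂ => ENNReal.ofReal (4 * (1 - ‖w‖ ^ 2) * Real.pi)) (g := fun _ => 0) (ENNReal.continuous_ofReal.comp (by fun_prop)) continuous_const).1 h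
    have h2 := congrFun h1 0
    have := Real.pi_pos
    rw [ENNReal.ofReal_eq_zero] at h2
    simp at h2
    linarith
  haveI : (volume : Measure (ℂ × ℂ)).IsAddHaarMeasure :=
    inferInstanceAs ((volume : Measure ℂ).prod (volume : Measure ℂ)).IsAddHaarMeasure
  haveI : (volume : Measure (Fin 2 → Fin 2 → ℝ)).IsAddHaarMeasure :=
    haveI := isAddHaarMeasure_volume_pi (Fin 2)
    Measure.pi.isAddHaarMeasure (fun _ : Fin 2 => (volume : Measure (Fin 2 → ℝ)))
  set L := splitCoord.toContinuousLinearEquiv with hL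
  set c := Measure.addHaarScalarFactor (Measure.map L (volume : Measure (Fin 2 → Fin 2 → ℝ))) (volume : Measure (ℂ × ℂ)) with hc
  have hLm : Measure.map L (volume : Measure (Fin 2 → Fin 2 → ℝ)) = c • volume := Measure.isAddLeftInvariant_eq_smul _ _
  have hc0 : 0 < c := Measure.addHaarScalarFactor_pos_of_isAddHaarMeasure _ _
  have hball : ∀ t, 0 < t → coneMeasure {g : SLR 2 | phi g ≤ t} = c * (ENNReal.ofReal (2 * Real.cosh (√2 * t) - 2) * K) := by
    intro t ht
    have hY : 2 < 2 * Real.cosh (√2 * t) := by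
      have := Real.one_lt_cosh.2 (show √2 * t ≠ 0 by positivity)
      linarith
    rw [← volume_splitBall hY, coneMeasure_apply (measurableSet_phi_le t)]
    have := congrArg (fun ν : Measure (ℂ × ℂ) => ν (splitBall (2 * Real.cosh (√2 * t)))) hLm
    simp only [Measure.map_apply L.continuous.measurable (measurableSet_splitBall _), Measure.smul_apply] at this
    refine Eq.trans ?_ this
    congr 1
    ext A
    have e1 : ‖(L A).1‖ ^ 2 - ‖(L A).2‖ ^ 2 = 4 * (A 0 0 * A 1 1 - A 0 1 * A 1 0) := by
      rw [Complex.sq_norm, Complex.sq_norm, Complex.normSq_apply, Complex.normSq_apply]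
      show (A 0 0 + A 1 1) * (A 0 0 + A 1 1) + (A 0 1 - A 1 0) * (A 0 1 - A 1 0) -
        ((A 0 0 - A 1 1) * (A 0 0 - A 1 1) + (A 0 1 + A 1 0) * (A 0 1 + A 1 0)) = _
      ring
    have e2 : ‖(L A).1‖ ^ 2 + ‖(L A).2‖ ^ 2 = 2 * (A 0 0 ^ 2 + A 0 1 ^ 2 + A 1 0 ^ 2 + A 1 1 ^ 2) := by
      rw [Complex.sq_norm, Complex.sq_norm, Complex.normSq_apply, Complex.normSq_apply]
      show (A 0 0 + A 1 1) * (A 0 0 + A 1 1) + (A 0 1 - A 1 0) * (A 0 1 - A 1 0) +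
        ((A 0 0 - A 1 1) * (A 0 0 - A 1 1) + (A 0 1 + A 1 0) * (A 0 1 + A 1 0)) = _
      ring
    simp only [Set.mem_inter_iff, Set.mem_preimage, Set.mem_setOf_eq, splitBall, e1, e2, unitCone]
    constructor
    · rintro ⟨h1, h2, h3⟩
      rw [phi_le_iff_fsq_le _ ht.le, fsq_unimod h2] at h1
      exact ⟨by linarith, by linarith, by linarith⟩
    · rintro ⟨h1, h2, h3⟩
      have h4 : 0 < A 0 0 * A 1 1 - A 0 1 * A 1 0 := by linarith
      rw [phi_le_iff_fsq_le _ ht.le, fsq_unimod h4]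
      exact ⟨by linarith, h4, by linarith⟩
  have hfin : IsFiniteMeasureOnCompacts coneMeasure := by
    refine ⟨fun s hs => ?_⟩
    obtain ⟨B, hB⟩ := (hs.image (continuous_phi (d := 2))).bddAbove
    have hsub : s ⊆ {g : SLR 2 | phi g ≤ |B| + 1} := fun g hg =>
      (hB (Set.mem_image_of_mem _ hg)).trans (by linarith [le_abs_self B])
    refine (measure_mono hsub).trans_lt ?_
    rw [hball _ (by positivity)]
    exact ENNReal.mul_lt_top ENNReal.coe_lt_top (ENNReal.mul_lt_top ENNReal.ofReal_lt_top hKt.lt_top)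
  set b := Measure.haarScalarFactor coneMeasure μ with hb
  have hbm : coneMeasure = b • μ := Measure.isMulLeftInvariant_eq_smul _ _
  have hKr : 0 < K.toReal := ENNReal.toReal_pos hK0 hKt
  have hvol : ∀ t, 0 < t → b * vol μ t = c * K.toReal * (2 * Real.cosh (√2 * t) - 2) := by
    intro t ht
    have h1 := hball t ht
    have hY := Real.one_le_cosh (√2 * t)
    rw [hbm] at h1
    have h2 := congrArg ENNReal.toReal h1
    simp only [Measure.smul_apply, ENNReal.smul_def, smul_eq_mul, ENNReal.toReal_mul, ENNReal.coe_toReal] at h2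
    rw [ENNReal.toReal_ofReal (by linarith)] at h2
    rw [vol, h2]; ring
  have hc0' : (0:ℝ) < c := hc0
  have hb0 : (b:ℝ) ≠ 0 := by
    intro h0
    have h1 := hvol 1 one_pos
    have hY := Real.one_lt_cosh.2 (show √2 * 1 ≠ 0 by positivity)
    rw [h0, zero_mul] at h1
    have : 0 < c * K.toReal * (2 * Real.cosh (√2 * 1) - 2) := mul_pos (mul_pos hc0' hKr) (by linarith)
    linarith
  have hb1 : (0:ℝ) < b := lt_of_le_of_ne b.coe_nonneg hb0.symm
  refine ⟨c * K.toReal / b, by positivity, fun t ht => ?_⟩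
  rw [div_mul_eq_mul_div, eq_div_iff hb0, ← hvol t ht, mul_comm]

end coneMeasure

section rankTwo

theorem exp_le_two_cosh (x : ℝ) : Real.exp x ≤ 2 * Real.cosh x := by
  rw [Real.cosh_eq]
  have := Real.exp_pos (-x)
  linarith

theorem two_cosh_add_le (x : ℝ) {h : ℝ} (hh : 0 ≤ h) : 2 * Real.cosh (x + h) ≤ Real.exp h * (2 * Real.cosh x) := by
  rw [Real.cosh_eq, Real.cosh_eq, neg_add, Real.exp_add, Real.exp_add]
  have h1 : Real.exp (-h) ≤ Real.exp h := Real.exp_le_exp.2 (by linarith)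
  have := Real.exp_pos (-x)
  nlinarith

theorem tendsto_two_cosh : Filter.Tendsto (fun t => 2 * Real.cosh (√2 * t)) Filter.atTop Filter.atTop := by
  refine Filter.tendsto_atTop_mono (fun t => exp_le_two_cosh _) (Real.tendsto_exp_atTop.comp ?_)
  exact Filter.tendsto_id.const_mul_atTop (by positivity)

theorem le_of_eventually_growth {f : ℝ → ℝ} (hf : Filter.Tendsto f Filter.atTop Filter.atTop) {a b K K' q : ℝ} (hq : q < 1)
    (h : ∀ᶠ T in Filter.atTop, a * f T ≤ b * f T + K + K' * f T ^ q) : a ≤ b := by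
  have h1 : Filter.Tendsto (fun T => b + K * (f T)⁻¹ + K' * f T ^ (-(1 - q))) Filter.atTop (nhds (b + K * 0 + K' * 0)) :=
    (tendsto_const_nhds.add ((tendsto_inv_atTop_zero.comp hf).const_mul K)).add
      (((tendsto_rpow_neg_atTop (by linarith)).comp hf).const_mul K')
  rw [mul_zero, mul_zero, add_zero, add_zero] at h1
  refine ge_of_tendsto h1 ?_
  filter_upwards [h, hf.eventually_gt_atTop 0] with T hT hT0
  rw [← mul_le_mul_iff_left₀ hT0]
  refine hT.trans (le_of_eq ?_)
  have e : f T ^ q = f T ^ (-(1 - q)) * f T := by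
    rw [← Real.rpow_add_one hT0.ne']; congr 1; ring
  rw [e]
  field_simp

theorem abs_setIntegral_le_of_tail (μ : Measure (SLR 2)) [μ.IsHaarMeasure] {φ : SLR 2 → ℝ} (hφ : Continuous φ) {B ε T₀ : ℝ} (hB : ∀ h, |φ h| ≤ B)
    (hε : 0 ≤ ε) (hT₀ : ∀ h, T₀ ≤ phi h → |φ h| ≤ ε) (T : ℝ) :
    |∫ h in {g : SLR 2 | phi g ≤ T}, φ h ∂μ| ≤ B * vol μ T₀ + ε * vol μ T := by
  have hB0 : 0 ≤ B := (abs_nonneg _).trans (hB 1)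
  have hm := measurableSet_phi_le (d := 2) T₀
  have hi : ∀ A : ℝ, IntegrableOn (fun _ : SLR 2 => A) {g : SLR 2 | phi g ≤ T} μ := fun A =>
    integrableOn_const (measure_ball_ne_top μ T)
  have h1 : |∫ h in {g : SLR 2 | phi g ≤ T}, φ h ∂μ| ≤
      ∫ h in {g : SLR 2 | phi g ≤ T}, ({g : SLR 2 | phi g ≤ T₀}.indicator (fun _ => B) h + ε) ∂μ := by
    rw [← Real.norm_eq_abs]
    refine norm_integral_le_of_norm_le (((hi B).indicator hm).add (hi ε)) (Filter.Eventually.of_forall fun h => ?_)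
    rw [Real.norm_eq_abs]
    by_cases hh : h ∈ {g : SLR 2 | phi g ≤ T₀}
    · rw [Set.indicator_of_mem hh]; linarith [hB h]
    · rw [Set.indicator_of_notMem hh, zero_add]
      exact hT₀ h (le_of_lt (not_le.1 hh))
  refine h1.trans ?_
  rw [integral_add ((hi B).indicator hm) (hi ε), integral_indicator hm, Measure.restrict_restrict hm,
    setIntegral_const, setIntegral_const, smul_eq_mul, smul_eq_mul, mul_comm B, mul_comm ε]
  refine add_le_add (mul_le_mul_of_nonneg_right ?_ hB0) le_rfl
  exact ENNReal.toReal_mono (measure_ball_ne_top μ T₀) (measure_mono Set.inter_subset_left)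

theorem density_eq (μ : Measure (SLR 2)) [μ.IsHaarMeasure] {F₀ : Set (SLR 2)}
    (hF₀ : IsFundamentalDomain (toSLR (d := 2)).range F₀ μ) {κ : ℝ} (hκ : 0 < κ)
    (hvol : ∀ t, 0 < t → vol μ t = κ * (2 * Real.cosh (√2 * t) - 2)) {p : ℕ} (hp : p.Prime)
    (γ : Matrix.SpecialLinearGroup (Fin 2) ℤ) {c C q : ℝ} (hC : 0 ≤ C) (hq0 : 0 ≤ q) (hq : q < 1)
    (hcnt : ∀ t, 0 ≤ t → |cnt 2 p γ t - c * (2 * Real.cosh (√2 * t))| ≤ C * (2 * Real.cosh (√2 * t)) ^ q) :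
    c = κ * (1 / ((congSubgroup 2 p).index * (μ F₀).toReal)) := by
  set M := 1 / ((congSubgroup 2 p).index * (μ F₀).toReal) with hM
  set Y : ℝ → ℝ := fun t => 2 * Real.cosh (√2 * t) with hY
  have hY0 : ∀ t, 0 < Y t := fun t => by have := Real.cosh_pos (√2 * t); simp only [hY]; positivity
  have hc0 : 0 ≤ c := by
    refine le_of_eventually_growth tendsto_two_cosh (K := 0) (K' := C) hq ?_
    filter_upwards [Filter.eventually_ge_atTop 0] with t ht
    have h1 : (0:ℝ) ≤ cnt 2 p γ t := Nat.cast_nonneg _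
    have h2 := (abs_le.1 (hcnt t ht)).2
    linarith only [h1, h2]
  set s : ℝ := 2 * √((2:ℕ):ℝ) with hs
  have hs0 : 0 < s := by positivity
  have hstep : ∀ t η, 0 < η → Y (t + s * η) ≤ Real.exp (√2 * (s * η)) * Y t := by
    intro t η hη
    simp only [hY]
    rw [mul_add]
    exact two_cosh_add_le _ (by positivity)
  have hbound : ∀ η ε : ℝ, 0 < η → 0 < ε → κ * M ≤ c * Real.exp (√2 * (s * η)) + κ * ε ∧
      c * Real.exp (-(√2 * (s * η))) ≤ κ * M + κ * ε := by
    intro η ε hη hε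
    obtain ⟨φ, hφc, hφB, -, hφ2, hsand⟩ := cnt_sandwich le_rfl hF₀ hp γ hη
    obtain ⟨T₀, hT₀⟩ := hφ2 rfl ε hε
    replace hsand : ∀ T, cnt 2 p γ (T - s * η) ≤ vol μ T * M + ∫ h in {g : SLR 2 | phi g ≤ T}, φ h ∂μ ∧
      vol μ T * M + ∫ h in {g : SLR 2 | phi g ≤ T}, φ h ∂μ ≤ cnt 2 p γ (T + s * η) := hsand
    have hitg := abs_setIntegral_le_of_tail μ hφc hφB hε.le hT₀
    set B := densBd (d := 2) μ η * vol μ T₀ with hB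
    have hsη : 0 < s * η := by positivity
    constructor
    · refine le_of_eventually_growth tendsto_two_cosh (K := 2 * κ * |M| + |B|) (K' := C * Real.exp (√2 * (s * η)) ^ q) hq ?_
      filter_upwards [Filter.eventually_gt_atTop 0] with t ht
      show κ * M * Y t ≤ (c * Real.exp (√2 * (s * η)) + κ * ε) * Y t + _ + C * Real.exp (√2 * (s * η)) ^ q * Y t ^ q
      have h1 := (hsand (t)).1
      have h2 := (hsand (t)).2
      have h3 := (abs_le.1 (hitg t)).1
      have h4 := (abs_le.1 (hcnt (t + s * η) (by linarith))).2
      have h5 := hstep t η hη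
      have h6 : c * Y (t + s * η) ≤ c * (Real.exp (√2 * (s * η)) * Y t) := mul_le_mul_of_nonneg_left h5 hc0
      have h7 : C * Y (t + s * η) ^ q ≤ C * (Real.exp (√2 * (s * η)) ^ q * Y t ^ q) := by
        rw [← Real.mul_rpow (Real.exp_pos _).le (hY0 t).le]
        exact mul_le_mul_of_nonneg_left (Real.rpow_le_rpow (hY0 _).le h5 hq0) hC
      have h8 : vol μ t = κ * (Y t - 2) := hvol t ht
      rw [h8] at h2 h3
      have h9 : κ * M ≤ κ * |M| := mul_le_mul_of_nonneg_left (le_abs_self M) hκ.le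
      have h10 := le_abs_self B
      have h11 : 0 < κ * ε := mul_pos hκ hε
      change cnt 2 p γ (t + s * η) - c * Y (t + s * η) ≤ C * Y (t + s * η) ^ q at h4
      linarith only [h2, h3, h4, h6, h7, h9, h10, h11]
    · refine le_of_eventually_growth tendsto_two_cosh (K := 2 * κ * |M| + |B|) (K' := C) hq ?_
      filter_upwards [Filter.eventually_gt_atTop (s * η)] with t ht
      show c * Real.exp (-(√2 * (s * η))) * Y t ≤ (κ * M + κ * ε) * Y t + _ + C * Y t ^ q
      have h1 := (hsand (t)).1
      have h3 := (abs_le.1 (hitg t)).2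
      have h4 := (abs_le.1 (hcnt (t - s * η) (by linarith))).1
      have h5 := hstep (t - s * η) η hη
      rw [sub_add_cancel] at h5
      have h6 : Real.exp (-(√2 * (s * η))) * Y t ≤ Y (t - s * η) := by
        rwa [Real.exp_neg, inv_mul_le_iff₀ (Real.exp_pos _)]
      have h6' := mul_le_mul_of_nonneg_left h6 hc0
      have h7 : C * Y (t - s * η) ^ q ≤ C * Y t ^ q := by
        refine mul_le_mul_of_nonneg_left (Real.rpow_le_rpow (hY0 _).le ?_ hq0) hC
        simp only [hY]
        have : Real.cosh (√2 * (t - s * η)) ≤ Real.cosh (√2 * t) := by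
          rw [Real.cosh_le_cosh]
          have h20 : 0 ≤ √2 * (t - s * η) := mul_nonneg (Real.sqrt_nonneg 2) (by linarith)
          have h2 : √2 * (t - s * η) ≤ √2 * t := mul_le_mul_of_nonneg_left (by linarith) (Real.sqrt_nonneg 2)
          rw [abs_of_nonneg h20, abs_of_nonneg (h20.trans h2)]
          exact h2
        linarith only [this]
      have h8 : vol μ t = κ * (Y t - 2) := hvol t (by linarith)
      rw [h8] at h1 h3
      have h9 : -(κ * M) ≤ κ * |M| := by
        rw [← mul_neg]; exact mul_le_mul_of_nonneg_left (neg_le_abs M) hκ.le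
      have h10 := le_abs_self B
      have h11 : 0 < κ * ε := mul_pos hκ hε
      change -(C * Y (t - s * η) ^ q) ≤ cnt 2 p γ (t - s * η) - c * Y (t - s * η) at h4
      linarith only [h1, h3, h4, h6', h7, h9, h10, h11]
  have hlim : ∀ σ : ℝ, Filter.Tendsto (fun η : ℝ => c * Real.exp (σ * (√2 * (s * η)))) (nhdsWithin 0 (Set.Ioi 0)) (nhds c) := by
    intro σ
    have : Continuous fun η : ℝ => c * Real.exp (σ * (√2 * (s * η))) := by fun_prop
    have h := this.tendsto 0
    simp only [mul_zero, Real.exp_zero, mul_one] at h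
    exact h.mono_left nhdsWithin_le_nhds
  have hlim2 : ∀ b : ℝ, Filter.Tendsto (fun η : ℝ => b + κ * η) (nhdsWithin 0 (Set.Ioi 0)) (nhds b) := by
    intro b
    have : Continuous fun η : ℝ => b + κ * η := by fun_prop
    have h := this.tendsto 0
    simp only [mul_zero, add_zero] at h
    exact h.mono_left nhdsWithin_le_nhds
  refine le_antisymm ?_ ?_
  · refine le_of_tendsto (hlim (-1)) ?_
    filter_upwards [self_mem_nhdsWithin] with η hη
    refine ge_of_tendsto (hlim2 (κ * M)) ?_
    filter_upwards [self_mem_nhdsWithin] with ε hε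
    rw [neg_one_mul]
    exact (hbound η ε hη hε).2
  · refine ge_of_tendsto (hlim 1) ?_
    filter_upwards [self_mem_nhdsWithin] with η hη
    refine ge_of_tendsto (hlim2 _) ?_
    filter_upwards [self_mem_nhdsWithin] with ε hε
    rw [one_mul]
    exact (hbound η ε hη hε).1

theorem cnt_asymptotic_two (μ : Measure (SLR 2)) [μ.IsHaarMeasure] {F₀ : Set (SLR 2)}
    (hF₀ : IsFundamentalDomain (toSLR (d := 2)).range F₀ μ) :
    ∃ ε : ℝ, 0 < ε ∧ ∃ C : ℝ, 0 < C ∧ ∀ p : ℕ, p.Prime → ∀ (γ : Matrix.SpecialLinearGroup (Fin 2) ℤ) (t : ℝ), 1 < t →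
      |cnt 2 p γ t - vol μ t / ((congSubgroup 2 p).index * (μ F₀).toReal)| ≤ C * vol μ t * Real.exp (-ε * t) := by
  obtain ⟨κ, hκ, hvol⟩ := exists_vol_two μ
  obtain ⟨C, hC, hcnt⟩ := cnt_two_asymp
  set M₀ : ℝ := 1 / (μ F₀).toReal with hM₀
  have hM₀0 : 0 ≤ M₀ := by positivity
  refine ⟨1 / 320, by norm_num, (C + 2 * κ * M₀) * (6 / κ), by positivity, fun p hp γ t ht => ?_⟩
  haveI : Fact p.Prime := ⟨hp⟩
  have hc := density_eq μ hF₀ hκ hvol hp γ hC.le (by norm_num) (by norm_num) (hcnt p γ)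
  have h1 := hcnt p γ t (by linarith)
  rw [hc] at h1
  set M : ℝ := 1 / ((congSubgroup 2 p).index * (μ F₀).toReal) with hM
  have hM0 : 0 ≤ M := by positivity
  have hMM : M ≤ M₀ := by
    rw [hM, one_div, _root_.mul_inv, hM₀, one_div]
    refine mul_le_of_le_one_left (by positivity) ?_
    rcases Nat.eq_zero_or_pos (congSubgroup 2 p).index with h | h
    · rw [h]; simp
    · exact inv_le_one_of_one_le₀ (by exact_mod_cast h)
  have hmain : vol μ t / ((congSubgroup 2 p).index * (μ F₀).toReal) = vol μ t * M := by rw [hM, mul_one_div]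
  rw [hmain, hvol t (by linarith)]
  have hexp := exp_le_two_cosh (√2 * t)
  set Y := 2 * Real.cosh (√2 * t) with hY
  have hs2 : (1.4:ℝ) ≤ √2 := Real.le_sqrt_of_sq_le (by norm_num)
  have hst : 1.4 * t ≤ √2 * t := by nlinarith
  have hY6 : Y ≤ 6 * (Y - 2) := by
    have := Real.add_one_le_exp (√2 * t)
    linarith
  have hY0 : 0 < Y := (Real.exp_pos _).trans_le hexp
  set e := Real.exp (-(1 / 320) * t) with he
  have he0 : 0 < e := Real.exp_pos _
  have hYe : 1 ≤ Y * e := by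
    refine le_trans ?_ (mul_le_mul_of_nonneg_right hexp he0.le)
    rw [he, ← Real.exp_add]
    exact Real.one_le_exp (by linarith)
  have hYq : Y ^ (1 - 1/320:ℝ) ≤ Y * e := by
    rw [sub_eq_add_neg, Real.rpow_add hY0, Real.rpow_one]
    refine mul_le_mul_of_nonneg_left ?_ hY0.le
    refine (Real.rpow_le_rpow_of_nonpos (Real.exp_pos _) hexp (by norm_num)).trans ?_
    rw [← Real.exp_mul]
    exact Real.exp_le_exp.2 (by linarith)
  have h2 : |cnt 2 p γ t - κ * (Y - 2) * M| ≤ C * Y ^ (1 - 1/320:ℝ) + 2 * κ * M := by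
    have h3 : cnt 2 p γ t - κ * (Y - 2) * M = (cnt 2 p γ t - κ * M * Y) + 2 * κ * M := by ring
    rw [h3]
    refine (abs_add_le _ _).trans (add_le_add h1 ?_)
    rw [abs_of_nonneg (by positivity)]
  calc _ ≤ C * (Y * e) + 2 * κ * M₀ * (Y * e) := by
        refine h2.trans (add_le_add (by gcongr) ?_)
        have : 2 * κ * M ≤ 2 * κ * M₀ := by gcongr
        refine this.trans (le_mul_of_one_le_right (by positivity) hYe)
    _ = (C + 2 * κ * M₀) * e * Y := by ring
    _ ≤ (C + 2 * κ * M₀) * e * (6 * (Y - 2)) := by gcongr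
    _ = _ := by field_simp

end rankTwo

end proof

theorem stmt14 (d : ℕ) (hd : 2 ≤ d)
    (μ : Measure (Matrix.SpecialLinearGroup (Fin d) ℝ)) [μ.IsHaarMeasure]
    (F₀ : Set (Matrix.SpecialLinearGroup (Fin d) ℝ))
    (hF₀ : MeasureTheory.IsFundamentalDomain
      (toSLR (d := d)).range F₀ μ) :
    ∃ ε > (0 : ℝ), ∃ C > (0 : ℝ), ∀ p : ℕ, p.Prime →
      ∀ γ : Matrix.SpecialLinearGroup (Fin d) ℤ, ∀ t : ℝ, t > 1 →
        |(Nat.card {x : Matrix.SpecialLinearGroup (Fin d) ℤ |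
              (∃ δ ∈ congSubgroup d p, x = γ * δ) ∧ toSLR x ∈ Dt d t} : ℝ)
          - (μ (Dt d t)).toReal / (((congSubgroup d p).index : ℝ) * (μ F₀).toReal)|
          ≤ C * (μ (Dt d t)).toReal * Real.exp (-ε * t) := by
  have hD : ∀ t, 1 < t → Dt d t = {g : SLR d | phi g ≤ t} := fun t ht => Set.ext fun g => mem_Dt_iff (by linarith)
  have key : ∃ ε : ℝ, 0 < ε ∧ ∃ C : ℝ, 0 < C ∧ ∀ p : ℕ, p.Prime → 
      ∀ (γ : Matrix.SpecialLinearGroup (Fin d) ℤ) (t : ℝ), 1 < t → 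
      |cnt d p γ t - vol μ t / ((congSubgroup d p).index * (μ F₀).toReal)| ≤ C * vol μ t * Real.exp (-ε * t) := by
    rcases hd.eq_or_lt with rfl | h
    · exact cnt_asymptotic_two μ hF₀
    · exact cnt_asymptotic_of_three_le μ h hF₀
  obtain ⟨ε, hε, C, hC, h⟩ := key
  refine ⟨ε, hε, C, hC, fun p hp γ t ht => ?_⟩
  rw [hD t ht]
  exact h p hp γ t ht
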